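/- Let k ≥ 5 and let b₁, b₂, …, b_k be distinct integers. Then the set of rational numbers x for which the product (x + b₁)(x + b₂)⋯(x + b_k) is the square of a rational number is finite. -/

import Mathlib

section

/-- Quadratic maps from the parallelogram law: triangle inequality for the square root. -/
lemma para_bilin {G : Type*} [AddCommGroup G] (q : G → ℝ)
    (hq : ∀ x y, q (x + y) + q (x - y) = 2 * q x + 2 * q y) (x y z : G) :
    q (x + y + z) + q x + q y + q z = q (x + y) + q (x + z) + q (y + z) := by
  have h0 : q 0 = 0 := by have := hq 0 0; simp at this; linarith
  have hneg : ∀ x, q (-x) = q x := by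
    intro x; have := hq 0 x; simp [h0] at this; linarith
  have h1 := hq (x + y) z
  have h2 := hq (x - z) y
  have h3 := hq x z
  have h4 := hq y z
  have h5 := hq (x+z) y
  have h6 := hq x (y+z)
  have h7 := hq x (y-z)
  have h8 := hq y z
  have e1 : x + y - z = x - z + y := by abel
  have e2 : x - z - y = x - (y + z) := by abel
  have e3 : x + z + y = x + y + z := by abel
  have e4 : x + (y + z) = x + y + z := by abel
  have e5 : x + z - y = x - (y - z) := by abel
  have e6 : x + (y - z) = x - z + y := by abel
  rw [e1] at h1; rw [e2] at h2; rw [e3, e5] at h5; rw [e4] at h6; rw [e6] at h7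
  linarith

lemma para_tri {G : Type*} [AddCommGroup G] (q : G → ℝ) (hnn : ∀ x, 0 ≤ q x)
    (hq : ∀ x y, q (x + y) + q (x - y) = 2 * q x + 2 * q y) (x y : G) :
    √(q (x + y)) ≤ √(q x) + √(q y) := by
  have h0 : q 0 = 0 := by have := hq 0 0; simp at this; linarith
  -- the polar form
  set B : G → G → ℝ := fun x y => q (x + y) - q x - q y with hB
  have hBadd : ∀ x y z, B (x + y) z = B x z + B y z := by
    intro x y z
    have := para_bilin q hq x y z
    simp only [hB]; linarith
  have hBcomm : ∀ x y, B x y = B y x := by intro x y; simp only [hB, add_comm]; ring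
  have hBn : ∀ (n : ℕ) x y, B (n • x) y = n * B x y := by
    intro n x y
    induction n with
    | zero => simp [hB, h0]
    | succ k ih => rw [succ_nsmul, hBadd, ih]; push_cast; ring
  have hq2 : ∀ x, B x x = 2 * q x := by
    intro x; have := hq x x; simp [h0] at this; simp only [hB]; linarith
  have hqn : ∀ (n : ℕ) x, q (n • x) = n ^ 2 * q x := by
    intro n x
    have h1 := hq2 (n • x)
    rw [hBn, hBcomm, hBn, hq2] at h1
    linarith
  have hnegq : ∀ x, q (-x) = q x := by
    intro x; have := hq 0 x; simp [h0] at this; linarith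
  have hBneg : ∀ x y, B (-x) y = - B x y := by
    intro x y
    have := hBadd x (-x) y
    simp [hB, h0] at this
    simp only [hB]; linarith
  -- nonnegativity on combos
  have key : ∀ (m n : ℕ), 0 ≤ (m:ℝ)^2 * q x - m * n * B x y + (n:ℝ)^2 * q y := by
    intro m n
    have h1 := hnn (m • x + -(n • y))
    have h2 : q (m • x + -(n • y)) = B (m • x) (-(n • y)) + q (m • x) + q (-(n•y)) := by
      simp only [hB]; ring
    rw [h2, hBcomm, hBneg, hBn, hBcomm, hBn, hnegq, hqn, hqn] at h1
    linarith
  -- discriminant inequality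
  have hle : B x y ≤ 2 * (√(q x) * √(q y)) := by
    by_contra hcon
    push Not at hcon
    have hx := hnn x
    have hy := hnn y
    -- t^2 qx - t B + qy ≥ 0 for t rational nonneg, hence real
    have hr : ∀ t : ℝ, 0 ≤ t → 0 ≤ t^2 * q x - t * B x y + q y := by
      intro t ht
      have hcl : IsClosed {t : ℝ | 0 ≤ t^2 * q x - t * B x y + q y} := by
        apply isClosed_le <;> fun_prop
      by_contra hneg
      have hop : {t : ℝ | 0 ≤ t^2 * q x - t * B x y + q y}ᶜ ∈ nhds t :=
        hcl.isOpen_compl.mem_nhds hneg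
      obtain ⟨δ, hδ, hb⟩ := Metric.mem_nhds_iff.mp hop
      obtain ⟨r, hr1, hr2⟩ := exists_rat_btwn (show t < t + δ by linarith)
      have hmem := hb (show (r:ℝ) ∈ Metric.ball t δ by
        rw [Metric.mem_ball, Real.dist_eq, abs_lt]; constructor <;> linarith)
      apply hmem
      have hrpos : (0:ℝ) < r := by linarith
      have hrpos' : 0 < r := by exact_mod_cast hrpos
      have hk := key r.num.toNat r.den
      have hnum : ((r.num.toNat : ℕ) : ℝ) = (r.num : ℝ) := by
        have : ((r.num.toNat : ℤ)) = r.num := Int.toNat_of_nonneg (Rat.num_nonneg.mpr hrpos'.le)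
        exact_mod_cast this
      rw [hnum] at hk
      have hden : (0:ℝ) < r.den := by exact_mod_cast r.den_pos
      have hrr : (r:ℝ) = r.num / r.den := by exact_mod_cast (Rat.num_div_den r).symm
      change 0 ≤ (r:ℝ)^2 * q x - r * B x y + q y
      have : (r:ℝ)^2 * q x - r * B x y + q y =
        ((r.num:ℝ)^2 * q x - r.num * r.den * B x y + (r.den:ℝ)^2 * q y) / (r.den:ℝ)^2 := by
        rw [hrr]; field_simp
      rw [this]; positivity
    have hBpos : 0 < B x y := lt_of_le_of_lt (by positivity) hcon
    rcases hx.eq_or_lt with h | h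
    · have := hr ((q y + 1) / B x y) (by positivity)
      rw [← h] at this
      rw [mul_zero, div_mul_cancel₀ _ hBpos.ne'] at this
      linarith
    · have := hr (B x y / (2 * q x)) (by positivity)
      have h2 : (B x y)^2 ≤ 4 * q x * q y := by
        have h3 : (B x y / (2 * q x))^2 * q x - B x y / (2 * q x) * B x y + q y =
          (4 * q x * q y - (B x y)^2) / (4 * q x) := by field_simp; ring
        rw [h3] at this
        have h4 : 0 < 4 * q x := by linarith
        have := (div_nonneg_iff.mp this)
        rcases this with h5 | h5 <;> linarith
      have h5 : (2 * (√(q x) * √(q y)))^2 = 4 * q x * q y := by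
        rw [mul_pow, mul_pow, Real.sq_sqrt hx, Real.sq_sqrt hy]; ring
      have h6 : 0 ≤ 2 * (√(q x) * √(q y)) := by positivity
      nlinarith
  apply Real.sqrt_le_iff.mpr
  refine ⟨by positivity, ?_⟩
  have : q (x + y) = B x y + q x + q y := by simp only [hB]; ring
  rw [this, add_sq, Real.sq_sqrt (hnn x), Real.sq_sqrt (hnn y)]
  linarith

/-- Canonical height as a seminorm. -/
lemma exists_canonical {G : Type*} [AddCommGroup G] (h : G → ℝ) (hnn : ∀ x, 0 ≤ h x) (C : ℝ)
    (hpar : ∀ x y, |h (x + y) + h (x - y) - 2 * (h x + h y)| ≤ C) :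
    ∃ n : G → ℝ, ∃ C' : ℝ, (∀ x, 0 ≤ n x) ∧ (∀ x y, n (x + y) ≤ n x + n y) ∧
      (∀ x, n (-x) = n x) ∧
      (∀ (s : ℕ) x, n (2 ^ s • x) = 2 ^ s * n x) ∧ (∀ x, |h x - n x ^ 2| ≤ C') := by
  have hC : 0 ≤ C := (abs_nonneg _).trans (hpar 0 0)
  -- doubling
  set C1 := C + h 0 with hC1
  have hdbl : ∀ x, |h ((2:ℕ) • x) - 4 * h x| ≤ C1 := by
    intro x
    have := hpar x x
    rw [sub_self, ← two_nsmul] at this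
    rw [abs_le] at this ⊢
    have := hnn 0
    constructor <;> linarith
  have hC1' : 0 ≤ C1 := add_nonneg hC (hnn 0)
  let u : G → ℕ → ℝ := fun x n => h ((2 ^ n : ℕ) • x) / 4 ^ n
  have hu : ∀ x n, dist (u x n) (u x (n+1)) ≤ (C1 / 4) * (1/4:ℝ) ^ n := by
    intro x n
    have := hdbl ((2 ^ n : ℕ) • x)
    rw [Real.dist_eq, abs_sub_comm]
    have e : u x (n+1) - u x n = (h ((2:ℕ) • ((2 ^ n : ℕ) • x)) - 4 * h ((2 ^ n : ℕ) • x)) / 4^(n+1) := by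
      simp only [u]
      rw [← mul_smul, ← pow_succ']
      field_simp
      ring
    rw [e, abs_div, abs_of_pos (by positivity : (0:ℝ) < 4^(n+1)), div_le_iff₀ (by positivity)]
    calc _ ≤ C1 := this
      _ = _ := by rw [one_div, inv_pow, pow_succ]; field_simp
  have hcau : ∀ x, CauchySeq (u x) := fun x =>
    cauchySeq_of_le_geometric (1/4) (C1/4) (by norm_num) (hu x)
  choose q hq using fun x => cauchySeq_tendsto_of_complete (hcau x)
  have hqh : ∀ x, |h x - q x| ≤ C1 / 3 := by
    intro x
    have := dist_le_of_le_geometric_of_tendsto₀ (1/4) (C1/4) (by norm_num) (hu x) (hq x)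
    simp only [u, pow_zero, one_smul, div_one, Real.dist_eq] at this
    have e : C1 / 4 / (1 - 1 / 4) = C1 / 3 := by ring
    rwa [e] at this
  have hqnn : ∀ x, 0 ≤ q x := fun x =>
    ge_of_tendsto' (hq x) (fun n => div_nonneg (hnn _) (by positivity))
  have hqp : ∀ x y, q (x + y) + q (x - y) = 2 * q x + 2 * q y := by
    intro x y
    have h1 : Filter.Tendsto (fun n => u (x + y) n + u (x - y) n - (2 * u x n + 2 * u y n)) Filter.atTop
      (nhds (q (x + y) + q (x - y) - (2 * q x + 2 * q y))) :=
      ((hq _).add (hq _)).sub (((hq _).const_mul _).add ((hq _).const_mul _))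
    have h2 : Filter.Tendsto (fun n => u (x + y) n + u (x - y) n - (2 * u x n + 2 * u y n)) Filter.atTop
      (nhds 0) := by
      apply squeeze_zero_norm (a := fun n => C * (1/4:ℝ)^n)
      · intro n
        have := hpar ((2^n : ℕ) • x) ((2^n : ℕ) • y)
        rw [← smul_add, ← smul_sub] at this
        have e : u (x + y) n + u (x - y) n - (2 * u x n + 2 * u y n) =
          (h ((2^n : ℕ) • (x + y)) + h ((2^n : ℕ) • (x - y)) - 2 * (h ((2^n : ℕ) • x) + h ((2^n : ℕ) • y))) / 4^n := by
          simp only [u]; ring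
        rw [e, Real.norm_eq_abs, abs_div, abs_of_pos (by positivity : (0:ℝ) < 4^n), div_le_iff₀ (by positivity)]
        calc _ ≤ C := this
          _ = _ := by rw [one_div, inv_pow]; field_simp
      · have := (tendsto_pow_atTop_nhds_zero_of_lt_one (by norm_num : (0:ℝ) ≤ 1/4) (by norm_num)).const_mul C
        simpa using this
    have := tendsto_nhds_unique h1 h2
    linarith
  have h0 : q 0 = 0 := by have := hqp 0 0; simp at this; linarith
  have hneg : ∀ x, q (-x) = q x := by
    intro x; have := hqp 0 x; simp [h0] at this; linarith
  have hq2 : ∀ (s : ℕ) x, q (2 ^ s • x) = 4 ^ s * q x := by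
    intro s x
    induction s with
    | zero => simp
    | succ k ih =>
      have := hqp (2 ^ k • x) (2 ^ k • x)
      rw [sub_self, h0, ← two_nsmul, ← mul_smul, ← pow_succ', ih] at this
      rw [pow_succ (4:ℝ)]; linarith
  refine ⟨fun x => √(q x), C1/3, fun x => Real.sqrt_nonneg _, para_tri q hqnn hqp, ?_, ?_, ?_⟩
  · intro x; simp only [hneg]
  · intro s x
    have e : (4:ℝ)^s = (2^s)^2 := by rw [← pow_mul, mul_comm, pow_mul]; norm_num
    simp only [hq2]
    rw [e, Real.sqrt_mul (by positivity), Real.sqrt_sq (by positivity)]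
  · intro x
    simp only [Real.sq_sqrt (hqnn x)]
    exact hqh x

end

section

lemma leading_digits {G : Type*} [AddCommGroup G] (n : G → ℝ)
    (hn0 : ∀ x, 0 ≤ n x) (htri : ∀ x y, n (x + y) ≤ n x + n y) (hneg : ∀ x, n (-x) = n x)
    (h2 : ∀ (s : ℕ) x, n (2 ^ s • x) = 2 ^ s * n x)
    (𝒯 : Set G) (τ : ℝ) (hτ : ∀ T ∈ 𝒯, n T ≤ τ)
    (hdiv : ∀ P, ∃ P', ∃ T ∈ 𝒯, P = 2 • P' + T) (g0 : ℝ) (hg0 : τ < g0) :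
    ∀ k : ℕ, ∀ Q, n Q ≤ τ + 2 ^ k * (g0 - τ) → ∃ (j : ℕ) (A : G), n A ≤ g0 ∧
      n (Q - 2 ^ j • A) ≤ τ * (2 ^ j - 1) ∧ ((n Q ≤ g0 ∧ A = Q) ∨ (g0 - τ) / 2 ≤ n A) := by
  intro k
  induction k with
  | zero =>
    intro Q hQ
    refine ⟨0, Q, by linarith, ?_, Or.inl ⟨by linarith, rfl⟩⟩
    have h0 : n 0 = 0 := by
      have := h2 1 (0:G)
      rw [smul_zero] at this; linarith
    simp [h0]
  | succ k ih =>
    intro Q hQ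
    by_cases hQ0 : n Q ≤ g0
    · refine ⟨0, Q, hQ0, ?_, Or.inl ⟨hQ0, rfl⟩⟩
      have h0 : n 0 = 0 := by
        have := h2 1 (0:G)
        rw [smul_zero] at this; linarith
      simp [h0]
    · obtain ⟨P, T, hT, rfl⟩ := hdiv Q
      have hT' := hτ T hT
      have e1 : 2 * n P = n (2 • P) := by have := h2 1 P; simpa using this.symm
      have e2 : n (2 • P) ≤ n (2 • P + T) + n T := by
        have := htri (2 • P + T) (-T)
        rwa [hneg, add_neg_cancel_right] at this
      have e3 := htri (2 • P) T
      obtain ⟨j, A, hA1, hA2, hA3⟩ := ih P (by rw [pow_succ] at hQ; linarith)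
      refine ⟨j + 1, A, hA1, ?_, Or.inr ?_⟩
      · have : 2 • P + T - 2 ^ (j+1) • A = 2 ^ 1 • (P - 2 ^ j • A) + T := by
          rw [pow_succ', mul_smul, smul_sub, pow_one]; abel
        rw [this]
        have h3 := htri (2 ^ 1 • (P - 2 ^ j • A)) T
        rw [h2] at h3
        rw [pow_succ (2:ℝ) j]; linarith
      · rcases hA3 with ⟨_, rfl⟩ | hA3
        · linarith
        · exact hA3

set_option maxHeartbeats 1000000 in
theorem digits_pair {G : Type*} [AddCommGroup G] (h : G → ℝ) (hnn : ∀ x, 0 ≤ h x) (C : ℝ)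
    (hpar : ∀ x y, |h (x + y) + h (x - y) - 2 * (h x + h y)| ≤ C)
    (hNor : ∀ B : ℝ, {x | h x ≤ B}.Finite)
    (𝒯 : Set G) (h𝒯 : 𝒯.Finite) (hdiv : ∀ P, ∃ P', ∃ T ∈ 𝒯, P = 2 • P' + T)
    (S : Set G) (hS : S.Infinite) (ε : ℝ) (hε : 0 < ε) (hε1 : ε < 1) (B : ℝ) (s0 : ℕ) :
    ∃ P ∈ S, ∃ Q ∈ S, ∃ s : ℕ, s0 ≤ s ∧ B ≤ h P ∧ h (Q - 2 ^ s • P) ≤ ε * h Q ∧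
      (1 - ε) * 4 ^ s * h P ≤ h Q := by
  obtain ⟨n, C', hn0, htri, hneg, h2, hcmp⟩ := exists_canonical h hnn C hpar
  have hC' : 0 ≤ C' := (abs_nonneg _).trans (hcmp 0)
  obtain ⟨τ, hτ0, hτ⟩ : ∃ τ : ℝ, 0 ≤ τ ∧ ∀ T ∈ 𝒯, n T ≤ τ := by
    obtain ⟨τ, hτ⟩ := (h𝒯.image n).bddAbove
    exact ⟨max τ 0, le_max_right _ _, fun T hT => (hτ ⟨T, hT, rfl⟩).trans (le_max_left _ _)⟩
  have hNor' : ∀ B : ℝ, {x | n x ≤ B}.Finite := by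
    intro B
    apply (hNor (B ^ 2 + C')).subset
    intro x hx
    simp only [Set.mem_ofPred_eq] at hx ⊢
    have h1 := abs_le.mp (hcmp x)
    have h3 := hn0 x
    nlinarith
  -- choose δ and g
  set δ := ε / 8 with hδ
  have hδ0 : 0 < δ := by positivity
  set g := τ + 2 * (τ + 1) / δ with hg
  set g0 := τ + 2 * g with hg0
  have hgτ : τ < g := by rw [hg]; have : 0 < 2 * (τ + 1) / δ := by positivity
                         linarith
  have hgpos : 0 < g := by linarith
  -- exponents
  have hdig : ∀ Q, g0 < n Q → ∃ (j : ℕ) (A : G), n A ≤ g0 ∧ n (Q - 2 ^ j • A) ≤ τ * 2 ^ j ∧ g ≤ n A := by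
    intro Q hQ
    obtain ⟨k, hk⟩ : ∃ k : ℕ, n Q ≤ τ + 2 ^ k * (g0 - τ) := by
      have : 0 < g0 - τ := by linarith
      obtain ⟨k, hk⟩ := pow_unbounded_of_one_lt (n Q / (g0 - τ)) (by norm_num : (1:ℝ) < 2)
      refine ⟨k, ?_⟩
      rw [div_lt_iff₀ this] at hk; linarith
    obtain ⟨j, A, hA1, hA2, hA3⟩ := leading_digits n hn0 htri hneg h2 𝒯 τ hτ hdiv g0 (by linarith) k Q hk
    refine ⟨j, A, hA1, by linarith, ?_⟩
    rcases hA3 with ⟨h3, _⟩ | h3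
    · linarith
    · linarith
  choose! j A hA1 hA2 hA3 using hdig
  -- infinite subset with same A
  set B0 := max g0 (|B| + C' + 8 * C' / ε + 1) with hB0
  have hS1 : (S \ {x | n x ≤ B0}).Infinite := hS.sdiff (hNor' _)
  obtain ⟨a, hSa⟩ : ∃ a, {x | x ∈ S \ {x | n x ≤ B0} ∧ A x = a}.Infinite := by
    by_contra hcon
    push Not at hcon
    apply hS1
    apply ((hNor' g0).biUnion (fun a _ => hcon a)).subset
    intro x hx
    have hx2 : g0 < n x := lt_of_le_of_lt (le_max_left _ _) (not_le.mp hx.2)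
    simp only [Set.mem_iUnion, Set.mem_ofPred_eq]
    exact ⟨A x, hA1 x hx2, hx, rfl⟩
  obtain ⟨P, ⟨hPS, hPB⟩, hPA⟩ := hSa.nonempty
  obtain ⟨Q, ⟨⟨hQS, hQB⟩, hQA⟩, hQn⟩ :=
    (hSa.sdiff (hNor' (2 ^ (j P + s0) * (g0 + τ)))).nonempty
  simp only [Set.mem_ofPred_eq, not_le] at hPB hQB hQn
  have hPg : g0 < n P := lt_of_le_of_lt (le_max_left _ _) hPB
  have hQg : g0 < n Q := lt_of_le_of_lt (le_max_left _ _) hQB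
  have hP1 : |B| + C' + 8 * C' / ε + 1 < n P := lt_of_le_of_lt (le_max_right _ _) hPB
  have hQ1 : |B| + C' + 8 * C' / ε + 1 < n Q := lt_of_le_of_lt (le_max_right _ _) hQB
  have hP2 := hA2 P hPg
  have hQ2 := hA2 Q hQg
  have hP3 := hA3 P hPg
  have hP4 := hA1 P hPg
  rw [hPA] at hP2 hP3 hP4
  rw [hQA] at hQ2
  have h0g : 0 < g0 + τ := by linarith
  -- upper bound for n Q
  have hQu : n Q ≤ 2 ^ j Q * (g0 + τ) := by
    have := htri (Q - 2 ^ j Q • a) (2 ^ j Q • a)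
    rw [sub_add_cancel, h2] at this
    have h5 : (2:ℝ) ^ j Q * n a ≤ 2 ^ j Q * g0 := by gcongr
    linarith
  have hQl : 2 ^ j Q * (g - τ) ≤ n Q := by
    have := htri Q (-(Q - 2 ^ j Q • a))
    rw [hneg, show Q + -(Q - 2 ^ j Q • a) = 2 ^ j Q • a by abel, h2] at this
    have h5 : (2:ℝ) ^ j Q * g ≤ 2 ^ j Q * n a := by gcongr
    linarith
  have hjj : j P + s0 ≤ j Q := by
    by_contra hlt
    push Not at hlt
    have : (2:ℝ) ^ j Q ≤ 2 ^ (j P + s0) := pow_le_pow_right₀ (by norm_num) hlt.le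
    have : (2:ℝ) ^ j Q * (g0 + τ) ≤ 2 ^ (j P + s0) * (g0 + τ) := by gcongr
    linarith
  obtain ⟨s, hs⟩ : ∃ s, j Q = j P + s := ⟨j Q - j P, by omega⟩
  have hR : n (Q - 2 ^ s • P) ≤ δ * n Q := by
    have e : Q - 2 ^ s • P = (Q - 2 ^ j Q • a) + -(2 ^ s • (P - 2 ^ j P • a)) := by
      rw [smul_sub, ← mul_smul, hs, ← pow_add, add_comm s]; abel
    have h5 := htri (Q - 2 ^ j Q • a) (-(2 ^ s • (P - 2 ^ j P • a)))
    rw [← e, hneg, h2] at h5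
    have h6 : (2:ℝ) ^ s * n (P - 2 ^ j P • a) ≤ τ * 2 ^ j Q := by
      calc (2:ℝ) ^ s * n (P - 2 ^ j P • a) ≤ 2 ^ s * (τ * 2 ^ j P) := by gcongr
        _ = _ := by rw [hs, pow_add]; ring
    have h7 : δ * (2 ^ j Q * (g - τ)) ≤ δ * n Q := by gcongr
    have h8 : δ * (2 ^ j Q * (g - τ)) = 2 ^ j Q * (2 * (τ + 1)) := by
      rw [hg]; field_simp; ring
    have h9 : (0:ℝ) < 2 ^ j Q := by positivity
    nlinarith
  have hQP : 2 ^ s * n P ≤ (1 + δ) * n Q := by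
    have h5 := htri Q (-(Q - 2 ^ s • P))
    rw [hneg, show Q + -(Q - 2 ^ s • P) = 2 ^ s • P by abel, h2] at h5
    linarith
  have hn_big : ∀ X, |B| + C' + 8 * C' / ε + 1 < n X → 8 * C' ≤ ε * n X ^ 2 ∧ B + C' ≤ n X ^ 2 := by
    intro X hX
    have hB := abs_nonneg B
    have hB' := le_abs_self B
    have h5 : 0 ≤ 8 * C' / ε := by positivity
    have h6 : 1 ≤ n X := by linarith
    have h7 : n X ≤ n X ^ 2 := by nlinarith
    refine ⟨?_, by linarith⟩
    have h8 : 8 * C' / ε ≤ n X ^ 2 := by linarith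
    rw [div_le_iff₀ hε] at h8; linarith
  obtain ⟨p1, p2⟩ := hn_big P hP1
  obtain ⟨q1, q2⟩ := hn_big Q hQ1
  have cP := abs_le.mp (hcmp P)
  have cQ := abs_le.mp (hcmp Q)
  have cR := abs_le.mp (hcmp (Q - 2 ^ s • P))
  refine ⟨P, hPS, Q, hQS, s, by omega, by linarith, ?_, ?_⟩
  · have h5 : n (Q - 2 ^ s • P) ^ 2 ≤ (δ * n Q) ^ 2 := pow_le_pow_left₀ (hn0 _) hR 2
    have h6 : (δ * n Q) ^ 2 ≤ ε / 8 * n Q ^ 2 := by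
      rw [mul_pow]; gcongr; rw [hδ]; nlinarith
    have h7 : ε * (n Q ^ 2 - C') ≤ ε * h Q := by
      apply mul_le_mul_of_nonneg_left _ hε.le; linarith
    have h8 : ε * C' ≤ 1 * C' := by apply mul_le_mul_of_nonneg_right hε1.le hC'
    linarith
  · have h5 : (2 ^ s * n P) ^ 2 ≤ ((1 + δ) * n Q) ^ 2 :=
      pow_le_pow_left₀ (mul_nonneg (by positivity) (hn0 _)) hQP 2
    have e4 : (4:ℝ) ^ s = (2 ^ s) ^ 2 := by rw [← pow_mul, mul_comm, pow_mul]; norm_num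
    have h6 : (1 - ε) * 4 ^ s * h P ≤ (1 - ε) * ((1 + ε / 8) * (2 ^ s * n P) ^ 2) := by
      have : h P ≤ (1 + ε / 8) * n P ^ 2 := by linarith
      rw [mul_pow, ← e4, mul_assoc]
      have h1ε : 0 ≤ 1 - ε := by linarith
      calc (1 - ε) * (4 ^ s * h P) ≤ (1 - ε) * (4 ^ s * ((1 + ε / 8) * n P ^ 2)) := by gcongr
        _ = _ := by ring
    have h1ε : 0 ≤ 1 - ε := by linarith
    have h7 : (1 - ε) * ((1 + ε / 8) * (2 ^ s * n P) ^ 2) ≤ (1 - ε) * ((1 + ε / 8) * ((1 + δ) * n Q) ^ 2) := by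
      gcongr
    have h8 : (1 - ε) * ((1 + ε / 8) * ((1 + δ) * n Q) ^ 2) = ((1 - ε) * (1 + ε / 8) ^ 3) * n Q ^ 2 := by
      rw [hδ]; ring
    have h9 : (1 - ε) * (1 + ε / 8) ^ 3 ≤ 1 - ε / 8 := by
      have : (1 + ε / 8) ^ 3 ≤ 1 + ε / 2 := by nlinarith [mul_pos hε hε, mul_pos hε (mul_pos hε hε)]
      nlinarith
    have h10 : ((1 - ε) * (1 + ε / 8) ^ 3) * n Q ^ 2 ≤ (1 - ε / 8) * n Q ^ 2 := by gcongr
    linarith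

end

section

open WeierstrassCurve

/-- The curve `y² = x³ + d a x² + d² b x` over `ℤ`, isomorphic to `d y² = x³ + a x² + b x`. -/
def EC (a b d : ℤ) : WeierstrassCurve ℤ := ⟨0, d * a, 0, d ^ 2 * b, 0⟩

/-- The base change to a field. -/
abbrev EK (a b d : ℤ) (K : Type*) [Field K] : WeierstrassCurve.Affine K :=
  ((EC a b d).baseChange K).toAffine

section
variable (a b d : ℤ) (K : Type*) [Field K]
@[simp] lemma EK_a1 : (EK a b d K).a₁ = 0 := by simp [EC, WeierstrassCurve.baseChange]
@[simp] lemma EK_a2 : (EK a b d K).a₂ = d * a := by simp [EC, WeierstrassCurve.baseChange]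
@[simp] lemma EK_a3 : (EK a b d K).a₃ = 0 := by simp [EC, WeierstrassCurve.baseChange]
@[simp] lemma EK_a4 : (EK a b d K).a₄ = d ^ 2 * b := by simp [EC, WeierstrassCurve.baseChange]
@[simp] lemma EK_a6 : (EK a b d K).a₆ = 0 := by simp [EC, WeierstrassCurve.baseChange]

lemma EK_equation (x y : K) : (EK a b d K).Equation x y ↔ y ^ 2 = x ^ 3 + d * a * x ^ 2 + d ^ 2 * b * x := by
  rw [Affine.equation_iff]
  simp only [EK_a1, EK_a2, EK_a3, EK_a4, EK_a6, zero_mul, add_zero]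

lemma EK_Δ : (EK a b d K).Δ = 16 * (d:K) ^ 6 * b ^ 2 * (a ^ 2 - 4 * b) := by
  simp only [WeierstrassCurve.Δ, WeierstrassCurve.b₂, WeierstrassCurve.b₄, WeierstrassCurve.b₆, WeierstrassCurve.b₈,
    EK_a1, EK_a2, EK_a3, EK_a4, EK_a6]; ring
end

/-- Nondegeneracy. -/
structure ND (a b d : ℤ) : Prop where
  hb : b ≠ 0
  hD : a ^ 2 - 4 * b ≠ 0
  hd : d ≠ 0

section
variable {a b d : ℤ} (hN : ND a b d) {K : Type*} [Field K] [CharZero K]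
include hN
lemma ND.bK : (b : K) ≠ 0 := by exact_mod_cast hN.hb
lemma ND.dK : (d : K) ≠ 0 := by exact_mod_cast hN.hd
lemma ND.DK : (a : K) ^ 2 - 4 * b ≠ 0 := by exact_mod_cast hN.hD

lemma EK_Δ_ne : (EK a b d K).Δ ≠ 0 := by
  rw [EK_Δ]
  have h1 := hN.bK (K := K); have h2 := hN.dK (K := K); have h3 := hN.DK (K := K)
  simp [h1, h2, h3]

lemma EK_nonsing {x y : K} : (EK a b d K).Nonsingular x y ↔ y ^ 2 = x ^ 3 + d * a * x ^ 2 + d ^ 2 * b * x := by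
  rw [← Affine.equation_iff_nonsingular_of_Δ_ne_zero (EK_Δ_ne hN), EK_equation]

end

/-- Weighted homogeneous coordinates `(X : η : Z)` of a point, in the quartic model
`d η² = X Z (X² + a X Z + b Z²)`. -/
def QRep {a b d : ℤ} {K : Type*} [Field K] (P : (EK a b d K).Point) (X η Z : K) : Prop :=
  (P = 0 ∧ Z = 0 ∧ η = 0 ∧ X ≠ 0) ∨
    ∃ x y h, P = Affine.Point.some x y h ∧ Z ≠ 0 ∧ x * Z = d * X ∧ y * Z ^ 2 = d ^ 2 * η

/-- `(X : Z)` is proportional to the `x`-coordinate of `P` (possibly `(0 : 0)`). -/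
def XPar {a b d : ℤ} {K : Type*} [Field K] (P : (EK a b d K).Point) (X Z : K) : Prop :=
  (P = 0 ∧ Z = 0) ∨ ∃ x y h, P = Affine.Point.some x y h ∧ x * Z = d * X

section
variable {a b d : ℤ} (hN : ND a b d) {K : Type*} [Field K] [CharZero K] [DecidableEq K]

def Mf {R : Type*} [CommRing R] (a b X Z : R) : R :=
  X ^ 4 + 2 * a * X ^ 3 * Z + 6 * b * X ^ 2 * Z ^ 2 + 2 * a * b * X * Z ^ 3 + b ^ 2 * Z ^ 4
def dX {R : Type*} [CommRing R] (b X Z : R) : R := (X ^ 2 - b * Z ^ 2) ^ 2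
def dZ {R : Type*} [CommRing R] (a b X Z : R) : R := 4 * (X * Z * (X ^ 2 + a * X * Z + b * Z ^ 2))
def dK {R : Type*} [CommRing R] (a b X Z : R) : R := 2 * (X ^ 2 - b * Z ^ 2) * Mf a b X Z

include hN in
lemma qrep_dbl {P : (EK a b d K).Point} {X η Z : K} (h : QRep P X η Z) :
    QRep ((2:ℕ) • P) (dX (b:K) X Z) (η * dK (a:K) b X Z) (dZ (a:K) b X Z) := by
  have hb := hN.bK (K := K); have hd := hN.dK (K := K); have hD := hN.DK (K := K)
  rw [two_nsmul]
  rcases h with ⟨rfl, rfl, rfl, hX⟩ | ⟨x, y, hns, rfl, hZ, hx, hy⟩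
  · left
    refine ⟨by simp, by simp [dZ], by simp, ?_⟩
    simp [dX, hX]
  · have heq := (EK_nonsing hN).mp hns
    obtain rfl : x = d * X / Z := by field_simp; linear_combination hx
    obtain rfl : y = d ^ 2 * η / Z ^ 2 := by field_simp; linear_combination hy
    have heq2 : d * η ^ 2 = X * Z * (X ^ 2 + a * X * Z + b * Z ^ 2) := by
      field_simp at heq
      linear_combination heq
    by_cases hη : η = 0
    · subst hη
      left
      refine ⟨?_, ?_, by simp, ?_⟩
      · apply Affine.Point.add_self_of_Y_eq
        simp only [Affine.negY, EK_a1, EK_a3]; simp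
      · rw [dZ]; linear_combination -4 * heq2
      · rw [dX]
        apply pow_ne_zero
        intro hc
        have h0 : X * (X ^ 2 + a * X * Z + b * Z ^ 2) = 0 := by
          apply mul_left_cancel₀ hZ; linear_combination -heq2
        rcases mul_eq_zero.mp h0 with h1 | h1
        · subst h1
          have : (b:K) * Z ^ 2 = 0 := by linear_combination -hc
          simp [hb, hZ] at this
        · apply hD
          have h2 : a * X + 2 * b * Z = 0 := by
            apply mul_left_cancel₀ hZ; linear_combination h1 - hc
          have h3 : (a^2 - 4 * b) * (b * Z^2) = 0 := by
            linear_combination (-(a:K)^2) * hc + (a * X - 2 * b * Z) * h2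
          simpa [hb, hZ] using h3
    · right
      have hYne : (d ^ 2 * η / Z ^ 2 : K) ≠ (EK a b d K).negY (d * X / Z) (d ^ 2 * η / Z ^ 2) := by
        simp only [Affine.negY, EK_a1, EK_a3, zero_mul, sub_zero]
        intro hc
        have : (d ^ 2 * η / Z ^ 2 : K) = 0 := by
          have : 2 * (d ^ 2 * η / Z ^ 2 : K) = 0 := by linear_combination hc
          simpa using this
        simp [hd, hη, hZ] at this
      have hdZ : dZ (a:K) b X Z = 4 * d * η ^ 2 := by rw [dZ]; linear_combination -4 * heq2
      refine ⟨_, _, _, Affine.Point.add_self_of_Y_ne hYne, ?_, ?_, ?_⟩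
      · rw [hdZ]; simp [hd, hη]
      · rw [hdZ, Affine.slope_of_Y_ne rfl hYne]
        simp only [Affine.addX, Affine.negY, EK_a1, EK_a2, EK_a3, EK_a4, zero_mul, sub_zero, add_zero,
          sub_neg_eq_add, dX]
        clear hdZ hYne hns hx hy heq
        generalize (d:K) = D at *
        obtain rfl : D = X * Z * (X ^ 2 + a * X * Z + b * Z ^ 2) / η ^ 2 := by
          field_simp; linear_combination heq2
        have hX : X ≠ 0 := by rintro rfl; simp at hd
        have hq : X ^ 2 + a * X * Z + b * Z ^ 2 ≠ 0 := by intro h; simp [h] at hd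
        field_simp
        ring
      · rw [hdZ, Affine.slope_of_Y_ne rfl hYne]
        simp only [Affine.addY, Affine.negAddY, Affine.addX, Affine.negY, EK_a1, EK_a2, EK_a3, EK_a4, zero_mul, sub_zero, add_zero,
          sub_neg_eq_add, dK, Mf]
        clear hdZ hYne hns hx hy heq
        generalize (d:K) = D at *
        obtain rfl : D = X * Z * (X ^ 2 + a * X * Z + b * Z ^ 2) / η ^ 2 := by
          field_simp; linear_combination heq2
        have hX : X ≠ 0 := by rintro rfl; simp at hd
        have hq : X ^ 2 + a * X * Z + b * Z ^ 2 ≠ 0 := by intro h; simp [h] at hd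
        field_simp
        ring

def sX {R : Type*} [CommRing R] (a b d X₁ η₁ Z₁ X₂ η₂ Z₂ : R) : R :=
  (X₁ * Z₂ + X₂ * Z₁) * (X₁ * X₂ + b * Z₁ * Z₂) + 2 * a * X₁ * X₂ * Z₁ * Z₂ + 2 * d * η₁ * η₂
def sZ {R : Type*} [CommRing R] (X₁ Z₁ X₂ Z₂ : R) : R := (X₁ * Z₂ - X₂ * Z₁) ^ 2

omit [CharZero K] [DecidableEq K] in
lemma xpar_zero (P : (EK a b d K).Point) : XPar P 0 0 := by
  rcases P with _ | ⟨x, y, h⟩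
  · left; exact ⟨rfl, rfl⟩
  · right; exact ⟨x, y, h, rfl, by simp⟩

include hN in
omit [DecidableEq K] in
lemma QRep.eq {P : (EK a b d K).Point} {X η Z : K} (h : QRep P X η Z) :
    d * η ^ 2 = X * Z * (X ^ 2 + a * X * Z + b * Z ^ 2) := by
  have hd := hN.dK (K := K)
  rcases h with ⟨rfl, rfl, rfl, hX⟩ | ⟨x, y, hns, rfl, hZ, hx, hy⟩
  · simp
  · have heq := (EK_nonsing hN).mp hns
    obtain rfl : x = d * X / Z := by field_simp; linear_combination hx
    obtain rfl : y = d ^ 2 * η / Z ^ 2 := by field_simp; linear_combination hy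
    field_simp at heq
    linear_combination heq

include hN in
lemma qrep_sub {P Q : (EK a b d K).Point} {X₁ η₁ Z₁ X₂ η₂ Z₂ : K} (h₁ : QRep P X₁ η₁ Z₁)
    (h₂ : QRep Q X₂ η₂ Z₂) :
    XPar (P - Q) (sX (a:K) b d X₁ η₁ Z₁ X₂ η₂ Z₂) (sZ X₁ Z₁ X₂ Z₂) := by
  have hd := hN.dK (K := K)
  have e1 := h₁.eq hN
  have e2 := h₂.eq hN
  rcases h₁ with ⟨rfl, rfl, rfl, hX₁⟩ | ⟨x₁, y₁, hns₁, rfl, hZ₁, hx₁, hy₁⟩ <;>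
  rcases h₂ with ⟨rfl, rfl, rfl, hX₂⟩ | ⟨x₂, y₂, hns₂, rfl, hZ₂, hx₂, hy₂⟩
  · left; simp [sZ]
  · right
    rw [zero_sub, Affine.Point.neg_some]
    refine ⟨_, _, _, rfl, ?_⟩
    simp only [sZ, sX]
    linear_combination X₁^2 * Z₂ * hx₂
  · right
    rw [sub_zero]
    refine ⟨_, _, _, rfl, ?_⟩
    simp only [sZ, sX]
    linear_combination X₂^2 * Z₁ * hx₁
  · obtain rfl : x₁ = d * X₁ / Z₁ := by field_simp; linear_combination hx₁
    obtain rfl : y₁ = d ^ 2 * η₁ / Z₁ ^ 2 := by field_simp; linear_combination hy₁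
    obtain rfl : x₂ = d * X₂ / Z₂ := by field_simp; linear_combination hx₂
    obtain rfl : y₂ = d ^ 2 * η₂ / Z₂ ^ 2 := by field_simp; linear_combination hy₂
    by_cases hX : X₁ * Z₂ = X₂ * Z₁
    · by_cases hη : η₁ * Z₂ ^ 2 = η₂ * Z₁ ^ 2
      · left
        refine ⟨?_, by simp [sZ, hX]⟩
        rw [sub_eq_zero]
        congr 1
        · field_simp; linear_combination hX
        · field_simp; linear_combination hη
      · have hη' : η₁ * Z₂ ^ 2 = - (η₂ * Z₁ ^ 2) := by
          have : (η₁ * Z₂ ^ 2 - η₂ * Z₁ ^ 2) * (η₁ * Z₂ ^ 2 + η₂ * Z₁ ^ 2) = 0 := by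
            have h3 : d * ((η₁ * Z₂ ^ 2 - η₂ * Z₁ ^ 2) * (η₁ * Z₂ ^ 2 + η₂ * Z₁ ^ 2)) = 0 := by
              obtain rfl : X₂ = X₁ * Z₂ / Z₁ := by field_simp; exact hX.symm
              field_simp at e2
              linear_combination Z₂^4 * e1 - Z₁ * e2
            simpa [hd] using h3
          rcases mul_eq_zero.mp this with h | h
          · exact absurd (by linear_combination h) hη
          · linear_combination h
        have h1 : sX (a:K) b d X₁ η₁ Z₁ X₂ η₂ Z₂ = 0 := by
          obtain rfl : X₂ = X₁ * Z₂ / Z₁ := by field_simp; exact hX.symm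
          obtain rfl : η₂ = - (η₁ * Z₂ ^ 2) / Z₁^2 := by
            field_simp; linear_combination hη'
          rw [sX]
          field_simp
          linear_combination -2 * Z₂^2 * e1
        have h2 : sZ X₁ Z₁ X₂ Z₂ = 0 := by simp [sZ, hX]
        rw [h1, h2]; exact xpar_zero _
    · right
      have hXne : d * X₁ / Z₁ ≠ d * X₂ / Z₂ := by
        intro h; field_simp at h; exact hX (by linear_combination h)
      rw [sub_eq_add_neg, Affine.Point.neg_some]
      refine ⟨_, _, _, Affine.Point.add_of_X_ne hXne, ?_⟩
      rw [Affine.slope_of_X_ne hXne]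
      simp only [Affine.addX, Affine.negY, EK_a1, EK_a2, EK_a3, zero_mul, sub_zero, add_zero,
        sub_neg_eq_add, sX, sZ]
      have hX' : X₁ * Z₂ - X₂ * Z₁ ≠ 0 := sub_ne_zero.mpr hX
      have e3 : (d * X₁ / Z₁ - d * X₂ / Z₂) = d * (X₁ * Z₂ - X₂ * Z₁) / (Z₁ * Z₂) := by field_simp
      rw [e3]
      have e4 : ((d ^ 2 * η₁ / Z₁ ^ 2 + d ^ 2 * η₂ / Z₂ ^ 2) / (d * (X₁ * Z₂ - X₂ * Z₁) / (Z₁ * Z₂))) ^ 2 * (X₁ * Z₂ - X₂ * Z₁) ^ 2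
          = d ^ 2 * (η₁ * Z₂ ^ 2 + η₂ * Z₁ ^ 2) ^ 2 / (Z₁ * Z₂) ^ 2 := by
        generalize (X₁ * Z₂ - X₂ * Z₁) = w at *
        field_simp
      rw [sub_mul, sub_mul, sub_mul, e4]
      field_simp
      linear_combination Z₂^4 * e1 + Z₁^4 * e2
end

end

section

open WeierstrassCurve Height

section
variable {a b d : ℤ} (hN : ND a b d) {K : Type*} [Field K] [CharZero K] [DecidableEq K]

omit [CharZero K] [DecidableEq K] in
lemma addSub_eval (s t u : K) (i : Fin 3) :
    (addSubMap (EK a b d K) i).eval ![s,t,u] =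
     (![s ^ 2 - 2 * d^2*b * s * u + d^4*b^2 * u^2, 2 * t * s + 4*d*a * s * u + 2*d^2*b*t*u, t ^ 2 - 4 * s * u] : Fin 3 → K) i := by
  fin_cases i <;> simp [addSubMap, WeierstrassCurve.b₂, WeierstrassCurve.b₄, WeierstrassCurve.b₆, WeierstrassCurve.b₈, -EK_a1, -EK_a2, -EK_a3, -EK_a4, -EK_a6, EC, WeierstrassCurve.baseChange] <;> ring

include hN in
lemma addSub_self (P : (EK a b d K).Point) :
    ∃ c : K, c ≠ 0 ∧ (fun i => (addSubMap (EK a b d K) i).eval (P.sym2x P)) = c • (P + P).sym2x (P - P) := by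
  rcases P with _ | ⟨x, y, hns⟩
  · refine ⟨1, one_ne_zero, ?_⟩
    change (fun i => (addSubMap (EK a b d K) i).eval ((0 : (EK a b d K).Point).sym2x 0)) = (1:K) • ((0 : (EK a b d K).Point) + 0).sym2x (0 - 0)
    ext i
    rw [add_zero, sub_zero, Affine.Point.sym2x_zero_zero, addSub_eval]
    fin_cases i <;> simp
  · have heq := (EK_nonsing hN).mp hns
    have := isElliptic_iff _ |>.mpr (isUnit_iff_ne_zero.mpr (EK_Δ_ne hN (K := K)))
    have hnz : (fun i => (addSubMap (EK a b d K) i).eval ((Affine.Point.some x y hns).sym2x (Affine.Point.some x y hns))) ≠ 0 :=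
      addSubMap_ne_zero _ (Affine.Point.sym2x_ne_zero _ _)
    rw [Affine.Point.sym2x_some_some] at hnz ⊢
    simp only [addSub_eval] at hnz ⊢
    rw [sub_self]
    by_cases hy : y = 0
    · rw [Affine.Point.add_self_of_Y_eq (by simp only [Affine.negY, EK_a1, EK_a3, hy]; simp), Affine.Point.sym2x_zero_zero]
      subst hy
      have h1 : 2 * (x + x) * (x*x) + 4*d*a * (x*x) * 1 + 2*d^2*b*(x+x)*1 = 0 := by linear_combination -4 * heq
      have h2 : (x + x)^2 - 4 * (x*x) * 1 = 0 := by ring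
      rw [h1, h2] at hnz ⊢
      refine ⟨(x * x) ^ 2 - 2 * d^2*b * (x*x) * 1 + d^4*b^2 * 1^2, fun h => hnz ?_, ?_⟩
      rotate_left 1
      · ext i; fin_cases i
        · simp
        · simp
        · simp
      · ext i; fin_cases i
        · exact h
        · simp
        · simp
    · have hYne : y ≠ (EK a b d K).negY x y := by
        simp only [Affine.negY, EK_a1, EK_a3, zero_mul, sub_zero]
        intro hc
        apply hy
        have : 2 * y = 0 := by linear_combination hc
        simpa using this
      rw [Affine.Point.add_self_of_Y_ne hYne, Affine.Point.sym2x_some_zero, Affine.slope_of_Y_ne rfl hYne]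
      refine ⟨4 * y^2, by simp [hy], ?_⟩
      simp only [Affine.addX, Affine.negY, EK_a1, EK_a2, EK_a3, EK_a4, zero_mul, sub_zero, add_zero,
          sub_neg_eq_add]
      ext i; fin_cases i
      · simp
        rw [← two_mul]
        field_simp
        linear_combination (32*x +16*d*a) * heq
      · simp
        linear_combination -4 * heq
      · simp; ring

include hN in
lemma addSub_all (P Q : (EK a b d K).Point) :
    ∃ c : K, c ≠ 0 ∧ (fun i => (addSubMap (EK a b d K) i).eval (P.sym2x Q)) = c • (P + Q).sym2x (P - Q) := by
  by_cases hPQ : P = Q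
  · subst hPQ; exact addSub_self hN P
  by_cases hPQ' : P = -Q
  · obtain ⟨c, hc, h⟩ := addSub_self hN P
    have hQ : Q = -P := by rw [hPQ', neg_neg]
    subst hQ
    refine ⟨c, hc, ?_⟩
    rw [Affine.Point.sym2x_neg_right, h, ← sub_eq_add_neg, sub_neg_eq_add, Affine.Point.sym2x_comm]
  rcases P with _ | ⟨x, y, hns⟩ <;> rcases Q with _ | ⟨x', y', hns'⟩
  · exact absurd rfl hPQ
  · refine ⟨1, one_ne_zero, ?_⟩
    change (fun i => (addSubMap (EK a b d K) i).eval ((0 : (EK a b d K).Point).sym2x _)) = (1:K) • ((0 : (EK a b d K).Point) + _).sym2x (0 - _)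
    ext i
    rw [zero_add, zero_sub, Affine.Point.sym2x_neg_right, Affine.Point.sym2x_zero_some, addSub_eval, Affine.Point.sym2x_some_some]
    fin_cases i <;> simp <;> ring
  · refine ⟨1, one_ne_zero, ?_⟩
    change (fun i => (addSubMap (EK a b d K) i).eval (Affine.Point.sym2x _ (0 : (EK a b d K).Point))) = (1:K) • (_ + (0 : (EK a b d K).Point)).sym2x (_ - 0)
    ext i
    rw [add_zero, sub_zero, Affine.Point.sym2x_some_zero, addSub_eval, Affine.Point.sym2x_some_some]
    fin_cases i <;> simp <;> ring
  · have hX : x ≠ x' := by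
      intro h
      rcases (Affine.Point.X_eq_iff (h₁ := hns) (h₂ := hns')).mp h with h | h
      · exact hPQ h
      · exact hPQ' h
    have e1 := (EK_nonsing hN).mp hns
    have e2 := (EK_nonsing hN).mp hns'
    refine ⟨(x - x')^2, pow_ne_zero _ (sub_ne_zero.mpr hX), ?_⟩
    rw [sub_eq_add_neg (Affine.Point.some x y hns), Affine.Point.neg_some, Affine.Point.add_of_X_ne hX, Affine.Point.add_of_X_ne hX]
    rw [Affine.Point.sym2x_some_some, Affine.Point.sym2x_some_some, Affine.slope_of_X_ne hX, Affine.slope_of_X_ne hX]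
    simp only [addSub_eval, Affine.addX, Affine.negY, EK_a1, EK_a2, EK_a3, zero_mul, sub_zero, add_zero,
          sub_neg_eq_add]
    have hw : x - x' ≠ 0 := sub_ne_zero.mpr hX
    obtain ⟨w, rfl⟩ : ∃ w, x = w + x' := ⟨x - x', by ring⟩
    simp only [add_sub_cancel_right] at hw ⊢
    ext i; fin_cases i
    · simp
      field_simp
      linear_combination (-(y^2-y'^2+((w+x')^3 + d * a * (w+x')^2 + d^2 * b * (w+x')) - (x' ^ 3 + d * a * x' ^ 2 + d ^ 2 * b * x'))) * (e1 - e2) + 2 * (d*a+w+x'+x')*w^2*(e1+e2)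
    · simp
      field_simp
      linear_combination -2*(e1+e2)
    · simp; ring
end

noncomputable def hgt {a b d : ℤ} (P : (EK a b d ℚ).Point) : ℝ := logHeight P.xRep

lemma hgt_zero {a b d : ℤ} : hgt (0 : (EK a b d ℚ).Point) = 0 := by
  rw [hgt, Affine.Point.xRep_zero, ← logHeight₁_div_eq_logHeight]; simp

lemma hgt_some {a b d : ℤ} {x y : ℚ} (h : (EK a b d ℚ).Nonsingular x y) :
    hgt (Affine.Point.some x y h) = logHeight₁ x := by
  rw [hgt, Affine.Point.xRep_some, logHeight₁_eq_logHeight]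

lemma hgt_nonneg {a b d : ℤ} (P : (EK a b d ℚ).Point) : 0 ≤ hgt P := by
  rcases P with _ | ⟨x, y, h⟩
  · exact hgt_zero.ge
  · rw [hgt_some]; exact zero_le_logHeight₁ x

lemma hgt_par {a b d : ℤ} (hN : ND a b d) :
    ∃ C, ∀ P Q : (EK a b d ℚ).Point, |hgt (P + Q) + hgt (P - Q) - 2 * (hgt P + hgt Q)| ≤ C := by
  have := isElliptic_iff _ |>.mpr (isUnit_iff_ne_zero.mpr (EK_Δ_ne hN (K := ℚ)))
  obtain ⟨C₁, h₁⟩ := abs_logHeight_addSubMap_sub_two_mul_logHeight_le (EK a b d ℚ)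
  obtain ⟨C₂, h₂⟩ := abs_logHeight_sym2_sub_le ℚ
  have key : ∀ P Q : (EK a b d ℚ).Point, |logHeight (P.sym2x Q) - (hgt P + hgt Q)| ≤ C₂ := by
    intro P Q
    have e : ∀ R : (EK a b d ℚ).Point, R.xRep = ![R.xRep 0, R.xRep 1] := by
      intro R; ext i; fin_cases i <;> rfl
    have := h₂ (a := P.xRep 0) (b := P.xRep 1) (c := Q.xRep 0) (d := Q.xRep 1)
      (by rw [← e]; exact P.xRep_ne_zero) (by rw [← e]; exact Q.xRep_ne_zero)
    rw [← e, ← e] at this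
    exact this
  refine ⟨C₁ + 3 * C₂, fun P Q => ?_⟩
  have k1 := key P Q
  have k2 := key (P + Q) (P - Q)
  obtain ⟨c, hc, h⟩ := addSub_all hN P Q
  have k3 := h₁ (P.sym2x Q)
  rw [h, logHeight_smul_eq_logHeight _ hc] at k3
  rw [abs_le] at *
  constructor <;> linarith [k1.1, k1.2, k2.1, k2.2, k3.1, k3.2]

lemma hgt_northcott {a b d : ℤ} (B : ℝ) : {P : (EK a b d ℚ).Point | hgt P ≤ B}.Finite := by
  have hf : (({![1,0]} : Set (Fin 2 → ℚ)) ∪ (fun x : ℚ => ![x,1]) '' {x : ℚ | logHeight₁ x ≤ B}).Finite :=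
    (Set.finite_singleton _).union ((NumberField.finite_setOfPred_logHeight₁_le ℚ B).image _)
  refine (hf.preimage' (f := fun P : (EK a b d ℚ).Point => P.xRep) ?_).subset ?_
  · intro v _
    by_cases hv : ∃ P : (EK a b d ℚ).Point, P.xRep = v
    · obtain ⟨P, rfl⟩ := hv
      refine (Set.toFinite {P, -P}).subset ?_
      intro Q hQ
      rcases Affine.Point.eq_or_eq_neg_of_xRep_eq_xRep hQ with h | h <;> simp [h]
    · convert Set.finite_empty
      ext P
      simp only [Set.mem_preimage, Set.mem_singleton_iff, Set.mem_empty_iff_false, iff_false]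
      exact fun h => hv ⟨P, h⟩
  · intro P hP
    rcases P with _ | ⟨x, y, h⟩
    · left; rfl
    · right
      refine ⟨x, ?_, rfl⟩
      have : hgt (Affine.Point.some x y h) ≤ B := hP
      rwa [hgt_some] at this

end

section

open WeierstrassCurve

/-- A nonzero rational with even valuation at all primes not dividing `M` is a bounded integer
times a square. -/
lemma rat_even_val (M : ℕ) (hM : M ≠ 0) (n : ℚ) (hn : n ≠ 0)
    (h : ∀ p : ℕ, p.Prime → ¬ p ∣ M → Even (padicValRat p n)) :
    ∃ d : ℤ, |d| ≤ M ∧ ∃ r : ℚ, n = d * r ^ 2 ∧ r ≠ 0 := by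
  obtain ⟨r, s, hrs, hs⟩ := Nat.sq_mul_squarefree (n.num.natAbs * n.den)
  have hnum : n.num ≠ 0 := Rat.num_ne_zero.mpr hn
  have hne : s ^ 2 * r ≠ 0 := by rw [hrs]; simp [hnum]
  have hs0 : s ≠ 0 := by rintro rfl; simp at hne
  have hr0 : r ≠ 0 := by rintro rfl; simp at hne
  have hden : (n.den : ℚ) ≠ 0 := by simp
  have hnd : n * n.den = n.num := Rat.mul_den_eq_num n
  have h1 : (n.num : ℚ) = (n.num.sign : ℚ) * (n.num.natAbs : ℚ) := by
    rw [← Int.cast_natCast (R := ℚ) n.num.natAbs, ← Int.cast_mul, Int.sign_mul_natAbs]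
  have h2 : ((s : ℚ) ^ 2 * r) = n.num.natAbs * n.den := by exact_mod_cast hrs
  have h3 : n = ((n.num.sign * r : ℤ) : ℚ) * ((s : ℚ) / n.den) ^ 2 := by
    push_cast
    field_simp
    linear_combination (n.den : ℚ) * hnd + (n.den : ℚ) * h1 - (n.num.sign : ℚ) * h2
  have hr' : (s : ℚ) / n.den ≠ 0 := div_ne_zero (by exact_mod_cast hs0) hden
  refine ⟨n.num.sign * r, ?_, (s : ℚ) / n.den, h3, hr'⟩
  have h4 : |n.num.sign * (r : ℤ)| = r := by
    rw [abs_mul, Int.abs_sign_of_ne_zero hnum]; simp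
  rw [h4]
  norm_cast
  apply Nat.le_of_dvd (Nat.pos_of_ne_zero hM)
  rw [← Nat.prod_primeFactors_of_squarefree hs]
  refine (Finset.prod_dvd_prod_of_subset _ M.primeFactors _ ?_).trans (Nat.prod_primeFactors_dvd M)
  intro p hp
  have hpp := Nat.prime_of_mem_primeFactors hp
  have hpr := Nat.dvd_of_mem_primeFactors hp
  rw [Nat.mem_primeFactors]
  refine ⟨hpp, ?_, hM⟩
  by_contra hpM
  have := Fact.mk hpp
  have h5 := h p hpp hpM
  have hd0 : ((n.num.sign * r : ℤ) : ℚ) ≠ 0 := by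
    simp [hr0, hnum]
  rw [h3, padicValRat.mul hd0 (pow_ne_zero 2 hr'), padicValRat.pow, padicValRat.of_int, padicValInt, Int.natAbs_mul,
    Int.natAbs_sign_of_ne_zero hnum, one_mul, Int.natAbs_natCast] at h5
  have h6 : padicValNat p r = 1 := by
    apply le_antisymm
    · by_contra hc
      push Not at hc
      have : p ^ 2 ∣ r := (padicValNat_dvd_iff_le hr0).mpr hc
      have := hs p (by rwa [← sq])
      exact hpp.one_lt.ne' (Nat.isUnit_iff.mp this)
    · exact one_le_padicValNat_of_dvd hr0 hpr
  rw [h6, Int.even_add] at h5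
  simp at h5

lemma padic_add_int {p : ℕ} [Fact p.Prime] {x : ℚ} (hx : padicValRat p x < 0) (b : ℤ) (hxb : x + b ≠ 0):
    padicValRat p (x + b) = padicValRat p x := by
  by_cases hb : b = 0
  · simp [hb]
  · have hx0 : x ≠ 0 := by rintro rfl; simp at hx
    refine padicValRat.add_eq_of_lt hxb hx0 (by exact_mod_cast hb) ?_
    refine lt_of_lt_of_le hx ?_
    simp

lemma pairs_square {k : ℕ} (b : Fin k → ℤ) (hb : Function.Injective b) :
    ∃ B : ℕ, ∀ x q : ℚ, (∏ i, (x + b i)) = q ^ 2 → (∀ i, x + b i ≠ 0) →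
      ∀ i j, ∃ d : ℤ, |d| ≤ B ∧ ∃ r : ℚ, (x + b i) * (x + b j) = d * r ^ 2 ∧ r ≠ 0 := by
  classical
  let M : ℕ := ∏ i, ∏ j, if i = j then 1 else (b i - b j).natAbs
  have hM : M ≠ 0 := by
    refine Finset.prod_ne_zero_iff.mpr fun i _ => Finset.prod_ne_zero_iff.mpr fun j _ => ?_
    split_ifs with h
    · simp
    · simpa [sub_eq_zero] using fun h' => h (hb h')
  refine ⟨M, fun x q hq hx i j => ?_⟩
  apply rat_even_val M hM _ (mul_ne_zero (hx i) (hx j))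
  intro p hp hpM
  have := Fact.mk hp
  rw [padicValRat.mul (hx i) (hx j)]
  by_cases hv : padicValRat p x < 0
  · rw [padic_add_int hv _ (hx i), padic_add_int hv _ (hx j)]
    exact ⟨_, rfl⟩
  · have hnn : ∀ i, 0 ≤ padicValRat p (x + b i) := by
      intro i
      refine le_trans ?_ (padicValRat.min_le_padicValRat_add (hx i))
      exact le_min (not_lt.mp hv) (by simp)
    have hdiff : ∀ i j, i ≠ j → 0 < padicValRat p (x + b i) → padicValRat p (x + b j) = 0 := by
      intro i j hij hi
      by_contra hj
      have hj : 0 < padicValRat p (x + b j) := lt_of_le_of_ne (hnn j) (Ne.symm hj)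
      apply hpM
      have hbij : (b i - b j : ℤ) ≠ 0 := by simpa [sub_eq_zero] using fun h' => hij (hb h')
      have h1 : 0 < padicValRat p ((b i - b j : ℤ) : ℚ) := by
        have e : ((b i - b j : ℤ) : ℚ) = (x + b i) + -(x + b j) := by push_cast; ring
        have hne : (x + b i) + -(x + b j) ≠ 0 := by rw [← e]; exact_mod_cast hbij
        rw [e]
        refine lt_of_lt_of_le ?_ (padicValRat.min_le_padicValRat_add hne)
        rw [padicValRat.neg]
        exact lt_min hi hj
      have h2 : p ∣ (b i - b j).natAbs := by
        rw [padicValRat.of_int] at h1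
        have : padicValInt p (b i - b j) ≠ 0 := by
          intro h; simp [h] at h1
        by_contra hc
        apply this
        exact padicValInt.eq_zero_of_not_dvd (fun h => hc (by rwa [← Int.natCast_dvd]))
      refine h2.trans ?_
      have h3 : (b i - b j).natAbs = if i = j then 1 else (b i - b j).natAbs := by simp [hij]
      rw [h3]
      exact (Finset.dvd_prod_of_mem (fun j => if i = j then 1 else (b i - b j).natAbs) (Finset.mem_univ j)).trans
        (Finset.dvd_prod_of_mem (fun i => ∏ j, if i = j then 1 else (b i - b j).natAbs) (Finset.mem_univ i))
    have heven : ∀ i, Even (padicValRat p (x + b i)) := by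
      intro i
      rcases (hnn i).eq_or_lt with h | h
      · rw [← h]; exact Even.zero
      · have h1 : padicValRat p (∏ i, (x + b i)) = ∑ i, padicValRat p (x + b i) := by
          have : ∀ s : Finset (Fin k), padicValRat p (∏ i ∈ s, (x + b i)) = ∑ i ∈ s, padicValRat p (x + b i) := by
            intro s
            induction s using Finset.induction_on with
            | empty => simp
            | insert a s ha ih =>
              rw [Finset.prod_insert ha, Finset.sum_insert ha, padicValRat.mul (hx a) (Finset.prod_ne_zero_iff.mpr fun i _ => hx i), ih]
          exact this _
        rw [Finset.sum_eq_single i (fun j _ hj => hdiff i j hj.symm h) (by simp)] at h1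
        rw [← h1, hq]
        have : q ≠ 0 := by
          rintro rfl
          have : ∏ i, (x + b i) ≠ 0 := Finset.prod_ne_zero_iff.mpr fun i _ => hx i
          simp [hq] at this
        rw [padicValRat.pow]
        exact ⟨_, by push_cast; ring⟩
    exact (heven i).add (heven j)

/-- The curve with roots `0, p, q`. -/
lemma ND_of_roots {p q d : ℤ} (hp : p ≠ 0) (hq : q ≠ 0) (hpq : p ≠ q) (hd : d ≠ 0) :
    ND (-(p+q)) (p*q) d := by
  refine ⟨mul_ne_zero hp hq, ?_, hd⟩
  have : (-(p+q))^2 - 4*(p*q) = (p-q)^2 := by ring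
  rw [this]
  exact pow_ne_zero _ (sub_ne_zero.mpr hpq)

lemma halving {p q d : ℤ} (hN : ND (-(p+q)) (p*q) d) (hp : p ≠ 0) (hq : q ≠ 0) (hpq : p ≠ q)
    (x y r₁ r₂ r₃ : ℚ) (hns : (EK (-(p+q)) (p*q) d ℚ).Nonsingular x y)
    (h1 : x = r₁^2) (h2 : x - d*p = r₂^2) (h3 : x - d*q = r₃^2) (hy : y = r₁*r₂*r₃) :
    ∃ R : (EK (-(p+q)) (p*q) d ℚ).Point, Affine.Point.some x y hns = 2 • R := by
  have hd := hN.dK (K := ℚ)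
  have hp' : (p:ℚ) ≠ 0 := by exact_mod_cast hp
  have hq' : (q:ℚ) ≠ 0 := by exact_mod_cast hq
  have hpq' : (p:ℚ) - q ≠ 0 := by exact_mod_cast sub_ne_zero.mpr hpq
  have n1 : r₁ + r₂ ≠ 0 := by
    intro h
    have : (d:ℚ) * p = 0 := by linear_combination h1 - h2 + (r₁ - r₂) * h
    simp [hd, hp'] at this
  have n2 : r₁ + r₃ ≠ 0 := by
    intro h
    have : (d:ℚ) * q = 0 := by linear_combination h1 - h3 + (r₁ - r₃) * h
    simp [hd, hq'] at this
  have n3 : r₂ + r₃ ≠ 0 := by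
    intro h
    have : (d:ℚ) * (p - q) = 0 := by linear_combination h3 - h2 - (r₂ - r₃) * h
    simp [hd, hpq'] at this
  have e1 : (d:ℚ) * p = r₁^2 - r₂^2 := by linear_combination h1 - h2
  have e2 : (d:ℚ) * q = r₁^2 - r₃^2 := by linear_combination h1 - h3
  have hns' : (EK (-(p+q)) (p*q) d ℚ).Nonsingular (x + r₁*r₂+r₁*r₃+r₂*r₃) ((r₁+r₂)*(r₁+r₃)*(r₂+r₃)) := by
    rw [EK_nonsing hN]
    push_cast
    have : ((x + r₁*r₂+r₁*r₃+r₂*r₃) ^ 3 + d * (-(p+q)) * (x + r₁*r₂+r₁*r₃+r₂*r₃) ^ 2 + d ^ 2 * (p*q) * (x + r₁*r₂+r₁*r₃+r₂*r₃) : ℚ) = (x + r₁*r₂+r₁*r₃+r₂*r₃) * (x + r₁*r₂+r₁*r₃+r₂*r₃ - d*p) * (x + r₁*r₂+r₁*r₃+r₂*r₃ - d*q) := by ring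
    rw [this, e1, e2, h1]; ring
  refine ⟨Affine.Point.some _ _ hns', ?_⟩
  rw [two_nsmul]
  have hYne : ((r₁+r₂)*(r₁+r₃)*(r₂+r₃)) ≠ (EK (-(p+q)) (p*q) d ℚ).negY (x + r₁*r₂+r₁*r₃+r₂*r₃) ((r₁+r₂)*(r₁+r₃)*(r₂+r₃)) := by
    simp only [Affine.negY, EK_a1, EK_a3, zero_mul, sub_zero]
    intro hc
    have : 2 * ((r₁+r₂)*(r₁+r₃)*(r₂+r₃)) = 0 := by linear_combination hc
    simp [n1, n2, n3] at this
  have hslope : (EK (-(p+q)) (p*q) d ℚ).slope (x + r₁*r₂+r₁*r₃+r₂*r₃) (x + r₁*r₂+r₁*r₃+r₂*r₃) ((r₁+r₂)*(r₁+r₃)*(r₂+r₃)) ((r₁+r₂)*(r₁+r₃)*(r₂+r₃)) = r₁ + r₂ + r₃ := by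
    rw [Affine.slope_of_Y_ne rfl hYne]
    simp only [Affine.negY, EK_a1, EK_a2, EK_a3, EK_a4, zero_mul, sub_zero, add_zero, sub_neg_eq_add]
    push_cast
    have e3 : (d:ℚ) * -(p + q) = -(r₁^2-r₂^2) - (r₁^2-r₃^2) := by rw [← e1, ← e2]; ring
    have e4 : (d:ℚ)^2 * (p * q) = (r₁^2-r₂^2) * (r₁^2-r₃^2) := by rw [← e1, ← e2]; ring
    rw [e3, e4, h1]
    rw [div_eq_iff]
    · ring
    · rw [← two_mul]
      exact mul_ne_zero two_ne_zero (mul_ne_zero (mul_ne_zero n1 n2) n3)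
  rw [Affine.Point.add_self_of_Y_ne hYne]
  have hx : (EK (-(p+q)) (p*q) d ℚ).addX (x + r₁*r₂+r₁*r₃+r₂*r₃) (x + r₁*r₂+r₁*r₃+r₂*r₃) (r₁ + r₂ + r₃) = x := by
    simp only [Affine.addX, EK_a1, EK_a2, zero_mul, add_zero]
    push_cast
    linear_combination e1 + e2 - 3 * h1
  congr 1
  · rw [hslope, hx]
  · rw [hslope]
    simp only [Affine.addY, Affine.negAddY, Affine.negY, hx, EK_a1, EK_a3]
    rw [hy]
    ring

lemma add_halve {p q d : ℤ} (hN : ND (-(p+q)) (p*q) d) (hp : p ≠ 0) (hq : q ≠ 0) (hpq : p ≠ q)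
    (x y x' y' : ℚ) (hns : (EK (-(p+q)) (p*q) d ℚ).Nonsingular x y)
    (hns' : (EK (-(p+q)) (p*q) d ℚ).Nonsingular x' y') (hy : y ≠ 0) (hy' : y' ≠ 0)
    (h1 : IsSquare (x * x')) (h2 : IsSquare ((x - d*p) * (x' - d*p)))
    (h3 : IsSquare ((x - d*q) * (x' - d*q))) :
    ∃ R : (EK (-(p+q)) (p*q) d ℚ).Point, Affine.Point.some x y hns + Affine.Point.some x' y' hns' = 2 • R := by
  by_cases hX : x = x'
  · rcases (Affine.Point.X_eq_iff (h₁ := hns) (h₂ := hns')).mp hX with h | h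
    · exact ⟨Affine.Point.some x y hns, by rw [← h, two_nsmul]⟩
    · exact ⟨0, by rw [h]; simp⟩
  · have e := (EK_nonsing hN).mp hns
    have e' := (EK_nonsing hN).mp hns'
    push_cast at e e'
    have hE : y^2 = x * (x - d*p) * (x - d*q) := by rw [e]; ring
    have hE' : y'^2 = x' * (x' - d*p) * (x' - d*q) := by rw [e']; ring
    have n1 : x ≠ 0 := by rintro rfl; simp at hE; exact hy hE
    have n2 : x - d*p ≠ 0 := by intro h; rw [h] at hE; simp at hE; exact hy hE
    have n3 : x - d*q ≠ 0 := by intro h; rw [h] at hE; simp at hE; exact hy hE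
    have n1' : x' ≠ 0 := by rintro rfl; simp at hE'; exact hy' hE'
    have n2' : x' - d*p ≠ 0 := by intro h; rw [h] at hE'; simp at hE'; exact hy' hE'
    have n3' : x' - d*q ≠ 0 := by intro h; rw [h] at hE'; simp at hE'; exact hy' hE'
    have hw : x - x' ≠ 0 := sub_ne_zero.mpr hX
    obtain ⟨x3, y3, hns3, hadd, hx3⟩ : ∃ x3 y3 hns3, Affine.Point.some x y hns + Affine.Point.some x' y' hns'
        = (Affine.Point.some x3 y3 hns3 : (EK (-(p+q)) (p*q) d ℚ).Point) ∧
        x3 = ((y-y')/(x-x'))^2 + d*p+d*q - x - x' := by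
      refine ⟨_, _, _, Affine.Point.add_of_X_ne hX, ?_⟩
      rw [Affine.slope_of_X_ne hX]
      simp only [Affine.addX, EK_a1, EK_a2, zero_mul, add_zero]
      push_cast
      ring
    rw [hadd]
    have e3 := (EK_nonsing hN).mp hns3
    push_cast at e3
    have hE3 : y3^2 = x3 * (x3 - d*p) * (x3 - d*q) := by rw [e3]; ring
    have key : ∀ t : ℚ, (t = 0 ∨ t = d*p ∨ t = d*q) → x - t ≠ 0 → x' - t ≠ 0 → IsSquare ((x - t) * (x' - t)) →
        ∃ r, x3 - t = r^2 := by
      intro t ht h h' hsq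
      obtain ⟨u, hu⟩ := hsq
      have hu0 : u ≠ 0 := by rintro rfl; simp [h, h'] at hu
      refine ⟨((y*(x'-t) - y'*(x-t))/(x-x'))/u, ?_⟩
      rw [div_pow, sq u, ← hu, eq_div_iff (mul_ne_zero h h'), hx3]
      have ht' : t * (t - d*p)*(t-d*q) = 0 := by
        rcases ht with rfl | rfl | rfl <;> ring
      clear hu hx3 hns3 hadd hE3 e3 h1 h2 h3
      have : ((y-y')/(x-x'))^2 + d*p+d*q - x - x' - t = ((y-y')^2 + (x-x')^2 * (d*p+d*q - x - x' - t)) / (x-x')^2 := by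
        field_simp; ring
      rw [this, div_pow, div_mul_eq_mul_div]
      congr 1
      linear_combination ((x'-t)*(x-x'))*hE - ((x-t)*(x-x')) * hE' - (x-x')^2 * ht'
    obtain ⟨r₁, hr₁⟩ := key 0 (by simp) (by simpa) (by simpa) (by simpa using h1)
    obtain ⟨r₂, hr₂⟩ := key (d*p) (by simp) n2 n2' h2
    obtain ⟨r₃, hr₃⟩ := key (d*q) (by simp) n3 n3' h3
    rw [sub_zero] at hr₁
    have hsq : y3^2 = (r₁*r₂*r₃)^2 := by rw [hE3, hr₂, hr₃, hr₁]; ring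
    rcases sq_eq_sq_iff_eq_or_eq_neg.mp hsq with h | h
    · exact halving hN hp hq hpq x3 y3 r₁ r₂ r₃ hns3 hr₁ hr₂ hr₃ h
    · exact halving hN hp hq hpq x3 y3 (-r₁) r₂ r₃ hns3 (by rw [hr₁]; ring) hr₂ hr₃ (by rw [h]; ring)

lemma weak_mw {p q d : ℤ} (hp : p ≠ 0) (hq : q ≠ 0) (hpq : p ≠ q) (hd : d ≠ 0) :
    ∃ 𝒯 : Set (EK (-(p+q)) (p*q) d ℚ).Point, 𝒯.Finite ∧ ∀ P, ∃ P', ∃ T ∈ 𝒯, P = 2 • P' + T := by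
  classical
  have hN := ND_of_roots hp hq hpq hd
  let b : Fin 3 → ℤ := ![0, -(d*p), -(d*q)]
  have hb : Function.Injective b := by
    intro i j hij
    fin_cases i <;> fin_cases j <;> simp [b, hp, hq, hd, hpq, Ne.symm hpq] at hij ⊢
  obtain ⟨B, hB⟩ := pairs_square b hb
  -- for each pair of indices
  have hcls : ∀ x y : ℚ, (EK (-(p+q)) (p*q) d ℚ).Nonsingular x y → y ≠ 0 →
      ∃ c : Fin 3 → ℤ, (∀ i, |c i| ≤ B) ∧ ∀ i, ∃ r : ℚ, x + b i = c i * r^2 ∧ r ≠ 0 := by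
    intro x y hns hy
    have e := (EK_nonsing hN).mp hns
    push_cast at e
    have hprod : ∏ i, (x + b i) = y^2 := by
      rw [e, Fin.prod_univ_three]
      simp [b]; ring
    have hne : ∀ i, x + b i ≠ 0 := by
      have : ∏ i, (x + b i) ≠ 0 := by rw [hprod]; exact pow_ne_zero _ hy
      intro i
      exact Finset.prod_ne_zero_iff.mp this i (Finset.mem_univ i)
    have : ∀ i, ∃ c : ℤ, |c| ≤ B ∧ ∃ r : ℚ, x + b i = c * r^2 ∧ r ≠ 0 := by
      intro i
      obtain ⟨c, hc, r, hr, hr0⟩ := hB x y hprod hne (i+1) (i+2)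
      have h3 : (x + b i) * ((x + b (i+1)) * (x + b (i+2))) = y^2 := by
        rw [← hprod, Fin.prod_univ_three]
        fin_cases i <;> simp <;> ring
      have hc0 : (c:ℚ) ≠ 0 := by
        intro h
        rw [h, zero_mul] at hr
        exact mul_ne_zero (hne _) (hne _) hr
      refine ⟨c, hc, y / (c * r), ?_, by simp [hy, hc0, hr0]⟩
      rw [hr] at h3
      field_simp
      linear_combination h3
    choose c hc using this
    exact ⟨c, fun i => (hc i).1, fun i => (hc i).2⟩
  let Pr : (Fin 3 → ℤ) → (EK (-(p+q)) (p*q) d ℚ).Point → Prop := fun c P =>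
    ∃ x y h, P = Affine.Point.some x y h ∧ y ≠ 0 ∧ ∀ i, ∃ r : ℚ, x + b i = c i * r^2 ∧ r ≠ 0
  let rep : (Fin 3 → ℤ) → (EK (-(p+q)) (p*q) d ℚ).Point := fun c =>
    if h : ∃ P, Pr c P then - h.choose else 0
  have hfin : {c : Fin 3 → ℤ | ∀ i, |c i| ≤ B}.Finite := by
    refine (Set.Finite.pi' (fun _ : Fin 3 => Set.finite_Icc (-(B:ℤ)) B)).subset ?_
    intro c hc i
    exact abs_le.mp (hc i)
  refine ⟨rep '' {c | ∀ i, |c i| ≤ B} ∪ {P | P = 0 ∨ ∃ x h, P = Affine.Point.some x 0 h}, ?_, ?_⟩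
  · refine (hfin.image _).union ?_
    refine (hgt_northcott (Height.logHeight₁ (d*p : ℚ) + Height.logHeight₁ (d*q:ℚ))).subset ?_
    have z1 := Height.zero_le_logHeight₁ (d*p : ℚ)
    have z2 := Height.zero_le_logHeight₁ (d*q : ℚ)
    rintro P (rfl | ⟨x, hns, rfl⟩)
    · rw [Set.mem_ofPred_eq, hgt_zero]; linarith
    · rw [Set.mem_ofPred_eq, hgt_some]
      have e := (EK_nonsing hN).mp hns
      push_cast at e
      have : x * (x - d*p) * (x - d*q) = 0 := by linear_combination -e
      rcases mul_eq_zero.mp this with h | h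
      · rcases mul_eq_zero.mp h with h | h
        · rw [h, Height.logHeight₁_zero]; linarith
        · rw [sub_eq_zero.mp h]; linarith
      · rw [sub_eq_zero.mp h]; linarith
  · intro P
    rcases P with _ | ⟨x, y, hns⟩
    · exact ⟨0, 0, Or.inr (Or.inl rfl), by simp; rfl⟩
    by_cases hy : y = 0
    · subst hy
      exact ⟨0, _, Or.inr (Or.inr ⟨x, hns, rfl⟩), by simp⟩
    obtain ⟨c, hc, hr⟩ := hcls x y hns hy
    have hex : ∃ P, Pr c P := ⟨_, x, y, hns, rfl, hy, hr⟩
    have hQ := hex.choose_spec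
    have hrep : rep c = - hex.choose := by simp only [rep]; rw [dif_pos hex]
    generalize hex.choose = Q at hQ hrep
    obtain ⟨x', y', hns', rfl, hy', hr'⟩ := hQ
    have hsq : ∀ i, IsSquare ((x + b i) * (x' + b i)) := by
      intro i
      obtain ⟨r, h, -⟩ := hr i
      obtain ⟨r', h', -⟩ := hr' i
      exact ⟨c i * r * r', by rw [h, h']; ring⟩
    obtain ⟨R, hR⟩ := add_halve hN hp hq hpq x y x' y' hns hns' hy hy'
      (by simpa [b] using hsq 0) (by simpa [b, sub_eq_add_neg] using hsq 1)
      (by simpa [b, sub_eq_add_neg] using hsq 2)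
    refine ⟨R, rep c, Or.inl ⟨c, hc, rfl⟩, ?_⟩
    rw [hrep, ← hR]; abel

end

section

/-- The core finiteness statement. -/
def CoreStmt : Prop := ∀ p q r d₁ d₂ : ℤ, p ≠ 0 → q ≠ 0 → r ≠ 0 → p ≠ q → p ≠ r → q ≠ r → d₁ ≠ 0 → d₂ ≠ 0 →
  {w : ℚ | (∃ y : ℚ, d₁ * y ^ 2 = w * (w - p) * (w - q)) ∧ ∃ z : ℚ, d₂ * z ^ 2 = w * (w - p) * (w - r)}.Finite

theorem reduction (hcore : CoreStmt) (k : ℕ) (hk : 5 ≤ k) (b : Fin k → ℤ)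
    (hb : Function.Injective b) :
    {x : ℚ | ∃ q : ℚ, (∏ i : Fin k, (x + (b i : ℚ))) = q ^ 2}.Finite := by
  classical
  obtain ⟨B, hB⟩ := pairs_square b hb
  let ι : Fin 5 → Fin k := Fin.castLE hk
  let c : Fin 5 → ℤ := fun i => b (ι i) - b (ι 0)
  have hι : Function.Injective ι := Fin.castLE_injective hk
  have hc : ∀ i j, i ≠ j → c i ≠ c j := by
    intro i j hij h
    exact hij (hι (hb (by simpa [c] using h)))
  have hc0 : c 0 = 0 := by simp [c]
  have h1 : c 1 ≠ 0 := hc0 ▸ hc 1 0 (by decide)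
  have h2 : c 2 ≠ 0 := hc0 ▸ hc 2 0 (by decide)
  have h3 : c 3 ≠ 0 := hc0 ▸ hc 3 0 (by decide)
  have h4 : c 4 ≠ 0 := hc0 ▸ hc 4 0 (by decide)
  have h12 := sub_ne_zero.mpr (hc 2 1 (by decide))
  have h13 := sub_ne_zero.mpr (hc 3 1 (by decide))
  have h14 := sub_ne_zero.mpr (hc 4 1 (by decide))
  have h23 := sub_ne_zero.mpr (hc 2 3 (by decide))
  have h24 := sub_ne_zero.mpr (hc 2 4 (by decide))
  have h34 := sub_ne_zero.mpr (hc 3 4 (by decide))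
  set p : ℤ := (c 2 - c 1) * c 3 * c 4 with hp
  set q : ℤ := (c 3 - c 1) * c 2 * c 4 with hq
  set r : ℤ := (c 4 - c 1) * c 2 * c 3 with hr
  let w : ℚ → ℚ := fun x => c 2 * c 3 * c 4 * (1 + c 1 * (x + b (ι 0))⁻¹)
  have hw : Function.Injective w := by
    intro x x' h
    have q1 : (c 1 : ℚ) ≠ 0 := by exact_mod_cast h1
    have q2 : (c 2 : ℚ) ≠ 0 := by exact_mod_cast h2
    have q3 : (c 3 : ℚ) ≠ 0 := by exact_mod_cast h3
    have q4 : (c 4 : ℚ) ≠ 0 := by exact_mod_cast h4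
    simpa [w, q1, q2, q3, q4] using h
  let D : Set (Fin 5 → ℤ) := {d | ∀ i, |d i| ≤ B}
  have hD : D.Finite := by
    refine (Set.Finite.pi' (fun _ : Fin 5 => Set.finite_Icc (-(B:ℤ)) B)).subset ?_
    intro c hc i
    exact abs_le.mp (hc i)
  let Cs : (Fin 5 → ℤ) → Set ℚ := fun d => {x | (∀ i, d i ≠ 0) ∧
    (∃ y : ℚ, ((c 4 * d 1 * d 2 * d 3 : ℤ) : ℚ) * y ^ 2 = w x * (w x - p) * (w x - q)) ∧
    ∃ z : ℚ, ((c 3 * d 1 * d 2 * d 4 : ℤ) : ℚ) * z ^ 2 = w x * (w x - p) * (w x - r)}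
  have hCs : ∀ d, (Cs d).Finite := by
    intro d
    by_cases hd : ∀ i, d i ≠ 0
    · refine ((hcore p q r (c 4 * d 1 * d 2 * d 3) (c 3 * d 1 * d 2 * d 4) ?_ ?_ ?_ ?_ ?_ ?_ ?_ ?_).preimage hw.injOn).subset ?_
      · simp [hp, h12, h3, h4]
      · simp [hq, h13, h2, h4]
      · simp [hr, h14, h2, h3]
      · rw [← sub_ne_zero]
        have : p - q = (c 2 - c 3) * c 1 * c 4 := by rw [hp, hq]; ring
        rw [this]; simp [h23, h1, h4]
      · rw [← sub_ne_zero]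
        have : p - r = (c 2 - c 4) * c 1 * c 3 := by rw [hp, hr]; ring
        rw [this]; simp [h24, h1, h3]
      · rw [← sub_ne_zero]
        have : q - r = (c 3 - c 4) * c 1 * c 2 := by rw [hq, hr]; ring
        rw [this]; simp [h34, h1, h2]
      · simp [hd, h4]
      · simp [hd, h3]
      · intro x hx
        exact hx.2
    · refine Set.finite_empty.subset ?_
      intro x hx
      exact hd hx.1
  have hbad : (Set.range fun i => -(b i : ℚ)).Finite := Set.finite_range _
  refine (hbad.union (hD.biUnion (fun d _ => hCs d))).subset ?_
  rintro x ⟨y, hy⟩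
  by_cases hx : ∃ i, x + b i = 0
  · obtain ⟨i, hi⟩ := hx
    left
    exact ⟨i, by linear_combination -hi⟩
  push Not at hx
  right
  have hall := fun i => hB x y hy hx (ι i) (ι 0)
  choose d hd s hs hs0 using hall
  rw [Set.mem_iUnion₂]
  refine ⟨d, hd, ?_, ?_⟩
  · intro i hi
    have := hs i
    rw [hi] at this
    simp [hx] at this
  set t : ℚ := (x + b (ι 0))⁻¹ with ht
  have htx : t * (x + b (ι 0)) = 1 := inv_mul_cancel₀ (hx _)
  have key : ∀ i, 1 + c i * t = d i * (s i * t) ^ 2 := by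
    intro i
    have e1 : (c i : ℚ) = b (ι i) - b (ι 0) := by simp [c]
    rw [e1]
    linear_combination (-(x + b (ι i)) * t - 1) * htx + t^2 * hs i
  have hwx : w x = c 2 * c 3 * c 4 * (1 + c 1 * t) := rfl
  have e1 : w x - p = c 1 * c 3 * c 4 * (1 + c 2 * t) := by rw [hwx, hp]; push_cast; ring
  have e2 : w x - q = c 1 * c 2 * c 4 * (1 + c 3 * t) := by rw [hwx, hq]; push_cast; ring
  have e3 : w x - r = c 1 * c 2 * c 3 * (1 + c 4 * t) := by rw [hwx, hr]; push_cast; ring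
  refine ⟨⟨c 1 * c 2 * c 3 * c 4 * (s 1 * t) * (s 2 * t) * (s 3 * t), ?_⟩,
    ⟨c 1 * c 2 * c 3 * c 4 * (s 1 * t) * (s 2 * t) * (s 4 * t), ?_⟩⟩
  · rw [e1, e2, hwx, key, key, key]; push_cast; ring
  · rw [e1, e3, hwx, key, key, key]; push_cast; ring

end

section

/-! ## Seminorms -/

/-- A submultiplicative seminorm on a commutative ring. -/
structure IsNu {R : Type*} [CommRing R] (ν : R → ℝ) : Prop where
  nonneg : ∀ x, 0 ≤ ν x
  zero : ν 0 = 0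
  one : ν 1 ≤ 1
  neg : ∀ x, ν (-x) = ν x
  add : ∀ x y, ν (x + y) ≤ ν x + ν y
  mul : ∀ x y, ν (x * y) ≤ ν x * ν y

namespace IsNu
variable {R : Type*} [CommRing R] {ν : R → ℝ} (h : IsNu ν)
include h

lemma sub (x y : R) : ν (x - y) ≤ ν x + ν y := by
  rw [sub_eq_add_neg, ← h.neg y]; exact h.add _ _

lemma pow (x : R) (n : ℕ) : ν (x ^ n) ≤ ν x ^ n := by
  induction n with
  | zero => simpa using h.one
  | succ n ih =>
    rw [pow_succ, pow_succ]
    exact (h.mul _ _).trans (mul_le_mul_of_nonneg_right ih (h.nonneg _))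

lemma nat (n : ℕ) : ν (n : R) ≤ n := by
  induction n with
  | zero => simp [h.zero]
  | succ n ih => push_cast; exact (h.add _ _).trans (add_le_add ih h.one)

lemma int (n : ℤ) : ν (n : R) ≤ |(n : ℝ)| := by
  obtain ⟨k, rfl | rfl⟩ := n.eq_nat_or_neg
  · simpa using h.nat k
  · simpa [h.neg] using h.nat k

lemma sum {ι : Type*} (s : Finset ι) (f : ι → R) : ν (∑ i ∈ s, f i) ≤ ∑ i ∈ s, ν (f i) := by
  classical
  induction s using Finset.induction_on with
  | empty => simp [h.zero]
  | insert a s ha ih =>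
    rw [Finset.sum_insert ha, Finset.sum_insert ha]
    exact (h.add _ _).trans (add_le_add le_rfl ih)

lemma add' {x y : R} {A B : ℝ} (hx : ν x ≤ A) (hy : ν y ≤ B) : ν (x + y) ≤ A + B :=
  (h.add _ _).trans (add_le_add hx hy)
lemma sub' {x y : R} {A B : ℝ} (hx : ν x ≤ A) (hy : ν y ≤ B) : ν (x - y) ≤ A + B :=
  (h.sub _ _).trans (add_le_add hx hy)
lemma mul' {x y : R} {A B : ℝ} (hx : ν x ≤ A) (hy : ν y ≤ B) : ν (x * y) ≤ A * B :=
  (h.mul _ _).trans (mul_le_mul hx hy (h.nonneg _) ((h.nonneg _).trans hx))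
lemma pow' {x : R} {A : ℝ} (hx : ν x ≤ A) (n : ℕ) : ν (x ^ n) ≤ A ^ n :=
  (h.pow _ _).trans (pow_le_pow_left₀ (h.nonneg _) hx n)
lemma num (n : ℕ) [n.AtLeastTwo] : ν (OfNat.ofNat n : R) ≤ (OfNat.ofNat n : ℝ) := by
  simpa using h.nat (OfNat.ofNat n)
end IsNu

lemma isNu_int : IsNu (fun n : ℤ => |(n : ℝ)|) where
  nonneg _ := abs_nonneg _
  zero := by simp
  one := by simp
  neg x := by simp
  add x y := by push_cast; exact abs_add_le _ _
  mul x y := by push_cast; rw [abs_mul]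

open Polynomial in
/-- The `L¹` norm of a polynomial. -/
noncomputable def l1 {R : Type*} [CommRing R] (ν : R → ℝ) (p : R[X]) : ℝ :=
  ∑ i ∈ p.support, ν (p.coeff i)

open Polynomial in
section
variable {R : Type*} [CommRing R] {ν : R → ℝ} (h : IsNu ν)
include h

lemma l1_eq_of_subset (p : R[X]) (s : Finset ℕ) (hs : p.support ⊆ s) :
    l1 ν p = ∑ i ∈ s, ν (p.coeff i) := by
  apply Finset.sum_subset hs
  intro i _ hi
  rw [notMem_support_iff.mp hi, h.zero]

lemma l1_add (p q : R[X]) : l1 ν (p + q) ≤ l1 ν p + l1 ν q := by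
  classical
  rw [l1_eq_of_subset h (p + q) (p.support ∪ q.support) support_add,
    l1_eq_of_subset h p (p.support ∪ q.support) Finset.subset_union_left,
    l1_eq_of_subset h q (p.support ∪ q.support) Finset.subset_union_right, ← Finset.sum_add_distrib]
  apply Finset.sum_le_sum
  intro i _
  rw [coeff_add]; exact h.add _ _

lemma l1_nonneg (p : R[X]) : 0 ≤ l1 ν p := Finset.sum_nonneg fun _ _ => h.nonneg _

lemma l1_monomial (n : ℕ) (c : R) : l1 ν (monomial n c) = ν c := by
  rw [l1_eq_of_subset h _ {n} (support_monomial_subset n c)]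
  simp

lemma l1_sum {ι : Type*} (s : Finset ι) (f : ι → R[X]) : l1 ν (∑ i ∈ s, f i) ≤ ∑ i ∈ s, l1 ν (f i) := by
  classical
  induction s using Finset.induction_on with
  | empty => simp [l1]
  | insert a s ha ih =>
    rw [Finset.sum_insert ha, Finset.sum_insert ha]
    exact (l1_add h _ _).trans (add_le_add le_rfl ih)

lemma l1_mul (p q : R[X]) : l1 ν (p * q) ≤ l1 ν p * l1 ν q := by
  have e : p * q = ∑ i ∈ p.support, ∑ j ∈ q.support, monomial (i + j) (p.coeff i * q.coeff j) := by
    conv_lhs => rw [p.as_sum_support, q.as_sum_support, Finset.sum_mul_sum]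
    simp only [monomial_mul_monomial]
  rw [e]
  refine (l1_sum h _ _).trans ?_
  unfold l1
  rw [Finset.sum_mul_sum]
  apply Finset.sum_le_sum
  intro i _
  refine (l1_sum h _ _).trans (Finset.sum_le_sum fun j _ => ?_)
  rw [l1_monomial h]; exact h.mul _ _

lemma isNu_l1 : IsNu (l1 ν) where
  nonneg := l1_nonneg h
  zero := by simp [l1]
  one := by
    have := l1_monomial h 0 (1 : R)
    rw [monomial_zero_left, C_1] at this
    rw [this]; exact h.one
  neg p := by unfold l1; rw [support_neg]; simp [h.neg]
  add := l1_add h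
  mul := l1_mul h

lemma l1_C (c : R) : l1 ν (C c) = ν c := by
  rw [← monomial_zero_left, l1_monomial h]
lemma l1_X : l1 ν (X : R[X]) ≤ 1 := by
  rw [← monomial_one_one_eq_X, l1_monomial h]; exact h.one
lemma coeff_le_l1 (p : R[X]) (n : ℕ) : ν (p.coeff n) ≤ l1 ν p := by
  by_cases hn : n ∈ p.support
  · exact Finset.single_le_sum (f := fun i => ν (p.coeff i)) (fun _ _ => h.nonneg _) hn
  · rw [notMem_support_iff.mp hn, h.zero]; exact l1_nonneg h p
end

/-- The weighted truncated norm on power series over `ℤ`. -/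
noncomputable def wnu (Λ : ℝ) (κ : ℕ) (g : PowerSeries ℤ) : ℝ :=
  ∑ k ∈ Finset.range (κ + 1), |((PowerSeries.coeff k g : ℤ) : ℝ)| * (Λ⁻¹) ^ k

lemma isNu_wnu {Λ : ℝ} (hΛ : 0 < Λ) (κ : ℕ) : IsNu (wnu Λ κ) where
  nonneg g := Finset.sum_nonneg fun k _ => by positivity
  zero := by simp [wnu]
  one := by
    unfold wnu
    rw [Finset.sum_eq_single 0]
    · simp
    · intro k _ hk; rw [PowerSeries.coeff_one]; simp [hk]
    · intro h; simp at h
  neg g := by simp [wnu]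
  add f g := by
    unfold wnu
    rw [← Finset.sum_add_distrib]
    apply Finset.sum_le_sum
    intro k _
    rw [map_add, ← add_mul]; push_cast
    exact mul_le_mul_of_nonneg_right (abs_add_le _ _) (by positivity)
  mul f g := by
    unfold wnu
    rw [Finset.sum_mul_sum, ← Finset.sum_product']
    have key : ∀ k ∈ Finset.range (κ + 1), |((PowerSeries.coeff k (f * g) : ℤ) : ℝ)| * (Λ⁻¹) ^ k ≤
        ∑ x ∈ Finset.HasAntidiagonal.antidiagonal k, (|((PowerSeries.coeff x.1 f : ℤ) : ℝ)| * (Λ⁻¹) ^ x.1) *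
          (|((PowerSeries.coeff x.2 g : ℤ) : ℝ)| * (Λ⁻¹) ^ x.2) := by
      intro k _
      rw [PowerSeries.coeff_mul]; push_cast
      calc _ ≤ (∑ x ∈ Finset.HasAntidiagonal.antidiagonal k, |((PowerSeries.coeff x.1 f : ℤ) : ℝ) * ((PowerSeries.coeff x.2 g : ℤ) : ℝ)|) * (Λ⁻¹) ^ k :=
            mul_le_mul_of_nonneg_right (Finset.abs_sum_le_sum_abs _ _) (by positivity)
        _ = _ := by
          rw [Finset.sum_mul]
          apply Finset.sum_congr rfl
          intro x hx
          rw [← Finset.HasAntidiagonal.mem_antidiagonal.mp hx, abs_mul, pow_add]; ring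
    refine (Finset.sum_le_sum key).trans ?_
    rw [Finset.sum_sigma']
    rw [← Finset.sum_image (s := (Finset.range (κ + 1)).sigma Finset.HasAntidiagonal.antidiagonal)
      (g := fun x : (_ : ℕ) × ℕ × ℕ => x.2)
      (f := fun x : ℕ × ℕ => |((PowerSeries.coeff x.1 f : ℤ) : ℝ)| * (Λ⁻¹) ^ x.1 *
          (|((PowerSeries.coeff x.2 g : ℤ) : ℝ)| * (Λ⁻¹) ^ x.2))]
    · apply Finset.sum_le_sum_of_subset_of_nonneg
      · intro x hx
        simp only [Finset.mem_image, Finset.mem_sigma, Finset.mem_range,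
          Finset.HasAntidiagonal.mem_antidiagonal] at hx
        obtain ⟨⟨k, y⟩, ⟨h1, h2⟩, rfl⟩ := hx
        simp only [Finset.mem_product, Finset.mem_range] at *
        omega
      · intro x _ _; positivity
    · rintro ⟨k, y⟩ h1 ⟨k', y'⟩ h2 h3
      simp only [Finset.coe_sigma, Set.mem_sigma_iff, Finset.mem_coe,
        Finset.HasAntidiagonal.mem_antidiagonal] at h1 h2 h3
      subst h3
      have : k = k' := by rw [← h1.2, ← h2.2]
      subst this; rfl

lemma coeff_le_wnu {Λ : ℝ} (hΛ : 0 < Λ) (κ : ℕ) (g : PowerSeries ℤ) :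
    |((PowerSeries.coeff κ g : ℤ) : ℝ)| ≤ wnu Λ κ g * Λ ^ κ := by
  have h1 : |((PowerSeries.coeff κ g : ℤ) : ℝ)| * (Λ⁻¹) ^ κ ≤ wnu Λ κ g :=
    Finset.single_le_sum (f := fun k => |((PowerSeries.coeff k g : ℤ) : ℝ)| * (Λ⁻¹) ^ k)
      (fun _ _ => by positivity) (by simp)
  have h2 := mul_le_mul_of_nonneg_right h1 (by positivity : 0 ≤ Λ ^ κ)
  rwa [mul_assoc, ← mul_pow, inv_mul_cancel₀ hΛ.ne', one_pow, mul_one] at h2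

lemma wnu_X {Λ : ℝ} (hΛ : 0 < Λ) (κ : ℕ) : wnu Λ κ PowerSeries.X ≤ Λ⁻¹ := by
  unfold wnu
  calc _ ≤ ∑ k ∈ Finset.range (κ + 1), if k = 1 then Λ⁻¹ else 0 := by
        apply Finset.sum_le_sum
        intro k _
        rw [PowerSeries.coeff_X]
        split_ifs with h <;> simp [h]
    _ ≤ Λ⁻¹ := by
        rw [Finset.sum_ite_eq']
        split_ifs
        · exact le_rfl
        · positivity

end

section

/-! ## Iterated duplication and the auxiliary forms -/
section iter
variable {R : Type*} [CommRing R]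

def fh (a b : ℤ) (X Z : R) : R := X * Z * (X ^ 2 + a * X * Z + b * Z ^ 2)

def itp (a b : ℤ) (X Z : R) : ℕ → R × R
  | 0 => (X, Z)
  | n + 1 => (dX (b : R) (itp a b X Z n).1 (itp a b X Z n).2,
      dZ (a : R) b (itp a b X Z n).1 (itp a b X Z n).2)
def iX (a b : ℤ) (X Z : R) (n : ℕ) : R := (itp a b X Z n).1
def iZ (a b : ℤ) (X Z : R) (n : ℕ) : R := (itp a b X Z n).2
def iK (a b : ℤ) (X Z : R) : ℕ → R
  | 0 => 1
  | n + 1 => iK a b X Z n * dK (a : R) b (iX a b X Z n) (iZ a b X Z n)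

variable (a b : ℤ) (X Z : R) (n : ℕ)
@[simp] lemma iX_zero : iX a b X Z 0 = X := rfl
@[simp] lemma iZ_zero : iZ a b X Z 0 = Z := rfl
@[simp] lemma iK_zero : iK a b X Z 0 = 1 := rfl
lemma iX_succ : iX a b X Z (n + 1) = dX (b : R) (iX a b X Z n) (iZ a b X Z n) := rfl
lemma iZ_succ : iZ a b X Z (n + 1) = dZ (a : R) b (iX a b X Z n) (iZ a b X Z n) := rfl
lemma iK_succ : iK a b X Z (n + 1) = iK a b X Z n * dK (a : R) b (iX a b X Z n) (iZ a b X Z n) := rfl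

lemma map_fh {S : Type*} [CommRing S] (φ : R →+* S) : φ (fh a b X Z) = fh a b (φ X) (φ Z) := by
  simp [fh]

lemma map_iXZ {S : Type*} [CommRing S] (φ : R →+* S) :
    φ (iX a b X Z n) = iX a b (φ X) (φ Z) n ∧ φ (iZ a b X Z n) = iZ a b (φ X) (φ Z) n := by
  induction n with
  | zero => simp
  | succ n ih =>
    simp only [iX_succ, iZ_succ, dX, dZ, map_pow, map_sub, map_mul, map_add, ih.1, ih.2, map_intCast,
      map_ofNat, and_self]
lemma map_iX {S : Type*} [CommRing S] (φ : R →+* S) : φ (iX a b X Z n) = iX a b (φ X) (φ Z) n :=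
  (map_iXZ a b X Z n φ).1
lemma map_iZ {S : Type*} [CommRing S] (φ : R →+* S) : φ (iZ a b X Z n) = iZ a b (φ X) (φ Z) n :=
  (map_iXZ a b X Z n φ).2
lemma map_iK {S : Type*} [CommRing S] (φ : R →+* S) : φ (iK a b X Z n) = iK a b (φ X) (φ Z) n := by
  induction n with
  | zero => simp
  | succ n ih =>
    simp only [iK_succ, dK, Mf, map_pow, map_sub, map_mul, map_add, ih, map_iX, map_iZ, map_intCast, map_ofNat]

lemma fh_iter : fh a b (iX a b X Z n) (iZ a b X Z n) = fh a b X Z * iK a b X Z n ^ 2 := by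
  induction n with
  | zero => simp
  | succ n ih =>
    have : ∀ x z : R, fh a b (dX (b:R) x z) (dZ (a:R) b x z) = fh a b x z * dK (a:R) b x z ^ 2 := by
      intro x z; simp only [fh, dX, dZ, dK, Mf]; ring
    rw [iX_succ, iZ_succ, this, ih, iK_succ]; ring

lemma scale_iXZ (c : R) : iX a b (c * X) (c * Z) n = c ^ (4 ^ n) * iX a b X Z n ∧
    iZ a b (c * X) (c * Z) n = c ^ (4 ^ n) * iZ a b X Z n := by
  induction n with
  | zero => simp
  | succ n ih =>
    simp only [iX_succ, iZ_succ, ih.1, ih.2, pow_succ 4 n, pow_mul]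
    generalize c ^ 4 ^ n = t
    simp only [dX, dZ]
    constructor <;> ring

lemma scale_iK (c : R) : c ^ 2 * iK a b (c * X) (c * Z) n = c ^ (2 * 4 ^ n) * iK a b X Z n := by
  induction n with
  | zero => simp
  | succ n ih =>
    have e : c ^ (2 * 4 ^ (n + 1)) = c ^ (2 * 4 ^ n) * (c ^ 4 ^ n) ^ 6 := by
      rw [← pow_mul, ← pow_add]; congr 1; ring
    rw [iK_succ, ← mul_assoc, ih, (scale_iXZ a b X Z n c).1, (scale_iXZ a b X Z n c).2, e, iK_succ]
    generalize c ^ 4 ^ n = t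
    generalize c ^ (2 * 4 ^ n) = t'
    simp only [dK, Mf]
    ring
end iter

section
variable {a b d : ℤ} (hN : ND a b d) {K : Type*} [Field K] [CharZero K] [DecidableEq K]
include hN
lemma qrep_iter {P : (EK a b d K).Point} {X η Z : K} (h : QRep P X η Z) (n : ℕ) :
    QRep ((2 ^ n : ℕ) • P) (iX a b X Z n) (η * iK a b X Z n) (iZ a b X Z n) := by
  induction n with
  | zero => simpa using h
  | succ n ih =>
    have := qrep_dbl hN ih
    rw [← mul_smul] at this
    rw [pow_succ', iX_succ, iZ_succ, iK_succ, ← mul_assoc]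
    exact this
end

section
variable {a b d : ℤ} (hN : ND a b d) {K : Type*} [Field K] [CharZero K]
include hN
lemma dbl_ne {X Z : K} (h1 : dX (b:K) X Z = 0) (h2 : dZ (a:K) b X Z = 0) : X = 0 ∧ Z = 0 := by
  have hb := hN.bK (K := K); have hD := hN.DK (K := K)
  have hc : X ^ 2 - b * Z ^ 2 = 0 := by simpa [dX] using h1
  by_cases hZ : Z = 0
  · subst hZ; simpa using hc
  exfalso
  have h0 : X * (X ^ 2 + a * X * Z + b * Z ^ 2) = 0 := by
    have : 4 * Z * (X * (X ^ 2 + a * X * Z + b * Z ^ 2)) = 0 := by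
      rw [dZ] at h2; linear_combination h2
    simpa [hZ] using this
  rcases mul_eq_zero.mp h0 with h1 | h1
  · subst h1
    have : (b:K) * Z ^ 2 = 0 := by linear_combination -hc
    simp [hb, hZ] at this
  · apply hD
    have h2 : a * X + 2 * b * Z = 0 := by
      apply mul_left_cancel₀ hZ; linear_combination h1 - hc
    have h3 : (a^2 - 4 * b) * (b * Z^2) = 0 := by
      linear_combination (-(a:K)^2) * hc + (a * X - 2 * b * Z) * h2
    simpa [hb, hZ] using h3

lemma iter_ne {X Z : K} (n : ℕ) (h1 : iX a b X Z n = 0) (h2 : iZ a b X Z n = 0) : X = 0 ∧ Z = 0 := by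
  induction n with
  | zero => exact ⟨h1, h2⟩
  | succ n ih =>
    rw [iX_succ] at h1; rw [iZ_succ] at h2
    exact ih (dbl_ne hN h1 h2).1 (dbl_ne hN h1 h2).2
end

section norms
variable {R : Type*} [CommRing R] {ν : R → ℝ} (h : IsNu ν)

/-- The constant in the norm estimate. -/
noncomputable def LL (a b : ℤ) : ℝ := 12 * (1 + |(a:ℝ)| + |(b:ℝ)|) ^ 3

lemma one_le_LL (a b : ℤ) : 1 ≤ LL a b := by
  have h1 : 1 ≤ 1 + |(a:ℝ)| + |(b:ℝ)| := by linarith [abs_nonneg (a:ℝ), abs_nonneg (b:ℝ)]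
  have := one_le_pow₀ h1 (n := 3)
  unfold LL; linarith

include h in
lemma nu_dbl (a b : ℤ) {X Z : R} {B : ℝ} (hX : ν X ≤ B) (hZ : ν Z ≤ B) :
    ν (dX (b:R) X Z) ≤ LL a b * B ^ 4 ∧ ν (dZ (a:R) b X Z) ≤ LL a b * B ^ 4 ∧
      ν (dK (a:R) b X Z) ≤ LL a b * B ^ 6 := by
  have ha := h.int a
  have hb := h.int b
  have hB : 0 ≤ B := (h.nonneg _).trans hX
  have h2 : ν (2:R) ≤ 2 := h.num 2
  have h4 : ν (4:R) ≤ 4 := h.num 4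
  have h6 : ν (6:R) ≤ 6 := h.num 6
  unfold LL
  generalize |(a:ℝ)| = A at *
  generalize |(b:ℝ)| = A' at *
  have hA : 0 ≤ A := (h.nonneg _).trans ha
  have hA' : 0 ≤ A' := (h.nonneg _).trans hb
  have hs := h.sub' (h.pow' hX 2) (h.mul' hb (h.pow' hZ 2))
  refine ⟨(h.pow' hs 2).trans ?_, 
    (h.mul' h4 (h.mul' (h.mul' hX hZ) (h.add' (h.add' (h.pow' hX 2) (h.mul' (h.mul' ha hX) hZ)) (h.mul' hb (h.pow' hZ 2))))).trans ?_,
    (h.mul' (h.mul' h2 hs) (h.add' (h.add' (h.add' (h.add' (h.pow' hX 4) 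
      (h.mul' (h.mul' (h.mul' h2 ha) (h.pow' hX 3)) hZ))
      (h.mul' (h.mul' (h.mul' h6 hb) (h.pow' hX 2)) (h.pow' hZ 2)))
      (h.mul' (h.mul' (h.mul' (h.mul' h2 ha) hb) hX) (h.pow' hZ 3)))
      (h.mul' (h.pow' hb 2) (h.pow' hZ 4)))).trans ?_⟩
  · rw [← sub_nonneg]; ring_nf; positivity
  · rw [← sub_nonneg]; ring_nf; positivity
  · rw [← sub_nonneg]; ring_nf; positivity

include h in
lemma nu_iter (a b : ℤ) {X Z : R} {B : ℝ} (hB : 1 ≤ B) (hX : ν X ≤ B) (hZ : ν Z ≤ B) (n : ℕ) :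
    LL a b * ν (iX a b X Z n) ≤ (LL a b * B) ^ (4 ^ n) ∧ LL a b * ν (iZ a b X Z n) ≤ (LL a b * B) ^ (4 ^ n) ∧
      LL a b * ν (iK a b X Z n) ≤ (LL a b * B) ^ (2 * 4 ^ n) := by
  have hL := one_le_LL a b
  have hL0 : 0 < LL a b := by linarith
  induction n with
  | zero =>
    simp only [iX_zero, iZ_zero, iK_zero, pow_zero, pow_one, mul_one]
    refine ⟨by gcongr, by gcongr, ?_⟩
    have := h.one
    nlinarith [mul_nonneg (sub_nonneg.mpr hL) (sub_nonneg.mpr hB), h.nonneg 1, mul_nonneg hL0.le (sub_nonneg.mpr h.one), mul_nonneg hL0.le (sub_nonneg.mpr hB)]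
  | succ n ih =>
    obtain ⟨i1, i2, i3⟩ := ih
    have eT : (LL a b * B) ^ (4 ^ (n + 1)) = ((LL a b * B) ^ (4 ^ n)) ^ 4 := by
      rw [← pow_mul]; congr 1
    have eT1 : (LL a b * B) ^ (2 * 4 ^ n) = ((LL a b * B) ^ (4 ^ n)) ^ 2 := by
      rw [← pow_mul]; congr 1; ring
    have eT2 : (LL a b * B) ^ (2 * 4 ^ (n+1)) = ((LL a b * B) ^ (4 ^ n)) ^ 8 := by
      rw [← pow_mul]; congr 1; ring
    rw [eT, eT2]
    rw [eT1] at i3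
    have hT : 0 < (LL a b * B) ^ (4 ^ n) := by positivity
    generalize (LL a b * B) ^ (4 ^ n) = T at *
    have j1 : ν (iX a b X Z n) ≤ T / LL a b := by rw [le_div_iff₀ hL0]; linarith
    have j2 : ν (iZ a b X Z n) ≤ T / LL a b := by rw [le_div_iff₀ hL0]; linarith
    have j3 : ν (iK a b X Z n) ≤ T ^ 2 / LL a b := by rw [le_div_iff₀ hL0]; linarith
    obtain ⟨k1, k2, k3⟩ := nu_dbl h a b j1 j2
    have e4 : LL a b * (LL a b * (T / LL a b) ^ 4) ≤ T ^ 4 := by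
      have : LL a b * (LL a b * (T / LL a b) ^ 4) = T ^ 4 / LL a b ^ 2 := by field_simp
      rw [this]; exact div_le_self (by positivity) (one_le_pow₀ hL)
    refine ⟨(mul_le_mul_of_nonneg_left k1 hL0.le).trans e4, (mul_le_mul_of_nonneg_left k2 hL0.le).trans e4, ?_⟩
    rw [iK_succ]
    refine (mul_le_mul_of_nonneg_left (h.mul' j3 k3) hL0.le).trans ?_
    have : LL a b * (T ^ 2 / LL a b * (LL a b * (T / LL a b) ^ 6)) = T ^ 8 / LL a b ^ 5 := by field_simp
    rw [this]; exact div_le_self (by positivity) (one_le_pow₀ hL)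

include h in
lemma nu_iter' (a b : ℤ) {X Z : R} {B : ℝ} (hB : 1 ≤ B) (hX : ν X ≤ B) (hZ : ν Z ≤ B) (n : ℕ) :
    ν (iX a b X Z n) ≤ (LL a b * B) ^ (2 * 4 ^ n) ∧ ν (iZ a b X Z n) ≤ (LL a b * B) ^ (2 * 4 ^ n) ∧
      ν (iK a b X Z n) ≤ (LL a b * B) ^ (2 * 4 ^ n) := by
  obtain ⟨h1, h2, h3⟩ := nu_iter h a b hB hX hZ n
  have hL := one_le_LL a b
  have hLB : 1 ≤ LL a b * B := one_le_mul_of_one_le_of_one_le hL hB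
  have hm : (LL a b * B) ^ (4 ^ n) ≤ (LL a b * B) ^ (2 * 4 ^ n) :=
    pow_le_pow_right₀ hLB (by omega)
  have hself : ∀ x, ν x ≤ LL a b * ν x := fun x => le_mul_of_one_le_left (h.nonneg _) hL
  exact ⟨(hself _).trans (h1.trans hm), (hself _).trans (h2.trans hm), (hself _).trans h3⟩
end norms

/-! ## Auxiliary forms -/
section forms
variable {R : Type*} [CommRing R]

def hU (a b : ℤ) (s : ℕ) (X₁ Z₁ X₂ Z₂ : R) : R :=
  (X₂ * iZ a b X₁ Z₁ s + Z₂ * iX a b X₁ Z₁ s) * (X₂ * iX a b X₁ Z₁ s + b * Z₂ * iZ a b X₁ Z₁ s)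
    + 2 * a * X₂ * Z₂ * iX a b X₁ Z₁ s * iZ a b X₁ Z₁ s
def hV (a b : ℤ) (s : ℕ) (X₁ Z₁ : R) : R := 2 * iK a b X₁ Z₁ s
def hZ (a b : ℤ) (s : ℕ) (X₁ Z₁ X₂ Z₂ : R) : R := (X₂ * iZ a b X₁ Z₁ s - Z₂ * iX a b X₁ Z₁ s) ^ 2
def hD (a b : ℤ) (X₁ Z₁ X₂ Z₂ : R) : R := fh a b X₁ Z₁ * fh a b X₂ Z₂

def pqs (a b : ℤ) (s : ℕ) (X₁ Z₁ X₂ Z₂ : R) : ℕ → R × R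
  | 0 => (1, 0)
  | j + 1 => (hU a b s X₁ Z₁ X₂ Z₂ * (pqs a b s X₁ Z₁ X₂ Z₂ j).1 +
        hV a b s X₁ Z₁ * hD a b X₁ Z₁ X₂ Z₂ * (pqs a b s X₁ Z₁ X₂ Z₂ j).2,
      hV a b s X₁ Z₁ * (pqs a b s X₁ Z₁ X₂ Z₂ j).1 + hU a b s X₁ Z₁ X₂ Z₂ * (pqs a b s X₁ Z₁ X₂ Z₂ j).2)

/-- `(𝒳^j)_α 𝒵^{n-j}`. -/
def Ac (a b : ℤ) (s : ℕ) (X₁ Z₁ X₂ Z₂ : R) (n j : ℕ) (α : Fin 2) : R :=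
  (if α = 0 then (pqs a b s X₁ Z₁ X₂ Z₂ j).1 else (pqs a b s X₁ Z₁ X₂ Z₂ j).2) * hZ a b s X₁ Z₁ X₂ Z₂ ^ (n - j)

lemma pqs_spec (a b : ℤ) (s : ℕ) (X₁ Z₁ X₂ Z₂ ρ : R) (hρ : ρ ^ 2 = hD a b X₁ Z₁ X₂ Z₂) (j : ℕ) :
    (pqs a b s X₁ Z₁ X₂ Z₂ j).1 + (pqs a b s X₁ Z₁ X₂ Z₂ j).2 * ρ =
      (hU a b s X₁ Z₁ X₂ Z₂ + hV a b s X₁ Z₁ * ρ) ^ j := by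
  induction j with
  | zero => simp [pqs]
  | succ j ih =>
    rw [pow_succ, ← ih, pqs, ← hρ]; ring

lemma Ac_spec (a b : ℤ) (s : ℕ) (X₁ Z₁ X₂ Z₂ ρ : R) (hρ : ρ ^ 2 = hD a b X₁ Z₁ X₂ Z₂) (n j : ℕ) :
    Ac a b s X₁ Z₁ X₂ Z₂ n j 0 + Ac a b s X₁ Z₁ X₂ Z₂ n j 1 * ρ =
      (hU a b s X₁ Z₁ X₂ Z₂ + hV a b s X₁ Z₁ * ρ) ^ j * hZ a b s X₁ Z₁ X₂ Z₂ ^ (n - j) := by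
  rw [← pqs_spec _ _ _ _ _ _ _ _ hρ]
  simp only [Ac, if_true, Fin.isValue, one_ne_zero, if_false]; ring

section map
variable {S : Type*} [CommRing S] (φ : R →+* S) (a b : ℤ) (s : ℕ) (X₁ Z₁ X₂ Z₂ : R)
lemma map_hU : φ (hU a b s X₁ Z₁ X₂ Z₂) = hU a b s (φ X₁) (φ Z₁) (φ X₂) (φ Z₂) := by
  simp [hU, map_iX, map_iZ, map_ofNat]
lemma map_hV : φ (hV a b s X₁ Z₁) = hV a b s (φ X₁) (φ Z₁) := by
  simp [hV, map_iK, map_ofNat]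
lemma map_hZ : φ (hZ a b s X₁ Z₁ X₂ Z₂) = hZ a b s (φ X₁) (φ Z₁) (φ X₂) (φ Z₂) := by
  simp [hZ, map_iX, map_iZ]
lemma map_hD : φ (hD a b X₁ Z₁ X₂ Z₂) = hD a b (φ X₁) (φ Z₁) (φ X₂) (φ Z₂) := by
  simp [hD, map_fh]
lemma map_pqs (j : ℕ) : φ (pqs a b s X₁ Z₁ X₂ Z₂ j).1 = (pqs a b s (φ X₁) (φ Z₁) (φ X₂) (φ Z₂) j).1 ∧
    φ (pqs a b s X₁ Z₁ X₂ Z₂ j).2 = (pqs a b s (φ X₁) (φ Z₁) (φ X₂) (φ Z₂) j).2 := by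
  induction j with
  | zero => simp [pqs]
  | succ j ih => simp [pqs, ih, map_hU, map_hV, map_hD]
lemma map_Ac (n j : ℕ) (α : Fin 2) :
    φ (Ac a b s X₁ Z₁ X₂ Z₂ n j α) = Ac a b s (φ X₁) (φ Z₁) (φ X₂) (φ Z₂) n j α := by
  unfold Ac
  split_ifs <;> simp [map_pqs, map_hZ]
end map

section scale
variable (a b : ℤ) (s : ℕ) (X₁ Z₁ X₂ Z₂ z w : R)
lemma scale_hU : hU a b s (z * X₁) (z * Z₁) (w * X₂) (w * Z₂) = z ^ (2 * 4 ^ s) * w ^ 2 * hU a b s X₁ Z₁ X₂ Z₂ := by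
  simp only [hU, (scale_iXZ a b X₁ Z₁ s z).1, (scale_iXZ a b X₁ Z₁ s z).2, two_mul, pow_add]; ring
lemma scale_hZ : hZ a b s (z * X₁) (z * Z₁) (w * X₂) (w * Z₂) = z ^ (2 * 4 ^ s) * w ^ 2 * hZ a b s X₁ Z₁ X₂ Z₂ := by
  simp only [hZ, (scale_iXZ a b X₁ Z₁ s z).1, (scale_iXZ a b X₁ Z₁ s z).2, two_mul, pow_add]; ring
lemma scale_hV : z ^ 2 * hV a b s (z * X₁) (z * Z₁) = z ^ (2 * 4 ^ s) * hV a b s X₁ Z₁ := by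
  simp only [hV]; linear_combination 2 * scale_iK a b X₁ Z₁ s z
lemma scale_fh : fh a b (z * X₁) (z * Z₁) = z ^ 4 * fh a b X₁ Z₁ := by
  simp only [fh]; ring
lemma scale_hD : hD a b (z * X₁) (z * Z₁) (w * X₂) (w * Z₂) = (z ^ 2 * w ^ 2) ^ 2 * hD a b X₁ Z₁ X₂ Z₂ := by
  simp only [hD, scale_fh]; ring
lemma scale_pqs (j : ℕ) :
    (pqs a b s (z * X₁) (z * Z₁) (w * X₂) (w * Z₂) j).1 = (z ^ (2 * 4 ^ s) * w ^ 2) ^ j * (pqs a b s X₁ Z₁ X₂ Z₂ j).1 ∧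
    z ^ 2 * w ^ 2 * (pqs a b s (z * X₁) (z * Z₁) (w * X₂) (w * Z₂) j).2 =
      (z ^ (2 * 4 ^ s) * w ^ 2) ^ j * (pqs a b s X₁ Z₁ X₂ Z₂ j).2 := by
  induction j with
  | zero => simp [pqs]
  | succ j ih =>
    obtain ⟨i1, i2⟩ := ih
    have hv := scale_hV a b s X₁ Z₁ z
    simp only [pqs, scale_hU, scale_hD, i1]
    generalize z ^ (2 * 4 ^ s) = t at *
    generalize (pqs a b s X₁ Z₁ X₂ Z₂ j).1 = p at *
    generalize (pqs a b s X₁ Z₁ X₂ Z₂ j).2 = q at *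
    generalize (pqs a b s (z * X₁) (z * Z₁) (w * X₂) (w * Z₂) j).2 = q' at *
    generalize hV a b s (z * X₁) (z * Z₁) = v' at *
    constructor
    · linear_combination (w ^ 2 * hD a b X₁ Z₁ X₂ Z₂ * (z ^ 2 * w ^ 2 * q')) * hv +
        (w ^ 2 * hD a b X₁ Z₁ X₂ Z₂ * t * hV a b s X₁ Z₁) * i2
    · linear_combination w ^ 2 * ((t * w ^ 2) ^ j * p) * hv + t * w ^ 2 * hU a b s X₁ Z₁ X₂ Z₂ * i2
lemma scale_Ac (n j : ℕ) (hj : j ≤ n) (α : Fin 2) :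
    (z ^ 2 * w ^ 2) ^ (α : ℕ) * Ac a b s (z * X₁) (z * Z₁) (w * X₂) (w * Z₂) n j α =
      (z ^ (2 * 4 ^ s) * w ^ 2) ^ n * Ac a b s X₁ Z₁ X₂ Z₂ n j α := by
  obtain ⟨i1, i2⟩ := scale_pqs a b s X₁ Z₁ X₂ Z₂ z w j
  obtain ⟨k, rfl⟩ := Nat.exists_eq_add_of_le hj
  unfold Ac
  rw [Nat.add_sub_cancel_left, scale_hZ, pow_add]
  fin_cases α
  · simp only [Fin.zero_eta, Fin.isValue, if_true, i1, pow_zero, mul_pow]; ring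
  · simp only [Fin.mk_one, Fin.isValue, one_ne_zero, if_false, pow_one]
    rw [← mul_assoc, i2, mul_pow _ (hZ _ _ _ _ _ _ _)]; ring
end scale

/-- The components of the auxiliary function. -/
def Fab (a₁ b₁ a₂ b₂ : ℤ) (s m n N : ℕ) (c : ℕ → ℕ → ℕ → ℤ) (α β : Fin 2) (X₁ Z₁ X₂ Z₂ : R) : R :=
  ∑ i ∈ Finset.range m, ∑ j ∈ Finset.range (n + 1), ∑ k ∈ Finset.range (N + 1),
    (c i j k : R) * (X₁ ^ i * Z₁ ^ (m - 1 - i)) *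
      (Ac a₁ b₁ s X₁ Z₁ X₂ Z₂ n j α * Ac a₂ b₂ s X₁ Z₁ X₂ Z₂ N k β)

lemma map_Fab {S : Type*} [CommRing S] (φ : R →+* S) (a₁ b₁ a₂ b₂ : ℤ) (s m n N : ℕ) (c : ℕ → ℕ → ℕ → ℤ)
    (α β : Fin 2) (X₁ Z₁ X₂ Z₂ : R) :
    φ (Fab a₁ b₁ a₂ b₂ s m n N c α β X₁ Z₁ X₂ Z₂) =
      Fab a₁ b₁ a₂ b₂ s m n N c α β (φ X₁) (φ Z₁) (φ X₂) (φ Z₂) := by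
  simp [Fab, map_sum, map_mul, map_Ac]

lemma scale_Fab (a₁ b₁ a₂ b₂ : ℤ) (s m n N : ℕ) (c : ℕ → ℕ → ℕ → ℤ)
    (α β : Fin 2) (X₁ Z₁ X₂ Z₂ z w : R) :
    (z ^ 2 * w ^ 2) ^ (α + β : ℕ) * Fab a₁ b₁ a₂ b₂ s m n N c α β (z * X₁) (z * Z₁) (w * X₂) (w * Z₂) =
      z ^ (m - 1) * (z ^ (2 * 4 ^ s) * w ^ 2) ^ (n + N) * Fab a₁ b₁ a₂ b₂ s m n N c α β X₁ Z₁ X₂ Z₂ := by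
  unfold Fab
  simp only [Finset.mul_sum]
  refine Finset.sum_congr rfl fun i hi => Finset.sum_congr rfl fun j hj => Finset.sum_congr rfl fun k hk => ?_
  rw [Finset.mem_range] at hi hj hk
  have e1 := scale_Ac a₁ b₁ s X₁ Z₁ X₂ Z₂ z w n j (by omega) α
  have e2 := scale_Ac a₂ b₂ s X₁ Z₁ X₂ Z₂ z w N k (by omega) β
  have e3 : z ^ (m - 1) = z ^ i * z ^ (m - 1 - i) := by rw [← pow_add]; congr 1; omega
  rw [pow_add, pow_add, e3, mul_pow z, mul_pow z]
  linear_combination (z ^ i * z ^ (m - 1 - i) * ((c i j k : R) * (X₁ ^ i * Z₁ ^ (m - 1 - i)))) *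
    ((z ^ 2 * w ^ 2) ^ (β : ℕ) * Ac a₂ b₂ s (z * X₁) (z * Z₁) (w * X₂) (w * Z₂) N k β * e1 + 
      (z ^ (2 * 4 ^ s) * w ^ 2) ^ n * Ac a₁ b₁ s X₁ Z₁ X₂ Z₂ n j α * e2)

/-- The auxiliary function in terms of `ρ₁, ρ₂`. -/
lemma Fab_spec (a₁ b₁ a₂ b₂ : ℤ) (s m n N : ℕ) (c : ℕ → ℕ → ℕ → ℤ) (X₁ Z₁ X₂ Z₂ ρ₁ ρ₂ : R)
    (h₁ : ρ₁ ^ 2 = hD a₁ b₁ X₁ Z₁ X₂ Z₂) (h₂ : ρ₂ ^ 2 = hD a₂ b₂ X₁ Z₁ X₂ Z₂) :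
    Fab a₁ b₁ a₂ b₂ s m n N c 0 0 X₁ Z₁ X₂ Z₂ + Fab a₁ b₁ a₂ b₂ s m n N c 1 0 X₁ Z₁ X₂ Z₂ * ρ₁ +
      Fab a₁ b₁ a₂ b₂ s m n N c 0 1 X₁ Z₁ X₂ Z₂ * ρ₂ + Fab a₁ b₁ a₂ b₂ s m n N c 1 1 X₁ Z₁ X₂ Z₂ * (ρ₁ * ρ₂) =
    ∑ i ∈ Finset.range m, ∑ j ∈ Finset.range (n + 1), ∑ k ∈ Finset.range (N + 1),
    (c i j k : R) * (X₁ ^ i * Z₁ ^ (m - 1 - i)) *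
      (((hU a₁ b₁ s X₁ Z₁ X₂ Z₂ + hV a₁ b₁ s X₁ Z₁ * ρ₁) ^ j * hZ a₁ b₁ s X₁ Z₁ X₂ Z₂ ^ (n - j)) *
       ((hU a₂ b₂ s X₁ Z₁ X₂ Z₂ + hV a₂ b₂ s X₁ Z₁ * ρ₂) ^ k * hZ a₂ b₂ s X₁ Z₁ X₂ Z₂ ^ (N - k))) := by
  simp only [← Ac_spec _ _ _ _ _ _ _ _ h₁, ← Ac_spec _ _ _ _ _ _ _ _ h₂]
  unfold Fab
  simp only [Finset.sum_mul, ← Finset.sum_add_distrib]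
  refine Finset.sum_congr rfl fun i hi => Finset.sum_congr rfl fun j hj => Finset.sum_congr rfl fun k hk => ?_
  ring

def Nmf (F₀₀ F₁₀ F₀₁ F₁₁ D₁ D₂ : R) : R :=
  (F₀₀ ^ 2 + F₁₀ ^ 2 * D₁ - D₂ * (F₀₁ ^ 2 + F₁₁ ^ 2 * D₁)) ^ 2 -
    (2 * F₀₀ * F₁₀ - 2 * D₂ * F₀₁ * F₁₁) ^ 2 * D₁

lemma Nmf_dvd (F₀₀ F₁₀ F₀₁ F₁₁ D₁ D₂ ρ₁ ρ₂ : R) (h₁ : ρ₁ ^ 2 = D₁) (h₂ : ρ₂ ^ 2 = D₂) :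
    F₀₀ + F₁₀ * ρ₁ + F₀₁ * ρ₂ + F₁₁ * (ρ₁ * ρ₂) ∣ Nmf F₀₀ F₁₀ F₀₁ F₁₁ D₁ D₂ := by
  subst h₁ h₂
  refine ⟨(F₀₀ + F₁₀ * ρ₁ - F₀₁ * ρ₂ - F₁₁ * (ρ₁ * ρ₂)) * ((F₀₀ - F₁₀ * ρ₁ + F₀₁ * ρ₂ - F₁₁ * (ρ₁ * ρ₂)) *
    (F₀₀ - F₁₀ * ρ₁ - F₀₁ * ρ₂ + F₁₁ * (ρ₁ * ρ₂))), ?_⟩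
  simp only [Nmf]; ring
end forms

section norms2
variable {R : Type*} [CommRing R] {ν : R → ℝ} (h : IsNu ν)

noncomputable def CA (a b : ℤ) (B : ℝ) (n : ℕ) : ℝ :=
  (8 * (1 + |(a:ℝ)| + |(b:ℝ)|) ^ 2 * B ^ 8 * (LL a b * B) ^ 4) ^ n

lemma one_le_CA0 (a b : ℤ) {B : ℝ} (hB : 1 ≤ B) :
    1 ≤ 8 * (1 + |(a:ℝ)| + |(b:ℝ)|) ^ 2 * B ^ 8 * (LL a b * B) ^ 4 := by
  have h1 : 1 ≤ 1 + |(a:ℝ)| + |(b:ℝ)| := by linarith [abs_nonneg (a:ℝ), abs_nonneg (b:ℝ)]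
  have hLB : 1 ≤ LL a b * B := one_le_mul_of_one_le_of_one_le (one_le_LL a b) hB
  have h8 : (1:ℝ) ≤ 8 := by norm_num
  exact one_le_mul_of_one_le_of_one_le (one_le_mul_of_one_le_of_one_le
    (one_le_mul_of_one_le_of_one_le h8 (one_le_pow₀ h1)) (one_le_pow₀ hB)) (one_le_pow₀ hLB)

lemma one_le_CA (a b : ℤ) {B : ℝ} (hB : 1 ≤ B) (n : ℕ) : 1 ≤ CA a b B n :=
  one_le_pow₀ (one_le_CA0 a b hB)

include h in
lemma nu_Ac (a b : ℤ) {X₁ Z₁ X₂ Z₂ : R} {B : ℝ} (hB : 1 ≤ B) (hX₁ : ν X₁ ≤ B) (hZ₁ : ν Z₁ ≤ B)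
    (hX₂ : ν X₂ ≤ B) (hZ₂ : ν Z₂ ≤ B) (s n j : ℕ) (hj : j ≤ n) (α : Fin 2) :
    ν (Ac a b s X₁ Z₁ X₂ Z₂ n j α) ≤ CA a b B n ^ (4 ^ s) := by
  obtain ⟨i1, i2, i3⟩ := nu_iter' h a b hB hX₁ hZ₁ s
  have hL := one_le_LL a b
  have hLB : 1 ≤ LL a b * B := one_le_mul_of_one_le_of_one_le hL hB
  have ha := h.int a
  have hb := h.int b
  have h2 : ν (2:R) ≤ 2 := h.num 2
  have hA : 0 ≤ |(a:ℝ)| := abs_nonneg _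
  have hA' : 0 ≤ |(b:ℝ)| := abs_nonneg _
  have hT : 1 ≤ (LL a b * B) ^ (2 * 4 ^ s) := one_le_pow₀ hLB
  set T := (LL a b * B) ^ (2 * 4 ^ s) with hTdef
  set M := 1 + |(a:ℝ)| + |(b:ℝ)| with hM
  have hM1 : 1 ≤ M := by linarith
  set T0 := 4 * M ^ 2 * B ^ 8 * T ^ 2 with hT0
  have hBp : 0 < B := by linarith
  have hMp : 0 < M := by linarith
  have hTp : 0 < T := by linarith
  have hMM : M ≤ M ^ 2 := by nlinarith
  have hB28 : B ^ 2 ≤ B ^ 8 := pow_le_pow_right₀ hB (by norm_num)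
  have hTT : T ≤ T ^ 2 := by nlinarith
  have hU' : ν (hU a b s X₁ Z₁ X₂ Z₂) ≤ T0 := by
    refine (h.add' (h.mul' (h.add' (h.mul' hX₂ i2) (h.mul' hZ₂ i1)) (h.add' (h.mul' hX₂ i1) (h.mul' (h.mul' hb hZ₂) i2)))
      (h.mul' (h.mul' (h.mul' (h.mul' (h.mul' h2 ha) hX₂) hZ₂) i1) i2)).trans ?_
    calc _ = 2 * M * (B ^ 2) * T ^ 2 := by rw [hM]; ring
      _ ≤ 4 * M ^ 2 * B ^ 8 * T ^ 2 := by gcongr; norm_num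
  have hV' : ν (hV a b s X₁ Z₁) ≤ 2 * T := h.mul' h2 i3
  have hf : ∀ X Z : R, ν X ≤ B → ν Z ≤ B → ν (fh a b X Z) ≤ M * B ^ 4 := by
    intro X Z hX hZ
    refine (h.mul' (h.mul' hX hZ) (h.add' (h.add' (h.pow' hX 2) (h.mul' (h.mul' ha hX) hZ)) (h.mul' hb (h.pow' hZ 2)))).trans ?_
    apply le_of_eq; rw [hM]; ring
  have hVD : ν (hV a b s X₁ Z₁ * hD a b X₁ Z₁ X₂ Z₂) ≤ T0 := by
    refine (h.mul' hV' (h.mul' (hf _ _ hX₁ hZ₁) (hf _ _ hX₂ hZ₂))).trans ?_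
    calc _ = 2 * M ^ 2 * B ^ 8 * T := by ring
      _ ≤ 4 * M ^ 2 * B ^ 8 * T ^ 2 := by gcongr; norm_num
  have hV'' : ν (hV a b s X₁ Z₁) ≤ T0 := by
    refine hV'.trans ?_
    calc _ = 2 * 1 * 1 * T := by ring
      _ ≤ 4 * M ^ 2 * B ^ 8 * T ^ 2 := by
        gcongr
        · norm_num
        · exact one_le_pow₀ hM1
        · exact one_le_pow₀ hB
  have hZ' : ν (hZ a b s X₁ Z₁ X₂ Z₂) ≤ T0 := by
    refine (h.pow' (h.sub' (h.mul' hX₂ i2) (h.mul' hZ₂ i1)) 2).trans ?_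
    calc _ = 4 * 1 * B ^ 2 * T ^ 2 := by ring
      _ ≤ 4 * M ^ 2 * B ^ 8 * T ^ 2 := by gcongr; exact one_le_pow₀ hM1
  have hT0p : 0 < T0 := by positivity
  have hT01 : 1 ≤ T0 := by
    calc (1:ℝ) ≤ 4 * 1 * 1 * 1 := by norm_num
      _ ≤ 4 * M ^ 2 * B ^ 8 * T ^ 2 := by
        gcongr
        · exact one_le_pow₀ hM1
        · exact one_le_pow₀ hB
        · exact one_le_pow₀ hT
  clear_value T0
  have hpq : ∀ j, ν (pqs a b s X₁ Z₁ X₂ Z₂ j).1 ≤ (2 * T0) ^ j ∧ ν (pqs a b s X₁ Z₁ X₂ Z₂ j).2 ≤ (2 * T0) ^ j := by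
    intro j
    induction j with
    | zero => simp [pqs, h.one, h.zero]
    | succ j ih =>
      have e : (2 * T0) ^ (j + 1) = T0 * (2 * T0) ^ j + T0 * (2 * T0) ^ j := by ring
      rw [e]
      exact ⟨h.add' (h.mul' hU' ih.1) (h.mul' hVD ih.2), h.add' (h.mul' hV'' ih.1) (h.mul' hU' ih.2)⟩
  have h3 : ν (Ac a b s X₁ Z₁ X₂ Z₂ n j α) ≤ (2 * T0) ^ n := by
    obtain ⟨k, rfl⟩ := Nat.exists_eq_add_of_le hj
    have hz : ν (hZ a b s X₁ Z₁ X₂ Z₂ ^ k) ≤ (2 * T0) ^ k := h.pow' (by linarith) k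
    unfold Ac
    rw [Nat.add_sub_cancel_left, pow_add]
    apply h.mul' _ hz
    split_ifs
    · exact (hpq j).1
    · exact (hpq j).2
  refine h3.trans ?_
  rw [CA, ← pow_mul, mul_comm n, pow_mul]
  apply pow_le_pow_left₀ (by positivity)
  rw [mul_pow _ ((LL a b * B) ^ 4), ← pow_mul]
  have e : T ^ 2 = (LL a b * B) ^ (4 * 4 ^ s) := by rw [hTdef, ← pow_mul]; congr 1; ring
  rw [hT0, e, ← mul_assoc]
  gcongr
  rw [← hM]
  have h1 : 1 ≤ 8 * M ^ 2 * B ^ 8 := one_le_mul_of_one_le_of_one_le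
    (one_le_mul_of_one_le_of_one_le (by norm_num) (one_le_pow₀ hM1)) (one_le_pow₀ hB)
  calc 2 * (4 * M ^ 2 * B ^ 8) = (8 * M ^ 2 * B ^ 8) ^ 1 := by ring
    _ ≤ (8 * M ^ 2 * B ^ 8) ^ (4 ^ s) := pow_le_pow_right₀ h1 (Nat.one_le_pow _ _ (by norm_num))

include h in
lemma nu_Fab (a₁ b₁ a₂ b₂ : ℤ) {X₁ Z₁ X₂ Z₂ : R} {B Cc : ℝ} (hB : 1 ≤ B) (hX₁ : ν X₁ ≤ B) (hZ₁ : ν Z₁ ≤ B)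
    (hX₂ : ν X₂ ≤ B) (hZ₂ : ν Z₂ ≤ B) (s m n N : ℕ) (c : ℕ → ℕ → ℕ → ℤ) (hc : ∀ i j k, |(c i j k : ℝ)| ≤ Cc) (α β : Fin 2) :
    ν (Fab a₁ b₁ a₂ b₂ s m n N c α β X₁ Z₁ X₂ Z₂) ≤
      m * ((n + 1 : ℕ) * ((N + 1 : ℕ) * (Cc * B ^ (m - 1) * (CA a₁ b₁ B n ^ 4 ^ s * CA a₂ b₂ B N ^ 4 ^ s)))) := by
  have hc0 : 0 ≤ Cc := (abs_nonneg _).trans (hc 0 0 0)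
  refine (h.sum _ _).trans ((Finset.sum_le_card_nsmul _ _ _ fun i hi => (h.sum _ _).trans
    (Finset.sum_le_card_nsmul _ _ _ fun j hj => (h.sum _ _).trans
      (Finset.sum_le_card_nsmul _ _ (Cc * B ^ (m - 1) * (CA a₁ b₁ B n ^ 4 ^ s * CA a₂ b₂ B N ^ 4 ^ s)) fun k hk => ?_))).trans ?_)
  · rw [Finset.mem_range] at hi hj hk
    have e : B ^ (m - 1) = B ^ i * B ^ (m - 1 - i) := by rw [← pow_add]; congr 1; omega
    rw [e]
    exact h.mul' (h.mul' ((h.int _).trans (hc _ _ _)) (h.mul' (h.pow' hX₁ _) (h.pow' hZ₁ _)))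
      (h.mul' (nu_Ac h a₁ b₁ hB hX₁ hZ₁ hX₂ hZ₂ s n j (by omega) α) (nu_Ac h a₂ b₂ hB hX₁ hZ₁ hX₂ hZ₂ s N k (by omega) β))
  · simp only [Finset.card_range, nsmul_eq_mul]; exact le_rfl

include h in
lemma nu_Nmf {F₀₀ F₁₀ F₀₁ F₁₁ D₁ D₂ : R} {B : ℝ} (hB : 1 ≤ B) (h1 : ν F₀₀ ≤ B) (h2 : ν F₁₀ ≤ B)
    (h3 : ν F₀₁ ≤ B) (h4 : ν F₁₁ ≤ B) (h5 : ν D₁ ≤ B) (h6 : ν D₂ ≤ B) :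
    ν (Nmf F₀₀ F₁₀ F₀₁ F₁₁ D₁ D₂) ≤ 32 * B ^ 8 := by
  have h7 : ν (2:R) ≤ 2 := h.num 2
  refine (h.sub' (h.pow' (h.sub' (h.add' (h.pow' h1 2) (h.mul' (h.pow' h2 2) h5)) (h.mul' h6 (h.add' (h.pow' h3 2) (h.mul' (h.pow' h4 2) h5)))) 2)
    (h.mul' (h.pow' (h.sub' (h.mul' (h.mul' h7 h1) h2) (h.mul' (h.mul' (h.mul' h7 h6) h3) h4)) 2) h5)).trans ?_
  have e2 : B ^ 2 ≤ B ^ 4 := pow_le_pow_right₀ hB (by norm_num)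
  have e3 : B ^ 3 ≤ B ^ 4 := pow_le_pow_right₀ hB (by norm_num)
  have e7 : B ^ 7 ≤ B ^ 8 := pow_le_pow_right₀ hB (by norm_num)
  have e6 : B ^ 6 ≤ B ^ 8 := pow_le_pow_right₀ hB (by norm_num)
  have e5 : B ^ 5 ≤ B ^ 8 := pow_le_pow_right₀ hB (by norm_num)
  have hp : 0 ≤ B := by linarith
  have k1 : (B ^ 2 + B ^ 2 * B + B * (B ^ 2 + B ^ 2 * B)) ^ 2 ≤ (4 * B ^ 4) ^ 2 := by
    apply pow_le_pow_left₀ (by positivity)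
    calc _ = B ^ 2 + 2 * B ^ 3 + B ^ 4 := by ring
      _ ≤ _ := by linarith
  have k2 : (2 * B * B + 2 * B * B * B) ^ 2 * B = 4 * B ^ 5 + 8 * B ^ 6 + 4 * B ^ 7 := by ring
  rw [k2]
  have k3 : (4 * B ^ 4) ^ 2 = 16 * B ^ 8 := by ring
  linarith
end norms2

end

section

attribute [local instance] Matrix.seminormedAddCommGroup Matrix.normedAddCommGroup in
lemma siegel_simple {α β : Type*} [Fintype α] [Fintype β] (A : Matrix α β ℤ) (M : ℝ) (hM : 1 ≤ M)
    (hA : ∀ i j, |(A i j : ℝ)| ≤ M) (h0 : 0 < Fintype.card α) (h2 : 2 * Fintype.card α ≤ Fintype.card β) :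
    ∃ t : β → ℤ, t ≠ 0 ∧ A.mulVec t = 0 ∧ ∀ j, |(t j : ℝ)| ≤ Fintype.card β * M := by
  obtain ⟨t, ht, h1, h3⟩ := Int.Matrix.exists_ne_zero_int_vec_norm_le A (by omega) h0
  refine ⟨t, ht, h1, fun j => ?_⟩
  have hAn : ‖A‖ ≤ M := by
    rw [Matrix.norm_le_iff (by linarith)]
    intro i j; rw [Int.norm_eq_abs]; exact hA i j
  have e1 : ‖t j‖ ≤ ‖t‖ := norm_le_pi_norm t j
  rw [Int.norm_eq_abs] at e1
  refine e1.trans (h3.trans ?_)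
  have hα : (0:ℝ) < Fintype.card α := by exact_mod_cast h0
  have hβ : 2 * (Fintype.card α : ℝ) ≤ Fintype.card β := by exact_mod_cast h2
  have hcard : (1:ℝ) ≤ Fintype.card α := by exact_mod_cast h0
  have hbase : (1:ℝ) ≤ Fintype.card β * max 1 ‖A‖ := 
    one_le_mul_of_one_le_of_one_le (by linarith) (le_max_left _ _)
  calc _ ≤ (Fintype.card β * max 1 ‖A‖) ^ (1:ℝ) := by
        apply Real.rpow_le_rpow_of_exponent_le hbase
        rw [div_le_one (by linarith)]; linarith
    _ = Fintype.card β * max 1 ‖A‖ := Real.rpow_one _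
    _ ≤ _ := by gcongr; exact max_le hM hAn

section
open Polynomial
variable {R : Type*} [CommRing R]

lemma nd_int_mul (a : ℤ) {p : R[X]} {n : ℕ} (h : p.natDegree ≤ n) : ((a : R[X]) * p).natDegree ≤ n := by
  refine natDegree_mul_le.trans ?_
  simpa using h

lemma nd_int (a : ℤ) (n : ℕ) : ((a : R[X])).natDegree ≤ n := by
  simp
lemma nd_add {p q : R[X]} {n : ℕ} (h : p.natDegree ≤ n) (h' : q.natDegree ≤ n) : (p + q).natDegree ≤ n :=
  natDegree_add_le_of_degree_le h h'
lemma nd_sub {p q : R[X]} {n : ℕ} (h : p.natDegree ≤ n) (h' : q.natDegree ≤ n) : (p - q).natDegree ≤ n :=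
  natDegree_sub_le_of_le h h' |>.trans (by simp)
lemma nd_mul {p q : R[X]} {n k l : ℕ} (h : p.natDegree ≤ k) (h' : q.natDegree ≤ l) (hn : k + l ≤ n) : (p * q).natDegree ≤ n :=
  (natDegree_mul_le_of_le h h').trans hn
lemma nd_pow {p : R[X]} {n k : ℕ} (l : ℕ) (h : p.natDegree ≤ k) (hn : l * k ≤ n) : (p ^ l).natDegree ≤ n :=
  (natDegree_pow_le_of_le l h).trans hn
lemma nd_num (k : ℕ) [k.AtLeastTwo] (n : ℕ) : ((OfNat.ofNat k : R[X])).natDegree ≤ n := by simp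

lemma nd_iter (a b : ℤ) (s : ℕ) : ∀ X Z : R[X], X.natDegree ≤ 1 → Z.natDegree ≤ 1 →
    (iX a b X Z s).natDegree ≤ 4 ^ s ∧ (iZ a b X Z s).natDegree ≤ 4 ^ s ∧ 
      (iK a b X Z s).natDegree ≤ 2 * 4 ^ s := by
  intro X Z hX hZ
  induction s with
  | zero => simp [hX, hZ]
  | succ s ih =>
    obtain ⟨h1, h2, h3⟩ := ih
    rw [iX_succ, iZ_succ, iK_succ, pow_succ]
    generalize 4 ^ s = q at *
    generalize iX a b X Z s = x at *
    generalize iZ a b X Z s = z at *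
    have hs : (x ^ 2 - b * z ^ 2).natDegree ≤ 2 * q := nd_sub (nd_pow 2 h1 le_rfl) (nd_int_mul _ (nd_pow 2 h2 le_rfl))
    refine ⟨nd_pow 2 hs (by omega), ?_, ?_⟩
    · refine nd_mul (nd_num 4 0) (nd_mul (l := 2 * q) (nd_mul h1 h2 le_rfl) (nd_add (nd_add (nd_pow 2 h1 le_rfl) ?_)
        (nd_int_mul _ (nd_pow 2 h2 le_rfl))) le_rfl) (by omega)
      exact nd_mul (nd_int_mul _ h1) h2 (by omega)
    · refine nd_mul h3 (l := 6 * q) (nd_mul (l := 4 * q) (nd_mul (nd_num 2 0) hs le_rfl) ?_ (by omega)) (by omega)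
      refine nd_add (nd_add (nd_add (nd_add ?_ ?_) ?_) ?_) ?_
      · exact nd_pow 4 h1 le_rfl
      · exact nd_mul (nd_mul (nd_mul (nd_num 2 0) (nd_int a 0) le_rfl) (nd_pow 3 h1 le_rfl) le_rfl) h2 (by omega)
      · exact nd_mul (nd_mul (nd_mul (nd_num 6 0) (nd_int b 0) le_rfl) (nd_pow 2 h1 le_rfl) le_rfl) (nd_pow 2 h2 le_rfl) (by omega)
      · exact nd_mul (nd_mul (nd_mul (nd_mul (nd_num 2 0) (nd_int a 0) le_rfl) (nd_int b 0) le_rfl) h1 le_rfl) (nd_pow 3 h2 le_rfl) (by omega)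
      · exact nd_mul (nd_pow 2 (nd_int b 0) le_rfl) (nd_pow 4 h2 le_rfl) (by omega)

lemma nd_fh (a b : ℤ) {X Z : R[X]} {d : ℕ} (hX : X.natDegree ≤ d) (hZ : Z.natDegree ≤ d) : (fh a b X Z).natDegree ≤ 4 * d := by
  refine nd_mul (l := 2 * d) (nd_mul hX hZ le_rfl) (nd_add (nd_add (nd_pow 2 hX le_rfl) (nd_mul (nd_int_mul _ hX) hZ (by omega)))
        (nd_int_mul _ (nd_pow 2 hZ le_rfl))) (by omega)

/-- degree bound for the components: `d₁ = 1` for the first variable, `d₂` for the second. -/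
lemma nd_Ac' (a b : ℤ) (s : ℕ) (X₁ Z₁ X₂ Z₂ : R[X]) (q d₁ d₂ : ℕ) (h1 : (iX a b X₁ Z₁ s).natDegree ≤ q)
    (h2 : (iZ a b X₁ Z₁ s).natDegree ≤ q) (h3 : (iK a b X₁ Z₁ s).natDegree ≤ 2 * q)
    (hX : X₁.natDegree ≤ d₁) (hZ1 : Z₁.natDegree ≤ d₁) (hX2 : X₂.natDegree ≤ d₂) (hZ2 : Z₂.natDegree ≤ d₂)
    (n j : ℕ) (hj : j ≤ n) (α : Fin 2) :
    (Ac a b s X₁ Z₁ X₂ Z₂ n j α).natDegree ≤ n * (2 * q + 4 * d₁ + 4 * d₂) := by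
  set M := 2 * q + 4 * d₁ + 4 * d₂
  have hU' : (hU a b s X₁ Z₁ X₂ Z₂).natDegree ≤ M := by
    refine nd_add (nd_mul (k := d₂ + q) (l := d₂ + q) (nd_add (nd_mul hX2 h2 le_rfl) (nd_mul hZ2 h1 le_rfl)) (nd_add (nd_mul hX2 h1 le_rfl)
      (nd_mul (nd_int_mul _ hZ2) h2 le_rfl)) (by omega)) ?_
    exact nd_mul (nd_mul (nd_mul (nd_mul (nd_mul (nd_num 2 0) (nd_int a 0) le_rfl) hX2 le_rfl) hZ2 le_rfl) h1 le_rfl) h2 (by omega)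
  have hV1 : (hV a b s X₁ Z₁).natDegree ≤ 2 * q := nd_mul (nd_num 2 0) h3 (by omega)
  have hV' : (hV a b s X₁ Z₁).natDegree ≤ M := hV1.trans (by omega)
  have hD' : (hD a b X₁ Z₁ X₂ Z₂).natDegree ≤ 4 * d₁ + 4 * d₂ := nd_mul (nd_fh a b hX hZ1) (nd_fh a b hX2 hZ2) le_rfl
  have hVD : (hV a b s X₁ Z₁ * hD a b X₁ Z₁ X₂ Z₂).natDegree ≤ M := nd_mul hV1 hD' (by omega)
  have hZ' : (hZ a b s X₁ Z₁ X₂ Z₂).natDegree ≤ M := 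
    nd_pow (k := d₂ + q) 2 (nd_sub (nd_mul hX2 h2 le_rfl) (nd_mul hZ2 h1 le_rfl)) (by omega)
  have hpq : ∀ j, (pqs a b s X₁ Z₁ X₂ Z₂ j).1.natDegree ≤ j * M ∧ (pqs a b s X₁ Z₁ X₂ Z₂ j).2.natDegree ≤ j * M := by
    intro j
    induction j with
    | zero => simp [pqs]
    | succ j ih =>
      have e : M + j * M ≤ (j + 1) * M := by rw [add_mul]; omega
      exact ⟨nd_add (nd_mul hU' ih.1 e) (nd_mul hVD ih.2 e), nd_add (nd_mul hV' ih.1 e) (nd_mul hU' ih.2 e)⟩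
  unfold Ac
  have e : j * M + (n - j) * M ≤ n * M := by rw [← add_mul]; gcongr; omega
  refine nd_mul ?_ (nd_pow (n - j) hZ' le_rfl) e
  split_ifs
  · exact (hpq j).1
  · exact (hpq j).2

lemma nd_Ac (a b : ℤ) (s : ℕ) (e : ℤ) (n j : ℕ) (hj : j ≤ n) (α : Fin 2) :
    (Ac a b s (X : R[X]) 1 (e : R[X]) 1 n j α).natDegree ≤ n * (2 * 4 ^ s + 4) := by
  obtain ⟨h1, h2, h3⟩ := nd_iter a b s (X : R[X]) 1 natDegree_X_le (by simp)
  have := nd_Ac' a b s (X : R[X]) 1 (e : R[X]) 1 (4 ^ s) 1 0 h1 h2 h3 natDegree_X_le (by simp) (by simp) (by simp) n j hj α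
  simpa using this
end

open Polynomial in
lemma siegel_aux (a₁ b₁ a₂ b₂ : ℤ) (N : ℕ) (hNN : N = 255) : ∃ C : ℝ, 1 ≤ C ∧ ∀ e : ℤ, |e| ≤ 9 → ∀ s : ℕ, 1 ≤ s → ∀ m : ℕ, m = 4 ^ (s - 1) →
    ∃ c : ℕ → ℕ → ℕ → ℤ, (∃ i j k, i < m ∧ j ≤ N ∧ k ≤ N ∧ c i j k ≠ 0) ∧ (∀ i j k, |(c i j k : ℝ)| ≤ C ^ (4 ^ s)) ∧
      ∀ α β, Fab a₁ b₁ a₂ b₂ s m N N c α β (X : ℤ[X]) 1 (e : ℤ[X]) 1 = 0 := by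
  set C₁ := CA a₁ b₁ 9 N
  set C₂ := CA a₂ b₂ 9 N
  have hC₁ : 1 ≤ C₁ := one_le_CA _ _ (by norm_num) _
  have hC₂ : 1 ≤ C₂ := one_le_CA _ _ (by norm_num) _
  refine ⟨2 * (N + 1) ^ 2 * (C₁ * C₂), ?_, ?_⟩
  · exact one_le_mul_of_one_le_of_one_le (one_le_mul_of_one_le_of_one_le (by norm_num) (one_le_pow₀ (by simp)))
      (one_le_mul_of_one_le_of_one_le hC₁ hC₂)
  intro e he s hs m hm
  have hm1 : 1 ≤ m := by rw [hm]; exact Nat.one_le_pow _ _ (by norm_num)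
  have hq : 4 ^ s = 4 * m := by rw [hm, ← pow_succ']; congr 1; omega
  let row := Fin 2 × Fin 2 × Fin (m + 2 * N * (2 * 4 ^ s + 4))
  let col := Fin m × Fin (N + 1) × Fin (N + 1)
  let T : col → Fin 2 → Fin 2 → ℤ[X] := fun x α β => X ^ (x.1 : ℕ) * 1 ^ (m - 1 - x.1) * 
    (Ac a₁ b₁ s (X : ℤ[X]) 1 (e : ℤ[X]) 1 N x.2.1 α * Ac a₂ b₂ s (X : ℤ[X]) 1 (e : ℤ[X]) 1 N x.2.2 β)
  let A : Matrix row col ℤ := fun r x => (T x r.1 r.2.1).coeff r.2.2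
  have hν := isNu_l1 isNu_int
  have he' : |(e:ℝ)| ≤ 9 := by exact_mod_cast he
  have hXn : l1 (fun n : ℤ => |(n : ℝ)|) (X : ℤ[X]) ≤ 9 := (l1_X isNu_int).trans (by norm_num)
  have h1n : l1 (fun n : ℤ => |(n : ℝ)|) (1 : ℤ[X]) ≤ 9 := hν.one.trans (by norm_num)
  have hen : l1 (fun n : ℤ => |(n : ℝ)|) (e : ℤ[X]) ≤ 9 := (hν.int e).trans he'
  have hA : ∀ r x, |(A r x : ℝ)| ≤ (C₁ * C₂) ^ (4 ^ s) := by
    intro r x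
    refine (coeff_le_l1 isNu_int _ _).trans ?_
    have hx1 := x.2.1.2
    have hx2 := x.2.2.2
    have hT : l1 (fun n : ℤ => |(n : ℝ)|) (T x r.1 r.2.1) ≤ (1 ^ (x.1:ℕ) * 1 ^ (m - 1 - x.1)) * (C₁ ^ 4 ^ s * C₂ ^ 4 ^ s) :=
      hν.mul' (hν.mul' (hν.pow' (l1_X isNu_int) _) (hν.pow' hν.one _)) (hν.mul' 
      (nu_Ac hν a₁ b₁ (by norm_num) hXn h1n hen h1n s N _ (by omega) _) 
      (nu_Ac hν a₂ b₂ (by norm_num) hXn h1n hen h1n s N _ (by omega) _))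
    rw [mul_pow]; simpa using hT
  have hcr : Fintype.card row = 4 * (m + 2 * N * (2 * 4 ^ s + 4)) := by
    simp only [row, Fintype.card_prod, Fintype.card_fin]; ring
  have hcc : Fintype.card col = m * (N + 1) ^ 2 := by
    simp only [col, Fintype.card_prod, Fintype.card_fin]; ring
  obtain ⟨t, ht, hAt, htb⟩ := siegel_simple A ((C₁ * C₂) ^ (4 ^ s)) (one_le_pow₀ (one_le_mul_of_one_le_of_one_le hC₁ hC₂)) hA
    (by rw [hcr]; omega) (by rw [hcr, hcc, hq, hNN]; omega)
  let c : ℕ → ℕ → ℕ → ℤ := fun i j k => if h : i < m ∧ j < N + 1 ∧ k < N + 1 then t (⟨i, h.1⟩, ⟨j, h.2.1⟩, ⟨k, h.2.2⟩) else 0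
  have hct : ∀ x : col, c x.1 x.2.1 x.2.2 = t x := by
    intro x; exact dif_pos ⟨x.1.2, x.2.1.2, x.2.2.2⟩
  refine ⟨c, ?_, ?_, ?_⟩
  · obtain ⟨x, hx⟩ := Function.ne_iff.mp ht
    refine ⟨x.1, x.2.1, x.2.2, x.1.2, by omega, by omega, ?_⟩
    rw [hct]; simpa using hx
  · have hb : ((Fintype.card col : ℕ) : ℝ) * (C₁ * C₂) ^ (4 ^ s) ≤ (2 * (N + 1) ^ 2 * (C₁ * C₂)) ^ 4 ^ s := by
      rw [mul_pow _ (C₁ * C₂), hcc]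
      gcongr
      push_cast
      rw [mul_pow]
      gcongr
      · have h1 : m ≤ 2 ^ 4 ^ s := by
          calc m ≤ 4 ^ s := by omega
            _ ≤ 2 ^ 4 ^ s := Nat.lt_two_pow_self.le
        exact_mod_cast h1
      · apply le_self_pow₀ (one_le_pow₀ (by simp)); positivity
    intro i j k
    simp only [c]
    split_ifs with h
    · exact (htb _).trans hb
    · simp only [Int.cast_zero, abs_zero]; positivity
  · intro α β
    have hF : Fab a₁ b₁ a₂ b₂ s m N N c α β (X : ℤ[X]) 1 (e : ℤ[X]) 1 = ∑ x : col, (t x : ℤ[X]) * T x α β := by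
      unfold Fab
      rw [Fintype.sum_prod_type]
      rw [Finset.sum_range]
      refine Finset.sum_congr rfl fun i _ => ?_
      rw [Fintype.sum_prod_type, Finset.sum_range]
      refine Finset.sum_congr rfl fun j _ => ?_
      rw [Finset.sum_range]
      refine Finset.sum_congr rfl fun k _ => ?_
      rw [← hct (i, j, k)]
      simp only [T]; ring
    rw [hF]
    ext r
    rw [coeff_zero, finsetSum_coeff]
    by_cases hr : r < m + 2 * N * (2 * 4 ^ s + 4)
    · have := congrFun hAt (α, β, ⟨r, hr⟩)
      simp only [Matrix.mulVec, dotProduct, Pi.zero_apply] at this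
      rw [← this]
      refine Finset.sum_congr rfl fun x _ => ?_
      rw [← Polynomial.C_eq_intCast, coeff_C_mul, mul_comm, Int.cast_id]
    · apply Finset.sum_eq_zero
      intro x _
      rw [← Polynomial.C_eq_intCast, coeff_C_mul]
      rw [coeff_eq_zero_of_natDegree_lt, mul_zero]
      have hx0 := x.1.2
      have hx1 := x.2.1.2
      have hx2 := x.2.2.2
      have : (T x α β).natDegree ≤ (m - 1) + (N * (2 * 4 ^ s + 4) + N * (2 * 4 ^ s + 4)) := by
        refine nd_mul (k := m - 1) ?_ (nd_mul (nd_Ac a₁ b₁ s e N _ (by omega) α) (nd_Ac a₂ b₂ s e N _ (by omega) β) le_rfl) le_rfl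
        rw [one_pow, mul_one]
        exact (natDegree_X_pow_le _).trans (by omega)
      have e2 : 2 * N * (2 * 4 ^ s + 4) = N * (2 * 4 ^ s + 4) + N * (2 * 4 ^ s + 4) := by ring
      omega

end

section

section parity
open Polynomial
/-- `D` is not a square in the strong sense. -/
def NSq {R : Type*} [CommRing R] (D : R) : Prop := ∀ u v : R, u ^ 2 = v ^ 2 * D → u = 0 ∧ v = 0

lemma nsq_of_simple_root {R : Type*} [CommRing R] [IsDomain R] (D G : R[X]) (t : R) (h : D = (X - C t) * G)
    (hG : G.eval t ≠ 0) : NSq D := by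
  intro u v huv
  have hG0 : G ≠ 0 := by rintro rfl; simp at hG
  have hD0 : D ≠ 0 := by rw [h]; exact mul_ne_zero (X_sub_C_ne_zero t) hG0
  have hD1 : D.rootMultiplicity t = 1 := by
    rw [h, rootMultiplicity_mul (h ▸ hD0), rootMultiplicity_X_sub_C_self, rootMultiplicity_eq_zero hG]
  by_cases hv : v = 0
  · subst hv; simpa using huv
  exfalso
  have hu : u ≠ 0 := by
    rintro rfl
    have : v ^ 2 * D = 0 := by rw [← huv]; simp
    simp [hv, hD0] at this
  have e := congrArg (rootMultiplicity t) huv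
  rw [rootMultiplicity_mul (mul_ne_zero (pow_ne_zero 2 hv) hD0), hD1, sq, sq, rootMultiplicity_mul (mul_ne_zero hu hu), 
    rootMultiplicity_mul (mul_ne_zero hv hv)] at e
  omega

lemma NSq.ne_zero {R : Type*} [CommRing R] [Nontrivial R] {D : R} (h : NSq D) : D ≠ 0 := by
  rintro rfl
  have := h 0 1 (by simp)
  simp at this

lemma Nmf_zero {R : Type*} [CommRing R] [IsDomain R] (h2 : (2:R) ≠ 0) {p w r t D₁ D₂ : R} (h₁ : NSq D₁) (h₂ : NSq D₂) (h₁₂ : NSq (D₁ * D₂))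
    (h : Nmf p w r t D₁ D₂ = 0) : p = 0 ∧ w = 0 ∧ r = 0 ∧ t = 0 := by
  have hD1 := h₁.ne_zero
  obtain ⟨hu, hv⟩ := h₁ _ _ (sub_eq_zero.mp h)
  have hv' : p * w = D₂ * r * t := by
    apply mul_left_cancel₀ h2; linear_combination hv
  have h3 : (p ^ 2 - r ^ 2 * D₂) * (p ^ 2 - t ^ 2 * (D₁ * D₂)) = 0 := by
    linear_combination p ^ 2 * hu - D₁ * (p * w + D₂ * r * t) * hv'
  rcases mul_eq_zero.mp h3 with h4 | h4
  · obtain ⟨rfl, rfl⟩ := h₂ _ _ (sub_eq_zero.mp h4)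
    have h5 : w ^ 2 = t ^ 2 * D₂ := by
      apply mul_left_cancel₀ hD1; linear_combination hu
    obtain ⟨rfl, rfl⟩ := h₂ _ _ h5
    simp
  · obtain ⟨rfl, rfl⟩ := h₁₂ _ _ (sub_eq_zero.mp h4)
    have h5 : (w * D₁) ^ 2 = r ^ 2 * (D₁ * D₂) := by linear_combination D₁ * hu
    obtain ⟨h6, rfl⟩ := h₁₂ _ _ h5
    simpa [hD1] using h6
end parity

section degs
open Polynomial
variable {R : Type*} [CommRing R] [IsDomain R] [CharZero R]

lemma deg_quad (a b : ℤ) {x z : R[X]} {q : ℕ} (h1 : x.Monic) (h2 : x.natDegree = q) (h4 : z.degree < (q:ℕ)) :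
    (x ^ 2 + a * x * z + b * z ^ 2).Monic ∧ (x ^ 2 + a * x * z + b * z ^ 2).natDegree = 2 * q := by
  have hx : x.degree = q := by rw [degree_eq_natDegree h1.ne_zero, h2]
  have hx2 : (x ^ 2).Monic := h1.pow 2
  have hxd : (x ^ 2).degree = (2 * q : ℕ) := by rw [degree_pow, hx]; simp
  have hsm : (a * x * z + b * z ^ 2 : R[X]).degree < (x ^ 2).degree := by
    by_cases hz : z = 0
    · subst hz; simp [h1.ne_zero, hxd]; exact WithBot.bot_lt_coe _
    have hzn : z.natDegree < q := (natDegree_lt_iff_degree_lt hz).mpr h4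
    rw [hxd]
    refine lt_of_le_of_lt degree_le_natDegree ?_
    rw [Nat.cast_lt]
    have : (a * x * z + b * z ^ 2 : R[X]).natDegree ≤ q + z.natDegree := 
      nd_add (nd_mul (nd_int_mul a h2.le) le_rfl le_rfl) (nd_int_mul b (nd_pow 2 le_rfl (by omega)))
    omega
  rw [add_assoc]
  refine ⟨hx2.add_of_left hsm, ?_⟩
  apply natDegree_eq_of_degree_eq_some
  rw [degree_add_eq_left_of_degree_lt hsm, hxd]

lemma deg_iter (a b : ℤ) (n : ℕ) : (iX a b (X : R[X]) 1 n).Monic ∧ (iX a b (X : R[X]) 1 n).natDegree = 4 ^ n ∧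
    iZ a b (X : R[X]) 1 n ≠ 0 ∧ (iZ a b (X : R[X]) 1 n).degree < (4 ^ n : ℕ) := by
  induction n with
  | zero => simp [monic_X]
  | succ n ih =>
    obtain ⟨h1, h2, h3, h4⟩ := ih
    rw [iX_succ, iZ_succ, pow_succ]
    generalize 4 ^ n = q at *
    generalize iX a b (X : R[X]) 1 n = x at *
    generalize iZ a b (X : R[X]) 1 n = z at *
    obtain ⟨k1, k2⟩ := deg_quad 0 (-b) h1 h2 h4
    have e : x ^ 2 + ((0:ℤ) : R[X]) * x * z + ((-b : ℤ) : R[X]) * z ^ 2 = x ^ 2 - b * z ^ 2 := by push_cast; ring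
    rw [e] at k1 k2
    obtain ⟨l1, l2⟩ := deg_quad a b h1 h2 h4
    have hzn : z.natDegree < q := (natDegree_lt_iff_degree_lt h3).mpr h4
    have hne : dZ (a : R[X]) b x z ≠ 0 := by
      unfold dZ
      exact mul_ne_zero (by norm_num) (mul_ne_zero (mul_ne_zero h1.ne_zero h3) l1.ne_zero)
    refine ⟨k1.pow 2, ?_, hne, ?_⟩
    · rw [dX, natDegree_pow, k2]; ring
    · rw [← natDegree_lt_iff_degree_lt hne]
      have : (dZ (a : R[X]) b x z).natDegree ≤ 0 + (q + z.natDegree + 2 * q) := 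
        nd_mul (nd_num 4 0) (nd_mul (nd_mul h2.le le_rfl le_rfl) l2.le le_rfl) le_rfl
      omega
lemma fh_iter_ne (a b a' b' : ℤ) (n : ℕ) : fh a b (iX a' b' (X : R[X]) 1 n) (iZ a' b' (X : R[X]) 1 n) ≠ 0 := by
  obtain ⟨h1, h2, h3, h4⟩ := deg_iter (R := R) a' b' n
  exact mul_ne_zero (mul_ne_zero h1.ne_zero h3) (deg_quad a b h1 h2 h4).1.ne_zero
lemma iK_ne (a b : ℤ) (n : ℕ) : iK a b (X : R[X]) 1 n ≠ 0 := by
  intro h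
  have := fh_iter_ne (R := R) a b a b n
  rw [fh_iter, h] at this
  simp at this
end degs

end

section

section
open Polynomial
lemma fh_roots {R : Type*} [CommRing R] (p q : ℤ) (x : R) : fh (-(p+q)) (p*q) x 1 = x * (x - p) * (x - q) := by
  simp only [fh]; push_cast; ring

lemma W_ne {p q r : ℤ} (hq : q ≠ 0) (hpq : p ≠ q) (hqr : q ≠ r) (s : ℕ) (hs : 1 ≤ s) :
    iX (-(p+q)) (p*q) (X : ℚ[X]) 1 s * iZ (-(p+r)) (p*r) (X : ℚ[X]) 1 s - 
      iZ (-(p+q)) (p*q) (X : ℚ[X]) 1 s * iX (-(p+r)) (p*r) (X : ℚ[X]) 1 s ≠ 0 := by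
  obtain ⟨n, rfl⟩ := Nat.exists_eq_add_of_le' hs
  rw [iX_succ, iX_succ, iZ_succ, iZ_succ]
  have e : ∀ (a b : ℤ) (x z : ℚ[X]), dZ (a:ℚ[X]) b x z = 4 * fh a b x z := fun _ _ _ _ => rfl
  rw [e, e, fh_iter, fh_iter]
  have h0 := (deg_iter (R := ℚ) (-(p+r)) (p*r) (n+1)).1.ne_zero
  have hk := iK_ne (R := ℚ) (-(p+q)) (p*q) n
  rw [iX_succ, dX] at h0
  unfold dX
  generalize iX (-(p+r)) (p*r) (X : ℚ[X]) 1 n ^ 2 - ((p * r : ℤ) : ℚ[X]) * iZ (-(p+r)) (p*r) (X : ℚ[X]) 1 n ^ 2 = g₂ at *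
  generalize iX (-(p+q)) (p*q) (X : ℚ[X]) 1 n ^ 2 - ((p * q : ℤ) : ℚ[X]) * iZ (-(p+q)) (p*q) (X : ℚ[X]) 1 n ^ 2 = g₁ at *
  generalize iK (-(p+r)) (p*r) (X : ℚ[X]) 1 n = k₂ at *
  generalize iK (-(p+q)) (p*q) (X : ℚ[X]) 1 n = k₁ at *
  intro h
  have hns : NSq (fh (-(p+q)) (p*q) (X : ℚ[X]) 1 * fh (-(p+r)) (p*r) (X : ℚ[X]) 1) := by
    apply nsq_of_simple_root _ ((X * (X - (p:ℚ[X]))) * (X * (X - (p:ℚ[X])) * (X - (r:ℚ[X])))) (q:ℚ)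
    · rw [fh_roots, fh_roots, map_intCast]; ring
    · have h1 : (q:ℚ) ≠ 0 := by exact_mod_cast hq
      have h2 : (q:ℚ) - p ≠ 0 := by rw [sub_ne_zero]; exact_mod_cast hpq.symm
      have h3 : (q:ℚ) - r ≠ 0 := by rw [sub_ne_zero]; exact_mod_cast hqr
      simp [h1, h2, h3]
  have := (hns (g₁ * fh (-(p+r)) (p*r) (X : ℚ[X]) 1 * k₂) (g₂ * k₁) ?_).2
  · rcases mul_eq_zero.mp this with h5 | h5
    · rw [h5] at h0; simp at h0
    · exact hk h5
  · have h4 : (4 : ℚ[X]) ≠ 0 := by norm_num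
    apply mul_left_cancel₀ h4
    linear_combination fh (-(p+r)) (p*r) (X : ℚ[X]) 1 * h

/-- The quadratic polynomial. -/
noncomputable def Qd (a₁ b₁ a₂ b₂ : ℤ) (s : ℕ) : ℚ[X][X] :=
  C (hZ a₂ b₂ s (X : ℚ[X]) 1 (iX a₁ b₁ (X : ℚ[X]) 1 s) (iZ a₁ b₁ (X : ℚ[X]) 1 s)) * X ^ 2 +
    C (-2 * hU a₂ b₂ s (X : ℚ[X]) 1 (iX a₁ b₁ (X : ℚ[X]) 1 s) (iZ a₁ b₁ (X : ℚ[X]) 1 s)) * X + 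
    C ((iX a₁ b₁ (X : ℚ[X]) 1 s * iX a₂ b₂ (X : ℚ[X]) 1 s - b₂ * iZ a₁ b₁ (X : ℚ[X]) 1 s * iZ a₂ b₂ (X : ℚ[X]) 1 s) ^ 2)

lemma Qd_prim {a₁ b₁ a₂ b₂ d₁ d₂ : ℤ} (h₁ : ND a₁ b₁ d₁) (h₂ : ND a₂ b₂ d₂) (s : ℕ)
    (hW : hZ a₂ b₂ s (X : ℚ[X]) 1 (iX a₁ b₁ (X : ℚ[X]) 1 s) (iZ a₁ b₁ (X : ℚ[X]) 1 s) ≠ 0) : (Qd a₁ b₁ a₂ b₂ s).IsPrimitive := by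
  intro t ht
  rw [C_dvd_iff_dvd_coeff] at ht
  have t2 := ht 2
  have t1 := ht 1
  have t0 := ht 0
  simp only [Qd, coeff_add, coeff_C_mul, coeff_X_pow, coeff_X, coeff_C] at t2 t1 t0
  norm_num at t2 t1 t0
  by_contra hu
  have ht0 : t ≠ 0 := by rintro rfl; exact hW (zero_dvd_iff.mp t2)
  obtain ⟨π, hπ, hπt⟩ := WfDvdMonoid.exists_irreducible_factor hu ht0
  have t2' := (AdjoinRoot.mk_eq_zero (f := π)).mpr (hπt.trans t2)
  have t1' := (AdjoinRoot.mk_eq_zero (f := π)).mpr (hπt.trans t1)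
  have t0' := (AdjoinRoot.mk_eq_zero (f := π)).mpr (hπt.trans t0)
  have := Fact.mk hπ
  have : CharZero (AdjoinRoot π) := charZero_of_injective_algebraMap (algebraMap ℚ (AdjoinRoot π)).injective
  have e2 : (2 : AdjoinRoot π) ≠ 0 := two_ne_zero
  rw [map_hZ] at t2'
  rw [map_mul, map_hU, map_ofNat] at t1'
  rw [map_pow, map_sub, map_mul, map_mul, map_mul, map_intCast] at t0'
  simp only [map_iX, map_iZ, map_one] at t2' t1' t0'
  set x := AdjoinRoot.mk π X
  have n1 : ¬ (iX a₁ b₁ x 1 s = 0 ∧ iZ a₁ b₁ x 1 s = 0) := fun h => one_ne_zero (iter_ne h₁ s h.1 h.2).2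
  have n2 : ¬ (iX a₂ b₂ x 1 s = 0 ∧ iZ a₂ b₂ x 1 s = 0) := fun h => one_ne_zero (iter_ne h₂ s h.1 h.2).2
  unfold hZ at t2'
  unfold hU at t1'
  replace t2' := pow_eq_zero_iff (two_ne_zero) |>.mp t2'
  replace t0' := pow_eq_zero_iff (two_ne_zero) |>.mp t0'
  replace t1' := (mul_eq_zero.mp t1').resolve_left e2
  have key : dX (b₂ : AdjoinRoot π) (iX a₂ b₂ x 1 s) (iZ a₂ b₂ x 1 s) = 0 ∧
     dZ (a₂ : AdjoinRoot π) b₂ (iX a₂ b₂ x 1 s) (iZ a₂ b₂ x 1 s) = 0 := by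
    generalize iX a₂ b₂ x 1 s = X₂ at *
    generalize iZ a₂ b₂ x 1 s = Z₂ at *
    generalize iX a₁ b₁ x 1 s = X₁ at *
    generalize iZ a₁ b₁ x 1 s = Z₁ at *
    unfold dX dZ
    by_cases hX : X₁ = 0
    · have hZ1 : Z₁ ≠ 0 := fun h => n1 ⟨hX, h⟩
      have hX2 : X₂ = 0 := by
        have : Z₁ * X₂ = 0 := by linear_combination Z₂ * hX - t2'
        simpa [hZ1] using this
      constructor
      · have : X₂ ^ 2 - b₂ * Z₂ ^ 2 = 0 := by
          apply mul_left_cancel₀ hZ1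
          linear_combination (Z₂) * t0' + Z₁ * X₂ * hX2 - X₂ * Z₂ * hX
        rw [this]; simp
      · rw [hX2]; simp
    · constructor
      · have : X₂ ^ 2 - b₂ * Z₂ ^ 2 = 0 := by
          apply mul_left_cancel₀ hX
          linear_combination X₂ * t0' - b₂ * Z₂ * t2'
        rw [this]; simp
      · apply mul_left_cancel₀ (mul_ne_zero hX hX)
        linear_combination 2 * X₂ ^ 2 * t1' + (4 * a₂ * X₁ * X₂ ^ 2 * Z₂ + 2 * X₁ * X₂ ^ 3 + 2 * b₂ * X₂ * Z₂ * (2 * X₁ * Z₂ + X₂ * Z₁)) * t2'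
  have := dbl_ne h₂ key.1 key.2
  exact n2 this
end

end

section

section
open Polynomial

lemma top_zero_aux (L : Type) [Field L] [Algebra (FractionRing ℚ[X]) L] [IsAlgClosed L] {a₁ b₁ a₂ b₂ d₁ d₂ : ℤ} (h₁ : ND a₁ b₁ d₁) (h₂ : ND a₂ b₂ d₂) (s N : ℕ)
    (hW : hZ a₂ b₂ s (X : ℚ[X]) 1 (iX a₁ b₁ (X : ℚ[X]) 1 s) (iZ a₁ b₁ (X : ℚ[X]) 1 s) ≠ 0) (A : ℕ → ℚ[X])
    (hA : ∀ k, (A k).natDegree < 4 ^ s)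
    (hs : ∀ β, ∑ k ∈ Finset.range (N + 1), A k * 
      Ac a₂ b₂ s (X : ℚ[X]) 1 (iX a₁ b₁ (X : ℚ[X]) 1 s) (iZ a₁ b₁ (X : ℚ[X]) 1 s) N k β = 0) :
    ∀ k, k ≤ N → A k = 0 := by
  have hprim := Qd_prim h₁ h₂ s hW
  obtain ⟨m1, m2, m3, m4⟩ := deg_iter (R := ℚ) a₁ b₁ s
  obtain ⟨l1, l2, l3, l4⟩ := deg_iter (R := ℚ) a₂ b₂ s
  have hfi := fh_iter a₂ b₂ (X : ℚ[X]) 1 s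
  have hf2 := fh_iter_ne (R := ℚ) a₂ b₂ a₁ b₁ s
  have hf0 := fh_iter_ne (R := ℚ) a₂ b₂ a₁ b₁ 0
  simp only [iX_zero, iZ_zero] at hf0
  have hK := iK_ne (R := ℚ) a₂ b₂ s
  set Φ₁ := iX a₁ b₁ (X : ℚ[X]) 1 s with hΦ₁
  set Ψ₁ := iZ a₁ b₁ (X : ℚ[X]) 1 s with hΨ₁
  let ψ : ℚ[X] →+* L := (algebraMap (FractionRing ℚ[X]) L).comp (algebraMap ℚ[X] (FractionRing ℚ[X]))
  have hψ : Function.Injective ψ :=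
    (algebraMap (FractionRing ℚ[X]) L).injective.comp (FaithfulSMul.algebraMap_injective ℚ[X] (FractionRing ℚ[X]))
  have hψ0 : ∀ x, x ≠ 0 → ψ x ≠ 0 := fun x hx h => hx (hψ (by rw [h, map_zero]))
  obtain ⟨ρ, hρ⟩ := IsAlgClosed.exists_pow_nat_eq (ψ (hD a₂ b₂ (X : ℚ[X]) 1 Φ₁ Ψ₁)) (n := 2) (by norm_num)
  have hD0 : hD a₂ b₂ (X : ℚ[X]) 1 Φ₁ Ψ₁ ≠ 0 := mul_ne_zero hf0 hf2
  have hρ0 : ρ ≠ 0 := by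
    rintro rfl
    exact hψ0 _ hD0 (by rw [← hρ]; simp)
  set W := hZ a₂ b₂ s (X : ℚ[X]) 1 Φ₁ Ψ₁ with hWdef
  set U := hU a₂ b₂ s (X : ℚ[X]) 1 Φ₁ Ψ₁ with hUdef
  set V := hV a₂ b₂ s (X : ℚ[X]) 1 with hVdef
  have hV0 : V ≠ 0 := mul_ne_zero two_ne_zero hK
  set c₂ := (Φ₁ * iX a₂ b₂ (X : ℚ[X]) 1 s - b₂ * Ψ₁ * iZ a₂ b₂ (X : ℚ[X]) 1 s) ^ 2 with hc₂
  have hQd : Qd a₁ b₁ a₂ b₂ s = C W * X ^ 2 + C (-2 * U) * X + C c₂ := rfl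
  have hident : U ^ 2 - V ^ 2 * hD a₂ b₂ (X : ℚ[X]) 1 Φ₁ Ψ₁ = W * c₂ := by
    rw [hUdef, hVdef, hWdef, hc₂, hU, hV, hZ, hD]
    generalize iX a₂ b₂ (X : ℚ[X]) 1 s = x at *
    generalize iZ a₂ b₂ (X : ℚ[X]) 1 s = z at *
    generalize iK a₂ b₂ (X : ℚ[X]) 1 s = k at *
    have : (2 * k) ^ 2 * (fh a₂ b₂ X 1 * fh a₂ b₂ Φ₁ Ψ₁) = 4 * (fh a₂ b₂ x z * fh a₂ b₂ Φ₁ Ψ₁) := by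
      rw [hfi]; ring
    rw [this]
    simp only [fh]; ring
  let AP : ℚ[X][X] := ∑ k ∈ Finset.range (N + 1), C (A k) * X ^ k
  have hAPc : ∀ k, AP.coeff k = if k < N + 1 then A k else 0 := by
    intro k
    simp only [AP, finsetSum_coeff, coeff_C_mul, coeff_X_pow, mul_ite, mul_one, mul_zero]
    rw [Finset.sum_ite_eq]
    simp only [Finset.mem_range]
  have hWψ := hψ0 _ hW
  have root : ∀ ρ' : L, ρ' ^ 2 = ψ (hD a₂ b₂ (X : ℚ[X]) 1 Φ₁ Ψ₁) → ((ψ U + ψ V * ρ') / ψ W) ∈ {y | (AP.map ψ).eval y = 0} := by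
    intro ρ' hρ'
    have e0 := congrArg ψ (hs 0)
    have e1 := congrArg ψ (hs 1)
    have hspec := fun k => Ac_spec a₂ b₂ s (ψ X) (ψ 1) (ψ Φ₁) (ψ Ψ₁) ρ' (by rw [hρ', map_hD]) N k
    simp only [← map_Ac, ← map_hU, ← map_hV, ← map_hZ] at hspec
    simp only [map_sum, map_mul, map_zero] at e0 e1
    have : ∑ k ∈ Finset.range (N + 1), ψ (A k) * ((ψ U + ψ V * ρ') ^ k * ψ W ^ (N - k)) = 0 := by
      simp only [hUdef, hVdef, hWdef, ← hspec, mul_add, Finset.sum_add_distrib, e0, ← mul_assoc, ← Finset.sum_mul, e1]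
      ring
    simp only [Set.mem_ofPred_eq, AP, Polynomial.map_sum, Polynomial.map_mul, Polynomial.map_pow, map_C, map_X, eval_finsetSum,
      eval_mul, eval_pow, eval_C, eval_X]
    apply mul_left_cancel₀ (pow_ne_zero N hWψ)
    rw [mul_zero, ← this, Finset.mul_sum]
    refine Finset.sum_congr rfl fun k hk => ?_
    rw [Finset.mem_range] at hk
    have e : ψ W ^ N = ψ W ^ (N - k) * ψ W ^ k := by rw [← pow_add]; congr 1; omega
    rw [e, div_pow]
    field_simp
  have r1 := root ρ hρ
  have r2 := root (-ρ) (by rw [neg_sq, hρ])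
  simp only [Set.mem_ofPred_eq] at r1 r2
  set y₁ := (ψ U + ψ V * ρ) / ψ W with hy₁
  set y₂ := (ψ U + ψ V * -ρ) / ψ W with hy₂
  have hne : y₁ ≠ y₂ := by
    intro h
    rw [hy₁, hy₂, div_left_inj' hWψ] at h
    have : 2 * (ψ V * ρ) = 0 := by linear_combination h
    have h2 : (2:L) ≠ 0 := by
      have := hψ0 2 two_ne_zero
      rwa [map_ofNat] at this
    simp [hψ0 _ hV0, hρ0, h2] at this
  have hdvd : (X - C y₁) * (X - C y₂) ∣ AP.map ψ := by
    apply IsCoprime.mul_dvd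
    · exact isCoprime_X_sub_C_of_isUnit_sub (sub_ne_zero.mpr hne).isUnit
    · rw [dvd_iff_isRoot]; exact r1
    · rw [dvd_iff_isRoot]; exact r2
  have hQm : (Qd a₁ b₁ a₂ b₂ s).map ψ = C (ψ W) * ((X - C y₁) * (X - C y₂)) := by
    have s1 : ψ W * (y₁ + y₂) = 2 * ψ U := by rw [hy₁, hy₂]; field_simp; ring
    have s2 : ψ W * (y₁ * y₂) = ψ c₂ := by
      have := congrArg ψ hident
      rw [map_sub, map_mul, map_pow, map_pow, map_mul, ← hρ] at this
      rw [hy₁, hy₂]; field_simp; linear_combination this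
    rw [hQd]
    simp only [Polynomial.map_add, Polynomial.map_mul, Polynomial.map_pow, map_C, map_X]
    have : C (ψ W) * ((X - C y₁) * (X - C y₂)) = C (ψ W) * X ^ 2 - C (ψ W * (y₁ + y₂)) * X + C (ψ W * (y₁ * y₂)) := by
      simp only [C_mul, C_add]; ring
    rw [this, s1, s2]
    simp only [map_mul, map_neg, map_ofNat]; ring
  have hdvd2 : (Qd a₁ b₁ a₂ b₂ s).map ψ ∣ AP.map ψ := by
    rw [hQm, (isUnit_C.mpr hWψ.isUnit).mul_left_dvd]; exact hdvd
  have hdvd3 : (Qd a₁ b₁ a₂ b₂ s).map (algebraMap ℚ[X] (FractionRing ℚ[X])) ∣ AP.map (algebraMap ℚ[X] (FractionRing ℚ[X])) := by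
    rw [← map_dvd_map' (algebraMap (FractionRing ℚ[X]) L), Polynomial.map_map, Polynomial.map_map]
    exact hdvd2
  obtain ⟨B, hB⟩ := hprim.dvd_of_fraction_map_dvd_fraction_map hdvd3
  have hAP0 : AP = 0 := by
    by_contra h0
    have hB0 : B ≠ 0 := by rintro rfl; rw [mul_zero] at hB; exact h0 hB
    have ht := congrArg trailingCoeff hB
    rw [trailingCoeff_mul] at ht
    have hcd : (Φ₁ * iX a₂ b₂ (X : ℚ[X]) 1 s - b₂ * Ψ₁ * iZ a₂ b₂ (X : ℚ[X]) 1 s).natDegree = 2 * 4 ^ s := by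
      have hm : (Φ₁ * iX a₂ b₂ (X : ℚ[X]) 1 s).natDegree = 2 * 4 ^ s := by
        rw [m1.natDegree_mul l1, m2, l2]; ring
      rw [← hm]
      apply natDegree_sub_eq_left_of_natDegree_lt
      rw [hm]
      have hz1 := (natDegree_lt_iff_degree_lt m3).mpr m4
      have hz2 := (natDegree_lt_iff_degree_lt l3).mpr l4
      have := nd_mul (nd_int_mul b₂ (le_refl Ψ₁.natDegree)) (le_refl (iZ a₂ b₂ (X : ℚ[X]) 1 s).natDegree) le_rfl
      omega
    have hc2d : c₂.natDegree = 2 * (2 * 4 ^ s) := by rw [hc₂, natDegree_pow, hcd]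
    have hpos : 0 < 4 ^ s := by positivity
    have hc20 : c₂ ≠ 0 := by rintro h; rw [h] at hc2d; simp at hc2d
    have hQ0 : (Qd a₁ b₁ a₂ b₂ s).coeff 0 = c₂ := by rw [hQd]; simp
    have hQt : (Qd a₁ b₁ a₂ b₂ s).trailingCoeff = c₂ := by
      rw [trailingCoeff, natTrailingDegree_eq_zero_of_constantCoeff_ne_zero, hQ0]
      rw [constantCoeff_apply, hQ0]; exact hc20
    rw [hQt] at ht
    have hd := congrArg natDegree ht
    rw [natDegree_mul hc20 (by rwa [Ne, trailingCoeff_eq_zero]), hc2d, trailingCoeff, hAPc] at hd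
    split_ifs at hd with h
    · have := hA AP.natTrailingDegree
      omega
    · simp at hd
      omega
  intro k hk
  have := hAPc k
  rw [hAP0, if_pos (by omega)] at this
  simpa using this.symm

lemma top_zero {a₁ b₁ a₂ b₂ d₁ d₂ : ℤ} (h₁ : ND a₁ b₁ d₁) (h₂ : ND a₂ b₂ d₂) (s N : ℕ)
    (hW : hZ a₂ b₂ s (X : ℚ[X]) 1 (iX a₁ b₁ (X : ℚ[X]) 1 s) (iZ a₁ b₁ (X : ℚ[X]) 1 s) ≠ 0) (A : ℕ → ℚ[X])
    (hA : ∀ k, (A k).natDegree < 4 ^ s)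
    (hs : ∀ β, ∑ k ∈ Finset.range (N + 1), A k * 
      Ac a₂ b₂ s (X : ℚ[X]) 1 (iX a₁ b₁ (X : ℚ[X]) 1 s) (iZ a₁ b₁ (X : ℚ[X]) 1 s) N k β = 0) :
    ∀ k, k ≤ N → A k = 0 :=
  top_zero_aux (AlgebraicClosure (FractionRing ℚ[X])) h₁ h₂ s N hW A hA hs
end

end

section

section
open Polynomial

lemma Fab_half {R : Type*} [CommRing R] (a₁ b₁ a₂ b₂ : ℤ) (s m n N : ℕ) (c : ℕ → ℕ → ℕ → ℤ) (X₁ Z₁ X₂ Z₂ ρ₁ : R)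
    (h₁ : ρ₁ ^ 2 = hD a₁ b₁ X₁ Z₁ X₂ Z₂) (β : Fin 2) :
    Fab a₁ b₁ a₂ b₂ s m n N c 0 β X₁ Z₁ X₂ Z₂ + Fab a₁ b₁ a₂ b₂ s m n N c 1 β X₁ Z₁ X₂ Z₂ * ρ₁ =
    ∑ i ∈ Finset.range m, ∑ j ∈ Finset.range (n + 1), ∑ k ∈ Finset.range (N + 1),
    (c i j k : R) * (X₁ ^ i * Z₁ ^ (m - 1 - i)) *
      (((hU a₁ b₁ s X₁ Z₁ X₂ Z₂ + hV a₁ b₁ s X₁ Z₁ * ρ₁) ^ j * hZ a₁ b₁ s X₁ Z₁ X₂ Z₂ ^ (n - j)) *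
       Ac a₂ b₂ s X₁ Z₁ X₂ Z₂ N k β) := by
  simp only [← Ac_spec _ _ _ _ _ _ _ _ h₁]
  unfold Fab
  simp only [Finset.sum_mul, ← Finset.sum_add_distrib]
  refine Finset.sum_congr rfl fun i hi => Finset.sum_congr rfl fun j hj => Finset.sum_congr rfl fun k hk => ?_
  ring

lemma Fab_step {R : Type*} [CommRing R] (a₁ b₁ a₂ b₂ : ℤ) (s m n N : ℕ) (c : ℕ → ℕ → ℕ → ℤ) (X₁ Z₁ X₂ Z₂ : R) (α β : Fin 2)
    (hc : ∀ i k, i < m → k ≤ N → c i (n + 1) k = 0) :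
    Fab a₁ b₁ a₂ b₂ s m (n + 1) N c α β X₁ Z₁ X₂ Z₂ = hZ a₁ b₁ s X₁ Z₁ X₂ Z₂ * Fab a₁ b₁ a₂ b₂ s m n N c α β X₁ Z₁ X₂ Z₂ := by
  unfold Fab
  rw [Finset.mul_sum]
  refine Finset.sum_congr rfl fun i hi => ?_
  rw [Finset.mem_range] at hi
  rw [Finset.sum_range_succ]
  have : ∑ k ∈ Finset.range (N + 1), (c i (n + 1) k : R) * (X₁ ^ i * Z₁ ^ (m - 1 - i)) *
      (Ac a₁ b₁ s X₁ Z₁ X₂ Z₂ (n + 1) (n + 1) α * Ac a₂ b₂ s X₁ Z₁ X₂ Z₂ N k β) = 0 := by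
    apply Finset.sum_eq_zero
    intro k hk
    rw [Finset.mem_range] at hk
    rw [hc i k hi (by omega)]; simp
  rw [this, add_zero, Finset.mul_sum]
  refine Finset.sum_congr rfl fun j hj => ?_
  rw [Finset.mul_sum]
  refine Finset.sum_congr rfl fun k hk => ?_
  rw [Finset.mem_range] at hj
  have e : Ac a₁ b₁ s X₁ Z₁ X₂ Z₂ (n + 1) j α = hZ a₁ b₁ s X₁ Z₁ X₂ Z₂ * Ac a₁ b₁ s X₁ Z₁ X₂ Z₂ n j α := by
    unfold Ac
    rw [show n + 1 - j = n - j + 1 by omega, pow_succ]; ring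
  rw [e]; ring

lemma top_coeff {a₁ b₁ a₂ b₂ d₁ d₂ : ℤ} (h₁ : ND a₁ b₁ d₁) (h₂ : ND a₂ b₂ d₂) (s m n N : ℕ) (e : ℤ) (hm : m ≤ 4 ^ s)
    (hW : hZ a₂ b₂ s (X : ℚ[X]) 1 (iX a₁ b₁ (X : ℚ[X]) 1 s) (iZ a₁ b₁ (X : ℚ[X]) 1 s) ≠ 0) (c : ℕ → ℕ → ℕ → ℤ)
    (h : ∀ α β, Fab a₁ b₁ a₂ b₂ s m n N c α β (C X : ℤ[X][X]) 1 (X + C (C e)) 1 = 0) :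
    ∀ i k, i < m → k ≤ N → c i n k = 0 := by
  obtain ⟨m1, m2, m3, m4⟩ := deg_iter (R := ℚ) a₁ b₁ s
  have hK := iK_ne (R := ℚ) a₁ b₁ s
  have hf0 := fh_iter_ne (R := ℚ) a₁ b₁ a₁ b₁ 0
  simp only [iX_zero, iZ_zero] at hf0
  have hF : ∀ α β, Fab a₁ b₁ a₂ b₂ s m n N c α β (X : ℚ[X]) 1 (iX a₁ b₁ (X : ℚ[X]) 1 s) (iZ a₁ b₁ (X : ℚ[X]) 1 s) = 0 := by
    intro α β
    have hinj := FaithfulSMul.algebraMap_injective ℚ[X] (FractionRing ℚ[X])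
    apply hinj
    rw [map_zero, map_Fab]
    set g := algebraMap ℚ[X] (FractionRing ℚ[X])
    have hz : g (iZ a₁ b₁ (X : ℚ[X]) 1 s) ≠ 0 := fun h => m3 (hinj (by rw [h, map_zero]))
    set w := g (iZ a₁ b₁ (X : ℚ[X]) 1 s)
    set v := g (iX a₁ b₁ (X : ℚ[X]) 1 s)
    let φ : ℤ[X][X] →+* FractionRing ℚ[X] := eval₂RingHom (g.comp (mapRingHom (Int.castRingHom ℚ))) (v / w - e)
    have h0 := congrArg φ (h α β)
    rw [map_zero, map_Fab] at h0
    have p1 : φ (C X) = g X := by simp [φ]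
    have p2 : φ (X + C (C e)) = v / w := by
      rw [map_add, show (C (C e) : ℤ[X][X]) = (e : ℤ[X][X]) by simp, map_intCast]
      simp [φ]
    rw [p1, p2, map_one] at h0
    have hsc := scale_Fab a₁ b₁ a₂ b₂ s m n N c α β (g X) 1 (v / w) 1 1 w
    rw [h0, mul_zero, one_mul, one_mul, mul_one, mul_div_cancel₀ _ hz] at hsc
    have hne : ((1:FractionRing ℚ[X]) ^ 2 * w ^ 2) ^ ((α:ℕ) + (β:ℕ)) ≠ 0 := pow_ne_zero _ (mul_ne_zero (by simp) (pow_ne_zero _ hz))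
    rw [map_one]
    exact (mul_eq_zero.mp hsc).resolve_left hne
  have hρ : (fh a₁ b₁ (X : ℚ[X]) 1 * iK a₁ b₁ (X : ℚ[X]) 1 s) ^ 2 = 
      hD a₁ b₁ (X : ℚ[X]) 1 (iX a₁ b₁ (X : ℚ[X]) 1 s) (iZ a₁ b₁ (X : ℚ[X]) 1 s) := by
    rw [hD, fh_iter]; ring
  have hT : hU a₁ b₁ s (X : ℚ[X]) 1 (iX a₁ b₁ (X : ℚ[X]) 1 s) (iZ a₁ b₁ (X : ℚ[X]) 1 s) + hV a₁ b₁ s (X : ℚ[X]) 1 * 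
      (fh a₁ b₁ (X : ℚ[X]) 1 * iK a₁ b₁ (X : ℚ[X]) 1 s) = 4 * (fh a₁ b₁ (X : ℚ[X]) 1 * iK a₁ b₁ (X : ℚ[X]) 1 s ^ 2) := by
    have := fh_iter a₁ b₁ (X : ℚ[X]) 1 s
    rw [fh] at this
    simp only [hU, hV]; linear_combination 2 * this
  have hZ0 : hZ a₁ b₁ s (X : ℚ[X]) 1 (iX a₁ b₁ (X : ℚ[X]) 1 s) (iZ a₁ b₁ (X : ℚ[X]) 1 s) = 0 := by
    simp only [hZ]; ring
  set T := 4 * (fh a₁ b₁ (X : ℚ[X]) 1 * iK a₁ b₁ (X : ℚ[X]) 1 s ^ 2) with hTd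
  have hT0 : T ≠ 0 := mul_ne_zero (by norm_num) (mul_ne_zero hf0 (pow_ne_zero _ hK))
  let A : ℕ → ℚ[X] := fun k => ∑ i ∈ Finset.range m, C (c i n k : ℚ) * X ^ i
  by_cases hm0 : m = 0
  · intro i k hi; omega
  have hAd : ∀ k, (A k).natDegree < 4 ^ s := by
    intro k
    have : (A k).natDegree ≤ m - 1 := by
      apply natDegree_sum_le_of_forall_le
      intro i hi
      rw [Finset.mem_range] at hi
      exact (natDegree_C_mul_X_pow_le _ _).trans (by omega)
    omega
  have hA := top_zero h₁ h₂ s N hW A hAd ?_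
  · intro i k hi hk
    have := congrArg (fun p => p.coeff i) (hA k hk)
    simp only [A, finsetSum_coeff, coeff_C_mul, coeff_X_pow, mul_ite, mul_one, mul_zero, Finset.sum_ite_eq, Finset.mem_range, hi,
      if_true, coeff_zero] at this
    exact_mod_cast this
  · intro β
    have hh := Fab_half a₁ b₁ a₂ b₂ s m n N c (X : ℚ[X]) 1 (iX a₁ b₁ (X : ℚ[X]) 1 s) (iZ a₁ b₁ (X : ℚ[X]) 1 s) _ hρ β
    rw [hF, hF, hT, hZ0, zero_mul, add_zero] at hh
    apply mul_left_cancel₀ (pow_ne_zero n hT0)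
    rw [mul_zero, hh, Finset.mul_sum]
    simp only [A, Finset.sum_mul, Finset.mul_sum]
    rw [Finset.sum_comm]
    refine Finset.sum_congr rfl fun i _ => ?_
    symm
    rw [Finset.sum_range_succ]
    rw [Finset.sum_eq_zero (s := Finset.range n), zero_add]
    · refine Finset.sum_congr rfl fun k _ => ?_
      simp only [one_pow, Nat.sub_self, pow_zero, mul_one, map_intCast]; ring
    · intro j hj
      rw [Finset.mem_range] at hj
      apply Finset.sum_eq_zero
      intro k _
      rw [zero_pow (by omega)]; ring

lemma nonvanish {p q r : ℤ} (hp : p ≠ 0) (hq : q ≠ 0) (hr : r ≠ 0) (hpq : p ≠ q) (hpr : p ≠ r) (hqr : q ≠ r) (s m N : ℕ) (e : ℤ)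
    (hs : 1 ≤ s) (hm : m ≤ 4 ^ s) (c : ℕ → ℕ → ℕ → ℤ) (n : ℕ)
    (h : ∀ α β, Fab (-(p+q)) (p*q) (-(p+r)) (p*r) s m n N c α β (C X : ℤ[X][X]) 1 (X + C (C e)) 1 = 0) :
    ∀ i j k, i < m → j ≤ n → k ≤ N → c i j k = 0 := by
  have h₁ := ND_of_roots hp hq hpq (one_ne_zero)
  have h₂ := ND_of_roots hp hr hpr (one_ne_zero)
  have hW : hZ (-(p+r)) (p*r) s (X : ℚ[X]) 1 (iX (-(p+q)) (p*q) (X : ℚ[X]) 1 s) (iZ (-(p+q)) (p*q) (X : ℚ[X]) 1 s) ≠ 0 := 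
    pow_ne_zero 2 (W_ne hq hpq hqr s hs)
  induction n with
  | zero =>
    intro i j k hi hj hk
    obtain rfl : j = 0 := by omega
    exact top_coeff h₁ h₂ s m 0 N e hm hW c h i k hi hk
  | succ n ih =>
    have ht := top_coeff h₁ h₂ s m (n+1) N e hm hW c h
    have hz : hZ (-(p+q)) (p*q) s (C X : ℤ[X][X]) 1 (X + C (C e)) 1 ≠ 0 := by
      unfold hZ
      apply pow_ne_zero
      intro h0
      have := congrArg (fun p => p.coeff 1) h0
      rw [← map_one C, ← map_iZ, ← map_iX, ← C_mul] at this
      simp only [add_mul, coeff_sub, coeff_add, coeff_X_mul, ← C_mul, coeff_C_zero, coeff_C_succ, coeff_zero, add_zero, sub_zero] at this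
      exact (deg_iter (R := ℤ) _ _ s).2.2.1 this
    have := ih (fun α β => by
      have := h α β
      rw [Fab_step _ _ _ _ _ _ _ _ _ _ _ _ _ _ _ ht] at this
      exact (mul_eq_zero.mp this).resolve_left hz)
    intro i j k hi hj hk
    rcases Nat.lt_or_ge n j with hj' | hj'
    · obtain rfl : j = n + 1 := by omega
      exact ht i k hi hk
    · exact this i j k hi hj' hk
end

end

section

section
open Polynomial

noncomputable def NmP (a₁ b₁ a₂ b₂ : ℤ) (s m N : ℕ) (c : ℕ → ℕ → ℕ → ℤ) (e : ℤ) : ℤ[X][X] :=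
  Nmf (Fab a₁ b₁ a₂ b₂ s m N N c 0 0 (C X : ℤ[X][X]) 1 (X + C (C e)) 1) (Fab a₁ b₁ a₂ b₂ s m N N c 1 0 (C X : ℤ[X][X]) 1 (X + C (C e)) 1)
    (Fab a₁ b₁ a₂ b₂ s m N N c 0 1 (C X : ℤ[X][X]) 1 (X + C (C e)) 1) (Fab a₁ b₁ a₂ b₂ s m N N c 1 1 (C X : ℤ[X][X]) 1 (X + C (C e)) 1)
    (hD a₁ b₁ (C X : ℤ[X][X]) 1 (X + C (C e)) 1) (hD a₂ b₂ (C X : ℤ[X][X]) 1 (X + C (C e)) 1)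

lemma nsq_one {R : Type*} [CommRing R] [IsDomain R] (x E : R) {p q : ℤ} (h0 : x ≠ 0) (h1 : x - p ≠ 0) (h2 : x - q ≠ 0)
    (h3 : (q : R) ≠ 0) (h4 : (q : R) - p ≠ 0) :
    NSq (hD (-(p+q)) (p*q) (C x : R[X]) 1 (X + C E) 1) := by
  apply nsq_of_simple_root _ ((C x * (C x - (p : R[X])) * (C x - (q : R[X]))) * ((X + C E) * (X + C E - (p : R[X])))) ((q:R) - E)
  · rw [hD, fh_roots, fh_roots, C_sub, map_intCast]; ring
  · simp only [eval_mul, eval_sub, eval_add, eval_X, eval_C, eval_intCast, sub_add_cancel]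
    exact mul_ne_zero (mul_ne_zero (mul_ne_zero h0 h1) h2) (mul_ne_zero h3 h4)

lemma nsq_two {R : Type*} [CommRing R] [IsDomain R] (x E : R) {p q r : ℤ} (h0 : x ≠ 0) (h1 : x - p ≠ 0) (h2 : x - q ≠ 0)
    (h3 : (q : R) ≠ 0) (h4 : (q : R) - p ≠ 0) (h5 : x - r ≠ 0) (h6 : (q : R) - r ≠ 0) :
    NSq (hD (-(p+q)) (p*q) (C x : R[X]) 1 (X + C E) 1 * hD (-(p+r)) (p*r) (C x : R[X]) 1 (X + C E) 1) := by
  apply nsq_of_simple_root _ (((C x * (C x - (p : R[X])) * (C x - (q : R[X]))) * ((X + C E) * (X + C E - (p : R[X])))) *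
      ((C x * (C x - (p : R[X])) * (C x - (r : R[X]))) * ((X + C E) * (X + C E - (p : R[X])) * (X + C E - (r : R[X])))))
      ((q:R) - E)
  · rw [hD, hD, fh_roots, fh_roots, fh_roots, fh_roots, C_sub, map_intCast]; ring
  · simp only [eval_mul, eval_sub, eval_add, eval_X, eval_C, eval_intCast, sub_add_cancel]
    exact mul_ne_zero (mul_ne_zero (mul_ne_zero (mul_ne_zero h0 h1) h2) (mul_ne_zero h3 h4))
        (mul_ne_zero (mul_ne_zero (mul_ne_zero h0 h1) h5) (mul_ne_zero (mul_ne_zero h3 h4) h6))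

lemma NmP_ne {p q r : ℤ} (hp : p ≠ 0) (hq : q ≠ 0) (hr : r ≠ 0) (hpq : p ≠ q) (hpr : p ≠ r) (hqr : q ≠ r) (s m N : ℕ) (e : ℤ)
    (hs : 1 ≤ s) (hm : m ≤ 4 ^ s) (c : ℕ → ℕ → ℕ → ℤ) (hc : ∃ i j k, i < m ∧ j ≤ N ∧ k ≤ N ∧ c i j k ≠ 0) :
    NmP (-(p+q)) (p*q) (-(p+r)) (p*r) s m N c e ≠ 0 := by
  intro h
  have hX : ∀ t : ℤ, (X - (t : ℤ[X])) ≠ 0 := fun t => by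
    have := X_sub_C_ne_zero t
    simpa using this
  have hne : ∀ t u : ℤ, t ≠ u → (t : ℤ[X]) - (u : ℤ[X]) ≠ 0 := fun t u h => by
    rw [sub_ne_zero]; exact_mod_cast h
  have hn0 : ∀ t : ℤ, t ≠ 0 → (t : ℤ[X]) ≠ 0 := fun t h => by exact_mod_cast h
  have hX0 : (X : ℤ[X]) ≠ 0 := X_ne_zero
  have n1 := nsq_one (X : ℤ[X]) (C e) hX0 (hX p) (hX q) (hn0 q hq) (hne q p hpq.symm)
  have n2 := nsq_one (X : ℤ[X]) (C e) hX0 (hX p) (hX r) (hn0 r hr) (hne r p hpr.symm)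
  have n3 := nsq_two (X : ℤ[X]) (C e) hX0 (hX p) (hX q) (hn0 q hq) (hne q p hpq.symm) (hX r) (hne q r hqr)
  have two : (2 : ℤ[X][X]) ≠ 0 := by exact_mod_cast (two_ne_zero : (2:ℕ) ≠ 0)
  unfold NmP at h
  have nv := nonvanish hp hq hr hpq hpr hqr s m N e hs hm c N
  obtain ⟨i, j, k, hi, hj, hk, hcc⟩ := hc
  apply hcc
  refine nv ?_ i j k hi hj hk
  clear nv hcc
  generalize hD (-(p+q)) (p*q) (C X : ℤ[X][X]) 1 (X + C (C e)) 1 = D₁ at *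
  generalize hD (-(p+r)) (p*r) (C X : ℤ[X][X]) 1 (X + C (C e)) 1 = D₂ at *
  generalize Fab (R := ℤ[X][X]) (-(p+q)) (p*q) (-(p+r)) (p*r) s m N N c = F at *
  obtain ⟨h1, h2, h3, h4⟩ := Nmf_zero two n1 n2 n3 h
  intro α β
  exact match α, β with
  | 0, 0 => h1
  | 1, 0 => h2
  | 0, 1 => h3
  | 1, 1 => h4
end

end

section

section
open Polynomial

/-- The height of a rational number. -/
noncomputable def Hq (x : ℚ) : ℝ := max |(x.num : ℝ)| (x.den : ℝ)

lemma one_le_Hq (x : ℚ) : 1 ≤ Hq x := by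
  apply le_max_of_le_right
  exact_mod_cast x.den_pos

lemma height_le_l1 (G : ℤ[X]) (hG : G ≠ 0) (x : ℚ) (n : ℕ)
    (h : (X - C x) ^ n ∣ G.map (Int.castRingHom ℚ)) : Hq x ^ n ≤ l1 (fun k : ℤ => |(k : ℝ)|) G := by
  have hd : (x.den : ℤ) ≠ 0 := by exact_mod_cast x.den_ne_zero
  set L : ℤ[X] := C (x.den : ℤ) * X - C x.num with hL
  have c0 : L.coeff 0 = -x.num := by simp [hL]
  have c1 : L.coeff 1 = x.den := by rw [hL, coeff_sub, coeff_C_mul, coeff_X_one, coeff_C_succ]; simp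
  have hprim : L.IsPrimitive := by
    intro r hr
    rw [C_dvd_iff_dvd_coeff] at hr
    have h0 := hr 0
    have h1 := hr 1
    rw [c0, dvd_neg] at h0
    rw [c1] at h1
    have : IsCoprime x.num (x.den : ℤ) := by
      rw [Int.isCoprime_iff_gcd_eq_one]
      have := x.reduced
      simpa [Int.gcd, Nat.Coprime] using this
    exact this.isUnit_of_dvd' h0 h1
  have hdeg : L.natDegree = 1 := by
    rw [hL, sub_eq_add_neg, ← C_neg]; exact natDegree_linear hd
  have hlc : L.leadingCoeff = x.den := by rw [leadingCoeff, hdeg, c1]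
  have hprimn : (L ^ n).IsPrimitive := by
    clear h
    induction n with
    | zero => rw [pow_zero]; exact isPrimitive_one
    | succ n ih => rw [pow_succ]; exact ih.mul hprim
  have hmap : L.map (Int.castRingHom ℚ) = C (x.den : ℚ) * (X - C x) := by
    rw [mul_sub, ← C_mul, mul_comm (x.den : ℚ) x, Rat.mul_den_eq_num, hL]
    simp
  have hdvd : L ^ n ∣ G := by
    rw [IsPrimitive.Int.dvd_iff_map_cast_dvd_map_cast _ _ hprimn, Polynomial.map_pow, hmap, mul_pow]
    have hu : IsUnit (C (x.den : ℚ) ^ n) := IsUnit.pow n (isUnit_C.mpr (by simp))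
    exact hu.mul_left_dvd.mpr h
  obtain ⟨K, hK⟩ := hdvd
  have hK0 : K ≠ 0 := by rintro rfl; simp at hK; exact hG hK
  have hn := isNu_int
  have one_le : ∀ t : ℤ, t ≠ 0 → (1:ℝ) ≤ |(t:ℝ)| := fun t ht => by exact_mod_cast Int.one_le_abs ht
  have hb1 : (x.den : ℝ) ^ n ≤ l1 (fun k : ℤ => |(k : ℝ)|) G := by
    refine le_trans ?_ (coeff_le_l1 hn G G.natDegree)
    have : G.coeff G.natDegree = x.den ^ n * K.leadingCoeff := by
      change G.leadingCoeff = _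
      rw [hK, leadingCoeff_mul, leadingCoeff_pow, hlc]
    rw [this]; push_cast
    rw [abs_mul, abs_pow, Nat.abs_cast]
    exact le_mul_of_one_le_right (by positivity) (one_le _ (leadingCoeff_ne_zero.mpr hK0))
  have hl1 : 0 ≤ l1 (fun k : ℤ => |(k : ℝ)|) G := l1_nonneg hn G
  have hb2 : |(x.num : ℝ)| ^ n ≤ l1 (fun k : ℤ => |(k : ℝ)|) G := by
    by_cases hx : x.num = 0
    · rcases Nat.eq_zero_or_pos n with rfl | hpos
      · simpa using hb1
      · rw [hx]; simp [hpos.ne']; exact hl1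
    · refine le_trans ?_ (coeff_le_l1 hn G G.natTrailingDegree)
      have hLt : L.trailingCoeff = -x.num := by
        rw [trailingCoeff, ← c0, natTrailingDegree_eq_zero.mpr]
        right; rw [c0]; simpa using hx
      have : G.coeff G.natTrailingDegree = (-x.num) ^ n * K.trailingCoeff := by
        change G.trailingCoeff = _
        have hp : ∀ n : ℕ, (L ^ n).trailingCoeff = L.trailingCoeff ^ n := by
          intro n
          induction n with
          | zero => simp [trailingCoeff]
          | succ n ih => rw [pow_succ, pow_succ, trailingCoeff_mul, ih]
        rw [hK, trailingCoeff_mul, hp, hLt]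
      rw [this]; push_cast
      rw [abs_mul, abs_pow, abs_neg]
      exact le_mul_of_one_le_right (by positivity) (one_le _ (trailingCoeff_eq_zero.not.mpr hK0))
  rw [Hq]
  rcases max_cases |(x.num : ℝ)| (x.den : ℝ) with h | h <;> rw [h.1] <;> assumption

/-- The operator `x d/dx`. -/
noncomputable def th {R : Type*} [CommRing R] (p : R[X]) : R[X] := X * derivative p

lemma coeff_th {R : Type*} [CommRing R] (p : R[X]) (i k : ℕ) : (th^[i] p).coeff k = (k : R) ^ i * p.coeff k := by
  induction i generalizing p with
  | zero => simp
  | succ i ih =>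
    rw [Function.iterate_succ_apply, ih]
    cases k with
    | zero => simp [th, pow_succ]
    | succ k => simp only [th, coeff_X_mul, coeff_derivative]; push_cast; ring

lemma th_map {R S : Type*} [CommRing R] [CommRing S] (f : R →+* S) (p : R[X]) (i : ℕ) : (th^[i] p).map f = th^[i] (p.map f) := by
  ext k; simp [coeff_th]

lemma th_sum {R ι : Type*} [CommRing R] (s : Finset ι) (a : ι → R) (f : ι → R[X]) (i : ℕ) :
    th^[i] (∑ k ∈ s, C (a k) * f k) = ∑ k ∈ s, C (a k) * th^[i] (f k) := by
  ext k
  simp only [coeff_th, Polynomial.finsetSum_coeff, coeff_C_mul, Finset.mul_sum]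
  exact Finset.sum_congr rfl fun _ _ => by ring

lemma dvd_th {R : Type*} [CommRing R] (x : R) (p : R[X]) (κ i : ℕ) (h : (X - C x) ^ κ ∣ p) : (X - C x) ^ (κ - i) ∣ th^[i] p := by
  induction i generalizing p κ with
  | zero => simpa using h
  | succ i ih =>
    rw [Function.iterate_succ_apply, add_comm, ← Nat.sub_sub]
    exact ih _ _ (Dvd.dvd.mul_left (pow_sub_one_dvd_derivative_of_pow_dvd h) X)

lemma wronsk_ne (n : ℕ) (φ : Fin n → ℚ[X]) (hφ : LinearIndependent ℚ φ) :
    (Matrix.of fun i k : Fin n => th^[(i:ℕ)] (φ k)).det ≠ 0 := by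
  intro h0
  obtain ⟨v, hv, hv0⟩ := Matrix.exists_vecMul_eq_zero_iff.mpr h0
  have hk : ∀ k, ∑ i : Fin n, v i * th^[(i:ℕ)] (φ k) = 0 := fun k => by
    have := congrFun hv0 k
    simpa [Matrix.vecMul, dotProduct] using this
  have hspan : ∀ a : Fin n → ℚ, ∑ i : Fin n, v i * th^[(i:ℕ)] (∑ k, C (a k) * φ k) = 0 := by
    intro a
    simp only [th_sum, Finset.mul_sum]
    rw [Finset.sum_comm]
    apply Finset.sum_eq_zero
    intro k _
    have := congrArg (fun t => C (a k) * t) (hk k)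
    simp only [Finset.mul_sum, mul_zero] at this
    rw [← this]
    exact Finset.sum_congr rfl fun _ _ => by ring
  obtain ⟨i₁, hi₁⟩ : ∃ i, v i ≠ 0 := by
    by_contra! hh; exact hv (funext hh)
  obtain ⟨i₀, hi₀m, hi₀⟩ := Finset.exists_max_image (Finset.univ.filter fun i => v i ≠ 0) (fun i => (v i).natDegree) ⟨i₁, by simp [hi₁]⟩
  simp only [Finset.mem_filter, Finset.mem_univ, true_and] at hi₀m hi₀
  set M := (v i₀).natDegree with hM
  have hMi : ∀ i, (v i).natDegree ≤ M := fun i => by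
    by_cases h : v i = 0
    · rw [h]; simp
    · exact hi₀ i h
  set χ : ℚ[X] := ∑ i : Fin n, monomial (i : ℕ) ((v i).coeff M) with hχ
  have hχc : ∀ i : Fin n, χ.coeff i = (v i).coeff M := by
    intro i
    rw [hχ, Polynomial.finsetSum_coeff, Finset.sum_eq_single i]
    · simp
    · intro j _ hj; rw [coeff_monomial, if_neg]; intro h; exact hj (Fin.ext h)
    · simp
  have hχ0 : χ ≠ 0 := by
    intro h
    have := hχc i₀
    rw [h, coeff_zero] at this
    exact hi₀m (leadingCoeff_eq_zero.mp this.symm)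
  have hχd : χ.natDegree < n := by
    have hn : 0 < n := Nat.lt_of_le_of_lt (Nat.zero_le _) i₀.2
    have : χ.natDegree ≤ n - 1 := by
      apply natDegree_sum_le_of_forall_le
      intro i _
      refine (natDegree_monomial_le _).trans ?_
      have := i.2
      omega
    omega
  have key : ∀ a : Fin n → ℚ, (∑ k, C (a k) * φ k) ≠ 0 → χ.IsRoot ((∑ k, C (a k) * φ k).natDegree : ℚ) := by
    intro a ha
    set f := ∑ k, C (a k) * φ k with hf
    have h1 := congrArg (fun t : ℚ[X] => t.coeff (M + f.natDegree)) (hspan a)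
    simp only [Polynomial.finsetSum_coeff, coeff_zero] at h1
    have h2 : ∀ i : Fin n, (v i * th^[(i:ℕ)] f).coeff (M + f.natDegree) = (v i).coeff M * ((f.natDegree : ℚ) ^ (i:ℕ) * f.leadingCoeff) := by
      intro i
      rw [coeff_mul_add_eq_of_natDegree_le (hMi i), coeff_th]; · rfl
      rw [natDegree_le_iff_coeff_eq_zero]
      intro k hk
      rw [coeff_th, coeff_eq_zero_of_natDegree_lt hk, mul_zero]
    rw [← hf] at h1
    simp only [h2] at h1
    rw [IsRoot, hχ, Polynomial.eval_finsetSum]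
    simp only [eval_monomial]
    have h3 : (∑ i : Fin n, (v i).coeff M * (f.natDegree : ℚ) ^ (i:ℕ)) * f.leadingCoeff = 0 := by
      rw [Finset.sum_mul, ← h1]
      exact Finset.sum_congr rfl fun _ _ => by ring
    exact (mul_eq_zero.mp h3).resolve_right (leadingCoeff_ne_zero.mpr ha)
  classical
  let Rt := χ.roots.toFinset
  let T : (Fin n → ℚ) →ₗ[ℚ] (Rt → ℚ) :=
    { toFun := fun a d => if h : ∃ j : ℕ, (j : ℚ) = d then (∑ k, C (a k) * φ k).coeff h.choose else 0
      map_add' := fun a b => by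
        funext d
        simp only [Pi.add_apply]
        split_ifs with h
        · simp only [C_add, add_mul, Finset.sum_add_distrib, coeff_add]
        · simp
      map_smul' := fun t a => by
        funext d
        simp only [Pi.smul_apply, RingHom.id_apply, smul_eq_mul]
        split_ifs with h
        · simp only [C_mul, mul_assoc, ← Finset.mul_sum, coeff_C_mul]
        · simp }
  have hinj : Function.Injective T := by
    rw [injective_iff_map_eq_zero]
    intro a ha
    by_contra hne
    have hf : (∑ k, C (a k) * φ k) ≠ 0 := by
      intro h
      apply hne
      rw [Fintype.linearIndependent_iff] at hφ
      funext k
      refine hφ a ?_ k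
      rw [← h]
      exact Finset.sum_congr rfl fun k _ => by rw [smul_eq_C_mul]
    have hr := key a hf
    have hd : ((∑ k, C (a k) * φ k).natDegree : ℚ) ∈ Rt := by
      simp only [Rt, Multiset.mem_toFinset]
      exact (mem_roots hχ0).mpr hr
    have h1 := congrFun ha ⟨_, hd⟩
    have hex : ∃ j : ℕ, (j : ℚ) = ((∑ k, C (a k) * φ k).natDegree : ℚ) := ⟨_, rfl⟩
    have h2 : (∑ k, C (a k) * φ k).coeff hex.choose = 0 := by
      have : T a ⟨_, hd⟩ = (∑ k, C (a k) * φ k).coeff hex.choose := dif_pos hex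
      rw [← this]; exact h1
    have h3 : hex.choose = (∑ k, C (a k) * φ k).natDegree := by
      exact_mod_cast hex.choose_spec
    rw [h3] at h2
    exact hf (leadingCoeff_eq_zero.mp h2)
  have hfr := LinearMap.finrank_le_finrank_of_injective hinj
  rw [Module.finrank_fin_fun, Module.finrank_fintype_fun_eq_card, Fintype.card_coe] at hfr
  have hc : Rt.card ≤ χ.natDegree := (Multiset.toFinset_card_le _).trans (card_roots' χ)
  omega
end

end

section

section
open Polynomial

/-- Weighted `L¹` norm on `ℤ[X]`. -/
noncomputable def lW (W : ℕ) (p : ℤ[X]) : ℝ := l1 (fun k : ℤ => |(k : ℝ)|) (p.comp (C (W:ℤ) * X))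

lemma isNu_lW (W : ℕ) : IsNu (lW W) where
  nonneg p := l1_nonneg isNu_int _
  zero := by simp [lW, l1]
  one := by
    have := (isNu_l1 isNu_int).one
    simpa [lW] using this
  neg p := by rw [lW, neg_comp, (isNu_l1 isNu_int).neg]; rfl
  add p q := by rw [lW, add_comp]; exact (isNu_l1 isNu_int).add _ _
  mul p q := by rw [lW, mul_comp]; exact (isNu_l1 isNu_int).mul _ _

lemma lW_X (W : ℕ) : lW W X ≤ W := by
  rw [lW, X_comp]
  refine ((isNu_l1 isNu_int).mul _ _).trans ?_
  rw [l1_C isNu_int]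
  have := l1_X isNu_int
  have h0 := (isNu_l1 isNu_int).nonneg (X : ℤ[X])
  push_cast
  rw [Nat.abs_cast]
  exact mul_le_of_le_one_right (by positivity) this

lemma l1_th (D i : ℕ) (hi : i ≤ D) (p : ℤ[X]) : l1 (fun k : ℤ => |(k : ℝ)|) (th^[i] p) ≤ lW (2 ^ D) p := by
  have e1 : (th^[i] p).support ⊆ p.support := by
    intro k hk
    rw [mem_support_iff] at hk ⊢
    intro h; rw [coeff_th, h, mul_zero] at hk; exact hk rfl
  have e2 : (p.comp (C ((2 ^ D : ℕ):ℤ) * X)).support ⊆ p.support := by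
    intro k hk
    rw [mem_support_iff] at hk ⊢
    intro h; rw [comp_C_mul_X_coeff, h, zero_mul] at hk; exact hk rfl
  rw [lW, l1_eq_of_subset isNu_int _ _ e1, l1_eq_of_subset isNu_int _ _ e2]
  apply Finset.sum_le_sum
  intro k _
  rw [coeff_th, comp_C_mul_X_coeff]
  push_cast
  rw [abs_mul, abs_mul, mul_comm]
  apply mul_le_mul_of_nonneg_left _ (abs_nonneg _)
  rw [abs_of_nonneg (by positivity), abs_of_nonneg (by positivity)]
  have : k ^ i ≤ (2 ^ D) ^ k := by
    rcases Nat.eq_zero_or_pos k with rfl | hk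
    · simpa using pow_le_one₀ (n := i) (Nat.zero_le 0) (Nat.zero_le 1)
    · calc k ^ i ≤ k ^ D := Nat.pow_le_pow_right hk hi
        _ ≤ (2 ^ k) ^ D := Nat.pow_le_pow_left Nat.lt_two_pow_self.le D
        _ = _ := by rw [← pow_mul, ← pow_mul, mul_comm]
  exact_mod_cast this

lemma nu_prod {R : Type*} [CommRing R] {ν : R → ℝ} (h : IsNu ν) {ι : Type*} (s : Finset ι) (f : ι → R) {M : ℝ}
    (hM : ∀ i ∈ s, ν (f i) ≤ M) : ν (∏ i ∈ s, f i) ≤ M ^ s.card := by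
  classical
  induction s using Finset.induction_on with
  | empty => simpa using h.one
  | insert a s ha ih =>
    rw [Finset.prod_insert ha, Finset.card_insert_of_notMem ha, pow_succ, mul_comm]
    exact h.mul' (ih fun i hi => hM i (Finset.mem_insert_of_mem hi)) (hM a (Finset.mem_insert_self _ _))

lemma nu_det {R : Type*} [CommRing R] {ν : R → ℝ} (h : IsNu ν) (n : ℕ) (A : Matrix (Fin n) (Fin n) R) {M : ℝ}
    (hM : ∀ i j, ν (A i j) ≤ M) : ν A.det ≤ n.factorial * M ^ n := by
  rw [Matrix.det_apply]
  refine (h.sum _ _).trans ?_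
  have : ∀ σ ∈ (Finset.univ : Finset (Equiv.Perm (Fin n))), ν (Equiv.Perm.sign σ • ∏ i, A (σ i) i) ≤ M ^ n := by
    intro σ _
    have hp := nu_prod h Finset.univ (fun i => A (σ i) i) (M := M) fun i _ => hM _ _
    rw [Finset.card_fin] at hp
    rcases Int.units_eq_one_or (Equiv.Perm.sign σ) with hs | hs <;> rw [hs]
    · simpa using hp
    · simpa [h.neg] using hp
  refine (Finset.sum_le_card_nsmul _ _ _ this).trans ?_
  rw [nsmul_eq_mul, Finset.card_univ, Fintype.card_perm, Fintype.card_fin]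

lemma zero_est (D κ : ℕ) (Φ : ℤ[X][X]) (M : ℝ) (hM1 : 1 ≤ M) (hM : ∀ k, lW (2 ^ D) (Φ.coeff k) ≤ M) (y x : ℚ) (g : ℚ[X])
    (hg : g = ∑ k ∈ Finset.range (D + 1), C (y ^ k) * (Φ.coeff k).map (Int.castRingHom ℚ)) (hg0 : g ≠ 0)
    (hdvd : (X - C x) ^ κ ∣ g) : Hq x ^ (κ - D) ≤ (D + 1).factorial * M ^ (D + 1) := by
  classical
  let v : Fin (D + 1) → ℚ[X] := fun k => (Φ.coeff k).map (Int.castRingHom ℚ)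
  obtain ⟨ι, a, ha, hsp, hli⟩ := exists_linearIndependent' ℚ v
  have : Finite ι := Finite.of_injective a ha
  have := Fintype.ofFinite ι
  let eq := Fintype.equivFin ι
  set n := Fintype.card ι with hn
  have hnD : n ≤ D + 1 := by simpa using Fintype.card_le_of_injective a ha
  let ψ : Fin n → ℤ[X] := fun k => Φ.coeff (a (eq.symm k))
  have hψ : ∀ k, (ψ k).map (Int.castRingHom ℚ) = v (a (eq.symm k)) := fun k => rfl
  have hli' : LinearIndependent ℚ fun k => (ψ k).map (Int.castRingHom ℚ) :=
    hli.comp eq.symm eq.symm.injective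
  have hsp' : g ∈ Submodule.span ℚ (Set.range fun k => (ψ k).map (Int.castRingHom ℚ)) := by
    have hr : (Set.range fun k => (ψ k).map (Int.castRingHom ℚ)) = Set.range (v ∘ a) := by
      have : (fun k => (ψ k).map (Int.castRingHom ℚ)) = (v ∘ a) ∘ eq.symm := rfl
      rw [this, eq.symm.surjective.range_comp]
    rw [hr, hsp, hg]
    apply Submodule.sum_mem
    intro k hk
    rw [← smul_eq_C_mul]
    apply Submodule.smul_mem
    apply Submodule.subset_span
    exact ⟨⟨k, Finset.mem_range.mp hk⟩, rfl⟩
  obtain ⟨t, ht⟩ := (Submodule.mem_span_range_iff_exists_fun ℚ).mp hsp'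
  simp only [smul_eq_C_mul] at ht
  obtain ⟨k₀, hk₀⟩ : ∃ k, t k ≠ 0 := by
    by_contra! hh
    apply hg0
    rw [← ht]
    exact Finset.sum_eq_zero fun k _ => by rw [hh k]; simp
  let A : Matrix (Fin n) (Fin n) ℤ[X] := Matrix.of fun i k => th^[(i:ℕ)] (ψ k)
  let B : Matrix (Fin n) (Fin n) ℚ[X] := Matrix.of fun i k : Fin n => th^[(i:ℕ)] ((ψ k).map (Int.castRingHom ℚ))
  have hB0 : B.det ≠ 0 := wronsk_ne n _ hli'
  have hAB : A.det.map (Int.castRingHom ℚ) = B.det := by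
    have := RingHom.map_det (mapRingHom (Int.castRingHom ℚ)) A
    rw [coe_mapRingHom] at this
    rw [this]
    congr 1
    ext1 i j
    simp only [RingHom.mapMatrix_apply, Matrix.map_apply, A, B, Matrix.of_apply, coe_mapRingHom, th_map]
  have hA0 : A.det ≠ 0 := by
    intro h; rw [h, Polynomial.map_zero] at hAB; exact hB0 hAB.symm
  have hvec : B.mulVec (fun k => C (t k)) = fun i : Fin n => th^[(i:ℕ)] g := by
    funext i
    simp only [Matrix.mulVec, dotProduct, B, Matrix.of_apply]
    rw [← ht, th_sum]
    exact Finset.sum_congr rfl fun _ _ => mul_comm _ _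
  have hcr : B.det * C (t k₀) = ∑ i, B.adjugate k₀ i * th^[(i:ℕ)] g := by
    have h1 := congrArg (fun w => B.adjugate.mulVec w k₀) hvec
    simp only [Matrix.mulVec_mulVec, Matrix.adjugate_mul, Matrix.smul_mulVec, Matrix.one_mulVec, Pi.smul_apply, smul_eq_mul] at h1
    rw [h1]; rfl
  have hdv : (X - C x) ^ (κ - D) ∣ A.det.map (Int.castRingHom ℚ) := by
    rw [hAB]
    have hu : IsUnit (C (t k₀)) := isUnit_C.mpr (isUnit_iff_ne_zero.mpr hk₀)
    rw [← hu.dvd_mul_right, hcr]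
    apply Finset.dvd_sum
    intro i _
    apply Dvd.dvd.mul_left
    refine (pow_dvd_pow _ ?_).trans (dvd_th x g κ i hdvd)
    have := i.2
    omega
  refine (height_le_l1 _ hA0 x _ hdv).trans ?_
  refine (nu_det (isNu_l1 isNu_int) n A (M := M) ?_).trans ?_
  · intro i j
    refine (l1_th D i ?_ _).trans (hM _)
    have := i.2
    omega
  · exact mul_le_mul (by exact_mod_cast Nat.factorial_le hnD) (pow_le_pow_right₀ hM1 hnD) (by positivity) (by positivity)
end

end

section

section
open Polynomial

lemma nd_Nmf {R : Type*} [CommRing R] {F₀₀ F₁₀ F₀₁ F₁₁ D₁ D₂ : R[X]} {n : ℕ} (h1 : F₀₀.natDegree ≤ n) (h2 : F₁₀.natDegree ≤ n)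
    (h3 : F₀₁.natDegree ≤ n) (h4 : F₁₁.natDegree ≤ n) (h5 : D₁.natDegree ≤ 4) (h6 : D₂.natDegree ≤ 4) :
    (Nmf F₀₀ F₁₀ F₀₁ F₁₁ D₁ D₂).natDegree ≤ 4 * n + 16 := by
  refine nd_sub (nd_pow 2 (k := 2 * n + 8) (nd_sub (nd_add (nd_pow 2 h1 (by omega)) (nd_mul (k := 2 * n) (nd_pow 2 h2 le_rfl) h5 (by omega)))
    (nd_mul (l := 2 * n + 4) h6 (nd_add (nd_pow 2 h3 (by omega)) (nd_mul (k := 2 * n) (nd_pow 2 h4 le_rfl) h5 (by omega))) (by omega))) (by omega))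
    (nd_mul (k := 4 * n + 8) (nd_pow 2 (k := 2 * n + 4) (nd_sub (nd_mul (k := n) (nd_mul (k := 0) (nd_num 2 0) h1 (by omega)) h2 (by omega))
      (nd_mul (k := n + 4) (nd_mul (k := 4) (nd_mul (k := 0) (nd_num 2 0) h6 (by omega)) h3 (by omega)) h4 (by omega))) (by omega)) h5 (by omega))

lemma nd_NmP (a₁ b₁ a₂ b₂ : ℤ) (s m N : ℕ) (c : ℕ → ℕ → ℕ → ℤ) (e : ℤ) :
    (NmP a₁ b₁ a₂ b₂ s m N c e).natDegree ≤ 4 * (8 * N) + 16 := by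
  have hx : (X + C (C e) : ℤ[X][X]).natDegree ≤ 1 := nd_add natDegree_X_le (by simp)
  have h1 : (1 : ℤ[X][X]).natDegree ≤ 1 := by simp
  have hA : ∀ a b : ℤ, ∀ j ≤ N, ∀ α : Fin 2, (Ac a b s (C X : ℤ[X][X]) 1 (X + C (C e)) 1 N j α).natDegree ≤ N * 4 := by
    intro a b j hj α
    have m1 := map_iX a b (X : ℤ[X]) 1 s (C : ℤ[X] →+* ℤ[X][X])
    have m2 := map_iZ a b (X : ℤ[X]) 1 s (C : ℤ[X] →+* ℤ[X][X])
    have m3 := map_iK a b (X : ℤ[X]) 1 s (C : ℤ[X] →+* ℤ[X][X])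
    rw [C_1] at m1 m2 m3
    have := nd_Ac' a b s (C X : ℤ[X][X]) 1 (X + C (C e)) 1 0 0 1 (by rw [← m1]; simp) (by rw [← m2]; simp) (by rw [← m3]; simp)
      (by simp) (by simp) hx h1 N j hj α
    simpa using this
  have hF : ∀ α β, (Fab a₁ b₁ a₂ b₂ s m N N c α β (C X : ℤ[X][X]) 1 (X + C (C e)) 1).natDegree ≤ 8 * N := by
    intro α β
    unfold Fab
    apply natDegree_sum_le_of_forall_le
    intro i _
    apply natDegree_sum_le_of_forall_le
    intro j hj
    apply natDegree_sum_le_of_forall_le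
    intro k hk
    rw [Finset.mem_range] at hj hk
    refine nd_mul (k := 0) (l := 8 * N) (nd_int_mul _ ?_) (nd_mul (hA _ _ j (by omega) α) (hA _ _ k (by omega) β) (by omega)) (by omega)
    rw [one_pow, mul_one, ← C_pow]; simp
  have hDd : ∀ a b : ℤ, (hD a b (C X : ℤ[X][X]) 1 (X + C (C e)) 1).natDegree ≤ 4 := by
    intro a b
    refine nd_mul (k := 0) (l := 4) (nd_fh a b (d := 0) (by simp) (by simp)) (nd_fh a b (d := 1) hx h1) (by omega)
  exact nd_Nmf (hF _ _) (hF _ _) (hF _ _) (hF _ _) (hDd _ _) (hDd _ _)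

lemma le_two_pow_pow (s : ℕ) : ((4 ^ s : ℕ) : ℝ) ≤ 2 ^ (4 ^ s) := by
  exact_mod_cast Nat.lt_two_pow_self.le

lemma le_pow_q {T : ℝ} (hT : 1 ≤ T) (s : ℕ) : T ≤ T ^ (4 ^ s) :=
  le_self_pow₀ hT (by positivity)

/-- uniform bound for `Fab` by `K ^ 4 ^ s`. -/
lemma nu_Fab' {R : Type*} [CommRing R] {ν : R → ℝ} (h : IsNu ν) (a₁ b₁ a₂ b₂ : ℤ) {X₁ Z₁ X₂ Z₂ : R} {B Cc : ℝ} (hB : 1 ≤ B)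
    (hCc : 1 ≤ Cc) (hX₁ : ν X₁ ≤ B) (hZ₁ : ν Z₁ ≤ B)
    (hX₂ : ν X₂ ≤ B) (hZ₂ : ν Z₂ ≤ B) (s m N : ℕ) (hm : m ≤ 4 ^ s) (c : ℕ → ℕ → ℕ → ℤ)
    (hc : ∀ i j k, |(c i j k : ℝ)| ≤ Cc ^ (4 ^ s)) (α β : Fin 2) :
    ν (Fab a₁ b₁ a₂ b₂ s m N N c α β X₁ Z₁ X₂ Z₂) ≤
      (2 * ((N + 1 : ℕ) * ((N + 1 : ℕ) * (Cc * B * (CA a₁ b₁ B N * CA a₂ b₂ B N))))) ^ (4 ^ s) := by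
  refine (nu_Fab h a₁ b₁ a₂ b₂ hB hX₁ hZ₁ hX₂ hZ₂ s m N N c hc α β).trans ?_
  have k1 := one_le_CA a₁ b₁ hB N
  have k2 := one_le_CA a₂ b₂ hB N
  have hN : (1:ℝ) ≤ (N + 1 : ℕ) := by exact_mod_cast Nat.le_add_left 1 N
  have hm' : (m : ℝ) ≤ 2 ^ (4 ^ s) := le_trans (by exact_mod_cast hm) (le_two_pow_pow s)
  have hB' : B ^ (m - 1) ≤ B ^ (4 ^ s) := pow_le_pow_right₀ hB (by omega)
  have hNq := le_pow_q hN s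
  simp only [mul_pow]
  gcongr

lemma Nmf_map {R S : Type*} [CommRing R] [CommRing S] (φ : R →+* S) (F₀₀ F₁₀ F₀₁ F₁₁ D₁ D₂ : R) :
    φ (Nmf F₀₀ F₁₀ F₀₁ F₁₁ D₁ D₂) = Nmf (φ F₀₀) (φ F₁₀) (φ F₀₁) (φ F₁₁) (φ D₁) (φ D₂) := by
  have : φ 2 = 2 := map_ofNat φ 2
  simp [Nmf, this]

/-- the norm form -/
def Ng {R : Type*} [CommRing R] (a₁ b₁ a₂ b₂ : ℤ) (s m N : ℕ) (c : ℕ → ℕ → ℕ → ℤ) (X₁ Z₁ X₂ Z₂ : R) : R :=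
  Nmf (Fab a₁ b₁ a₂ b₂ s m N N c 0 0 X₁ Z₁ X₂ Z₂) (Fab a₁ b₁ a₂ b₂ s m N N c 1 0 X₁ Z₁ X₂ Z₂)
    (Fab a₁ b₁ a₂ b₂ s m N N c 0 1 X₁ Z₁ X₂ Z₂) (Fab a₁ b₁ a₂ b₂ s m N N c 1 1 X₁ Z₁ X₂ Z₂)
    (hD a₁ b₁ X₁ Z₁ X₂ Z₂) (hD a₂ b₂ X₁ Z₁ X₂ Z₂)

lemma map_Ng {R S : Type*} [CommRing R] [CommRing S] (φ : R →+* S) (a₁ b₁ a₂ b₂ : ℤ) (s m N : ℕ) (c : ℕ → ℕ → ℕ → ℤ) (X₁ Z₁ X₂ Z₂ : R) :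
    φ (Ng a₁ b₁ a₂ b₂ s m N c X₁ Z₁ X₂ Z₂) = Ng a₁ b₁ a₂ b₂ s m N c (φ X₁) (φ Z₁) (φ X₂) (φ Z₂) := by
  simp only [Ng, Nmf_map, map_Fab, map_hD]

lemma NmP_eval (a₁ b₁ a₂ b₂ : ℤ) (s m N : ℕ) (c : ℕ → ℕ → ℕ → ℤ) (e : ℤ) (x : ℚ) (D : ℕ) (hD : (NmP a₁ b₁ a₂ b₂ s m N c e).natDegree ≤ D) :
    Ng a₁ b₁ a₂ b₂ s m N c (X : ℚ[X]) 1 (C x) 1 =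
      ∑ k ∈ Finset.range (D + 1), C ((x - e) ^ k) * ((NmP a₁ b₁ a₂ b₂ s m N c e).coeff k).map (Int.castRingHom ℚ) := by
  have h1 := map_Ng (eval₂RingHom (mapRingHom (Int.castRingHom ℚ)) (C (x - e))) a₁ b₁ a₂ b₂ s m N c (C X : ℤ[X][X]) 1 (X + C (C e)) 1
  have h2 : Ng a₁ b₁ a₂ b₂ s m N c (C X : ℤ[X][X]) 1 (X + C (C e)) 1 = NmP a₁ b₁ a₂ b₂ s m N c e := rfl
  rw [h2] at h1
  rw [coe_eval₂RingHom] at h1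
  rw [eval₂_C, eval₂_add, eval₂_X, eval₂_C, eval₂_one, coe_mapRingHom, map_X, map_C] at h1
  have h3 : (C (x - e) + C ((Int.castRingHom ℚ) e) : ℚ[X]) = C x := by rw [← C_add]; simp
  rw [h3] at h1
  rw [← h1, eval₂_eq_sum_range' _ (Nat.lt_succ_of_le hD)]
  apply Finset.sum_congr rfl
  intro k _
  rw [mul_comm, C_pow]; rfl

lemma part_F {p q r : ℤ} (hp : p ≠ 0) (hq : q ≠ 0) (hr : r ≠ 0) (hpq : p ≠ q) (hpr : p ≠ r) (hqr : q ≠ r) (N : ℕ) (hNN : N = 255) :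
    ∃ K : ℝ, 1 ≤ K ∧ ∃ D : ℕ, ∀ e : ℤ, |e| ≤ 9 → ∀ s : ℕ, 1 ≤ s → ∀ m : ℕ, m = 4 ^ (s - 1) → ∃ c : ℕ → ℕ → ℕ → ℤ,
      (∀ i j k, |(c i j k : ℝ)| ≤ K ^ (4 ^ s)) ∧
      (∀ α β, Fab (-(p+q)) (p*q) (-(p+r)) (p*r) s m N N c α β (X : ℤ[X]) 1 (e : ℤ[X]) 1 = 0) ∧
      ∀ x : ℚ, K ^ (4 ^ s) < Hq (x - e) → Ng (-(p+q)) (p*q) (-(p+r)) (p*r) s m N c (X : ℚ[X]) 1 (C x) 1 ≠ 0 ∧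
        ∀ (t : ℚ) (κ : ℕ), (X - C t) ^ κ ∣ Ng (-(p+q)) (p*q) (-(p+r)) (p*r) s m N c (X : ℚ[X]) 1 (C x) 1 →
          Hq t ^ (κ - D) ≤ K ^ (4 ^ s) := by
  obtain ⟨C₀, hC₀, hsieg⟩ := siegel_aux (-(p+q)) (p*q) (-(p+r)) (p*r) N hNN
  generalize hD₀ : 4 * (8 * N) + 16 = D
  set B : ℝ := 2 ^ D + 10 with hB
  have hB1 : 1 ≤ B := by rw [hB]; have : (0:ℝ) < 2 ^ D := by positivity
                         linarith
  set a₁ := -(p+q); set b₁ := p*q; set a₂ := -(p+r); set b₂ := p*r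
  set K₁ : ℝ := (2 * ((N + 1 : ℕ) * ((N + 1 : ℕ) * (C₀ * B * (CA a₁ b₁ B N * CA a₂ b₂ B N))))) with hK₁
  have k1 := one_le_CA a₁ b₁ hB1 N
  have k2 := one_le_CA a₂ b₂ hB1 N
  have hN1 : (1:ℝ) ≤ (N + 1 : ℕ) := by exact_mod_cast Nat.le_add_left 1 N
  have hK₁1 : 1 ≤ K₁ := one_le_mul_of_one_le_of_one_le (by norm_num) (one_le_mul_of_one_le_of_one_le hN1 (one_le_mul_of_one_le_of_one_le hN1
    (one_le_mul_of_one_le_of_one_le (one_le_mul_of_one_le_of_one_le hC₀ hB1) (one_le_mul_of_one_le_of_one_le k1 k2))))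
  clear_value K₁
  set M₁ := 1 + |(a₁:ℝ)| + |(b₁:ℝ)| with hM₁
  set M₂ := 1 + |(a₂:ℝ)| + |(b₂:ℝ)| with hM₂
  have hM₁1 : 1 ≤ M₁ := by rw [hM₁]; linarith [abs_nonneg (a₁:ℝ), abs_nonneg (b₁:ℝ)]
  have hM₂1 : 1 ≤ M₂ := by rw [hM₂]; linarith [abs_nonneg (a₂:ℝ), abs_nonneg (b₂:ℝ)]
  set K₂ := K₁ * ((M₁ * B ^ 4) * (M₁ * B ^ 4)) * ((M₂ * B ^ 4) * (M₂ * B ^ 4)) with hK₂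
  have hMB1 : 1 ≤ M₁ * B ^ 4 := one_le_mul_of_one_le_of_one_le hM₁1 (one_le_pow₀ hB1)
  have hMB2 : 1 ≤ M₂ * B ^ 4 := one_le_mul_of_one_le_of_one_le hM₂1 (one_le_pow₀ hB1)
  have hQ1 := one_le_mul_of_one_le_of_one_le hMB1 hMB1
  have hQ2 := one_le_mul_of_one_le_of_one_le hMB2 hMB2
  have hK₂1 : 1 ≤ K₂ := one_le_mul_of_one_le_of_one_le (one_le_mul_of_one_le_of_one_le hK₁1 hQ1) hQ2
  have hK₁₂ : K₁ ≤ K₂ := by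
    rw [hK₂, mul_assoc]; exact le_mul_of_one_le_right (by linarith) (one_le_mul_of_one_le_of_one_le hQ1 hQ2)
  have hQ₁₂ : (M₁ * B ^ 4) * (M₁ * B ^ 4) ≤ K₂ := by
    rw [hK₂, mul_comm K₁, mul_assoc _ K₁]; exact le_mul_of_one_le_right (zero_le_one.trans hQ1) (one_le_mul_of_one_le_of_one_le hK₁1 hQ2)
  have hQ₂₂ : (M₂ * B ^ 4) * (M₂ * B ^ 4) ≤ K₂ := by
    rw [hK₂]; exact le_mul_of_one_le_left (zero_le_one.trans hQ2) (one_le_mul_of_one_le_of_one_le hK₁1 hQ1)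
  clear_value K₂
  set K₃ := 32 * K₂ ^ 8 with hK₃
  have hK₃1 : 1 ≤ K₃ := one_le_mul_of_one_le_of_one_le (by norm_num) (one_le_pow₀ hK₂1)
  clear_value K₃
  have hfac : (1:ℝ) ≤ (D + 1).factorial := by exact_mod_cast Nat.factorial_pos _
  have hKD : K₃ ≤ K₃ ^ (D + 1) := le_self_pow₀ hK₃1 (by omega)
  have hfD : ((D + 1 : ℕ) : ℝ) ≤ (D + 1).factorial := by exact_mod_cast Nat.self_le_factorial _
  refine ⟨C₀ * ((D + 1).factorial * K₃ ^ (D + 1)), one_le_mul_of_one_le_of_one_le hC₀ (one_le_mul_of_one_le_of_one_le hfac (one_le_pow₀ hK₃1)), D, ?_⟩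
  intro e he s hs m hm
  obtain ⟨c, hc0, hcb, hcF⟩ := hsieg e he s hs m hm
  have hms : m ≤ 4 ^ s := by rw [hm]; exact Nat.pow_le_pow_right (by norm_num) (Nat.sub_le _ _)
  refine ⟨c, ?_, hcF, ?_⟩
  · intro i j k
    refine (hcb i j k).trans (pow_le_pow_left₀ (by linarith) ?_ _)
    exact le_mul_of_one_le_right (by linarith) (one_le_mul_of_one_le_of_one_le hfac (one_le_pow₀ hK₃1))
  · intro x hx
    set Φ := NmP a₁ b₁ a₂ b₂ s m N c e with hΦ
    have hΦ0 : Φ ≠ 0 := NmP_ne hp hq hr hpq hpr hqr s m N e hs hms c hc0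
    have hΦd : Φ.natDegree ≤ D := hD₀ ▸ nd_NmP a₁ b₁ a₂ b₂ s m N c e
    have hν := isNu_l1 (isNu_lW (2 ^ D))
    have hX₁ : l1 (lW (2 ^ D)) (C X : ℤ[X][X]) ≤ B := by
      rw [l1_C (isNu_lW _)]
      refine (lW_X _).trans ?_
      push_cast; rw [hB]; linarith
    have hZ₁ : l1 (lW (2 ^ D)) (1 : ℤ[X][X]) ≤ B := hν.one.trans hB1
    have hX₂ : l1 (lW (2 ^ D)) (X + C (C e) : ℤ[X][X]) ≤ B := by
      have he' : |(e:ℝ)| ≤ 9 := by exact_mod_cast he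
      have h1 : l1 (lW (2 ^ D)) (C (C e) : ℤ[X][X]) ≤ 9 := by
        have h2 : (C (C e) : ℤ[X][X]) = (e : ℤ[X][X]) := by simp
        rw [h2]; exact (hν.int e).trans he'
      refine (hν.add' (l1_X (isNu_lW _)) h1).trans ?_
      rw [hB]; have : (0:ℝ) < 2 ^ D := by positivity
      linarith
    have hF : ∀ α β, l1 (lW (2 ^ D)) (Fab a₁ b₁ a₂ b₂ s m N N c α β (C X : ℤ[X][X]) 1 (X + C (C e)) 1) ≤ K₂ ^ (4 ^ s) := fun α β => by
      have := nu_Fab' hν a₁ b₁ a₂ b₂ hB1 hC₀ hX₁ hZ₁ hX₂ hZ₁ s m N hms c hcb α β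
      rw [← hK₁] at this
      exact this.trans (pow_le_pow_left₀ (by linarith) hK₁₂ _)
    have hf : ∀ (a b : ℤ) (U V : ℤ[X][X]), l1 (lW (2 ^ D)) U ≤ B → l1 (lW (2 ^ D)) V ≤ B →
        l1 (lW (2 ^ D)) (fh a b U V) ≤ (1 + |(a:ℝ)| + |(b:ℝ)|) * B ^ 4 := by
      intro a b U V hU hV
      refine (hν.mul' (hν.mul' hU hV) (hν.add' (hν.add' (hν.pow' hU 2) (hν.mul' (hν.mul' (hν.int a) hU) hV)) (hν.mul' (hν.int b) (hν.pow' hV 2)))).trans ?_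
      apply le_of_eq; ring
    have hN : l1 (lW (2 ^ D)) Φ ≤ K₃ ^ (4 ^ s) := by
      refine (nu_Nmf hν (one_le_pow₀ hK₂1) (hF 0 0) (hF 1 0) (hF 0 1) (hF 1 1)
        ((hν.mul' (hf a₁ b₁ _ _ hX₁ hZ₁) (hf a₁ b₁ _ _ hX₂ hZ₁)).trans (hQ₁₂.trans (le_pow_q hK₂1 s)))
        ((hν.mul' (hf a₂ b₂ _ _ hX₁ hZ₁) (hf a₂ b₂ _ _ hX₂ hZ₁)).trans (hQ₂₂.trans (le_pow_q hK₂1 s)))).trans ?_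
      rw [hK₃, mul_pow, ← pow_mul, ← pow_mul, mul_comm (4 ^ s) 8]
      have := le_pow_q (show (1:ℝ) ≤ 32 by norm_num) s
      gcongr
    have hM : ∀ k, lW (2 ^ D) (Φ.coeff k) ≤ K₃ ^ (4 ^ s) := fun k => (coeff_le_l1 (isNu_lW _) Φ k).trans hN
    have hev := NmP_eval a₁ b₁ a₂ b₂ s m N c e x D hΦd
    rw [← hΦ] at hev
    have hfin : ((D + 1).factorial : ℝ) * (K₃ ^ (4 ^ s)) ^ (D + 1) ≤ (C₀ * ((D + 1).factorial * K₃ ^ (D + 1))) ^ (4 ^ s) := by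
      rw [← pow_mul, mul_comm (4 ^ s), pow_mul]
      have h1 := le_pow_q hfac s
      have h2 : (1:ℝ) ≤ C₀ ^ (4 ^ s) := one_le_pow₀ hC₀
      rw [mul_pow, mul_pow]
      calc _ ≤ ((D + 1).factorial : ℝ) ^ (4 ^ s) * (K₃ ^ (D + 1)) ^ (4 ^ s) := by gcongr
        _ ≤ _ := le_mul_of_one_le_left (by positivity) h2
    have hg0 : Ng a₁ b₁ a₂ b₂ s m N c (X : ℚ[X]) 1 (C x) 1 ≠ 0 := by
      intro h0
      obtain ⟨k₀, hk₀⟩ : ∃ k, Φ.coeff k ≠ 0 := by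
        by_contra! hh; exact hΦ0 (Polynomial.ext fun k => by simpa using hh k)
      obtain ⟨i, hi⟩ : ∃ i, (Φ.coeff k₀).coeff i ≠ 0 := by
        by_contra! hh; exact hk₀ (Polynomial.ext fun k => by simpa using hh k)
      let G : ℤ[X] := ∑ k ∈ Finset.range (D + 1), monomial k ((Φ.coeff k).coeff i)
      have hGc : G.coeff k₀ = (Φ.coeff k₀).coeff i := by
        have hk₀D : k₀ < D + 1 := by
          by_contra hlt
          exact hk₀ (coeff_eq_zero_of_natDegree_lt (by omega))
        simp only [G, Polynomial.finsetSum_coeff, coeff_monomial]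
        simp [hk₀D]
      have hG0 : G ≠ 0 := by intro h; rw [h, coeff_zero] at hGc; exact hi hGc.symm
      have hroot : (G.map (Int.castRingHom ℚ)).IsRoot (x - e) := by
        have h1 := congrArg (fun t : ℚ[X] => t.coeff i) (hev.symm.trans h0)
        simp only [Polynomial.finsetSum_coeff, coeff_C_mul, coeff_map, coeff_zero] at h1
        rw [IsRoot, ← h1]
        simp only [G, Polynomial.map_sum, Polynomial.eval_finsetSum, map_monomial, eval_monomial]
        exact Finset.sum_congr rfl fun _ _ => mul_comm _ _
      have hdv : (X - C (x - e)) ^ 1 ∣ G.map (Int.castRingHom ℚ) := by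
        rw [pow_one]; exact dvd_iff_isRoot.mpr hroot
      have hle := height_le_l1 G hG0 (x - e) 1 hdv
      rw [pow_one] at hle
      have hl1G : l1 (fun k : ℤ => |(k : ℝ)|) G ≤ (D + 1 : ℕ) * K₃ ^ (4 ^ s) := by
        refine ((isNu_l1 isNu_int).sum _ _).trans ?_
        refine (Finset.sum_le_card_nsmul _ _ (K₃ ^ (4 ^ s)) ?_).trans (by rw [Finset.card_range, nsmul_eq_mul])
        intro k _
        rw [l1_monomial isNu_int]
        refine le_trans ?_ (hM k)
        refine (coeff_le_l1 isNu_int _ i).trans ?_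
        exact l1_th D 0 (Nat.zero_le _) (Φ.coeff k)
      have : (D + 1 : ℕ) * K₃ ^ (4 ^ s) ≤ ((D + 1).factorial : ℝ) * (K₃ ^ (4 ^ s)) ^ (D + 1) :=
        mul_le_mul hfD (le_self_pow₀ (one_le_pow₀ hK₃1) (by omega)) (by positivity) (by positivity)
      linarith
    refine ⟨hg0, ?_⟩
    intro t κ hdv
    exact (zero_est D κ Φ (K₃ ^ (4 ^ s)) (one_le_pow₀ hK₃1) hM (x - e) t _ hev hg0 hdv).trans hfin
end

end

section

/-! ## Square roots of power series -/
section tlem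
open PowerSeries

noncomputable def tit (h : PowerSeries ℤ) : ℕ → PowerSeries ℤ
  | 0 => 0
  | n + 1 => h - tit h n ^ 2

lemma tit_X {h : PowerSeries ℤ} (h0 : (X : PowerSeries ℤ) ∣ h) (n : ℕ) : (X : PowerSeries ℤ) ∣ tit h n := by
  induction n with
  | zero => simp [tit]
  | succ n ih => exact dvd_sub h0 (dvd_pow ih two_ne_zero)

lemma tit_diff {h : PowerSeries ℤ} (h0 : (X : PowerSeries ℤ) ∣ h) (n : ℕ) :
    (X : PowerSeries ℤ) ^ (n + 1) ∣ tit h (n + 1) - tit h n := by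
  induction n with
  | zero => simpa [tit] using h0
  | succ n ih =>
    have e : tit h (n + 1 + 1) - tit h (n + 1) = -((tit h (n + 1) - tit h n) * (tit h (n + 1) + tit h n)) := by
      change h - tit h (n + 1) ^ 2 - (h - tit h n ^ 2) = _
      ring
    rw [e, dvd_neg, pow_succ]
    exact mul_dvd_mul ih (dvd_add (tit_X h0 _) (tit_X h0 _))

lemma tit_coeff {h : PowerSeries ℤ} (h0 : (X : PowerSeries ℤ) ∣ h) (k n : ℕ) (hn : k ≤ n) :
    coeff k (tit h n) = coeff k (tit h k) := by
  induction n, hn using Nat.le_induction with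
  | base => rfl
  | succ n hn ih =>
    have := X_pow_dvd_iff.mp (tit_diff h0 n) k (by omega)
    rw [map_sub] at this
    linarith

lemma exists_t (h : PowerSeries ℤ) (h0 : constantCoeff h = 0) :
    ∃ t : PowerSeries ℤ, constantCoeff t = 0 ∧ t + t ^ 2 = h ∧
      ∀ (Λ : ℝ) (κ : ℕ), 0 < Λ → wnu Λ κ h ≤ 1 / 4 → wnu Λ κ t ≤ 2 * wnu Λ κ h := by
  have h0 := X_dvd_iff.mpr h0
  have key : ∀ k, (X : PowerSeries ℤ) ^ (k + 1) ∣ mk (fun k => coeff k (tit h k)) - tit h k := by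
    intro k
    rw [X_pow_dvd_iff]
    intro j hj
    rw [map_sub, coeff_mk, tit_coeff h0 j k (by omega), sub_self]
  refine ⟨mk fun k => coeff k (tit h k), ?_, ?_, ?_⟩
  · rw [← coeff_zero_eq_constantCoeff_apply, coeff_mk]; simp [tit]
  · rw [← sub_eq_zero]
    ext k
    have : (X : PowerSeries ℤ) ^ (k + 1) ∣ mk (fun k => coeff k (tit h k)) + mk (fun k => coeff k (tit h k)) ^ 2 - h := by
      generalize hT : mk (fun k => coeff k (tit h k)) = T
      have h1 := key k
      rw [hT] at h1
      have h2 := tit_diff h0 k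
      have e : T + T ^ 2 - h = (T - tit h k) * (1 + T + tit h k) - (tit h (k + 1) - tit h k) := by
        change _ = _ - (h - tit h k ^ 2 - tit h k)
        ring
      rw [e]
      exact dvd_sub (h1.mul_right _) h2
    rw [X_pow_dvd_iff.mp this k (by omega), map_zero]
  · intro Λ κ hΛ hw
    have hν := isNu_wnu hΛ κ
    have e : wnu Λ κ (mk fun k => coeff k (tit h k)) = wnu Λ κ (tit h κ) := by
      unfold wnu
      apply Finset.sum_congr rfl
      intro k hk
      rw [coeff_mk, tit_coeff h0 k κ (by simpa [Nat.lt_succ_iff] using hk)]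
    rw [e]
    have : ∀ n, wnu Λ κ (tit h n) ≤ 2 * wnu Λ κ h := by
      intro n
      have hp := hν.nonneg h
      induction n with
      | zero => simp only [tit, hν.zero]; positivity
      | succ n ih =>
        refine (hν.sub' le_rfl (hν.pow' ih 2)).trans ?_
        nlinarith
    exact this κ
end tlem

/-! ## More on `QRep` -/
set_option linter.unusedSectionVars false
section qr
open WeierstrassCurve
variable {a b d : ℤ} (hN : ND a b d) {K : Type*} [Field K] [CharZero K]

include hN in
lemma qrep_exists {X η Z : K} (hZ : Z ≠ 0) (h : d * η ^ 2 = fh a b X Z) :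
    ∃ P : (EK a b d K).Point, QRep P X η Z := by
  have hns : (EK a b d K).Nonsingular (d * X / Z) (d ^ 2 * η / Z ^ 2) := by
    rw [EK_nonsing hN]
    rw [fh] at h
    generalize (d:K) = D at *
    field_simp
    linear_combination D ^ 3 * h
  exact ⟨_, Or.inr ⟨_, _, hns, rfl, hZ, by field_simp, by field_simp⟩⟩

include hN in
lemma xpar_cross {P : (EK a b d K).Point} {X Z X' Z' : K} (h : XPar P X Z) (h' : XPar P X' Z') :
    X * Z' = Z * X' := by
  have hd := hN.dK (K := K)
  rcases h with ⟨rfl, rfl⟩ | ⟨x, y, hh, rfl, h1⟩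
  · rcases h' with ⟨_, rfl⟩ | ⟨x, y, hh, h2, _⟩
    · ring
    · simp at h2
  · rcases h' with ⟨h2, _⟩ | ⟨x', y', hh', h2, h3⟩
    · simp at h2
    · simp only [Affine.Point.some.injEq] at h2
      obtain ⟨rfl, rfl⟩ := h2
      apply mul_left_cancel₀ hd
      linear_combination (-Z') * h1 + Z * h3

lemma QRep.xpar {P : (EK a b d K).Point} {X η Z : K} (h : QRep P X η Z) : XPar P X Z := by
  rcases h with ⟨h1, h2, _⟩ | ⟨x, y, hh, h1, _, h2, _⟩
  · exact Or.inl ⟨h1, h2⟩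
  · exact Or.inr ⟨x, y, hh, h1, h2⟩

lemma XPar.neg {P : (EK a b d K).Point} {X Z : K} (h : XPar P X Z) : XPar (-P) X Z := by
  rcases h with ⟨rfl, h2⟩ | ⟨x, y, hh, rfl, h2⟩
  · exact Or.inl ⟨by simp, h2⟩
  · exact Or.inr ⟨x, _, _, Affine.Point.neg_some _, h2⟩

include hN in
lemma qrep_sub_full [DecidableEq K] {P Q : (EK a b d K).Point} {X₁ η₁ Z X₂ η₂ c A B C : K}
    (h₁ : QRep P X₁ η₁ Z) (h₂ : QRep Q X₂ η₂ Z) (hZ : Z ≠ 0) (hv : X₁ - X₂ ≠ 0) (hc : c ≠ 0)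
    (hA : c * A = sX (a:K) b d X₁ η₁ Z X₂ η₂ Z)
    (hC : c * C = (Z * (X₁ - X₂)) ^ 2)
    (hB : c ^ 2 * B = -(Z * (X₁ - X₂)) * (η₁ * Z * (X₁ - X₂) ^ 3 + (η₁ + η₂) *
      (sX (a:K) b d X₁ η₁ Z X₂ η₂ Z - X₁ * Z * (X₁ - X₂) ^ 2))) :
    QRep (P - Q) A B C := by
  have hd := hN.dK (K := K)
  have q1 := h₁.eq hN
  have q2 := h₂.eq hN
  rcases h₁ with ⟨_, h, _⟩ | ⟨x₁, y₁, n₁, rfl, -, hx₁, hy₁⟩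
  · exact absurd h hZ
  rcases h₂ with ⟨_, h, _⟩ | ⟨x₂, y₂, n₂, rfl, -, hx₂, hy₂⟩
  · exact absurd h hZ
  obtain rfl : x₁ = d * X₁ / Z := by field_simp; linear_combination hx₁
  obtain rfl : y₁ = d ^ 2 * η₁ / Z ^ 2 := by field_simp; linear_combination hy₁
  obtain rfl : x₂ = d * X₂ / Z := by field_simp; linear_combination hx₂
  obtain rfl : y₂ = d ^ 2 * η₂ / Z ^ 2 := by field_simp; linear_combination hy₂
  have hxne : (d * X₁ / Z : K) ≠ d * X₂ / Z := by
    intro h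
    apply hv
    field_simp at h
    linear_combination h
  right
  rw [sub_eq_add_neg, Affine.Point.neg_some]
  have hCne : C ≠ 0 := by
    rintro rfl
    have : (Z * (X₁ - X₂)) ^ 2 ≠ 0 := by positivity
    apply this; rw [← hC]; ring
  have hCe : C = (Z * (X₁ - X₂)) ^ 2 / c := by field_simp; linear_combination hC
  have hAe : A = sX (a:K) b d X₁ η₁ Z X₂ η₂ Z / c := by field_simp; linear_combination hA
  have hsl : (EK a b d K).slope (d * X₁ / Z) (d * X₂ / Z) (d ^ 2 * η₁ / Z ^ 2)
      ((EK a b d K).negY (d * X₂ / Z) (d ^ 2 * η₂ / Z ^ 2)) = d * (η₁ + η₂) / (Z * (X₁ - X₂)) := by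
    rw [Affine.slope_of_X_ne hxne]
    simp only [Affine.negY, EK_a1, EK_a3, zero_mul, sub_zero, sub_neg_eq_add]
    have e3 : (d * X₁ / Z - d * X₂ / Z) = d * (X₁ - X₂) / Z := by field_simp
    rw [e3]
    generalize X₁ - X₂ = v at *
    field_simp
  have hx3 : (EK a b d K).addX (d * X₁ / Z) (d * X₂ / Z) (d * (η₁ + η₂) / (Z * (X₁ - X₂))) * C = d * A := by
    simp only [Affine.addX, EK_a1, EK_a2, zero_mul, add_zero]
    rw [hCe, hAe]
    have e4 : (d * (η₁ + η₂) / (Z * (X₁ - X₂))) ^ 2 * (Z * (X₁ - X₂)) ^ 2 = d ^ 2 * (η₁ + η₂) ^ 2 := by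
      generalize X₁ - X₂ = v at *
      field_simp
    have e5 : ((d * (η₁ + η₂) / (Z * (X₁ - X₂))) ^ 2 - d * a - d * X₁ / Z - d * X₂ / Z) * (Z * (X₁ - X₂)) ^ 2
        = d * sX (a:K) b d X₁ η₁ Z X₂ η₂ Z := by
      have : (- d * a - d * X₁ / Z - d * X₂ / Z : K) * Z ^ 2 = - d * (a * Z ^ 2 + X₁ * Z + X₂ * Z) := by
        field_simp; ring
      rw [sX]
      linear_combination e4 + (X₁ - X₂) ^ 2 * this + d * q1 + d * q2
    have e6 : ∀ u v w : K, u * v = w → u * (v / c) = w / c := by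
      intro u v w h; rw [← h]; ring
    rw [e6 _ _ _ e5]
    ring
  refine ⟨_, _, _, Affine.Point.add_of_X_ne hxne, hCne, ?_, ?_⟩
  · rw [hsl]; exact hx3
  · rw [hsl]
    simp only [Affine.addY, Affine.negAddY, Affine.negY, EK_a1, EK_a3, zero_mul, sub_zero]
    have hBe : B = (c ^ 2 * B) / c ^ 2 := by field_simp
    rw [hBe, hB]
    have e7 : ∀ u l x1 y1 : K, -(l * (u - x1) + y1) * C ^ 2 = - (l * (u * C - x1 * C) * C + y1 * C ^ 2) := by
      intros; ring
    rw [e7, hx3, hAe, hCe]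
    generalize sX (a:K) b d X₁ η₁ Z X₂ η₂ Z = S at *
    generalize hvv : X₁ - X₂ = v at *
    field_simp
    ring
end qr

end

section

set_option linter.unusedSectionVars false
/-! ## The local expansion -/
section pmap
open WeierstrassCurve
variable (a b d : ℤ) (K : Type*) [Field K] [CharZero K] [DecidableEq K]

lemma exists_pmap : ∃ Φ : (EK a b d ℚ).Point →+ (EK a b d K).Point, ∀ (P : (EK a b d ℚ).Point) (X η Z : ℚ),
    QRep P X η Z → QRep (Φ P) (X : K) (η : K) (Z : K) := by
  let f : ℚ →ₐ[ℤ] K := (Algebra.ofId ℚ K).restrictScalars ℤ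
  have hf : ∀ x : ℚ, f x = (x : K) := fun x => by simp [f]
  refine ⟨Affine.Point.map (W' := EC a b d) f, ?_⟩
  intro P X η Z h
  rcases h with ⟨rfl, rfl, rfl, hX⟩ | ⟨x, y, hn, rfl, hZ, hx, hy⟩
  · left
    refine ⟨map_zero _, by simp, by simp, by exact_mod_cast hX⟩
  · right
    refine ⟨_, _, _, Affine.Point.map_some f hn, by exact_mod_cast hZ, ?_, ?_⟩
    · rw [hf]; exact_mod_cast congrArg (Rat.cast : ℚ → K) hx
    · rw [hf]; exact_mod_cast congrArg (Rat.cast : ℚ → K) hy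
end pmap

section gdefs
variable {S : Type*} [CommRing S]
def gX1 (X Z f θ τ : S) : S := X + Z * (4 * f * θ * τ)
def gh (a b : ℤ) (X Z f θ τ : S) : S :=
  θ * τ * (Z ^ 2 * (3 * X ^ 2 + 3 * X * Z * (4 * f * θ * τ) + Z ^ 2 * (4 * f * θ * τ) ^ 2)
    + a * Z ^ 3 * (2 * X + Z * (4 * f * θ * τ)) + b * Z ^ 4)
def gn (a b : ℤ) (X Z f θ τ t : S) : S :=
  θ * τ * (Z ^ 2 * (X ^ 2 + b * Z ^ 2) + 2 * X ^ 2 * Z ^ 2 + X * Z ^ 3 * (4 * f * θ * τ) + 2 * a * X * Z ^ 3) + t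
def gξ (a b : ℤ) (X Z f θ τ t : S) : S :=
  -(Z ^ 2 * θ * τ) * (16 * (1 + 2 * t) * Z ^ 4 * f ^ 2 * θ ^ 3 * τ ^ 3
    + (2 + 2 * t) * (1 + gn a b X Z f θ τ t - 4 * f * gX1 X Z f θ τ * Z ^ 3 * θ ^ 2 * τ ^ 2))
def gZu (Z f θ τ : S) : S := 4 * f * Z ^ 4 * θ ^ 2 * τ ^ 2

def gVX (a b : ℤ) (s : ℕ) (X Z f θ τ t : S) : S := iX a b (1 + gn a b X Z f θ τ t) (gZu Z f θ τ) s
def gVZ (a b : ℤ) (s : ℕ) (X Z f θ τ t : S) : S := iZ a b (1 + gn a b X Z f θ τ t) (gZu Z f θ τ) s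
def gVK (a b : ℤ) (s : ℕ) (X Z f θ τ t : S) : S :=
  gξ a b X Z f θ τ t * iK a b (1 + gn a b X Z f θ τ t) (gZu Z f θ τ) s

/-- numerator for `R - V`, where `g = d η_R η_P` -/
def gRX (a b : ℤ) (XR ZR g VX VZ VK : S) : S :=
  (XR * VZ + VX * ZR) * (XR * VX + b * ZR * VZ) + 2 * a * XR * ZR * VX * VZ + 2 * g * VK
def gRZ (XR ZR VX VZ : S) : S := (XR * VZ - VX * ZR) ^ 2

variable {T : Type*} [CommRing T] (φ : S →+* T) (a b : ℤ) (s : ℕ) (X Z f θ τ t XR ZR g VX VZ VK : S)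
lemma map_gX1 : φ (gX1 X Z f θ τ) = gX1 (φ X) (φ Z) (φ f) (φ θ) (φ τ) := by simp [gX1, map_ofNat]
lemma map_gh : φ (gh a b X Z f θ τ) = gh a b (φ X) (φ Z) (φ f) (φ θ) (φ τ) := by simp [gh, map_ofNat]
lemma map_gn : φ (gn a b X Z f θ τ t) = gn a b (φ X) (φ Z) (φ f) (φ θ) (φ τ) (φ t) := by simp [gn, map_ofNat]
lemma map_gZu : φ (gZu Z f θ τ) = gZu (φ Z) (φ f) (φ θ) (φ τ) := by simp [gZu, map_ofNat]
lemma map_gξ : φ (gξ a b X Z f θ τ t) = gξ a b (φ X) (φ Z) (φ f) (φ θ) (φ τ) (φ t) := by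
  simp [gξ, map_gn, map_gX1, map_ofNat]
lemma map_gVX : φ (gVX a b s X Z f θ τ t) = gVX a b s (φ X) (φ Z) (φ f) (φ θ) (φ τ) (φ t) := by
  simp [gVX, map_gn, map_gZu, map_iX]
lemma map_gVZ : φ (gVZ a b s X Z f θ τ t) = gVZ a b s (φ X) (φ Z) (φ f) (φ θ) (φ τ) (φ t) := by
  simp [gVZ, map_gn, map_gZu, map_iZ]
lemma map_gVK : φ (gVK a b s X Z f θ τ t) = gVK a b s (φ X) (φ Z) (φ f) (φ θ) (φ τ) (φ t) := by
  simp [gVK, map_gn, map_gξ, map_gZu, map_iK]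
lemma map_gRX : φ (gRX a b XR ZR g VX VZ VK) = gRX a b (φ XR) (φ ZR) (φ g) (φ VX) (φ VZ) (φ VK) := by
  simp [gRX, map_ofNat]
lemma map_gRZ : φ (gRZ XR ZR VX VZ) = gRZ (φ XR) (φ ZR) (φ VX) (φ VZ) := by
  simp [gRZ]

lemma fh_gX1 (hf : f = fh a b X Z) : fh a b (gX1 X Z f θ τ) Z = f * (1 + 4 * gh a b X Z f θ τ) := by
  have : fh a b (gX1 X Z f θ τ) Z = fh a b X Z + 4 * f * gh a b X Z f θ τ := by
    simp only [fh, gX1, gh]; ring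
  rw [this, ← hf]; ring
end gdefs

section cross
open WeierstrassCurve
variable {a b d : ℤ} (hN : ND a b d) {K : Type*} [Field K] [CharZero K] [DecidableEq K]
include hN

/-- The cross relation over the field `K`. -/
lemma cross_K (s : ℕ) {P Q R : (EK a b d K).Point} {XP ηP ZP XQ ηQ ZQ XR ηR ZR : K}
    (hP : QRep P XP ηP ZP) (hQ : QRep Q XQ ηQ ZQ) (hR : QRep R XR ηR ZR)
    (hPQR : R = Q - (2 ^ s : ℕ) • P) (hZP : ZP ≠ 0) {f θ τ t : K} (hf : f = fh a b XP ZP) (hf0 : f ≠ 0)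
    (hθ : θ ≠ 0) (hτ : τ ≠ 0) (ht : t + t ^ 2 = gh a b XP ZP f θ τ) :
    ((hU a b s (gX1 XP ZP f θ τ) ZP XQ ZQ + hV a b s (gX1 XP ZP f θ τ) ZP * (d * ηQ * ηP * (1 + 2 * t)))
        * gRZ XR ZR (gVX a b s XP ZP f θ τ t) (gVZ a b s XP ZP f θ τ t) =
      hZ a b s (gX1 XP ZP f θ τ) ZP XQ ZQ * gRX a b XR ZR (d * ηR * ηP) (gVX a b s XP ZP f θ τ t)
        (gVZ a b s XP ZP f θ τ t) (gVK a b s XP ZP f θ τ t)) ∧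
    (ZR = 0 →
      (hU a b s (gX1 XP ZP f θ τ) ZP XQ ZQ + hV a b s (gX1 XP ZP f θ τ) ZP * (d * ηQ * ηP * (1 + 2 * t)))
        * gVZ a b s XP ZP f θ τ t =
      hZ a b s (gX1 XP ZP f θ τ) ZP XQ ZQ * gVX a b s XP ZP f θ τ t) := by
  have hPe : d * ηP ^ 2 = f := by rw [hP.eq hN, hf, fh]
  obtain ⟨P', hP'⟩ : ∃ P' : (EK a b d K).Point, QRep P' (gX1 XP ZP f θ τ) (ηP * (1 + 2 * t)) ZP := by
    apply qrep_exists hN hZP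
    rw [fh_gX1 a b XP ZP f θ τ hf, ← ht, ← hPe]; ring
  have hv : gX1 XP ZP f θ τ - XP = 4 * f * ZP * θ * τ := by rw [gX1]; ring
  have hsX : 4 * f * (1 + gn a b XP ZP f θ τ t) = sX (a:K) b d (gX1 XP ZP f θ τ) (ηP * (1 + 2 * t)) ZP XP ηP ZP := by
    have hf' := hf
    rw [fh] at hf'
    simp only [sX, gn, gX1]
    linear_combination (-2 - 4 * t) * hPe + 2 * hf'
  have hu : QRep (P' - P) (1 + gn a b XP ZP f θ τ t) (ηP * gξ a b XP ZP f θ τ t) (gZu ZP f θ τ) := by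
    refine qrep_sub_full hN (c := 4 * f) hP' hP hZP ?_ (by simpa using hf0) hsX ?_ ?_
    · rw [hv]; simp [hf0, hZP, hθ, hτ]
    · rw [hv, gZu]; ring
    · rw [hv, ← hsX, gξ]; ring
  have hV := qrep_iter hN hu s
  have h1 : XPar (Q - (2 ^ s : ℕ) • P') (hU a b s (gX1 XP ZP f θ τ) ZP XQ ZQ
      + _root_.hV a b s (gX1 XP ZP f θ τ) ZP * (d * ηQ * ηP * (1 + 2 * t))) (hZ a b s (gX1 XP ZP f θ τ) ZP XQ ZQ) := by
    have := qrep_sub hN hQ (qrep_iter hN hP' s)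
    convert this using 1
    · rw [hU, _root_.hV, sX]; ring
    · rw [hZ, sZ]; ring
  have e : R - (2 ^ s : ℕ) • (P' - P) = Q - (2 ^ s : ℕ) • P' := by rw [hPQR, smul_sub]; abel
  constructor
  · have h2 : XPar (Q - (2 ^ s : ℕ) • P') (gRX a b XR ZR (d * ηR * ηP) (gVX a b s XP ZP f θ τ t)
        (gVZ a b s XP ZP f θ τ t) (gVK a b s XP ZP f θ τ t)) (gRZ XR ZR (gVX a b s XP ZP f θ τ t) (gVZ a b s XP ZP f θ τ t)) := by
      have := qrep_sub hN hR hV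
      rw [e] at this
      convert this using 1
      · simp only [gRX, sX, gVX, gVZ, gVK]; ring
      · simp only [gRZ, sZ, gVX, gVZ]
    exact xpar_cross hN h1 h2
  · intro hZR
    have hR0 : R = 0 := by
      rcases hR with ⟨h, _⟩ | ⟨_, _, _, _, h, _⟩
      · exact h
      · exact absurd hZR h
    rw [hR0, zero_sub] at e
    have h2 := hV.xpar.neg
    rw [e] at h2
    exact xpar_cross hN h1 h2
end cross

end

section

set_option linter.unusedSectionVars false
section gnorm
variable {S : Type*} [CommRing S] {ν : S → ℝ} (h : IsNu ν)
include h

lemma nu_g (a b : ℤ) {X Z f θ τ t : S} {H A B y : ℝ} (hH : 1 ≤ H) (hA : 1 ≤ A) (hB : 1 ≤ B) (hy : 0 ≤ y)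
    (hX : ν X ≤ H) (hZ : ν Z ≤ H) (hf : ν f ≤ A) (hθ : ν θ ≤ B) (hτ : ν τ ≤ y)
    (hyy : 100 * (1 + |(a:ℝ)| + |(b:ℝ)|) * H ^ 4 * A ^ 2 * B ^ 2 * y ≤ 1) :
    ν (gX1 X Z f θ τ) ≤ 2 * H ∧ ν (gh a b X Z f θ τ) ≤ 7 / 100 ∧ (ν t ≤ 14 / 100 →
      ν (1 + gn a b X Z f θ τ t) ≤ 2 ∧ ν (gZu Z f θ τ) ≤ 1 ∧ ν (gξ a b X Z f θ τ t) ≤ 1) := by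
  have ha := h.int a
  have hb := h.int b
  have ha0 := abs_nonneg (a:ℝ)
  have hb0 := abs_nonneg (b:ℝ)
  generalize |(a:ℝ)| = α at *
  generalize |(b:ℝ)| = β at *
  obtain ⟨r, hr⟩ : ∃ r, r = B * y := ⟨_, rfl⟩
  have hr0 : 0 ≤ r := by rw [hr]; positivity
  have hM : 1 ≤ 1 + α + β := by linarith
  have hH4 : 1 ≤ H ^ 4 := one_le_pow₀ hH
  have hAB : 1 ≤ A ^ 2 * B := by nlinarith
  have k1 : (1 + α + β) * H ^ 4 * r * 100 ≤ 1 := by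
    have : (1 + α + β) * H ^ 4 * r * 100 * 1 ≤ (1 + α + β) * H ^ 4 * r * 100 * (A ^ 2 * B) := by gcongr
    rw [hr] at this ⊢
    calc _ = (1 + α + β) * H ^ 4 * (B * y) * 100 * 1 := by ring
      _ ≤ _ := this
      _ = 100 * (1 + α + β) * H ^ 4 * A ^ 2 * B ^ 2 * y := by ring
      _ ≤ 1 := hyy
  have k2 : A * r * H * 100 ≤ 1 := by
    have e : A * r * H * 100 ≤ (1 + α + β) * H ^ 4 * r * 100 * (A ^ 2 * B) := by
      have h1 : A ≤ A ^ 2 * B := by nlinarith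
      have h2 : H ≤ (1 + α + β) * H ^ 4 := by
        have : H ^ 1 ≤ H ^ 4 := pow_le_pow_right₀ hH (by norm_num)
        nlinarith
      calc A * r * H * 100 = (A * H) * (r * 100) := by ring
        _ ≤ ((A ^ 2 * B) * ((1 + α + β) * H ^ 4)) * (r * 100) := by gcongr
        _ = _ := by ring
    rw [hr] at e ⊢
    calc _ ≤ _ := e
      _ = 100 * (1 + α + β) * H ^ 4 * A ^ 2 * B ^ 2 * y := by ring
      _ ≤ 1 := hyy
  have k3 : r * H ^ 4 * 100 ≤ 1 := by
    refine le_trans ?_ k1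
    have : r * H ^ 4 * 100 * 1 ≤ r * H ^ 4 * 100 * (1 + α + β) := by gcongr
    linarith
  have hδZ : ν (Z * (4 * f * θ * τ)) ≤ 1 / 25 := by
    refine (h.mul' hZ (h.mul' (h.mul' (h.mul' (h.num 4) hf) hθ) hτ)).trans ?_
    rw [hr] at k2
    linarith
  have hδ : ν (4 * f * θ * τ) ≤ 1 / 25 := by
    refine ((h.mul' (h.mul' (h.mul' (h.num 4) hf) hθ) hτ)).trans ?_
    have : A * r * 1 * 100 ≤ A * r * H * 100 := by gcongr
    rw [hr] at k2 this
    linarith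
  have hθτ : ν (θ * τ) ≤ r := by rw [hr]; exact h.mul' hθ hτ
  have c1 : ν (gX1 X Z f θ τ) ≤ 2 * H := by
    refine (h.add' hX hδZ).trans ?_
    linarith
  refine ⟨c1, ?_, ?_⟩
  · rw [gh]
    refine (h.mul' hθτ (h.add' (h.add' (h.mul' (h.pow' hZ 2) (h.add' (h.add' (h.mul' (h.num 3) (h.pow' hX 2))
      (h.mul' (h.mul' (h.mul' (h.num 3) hX) hZ) hδ)) (h.mul' (h.pow' hZ 2) (h.pow' hδ 2))))
      (h.mul' (h.mul' ha (h.pow' hZ 3)) (h.add' (h.mul' (h.num 2) hX) (h.mul' hZ hδ))))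
      (h.mul' hb (h.pow' hZ 4)))).trans ?_
    calc _ ≤ r * (H ^ 2 * (3 * H ^ 2 + 3 * H * H * 1 + H ^ 2 * 1 ^ 2) + α * H ^ 3 * (2 * H + H * 1) + β * H ^ 4) := by
          gcongr <;> norm_num
      _ = r * H ^ 4 * (7 + 3 * α + β) := by ring
      _ ≤ r * H ^ 4 * (7 * (1 + α + β)) := by gcongr; linarith
      _ ≤ _ := by linarith
  · intro ht
    have hn : ν (gn a b X Z f θ τ t) ≤ 18 / 100 := by
      rw [gn]
      refine (h.add' (h.mul' hθτ (h.add' (h.add' (h.add' (h.mul' (h.pow' hZ 2) (h.add' (h.pow' hX 2) (h.mul' hb (h.pow' hZ 2))))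
        (h.mul' (h.mul' (h.num 2) (h.pow' hX 2)) (h.pow' hZ 2))) (h.mul' (h.mul' hX (h.pow' hZ 3)) hδ))
        (h.mul' (h.mul' (h.mul' (h.num 2) ha) hX) (h.pow' hZ 3)))) ht).trans ?_
      have : r * (H ^ 2 * (H ^ 2 + β * H ^ 2) + 2 * H ^ 2 * H ^ 2 + H * H ^ 3 * (1 / 25) + 2 * α * H * H ^ 3) ≤ 4 / 100 := by
        calc _ = r * H ^ 4 * (3 + 1 / 25 + 2 * α + β) := by ring
          _ ≤ r * H ^ 4 * (4 * (1 + α + β)) := by gcongr; linarith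
          _ ≤ _ := by linarith
      linarith
    have h1n : ν (1 + gn a b X Z f θ τ t) ≤ 118 / 100 := (h.add' h.one hn).trans (by norm_num)
    refine ⟨h1n.trans (by norm_num), ?_, ?_⟩
    · have e : gZu Z f θ τ = (4 * f * θ * τ) * (θ * τ * Z ^ 4) := by rw [gZu]; ring
      rw [e]
      refine (h.mul' hδ (h.mul' hθτ (h.pow' hZ 4))).trans ?_
      linarith
    · have e : gξ a b X Z f θ τ t = -((θ * τ * Z ^ 2) * ((1 + 2 * t) * (4 * f * θ * τ) ^ 2 * (θ * τ * Z ^ 4)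
          + (2 + 2 * t) * (1 + gn a b X Z f θ τ t - (4 * f * θ * τ) * (θ * τ * (gX1 X Z f θ τ * Z ^ 3))))) := by
        rw [gξ]; ring
      rw [e, h.neg]
      have t1 : ν (1 + 2 * t) ≤ 2 := (h.add' h.one (h.mul' (h.num 2) ht)).trans (by norm_num)
      have t2 : ν (2 + 2 * t) ≤ 3 := (h.add' (h.num 2) (h.mul' (h.num 2) ht)).trans (by norm_num)
      have t3 : ν (θ * τ * Z ^ 4) ≤ 1 := (h.mul' hθτ (h.pow' hZ 4)).trans (by linarith)
      have t4 : ν (θ * τ * Z ^ 2) ≤ 1 / 100 := by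
        refine (h.mul' hθτ (h.pow' hZ 2)).trans ?_
        have : r * H ^ 2 ≤ r * H ^ 4 := by gcongr <;> norm_num [hH]
        linarith
      have t5 : ν (θ * τ * (gX1 X Z f θ τ * Z ^ 3)) ≤ 1 := by
        refine (h.mul' hθτ (h.mul' c1 (h.pow' hZ 3))).trans ?_
        calc _ = 2 * (r * H ^ 4) := by ring
          _ ≤ 1 := by linarith
      refine (h.mul' t4 (h.add' (h.mul' (h.mul' t1 (h.pow' hδ 2)) t3) (h.mul' t2 (h.sub' h1n (h.mul' hδ t5))))).trans ?_
      norm_num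

lemma nu_gR (a b : ℤ) {XR ZR g U W : S} {VK : S} {HR HP B : ℝ} (hHR : 1 ≤ HR) (hHP : 1 ≤ HP) (hB : 1 ≤ B)
    (hXR : ν XR ≤ HR) (hZR : ν ZR ≤ HR) (hg : ν g ≤ (1 + |(a:ℝ)| + |(b:ℝ)|) * (HR ^ 2 * HP ^ 2))
    (hU : ν U ≤ B) (hW : ν W ≤ B) (hK : ν VK ≤ B) :
    ν (gRX a b XR ZR g U W VK) ≤ 4 * (1 + |(a:ℝ)| + |(b:ℝ)|) * B ^ 2 * (HR ^ 2 * HP ^ 2) ∧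
    ν (gRZ XR ZR U W) ≤ 4 * (1 + |(a:ℝ)| + |(b:ℝ)|) * B ^ 2 * (HR ^ 2 * HP ^ 2) := by
  have ha := h.int a
  have hb := h.int b
  have ha0 := abs_nonneg (a:ℝ)
  have hb0 := abs_nonneg (b:ℝ)
  generalize |(a:ℝ)| = α at *
  generalize |(b:ℝ)| = β at *
  have hHP2 : 1 ≤ HP ^ 2 := one_le_pow₀ hHP
  have e1 : HR ^ 2 ≤ HR ^ 2 * HP ^ 2 := le_mul_of_one_le_right (by positivity) hHP2
  have e2 : B ≤ B ^ 2 := by nlinarith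
  constructor
  · rw [gRX]
    refine (h.add' (h.add' (h.mul' (h.add' (h.mul' hXR hW) (h.mul' hU hZR)) (h.add' (h.mul' hXR hU)
      (h.mul' (h.mul' hb hZR) hW))) (h.mul' (h.mul' (h.mul' (h.mul' (h.num 2) ha) hXR) hZR) hU |> fun q => h.mul' q hW))
      (h.mul' (h.mul' (h.num 2) hg) hK)).trans ?_
    calc _ = (2 + 2 * β + 2 * α) * B ^ 2 * HR ^ 2 + 2 * (1 + α + β) * (HR ^ 2 * HP ^ 2) * B := by ring
      _ ≤ (2 + 2 * β + 2 * α) * B ^ 2 * (HR ^ 2 * HP ^ 2) + 2 * (1 + α + β) * (HR ^ 2 * HP ^ 2) * B ^ 2 := by gcongr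
      _ = _ := by ring
  · rw [gRZ]
    refine (h.pow' (h.sub' (h.mul' hXR hW) (h.mul' hU hZR)) 2).trans ?_
    calc _ = 4 * 1 * B ^ 2 * HR ^ 2 := by ring
      _ ≤ 4 * (1 + α + β) * B ^ 2 * (HR ^ 2 * HP ^ 2) := by gcongr; linarith
end gnorm

end

section

set_option linter.unusedSectionVars false

lemma rat_sq_int {x : ℚ} {n : ℤ} (h : x ^ 2 = n) : ∃ m : ℤ, x = m := by
  have h1 : IsSquare ((n : ℤ) : ℚ) := ⟨x, by rw [← h]; ring⟩
  rw [Rat.isSquare_intCast_iff] at h1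
  obtain ⟨m, rfl⟩ := h1
  have : (x - m) * (x + m) = 0 := by push_cast at h; linear_combination h
  rcases mul_eq_zero.mp this with h | h
  · exact ⟨m, by linear_combination h⟩
  · exact ⟨-m, by push_cast; linear_combination h⟩

lemma iXZ_one {S : Type*} [CommRing S] (a b : ℤ) (s : ℕ) : iX a b (1:S) 0 s = 1 ∧ iZ a b (1:S) 0 s = 0 := by
  induction s with
  | zero => simp
  | succ n ih => rw [iX_succ, iZ_succ, ih.1, ih.2]; simp [dX, dZ]

lemma gV_zero {S : Type*} [CommRing S] (a b : ℤ) (s : ℕ) (X Z f θ : S) :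
    gVX a b s X Z f θ 0 0 = 1 ∧ gVZ a b s X Z f θ 0 0 = 0 ∧ gVK a b s X Z f θ 0 0 = 0 := by
  have h1 : gn a b X Z f θ 0 0 = 0 := by simp [gn]
  have h2 : gZu Z f θ 0 = 0 := by simp [gZu]
  refine ⟨?_, ?_, ?_⟩
  · rw [gVX, h1, h2, add_zero, (iXZ_one a b s).1]
  · rw [gVZ, h1, h2, add_zero, (iXZ_one a b s).2]
  · rw [gVK]; simp [gξ]

lemma abs_fh_le (a b : ℤ) {X Z : ℤ} {H : ℝ} (hX : |(X:ℝ)| ≤ H) (hZ : |(Z:ℝ)| ≤ H) :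
    |((fh a b X Z : ℤ) : ℝ)| ≤ (1 + |(a:ℝ)| + |(b:ℝ)|) * H ^ 4 := by
  have hH : 0 ≤ H := (abs_nonneg _).trans hX
  rw [fh]; push_cast
  rw [abs_mul, abs_mul]
  have h1 : |(X:ℝ) ^ 2 + a * X * Z + b * Z ^ 2| ≤ H ^ 2 + |(a:ℝ)| * H * H + |(b:ℝ)| * H ^ 2 := by
    refine (abs_add_le _ _).trans (add_le_add ((abs_add_le _ _).trans (add_le_add ?_ ?_)) ?_)
    · rw [abs_pow]; gcongr
    · rw [abs_mul, abs_mul]; gcongr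
    · rw [abs_mul, abs_pow]; gcongr
  calc _ ≤ H * H * (H ^ 2 + |(a:ℝ)| * H * H + |(b:ℝ)| * H ^ 2) := by gcongr
    _ = _ := by ring

section
open PowerSeries
variable {a b d : ℤ} (hN : ND a b d)
include hN

lemma cross_Z (s : ℕ) {P Q R : (EK a b d ℚ).Point} {XP ZP XQ ZQ XR ZR g gR : ℤ} {ηP ηQ ηR : ℚ}
    (hP : QRep P (XP:ℚ) ηP ZP) (hQ : QRep Q (XQ:ℚ) ηQ ZQ) (hR : QRep R (XR:ℚ) ηR ZR)
    (hPQR : R = Q - (2 ^ s : ℕ) • P) (hZP : ZP ≠ 0) {f θ : ℤ} {t : PowerSeries ℤ}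
    (hf : f = fh a b XP ZP) (hf0 : f ≠ 0)
    (hθ : θ ≠ 0) (hg : d * ηQ * ηP = g) (hgR : d * ηR * ηP = gR)
    (ht : t + t ^ 2 = gh a b (XP : PowerSeries ℤ) ZP f θ X) :
    ((hU a b s (gX1 (XP : PowerSeries ℤ) ZP f θ X) ZP XQ ZQ
          + hV a b s (gX1 (XP : PowerSeries ℤ) ZP f θ X) ZP * (g * (1 + 2 * t)))
        * gRZ (XR : PowerSeries ℤ) ZR (gVX a b s (XP : PowerSeries ℤ) ZP f θ X t) (gVZ a b s (XP : PowerSeries ℤ) ZP f θ X t) =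
      hZ a b s (gX1 (XP : PowerSeries ℤ) ZP f θ X) ZP XQ ZQ *
        gRX a b (XR : PowerSeries ℤ) ZR gR (gVX a b s (XP : PowerSeries ℤ) ZP f θ X t)
        (gVZ a b s (XP : PowerSeries ℤ) ZP f θ X t) (gVK a b s (XP : PowerSeries ℤ) ZP f θ X t)) ∧
    (ZR = 0 →
      (hU a b s (gX1 (XP : PowerSeries ℤ) ZP f θ X) ZP XQ ZQ
          + hV a b s (gX1 (XP : PowerSeries ℤ) ZP f θ X) ZP * (g * (1 + 2 * t)))
        * gVZ a b s (XP : PowerSeries ℤ) ZP f θ X t =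
      hZ a b s (gX1 (XP : PowerSeries ℤ) ZP f θ X) ZP XQ ZQ * gVX a b s (XP : PowerSeries ℤ) ZP f θ X t) := by
  classical
  obtain ⟨K, i1, i2, ι, hι⟩ : ∃ (K : Type) (_ : Field K) (_ : CharZero K) (ι : PowerSeries ℤ →+* K),
      Function.Injective ι := by
    have : CharZero (PowerSeries ℤ) := charZero_of_injective_ringHom (f := (C : ℤ →+* PowerSeries ℤ)) C_injective
    exact ⟨FractionRing (PowerSeries ℤ), inferInstance,
      charZero_of_injective_ringHom (IsFractionRing.injective (PowerSeries ℤ) (FractionRing (PowerSeries ℤ))),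
      algebraMap _ _, IsFractionRing.injective _ _⟩
  obtain ⟨Φ, hΦ⟩ := exists_pmap a b d K
  have hP' := hΦ _ _ _ _ hP
  have hQ' := hΦ _ _ _ _ hQ
  have hR' := hΦ _ _ _ _ hR
  simp only [Rat.cast_intCast] at hP' hQ' hR'
  have hτ : ι X ≠ 0 := by
    rw [Ne, map_eq_zero_iff ι hι]; exact X_ne_zero
  have ht' : ι t + ι t ^ 2 = gh a b (XP : K) ZP f θ (ι X) := by
    rw [← map_pow, ← map_add, ht, map_gh]; simp
  have hg' : (d:K) * ηQ * ηP = g := by exact_mod_cast congrArg (Rat.cast : ℚ → K) hg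
  have hgR' : (d:K) * ηR * ηP = gR := by exact_mod_cast congrArg (Rat.cast : ℚ → K) hgR
  have key := cross_K hN s hP' hQ' hR' (by rw [hPQR, map_sub, map_nsmul]) (by exact_mod_cast hZP)
    (f := (f : K)) (θ := (θ:K)) (τ := ι X) (t := ι t)
    (by rw [hf]; have := map_fh a b XP ZP (Int.castRingHom K); simpa using this)
    (by exact_mod_cast hf0) (by exact_mod_cast hθ) hτ ht'
  rw [hg', hgR'] at key
  constructor
  · apply hι
    simp only [map_mul, map_add, map_hU, map_hV, map_hZ, map_gRX, map_gRZ, map_gVX, map_gVZ, map_gVK, map_gX1,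
      map_intCast, map_one, map_ofNat]
    exact key.1
  · intro h
    apply hι
    simp only [map_mul, map_add, map_hU, map_hV, map_hZ, map_gVX, map_gVZ, map_gX1,
      map_intCast, map_one, map_ofNat]
    exact key.2 (by exact_mod_cast h)

lemma local_exp : ∃ C : ℝ, 1 ≤ C ∧ ∀ (s : ℕ) {P Q R : (EK a b d ℚ).Point} {XP ZP XQ ZQ XR ZR : ℤ} {ηP ηQ ηR : ℚ}
    (_ : QRep P (XP:ℚ) ηP ZP) (_ : QRep Q (XQ:ℚ) ηQ ZQ) (_ : QRep R (XR:ℚ) ηR ZR)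
    (_ : R = Q - (2 ^ s : ℕ) • P) (_ : ZP ≠ 0) (_ : IsCoprime XR ZR) {f θ : ℤ}
    (_ : f = fh a b XP ZP) (_ : f ≠ 0) (_ : θ ≠ 0),
    ∃ σ U W : PowerSeries ℤ, ∃ μ : ℤ, μ ≠ 0 ∧ constantCoeff U = μ * XR ∧ constantCoeff W = μ * ZR ∧
      σ ^ 2 = hD a b (gX1 (XP : PowerSeries ℤ) ZP f θ X) ZP XQ ZQ ∧
      (hU a b s (gX1 (XP : PowerSeries ℤ) ZP f θ X) ZP XQ ZQ
          + hV a b s (gX1 (XP : PowerSeries ℤ) ZP f θ X) ZP * σ) * W =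
        hZ a b s (gX1 (XP : PowerSeries ℤ) ZP f θ X) ZP XQ ZQ * U ∧
      ∀ (Λ : ℝ) (κ : ℕ) (HP HR : ℝ), 1 ≤ HP → 1 ≤ HR → |(XP:ℝ)| ≤ HP → |(ZP:ℝ)| ≤ HP → |(XR:ℝ)| ≤ HR →
        |(ZR:ℝ)| ≤ HR → 100 * (1 + |(a:ℝ)| + |(b:ℝ)|) * HP ^ 4 * |(f:ℝ)| ^ 2 * |(θ:ℝ)| ^ 2 ≤ Λ →
        wnu Λ κ (gX1 (XP : PowerSeries ℤ) ZP f θ X) ≤ 2 * HP ∧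
        wnu Λ κ U ≤ C ^ (4 ^ s) * (HR ^ 2 * HP ^ 2) ∧ wnu Λ κ W ≤ C ^ (4 ^ s) * (HR ^ 2 * HP ^ 2) := by
  have hL := one_le_LL a b
  have hM : 1 ≤ 1 + |(a:ℝ)| + |(b:ℝ)| := by linarith [abs_nonneg (a:ℝ), abs_nonneg (b:ℝ)]
  refine ⟨4 * (1 + |(a:ℝ)| + |(b:ℝ)|) * (LL a b * 2) ^ 4, ?_, ?_⟩
  · have : 1 ≤ (LL a b * 2) ^ 4 := one_le_pow₀ (by linarith)
    nlinarith
  intro s P Q R XP ZP XQ ZQ XR ZR ηP ηQ ηR hP hQ hR hPQR hZP hco f θ hf hf0 hθ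
  have hfq : ∀ x z : ℤ, ((fh a b x z : ℤ) : ℚ) = fh a b (x:ℚ) z := fun x z => by
    have := map_fh a b x z (Int.castRingHom ℚ); simpa using this
  have eP : (d:ℚ) * ηP ^ 2 = ((fh a b XP ZP : ℤ) : ℚ) := by rw [hP.eq hN, hfq, fh]
  have eQ : (d:ℚ) * ηQ ^ 2 = ((fh a b XQ ZQ : ℤ) : ℚ) := by rw [hQ.eq hN, hfq, fh]
  have eR : (d:ℚ) * ηR ^ 2 = ((fh a b XR ZR : ℤ) : ℚ) := by rw [hR.eq hN, hfq, fh]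
  obtain ⟨g, hg⟩ : ∃ g : ℤ, (d:ℚ) * ηQ * ηP = g := by
    apply rat_sq_int (n := fh a b XQ ZQ * fh a b XP ZP)
    push_cast; rw [← eP, ← eQ]; ring
  obtain ⟨gR, hgR⟩ : ∃ g : ℤ, (d:ℚ) * ηR * ηP = g := by
    apply rat_sq_int (n := fh a b XR ZR * fh a b XP ZP)
    push_cast; rw [← eP, ← eR]; ring
  have hg2 : g ^ 2 = f * fh a b XQ ZQ := by
    have : (g:ℚ) ^ 2 = f * (fh a b XQ ZQ : ℤ) := by rw [hf, ← eP, ← eQ, ← hg]; ring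
    exact_mod_cast this
  have hgR2 : gR ^ 2 = fh a b XR ZR * fh a b XP ZP := by
    have : (gR:ℚ) ^ 2 = (fh a b XR ZR : ℤ) * (fh a b XP ZP : ℤ) := by rw [← eP, ← eR, ← hgR]; ring
    exact_mod_cast this
  have hh0 : constantCoeff (gh a b (XP : PowerSeries ℤ) ZP f θ X) = 0 := by
    rw [map_gh]; simp [gh]
  obtain ⟨t, ht0, ht, htn⟩ := exists_t _ hh0
  have cross := cross_Z hN s hP hQ hR hPQR hZP hf hf0 hθ hg hgR ht
  have hσ : ((g:PowerSeries ℤ) * (1 + 2 * t)) ^ 2 = hD a b (gX1 (XP : PowerSeries ℤ) ZP f θ X) ZP XQ ZQ := by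
    have h1 := fh_gX1 a b (XP : PowerSeries ℤ) ZP f θ X
      (by rw [hf]; have := map_fh a b XP ZP (Int.castRingHom (PowerSeries ℤ)); simpa using this)
    have h2 : ((fh a b XQ ZQ : ℤ) : PowerSeries ℤ) = fh a b (XQ:PowerSeries ℤ) ZQ := by
      have := map_fh a b XQ ZQ (Int.castRingHom (PowerSeries ℤ)); simpa using this
    have h3 : (g:PowerSeries ℤ) ^ 2 = f * fh a b (XQ:PowerSeries ℤ) ZQ := by
      rw [← h2]; exact_mod_cast congrArg (Int.cast : ℤ → PowerSeries ℤ) hg2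
    rw [hD, h1, ← ht]
    linear_combination (1 + 2 * t) ^ 2 * h3
  have hnorm : ∀ (Λ : ℝ) (κ : ℕ) (HP : ℝ), 1 ≤ HP → |(XP:ℝ)| ≤ HP → |(ZP:ℝ)| ≤ HP →
      100 * (1 + |(a:ℝ)| + |(b:ℝ)|) * HP ^ 4 * |(f:ℝ)| ^ 2 * |(θ:ℝ)| ^ 2 ≤ Λ → 0 < Λ ∧
      wnu Λ κ (gX1 (XP : PowerSeries ℤ) ZP f θ X) ≤ 2 * HP ∧
      wnu Λ κ (gVX a b s (XP : PowerSeries ℤ) ZP f θ X t) ≤ (LL a b * 2) ^ (2 * 4 ^ s) ∧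
      wnu Λ κ (gVZ a b s (XP : PowerSeries ℤ) ZP f θ X t) ≤ (LL a b * 2) ^ (2 * 4 ^ s) ∧
      wnu Λ κ (gVK a b s (XP : PowerSeries ℤ) ZP f θ X t) ≤ (LL a b * 2) ^ (2 * 4 ^ s) := by
    intro Λ κ HP hHP hXP hZP' hΛ
    have hf1 : 1 ≤ |(f:ℝ)| := by exact_mod_cast Int.one_le_abs hf0
    have hθ1 : 1 ≤ |(θ:ℝ)| := by exact_mod_cast Int.one_le_abs hθ
    have hΛ0 : 0 < Λ := lt_of_lt_of_le (by positivity) hΛ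
    have hν := isNu_wnu hΛ0 κ
    have hc : ∀ (n : ℤ) (B : ℝ), |(n:ℝ)| ≤ B → wnu Λ κ (n : PowerSeries ℤ) ≤ B := fun n B h => (hν.int n).trans h
    have hy : 100 * (1 + |(a:ℝ)| + |(b:ℝ)|) * HP ^ 4 * |(f:ℝ)| ^ 2 * |(θ:ℝ)| ^ 2 * Λ⁻¹ ≤ 1 := by
      rw [← div_eq_mul_inv, div_le_one hΛ0]; exact hΛ
    obtain ⟨n1, n2, n3⟩ := nu_g hν a b (t := t) hHP hf1 hθ1 (inv_nonneg.mpr hΛ0.le) (hc XP HP hXP) (hc ZP HP hZP')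
      (hc f _ le_rfl) (hc θ _ le_rfl) (wnu_X hΛ0 κ) hy
    obtain ⟨n4, n5, n6⟩ := n3 ((htn Λ κ hΛ0 (n2.trans (by norm_num))).trans (by linarith))
    obtain ⟨m1, m2, m3⟩ := nu_iter' hν a b (B := 2) (by norm_num) n4 (n5.trans (by norm_num)) s
    refine ⟨hΛ0, n1, m1, m2, ?_⟩
    rw [gVK]
    refine (hν.mul' n6 m3).trans (by rw [one_mul])
  have hcc : ∀ n : ℤ, constantCoeff (n : PowerSeries ℤ) = n := fun n => by simp
  have k1 : constantCoeff (gVX a b s (XP : PowerSeries ℤ) ZP f θ X t) = 1 := by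
    rw [map_gVX, ht0, constantCoeff_X]; exact (gV_zero a b s _ _ _ _).1
  have k2 : constantCoeff (gVZ a b s (XP : PowerSeries ℤ) ZP f θ X t) = 0 := by
    rw [map_gVZ, ht0, constantCoeff_X]; exact (gV_zero a b s _ _ _ _).2.1
  have k3 : constantCoeff (gVK a b s (XP : PowerSeries ℤ) ZP f θ X t) = 0 := by
    rw [map_gVK, ht0, constantCoeff_X]; exact (gV_zero a b s _ _ _ _).2.2
  have hBq : (1:ℝ) ≤ (LL a b * 2) ^ (2 * 4 ^ s) := one_le_pow₀ (by linarith)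
  have hCq : 4 * (1 + |(a:ℝ)| + |(b:ℝ)|) * ((LL a b * 2) ^ (2 * 4 ^ s)) ^ 2 ≤
      (4 * (1 + |(a:ℝ)| + |(b:ℝ)|) * (LL a b * 2) ^ 4) ^ (4 ^ s) := by
    rw [mul_pow _ ((LL a b * 2) ^ 4), ← pow_mul, ← pow_mul]
    have : 4 * (1 + |(a:ℝ)| + |(b:ℝ)|) ≤ (4 * (1 + |(a:ℝ)| + |(b:ℝ)|)) ^ (4 ^ s) := le_pow_q (by linarith) s
    have e : 2 * 4 ^ s * 2 = 4 * 4 ^ s := by ring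
    rw [e]
    gcongr
  by_cases hZR : ZR = 0
  · have hu : XR * XR = 1 := by
      rw [hZR, isCoprime_zero_right] at hco
      rcases Int.isUnit_iff.mp hco with h | h <;> simp [h]
    refine ⟨g * (1 + 2 * t), gVX a b s (XP : PowerSeries ℤ) ZP f θ X t, gVZ a b s (XP : PowerSeries ℤ) ZP f θ X t, XR,
      ?_, by rw [k1, hu], by rw [k2, hZR, mul_zero], hσ, cross.2 hZR, ?_⟩
    · rintro rfl; simp at hu
    · intro Λ κ HP HR hHP hHR hXP hZP' _ _ hΛ
      obtain ⟨_, n1, n2, n3, _⟩ := hnorm Λ κ HP hHP hXP hZP' hΛ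
      have : (LL a b * 2) ^ (2 * 4 ^ s) ≤ (4 * (1 + |(a:ℝ)| + |(b:ℝ)|) * (LL a b * 2) ^ 4) ^ (4 ^ s) * (HR ^ 2 * HP ^ 2) := by
        have h1 : 1 ≤ HR ^ 2 * HP ^ 2 := one_le_mul_of_one_le_of_one_le (one_le_pow₀ hHR) (one_le_pow₀ hHP)
        have h2 : (LL a b * 2) ^ (2 * 4 ^ s) ≤ 4 * (1 + |(a:ℝ)| + |(b:ℝ)|) * ((LL a b * 2) ^ (2 * 4 ^ s)) ^ 2 := by nlinarith
        refine h2.trans (hCq.trans (le_mul_of_one_le_right ?_ h1))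
        positivity
      exact ⟨n1, n2.trans this, n3.trans this⟩
  · refine ⟨g * (1 + 2 * t), gRX a b (XR : PowerSeries ℤ) ZR gR (gVX a b s (XP : PowerSeries ℤ) ZP f θ X t)
        (gVZ a b s (XP : PowerSeries ℤ) ZP f θ X t) (gVK a b s (XP : PowerSeries ℤ) ZP f θ X t),
        gRZ (XR : PowerSeries ℤ) ZR (gVX a b s (XP : PowerSeries ℤ) ZP f θ X t) (gVZ a b s (XP : PowerSeries ℤ) ZP f θ X t),
        ZR, hZR, ?_, ?_, hσ, cross.1, ?_⟩
    · rw [map_gRX, k1, k2, k3, hcc, hcc, hcc, gRX]; ring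
    · rw [map_gRZ, k1, k2, hcc, hcc, gRZ]; ring
    · intro Λ κ HP HR hHP hHR hXP hZP' hXR hZR' hΛ
      obtain ⟨hΛ0, n1, n2, n3, n4⟩ := hnorm Λ κ HP hHP hXP hZP' hΛ
      have hν := isNu_wnu hΛ0 κ
      have hgRle : |(gR:ℝ)| ≤ (1 + |(a:ℝ)| + |(b:ℝ)|) * (HR ^ 2 * HP ^ 2) := by
        apply abs_le_of_sq_le_sq' _ (by positivity) |> abs_le.mpr
        have h1 := abs_fh_le a b hXR hZR'
        have h2 := abs_fh_le a b hXP hZP'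
        have h3 : (gR:ℝ) ^ 2 = (fh a b XR ZR : ℤ) * (fh a b XP ZP : ℤ) := by exact_mod_cast hgR2
        rw [h3]
        refine (le_abs_self _).trans ?_
        rw [abs_mul]
        calc _ ≤ ((1 + |(a:ℝ)| + |(b:ℝ)|) * HR ^ 4) * ((1 + |(a:ℝ)| + |(b:ℝ)|) * HP ^ 4) := by gcongr
          _ = _ := by ring
      obtain ⟨r1, r2⟩ := nu_gR hν a b hHR hHP hBq ((hν.int XR).trans hXR) ((hν.int ZR).trans hZR')
        ((hν.int gR).trans hgRle) n2 n3 n4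
      exact ⟨n1, r1.trans (mul_le_mul_of_nonneg_right hCq (by positivity)),
        r2.trans (mul_le_mul_of_nonneg_right hCq (by positivity))⟩
end

end

section

set_option linter.unusedSectionVars false

section
variable {R : Type*} [CommRing R]

lemma Nmf_scale (G₀₀ G₁₀ G₀₁ G₁₁ F₀₀ F₁₀ F₀₁ F₁₁ D₁ D₂ u k : R) (h0 : G₀₀ = k * F₀₀) (h1 : u * G₁₀ = k * F₁₀)
    (h2 : u * G₀₁ = k * F₀₁) (h3 : u ^ 2 * G₁₁ = k * F₁₁) :
    Nmf G₀₀ G₁₀ G₀₁ G₁₁ (u ^ 2 * D₁) (u ^ 2 * D₂) = k ^ 4 * Nmf F₀₀ F₁₀ F₀₁ F₁₁ D₁ D₂ := by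
  have e1 : Nmf G₀₀ G₁₀ G₀₁ G₁₁ (u ^ 2 * D₁) (u ^ 2 * D₂) = Nmf G₀₀ (u * G₁₀) (u * G₀₁) (u ^ 2 * G₁₁) D₁ D₂ := by
    simp only [Nmf]; ring
  rw [e1, h0, h1, h2, h3]
  simp only [Nmf]; ring

lemma scale_Ng (a₁ b₁ a₂ b₂ : ℤ) (s m N : ℕ) (c : ℕ → ℕ → ℕ → ℤ) (X₁ Z₁ X₂ Z₂ z w : R) :
    Ng a₁ b₁ a₂ b₂ s m N c (z * X₁) (z * Z₁) (w * X₂) (w * Z₂) =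
      (z ^ (m - 1) * (z ^ (2 * 4 ^ s) * w ^ 2) ^ (N + N)) ^ 4 * Ng a₁ b₁ a₂ b₂ s m N c X₁ Z₁ X₂ Z₂ := by
  have hs := fun α β => scale_Fab a₁ b₁ a₂ b₂ s m N N c α β X₁ Z₁ X₂ Z₂ z w
  have h00 := hs 0 0
  have h10 := hs 1 0
  have h01 := hs 0 1
  have h11 := hs 1 1
  have d1 : hD a₁ b₁ (z * X₁) (z * Z₁) (w * X₂) (w * Z₂) = (z ^ 2 * w ^ 2) ^ 2 * hD a₁ b₁ X₁ Z₁ X₂ Z₂ := by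
    simp only [hD, fh]; ring
  have d2 : hD a₂ b₂ (z * X₁) (z * Z₁) (w * X₂) (w * Z₂) = (z ^ 2 * w ^ 2) ^ 2 * hD a₂ b₂ X₁ Z₁ X₂ Z₂ := by
    simp only [hD, fh]; ring
  rw [Ng, Ng, d1, d2]
  generalize Fab a₁ b₁ a₂ b₂ s m N N c 0 0 (z * X₁) (z * Z₁) (w * X₂) (w * Z₂) = G00 at *
  generalize Fab a₁ b₁ a₂ b₂ s m N N c 1 0 (z * X₁) (z * Z₁) (w * X₂) (w * Z₂) = G10 at *
  generalize Fab a₁ b₁ a₂ b₂ s m N N c 0 1 (z * X₁) (z * Z₁) (w * X₂) (w * Z₂) = G01 at *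
  generalize Fab a₁ b₁ a₂ b₂ s m N N c 1 1 (z * X₁) (z * Z₁) (w * X₂) (w * Z₂) = G11 at *
  apply Nmf_scale
  · simpa using h00
  · simpa using h10
  · simpa using h01
  · simpa using h11

lemma Fab_hom_zero {a₁ b₁ a₂ b₂ : ℤ} {s m N : ℕ} {c : ℕ → ℕ → ℕ → ℤ} {e : ℤ} {α β : Fin 2}
    (h : Fab a₁ b₁ a₂ b₂ s m N N c α β (Polynomial.X : Polynomial ℤ) 1 (e : Polynomial ℤ) 1 = 0) (X Z w : R) :
    Fab a₁ b₁ a₂ b₂ s m N N c α β X Z (e * w) w = 0 := by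
  have h1 : ∀ {S : Type} [CommRing S] (t : S), Fab a₁ b₁ a₂ b₂ s m N N c α β t 1 (e : S) 1 = 0 := by
    intro S _ t
    have := congrArg (Polynomial.eval₂RingHom (Int.castRingHom S) t) h
    rw [map_Fab] at this
    simpa using this
  have h2 : Fab a₁ b₁ a₂ b₂ s m N N c α β (MvPolynomial.X 0 : MvPolynomial (Fin 3) ℤ) (MvPolynomial.X 1)
      ((e : MvPolynomial (Fin 3) ℤ) * MvPolynomial.X 2) (MvPolynomial.X 2) = 0 := by
    apply IsFractionRing.injective (MvPolynomial (Fin 3) ℤ) (FractionRing (MvPolynomial (Fin 3) ℤ))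
    rw [map_Fab, map_zero, map_mul, map_intCast]
    set z := algebraMap (MvPolynomial (Fin 3) ℤ) (FractionRing (MvPolynomial (Fin 3) ℤ)) (MvPolynomial.X 1) with hz
    set w := algebraMap (MvPolynomial (Fin 3) ℤ) (FractionRing (MvPolynomial (Fin 3) ℤ)) (MvPolynomial.X 2) with hw
    set x := algebraMap (MvPolynomial (Fin 3) ℤ) (FractionRing (MvPolynomial (Fin 3) ℤ)) (MvPolynomial.X 0) with hx
    have hz0 : z ≠ 0 := by
      rw [hz]; intro hh
      exact MvPolynomial.X_ne_zero (R := ℤ) (1 : Fin 3) ((map_eq_zero_iff _ (IsFractionRing.injective _ _)).1 hh)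
    have hw0 : w ≠ 0 := by
      rw [hw]; intro hh
      exact MvPolynomial.X_ne_zero (R := ℤ) (2 : Fin 3) ((map_eq_zero_iff _ (IsFractionRing.injective _ _)).1 hh)
    have hs := scale_Fab a₁ b₁ a₂ b₂ s m N N c α β (x / z) 1 (e : FractionRing (MvPolynomial (Fin 3) ℤ)) 1 z w
    rw [h1, mul_zero, mul_div_cancel₀ _ hz0, mul_one, mul_one, mul_comm w] at hs
    rcases mul_eq_zero.1 hs with h | h
    · exact absurd h (by positivity)
    · exact h
  have := congrArg (MvPolynomial.eval₂Hom (Int.castRingHom R) ![X, Z, w]) h2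
  rw [map_Fab, map_mul, map_intCast] at this
  simpa using this

lemma Fab_dvd {a₁ b₁ a₂ b₂ : ℤ} {s m N : ℕ} {c : ℕ → ℕ → ℕ → ℤ} {e : ℤ} {α β : Fin 2}
    (h : Fab a₁ b₁ a₂ b₂ s m N N c α β (Polynomial.X : Polynomial ℤ) 1 (e : Polynomial ℤ) 1 = 0) (X Z V w : R) :
    V - e * w ∣ Fab a₁ b₁ a₂ b₂ s m N N c α β X Z V w := by
  rw [← Ideal.mem_span_singleton, ← Ideal.Quotient.eq_zero_iff_mem, map_Fab]
  have : Ideal.Quotient.mk (Ideal.span {V - e * w}) V = e * Ideal.Quotient.mk (Ideal.span {V - e * w}) w := by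
    rw [← sub_eq_zero, ← map_intCast (Ideal.Quotient.mk (Ideal.span {V - e * w})), ← map_mul, ← map_sub,
      Ideal.Quotient.eq_zero_iff_mem, Ideal.mem_span_singleton]
  rw [this]
  exact Fab_hom_zero h _ _ _

def cc2 (b : ℤ) (X₂ Z₂ Φ Ψ : R) : R := (X₂ * Φ - b * Z₂ * Ψ) ^ 2

lemma hU_quad (a b : ℤ) (s : ℕ) (X₁ Z₁ X₂ Z₂ σ : R) (hσ : σ ^ 2 = hD a b X₁ Z₁ X₂ Z₂) :
    (hU a b s X₁ Z₁ X₂ Z₂ + hV a b s X₁ Z₁ * σ) ^ 2 -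
      2 * hU a b s X₁ Z₁ X₂ Z₂ * (hU a b s X₁ Z₁ X₂ Z₂ + hV a b s X₁ Z₁ * σ) +
      hZ a b s X₁ Z₁ X₂ Z₂ * cc2 b X₂ Z₂ (iX a b X₁ Z₁ s) (iZ a b X₁ Z₁ s) = 0 := by
  have h1 := fh_iter a b X₁ Z₁ s
  rw [hD] at hσ
  simp only [hU, hV, hZ, cc2]
  generalize iX a b X₁ Z₁ s = Φ at *
  generalize iZ a b X₁ Z₁ s = Ψ at *
  generalize iK a b X₁ Z₁ s = k at *
  have h2 : (2 * k * σ) ^ 2 = 4 * (fh a b Φ Ψ * fh a b X₂ Z₂) := by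
    rw [h1]; linear_combination 4 * k ^ 2 * hσ
  simp only [fh] at h2
  linear_combination h2
end

section
open PowerSeries
lemma ratio_aux {x z U W : PowerSeries ℤ} {μ XR ZR : ℤ} (h : x * W = z * U) (hμ : μ ≠ 0)
    (hU : constantCoeff U = μ * XR) (hW : constantCoeff W = μ * ZR) (hco : IsCoprime XR ZR) :
    ∃ ℓ : PowerSeries ℚ, ∃ lam : ℤ, map (Int.castRingHom ℚ) x = ℓ * map (Int.castRingHom ℚ) U ∧
      map (Int.castRingHom ℚ) z = ℓ * map (Int.castRingHom ℚ) W ∧ constantCoeff ℓ * μ = lam ∧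
      constantCoeff x = lam * XR ∧ constantCoeff z = lam * ZR := by
  have hcm : ∀ y : PowerSeries ℤ, constantCoeff (map (Int.castRingHom ℚ) y) = ((constantCoeff y : ℤ) : ℚ) := by
    intro y; rw [← coeff_zero_eq_constantCoeff_apply, coeff_map, coeff_zero_eq_constantCoeff_apply]; rfl
  have h' : map (Int.castRingHom ℚ) x * map (Int.castRingHom ℚ) W = map (Int.castRingHom ℚ) z * map (Int.castRingHom ℚ) U := by
    rw [← map_mul, ← map_mul, h]
  have key : ∃ ℓ : PowerSeries ℚ, map (Int.castRingHom ℚ) x = ℓ * map (Int.castRingHom ℚ) U ∧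
      map (Int.castRingHom ℚ) z = ℓ * map (Int.castRingHom ℚ) W := by
    by_cases hX : XR = 0
    · have hZ : ZR ≠ 0 := by
        rintro rfl; rw [hX] at hco; exact not_isCoprime_zero_zero hco
      have hu : constantCoeff (map (Int.castRingHom ℚ) W) ≠ 0 := by
        rw [hcm, hW]; exact_mod_cast mul_ne_zero hμ hZ
      have h1 := PowerSeries.mul_inv_cancel _ hu
      refine ⟨map (Int.castRingHom ℚ) z * (map (Int.castRingHom ℚ) W)⁻¹, ?_, ?_⟩
      · linear_combination (map (Int.castRingHom ℚ) W)⁻¹ * h' - map (Int.castRingHom ℚ) x * h1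
      · linear_combination - map (Int.castRingHom ℚ) z * h1
    · have hu : constantCoeff (map (Int.castRingHom ℚ) U) ≠ 0 := by
        rw [hcm, hU]; exact_mod_cast mul_ne_zero hμ hX
      have h1 := PowerSeries.mul_inv_cancel _ hu
      refine ⟨map (Int.castRingHom ℚ) x * (map (Int.castRingHom ℚ) U)⁻¹, ?_, ?_⟩
      · linear_combination - map (Int.castRingHom ℚ) x * h1
      · linear_combination -(map (Int.castRingHom ℚ) U)⁻¹ * h' - map (Int.castRingHom ℚ) z * h1
  obtain ⟨ℓ, h1, h2⟩ := key
  obtain ⟨u, v, huv⟩ := hco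
  have c1 := congrArg constantCoeff h1
  have c2 := congrArg constantCoeff h2
  rw [map_mul, hcm, hcm, hU] at c1
  rw [map_mul, hcm, hcm, hW] at c2
  push_cast at c1 c2
  have huv' : (u:ℚ) * XR + v * ZR = 1 := by exact_mod_cast huv
  have hl : constantCoeff ℓ * μ = ((u * constantCoeff x + v * constantCoeff z : ℤ) : ℚ) := by
    push_cast
    linear_combination -(constantCoeff ℓ * μ) * huv' - u * c1 - v * c2
  refine ⟨ℓ, u * constantCoeff x + v * constantCoeff z, h1, h2, hl, ?_, ?_⟩
  · have : ((constantCoeff x : ℤ) : ℚ) = ((u * constantCoeff x + v * constantCoeff z : ℤ) : ℚ) * XR := by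
      rw [← hl, c1]; ring
    exact_mod_cast this
  · have : ((constantCoeff z : ℤ) : ℚ) = ((u * constantCoeff x + v * constantCoeff z : ℤ) : ℚ) * ZR := by
      rw [← hl, c2]; ring
    exact_mod_cast this

lemma ratio (a b : ℤ) (s : ℕ) {X1 σ U W : PowerSeries ℤ} {XP ZP XQ ZQ μ XR ZR : ℤ} (hX1 : constantCoeff X1 = XP)
    (hσ : σ ^ 2 = hD a b X1 (ZP : PowerSeries ℤ) XQ ZQ)
    (h : (hU a b s X1 (ZP : PowerSeries ℤ) XQ ZQ + hV a b s X1 (ZP : PowerSeries ℤ) * σ) * W =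
      hZ a b s X1 (ZP : PowerSeries ℤ) XQ ZQ * U) (hμ : μ ≠ 0)
    (hU' : constantCoeff U = μ * XR) (hW : constantCoeff W = μ * ZR) (hco : IsCoprime XR ZR) :
    ∃ ℓ : PowerSeries ℚ, ∃ lam : ℤ,
      map (Int.castRingHom ℚ) (hU a b s X1 (ZP : PowerSeries ℤ) XQ ZQ + hV a b s X1 (ZP : PowerSeries ℤ) * σ) =
        ℓ * map (Int.castRingHom ℚ) U ∧
      map (Int.castRingHom ℚ) (hZ a b s X1 (ZP : PowerSeries ℤ) XQ ZQ) = ℓ * map (Int.castRingHom ℚ) W ∧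
      constantCoeff ℓ * μ = lam ∧ hZ a b s XP ZP XQ ZQ = lam * ZR ∧
      (ℓ ≠ 0 → lam * XR ^ 2 - 2 * hU a b s XP ZP XQ ZQ * XR +
        cc2 b XQ ZQ (iX a b XP ZP s) (iZ a b XP ZP s) * ZR = 0) := by
  obtain ⟨ℓ, lam, h1, h2, h3, h4, h5⟩ := ratio_aux h hμ hU' hW hco
  have hcc : ∀ n : ℤ, constantCoeff (n : PowerSeries ℤ) = n := fun n => by simp
  refine ⟨ℓ, lam, h1, h2, h3, ?_, ?_⟩
  · rw [map_hZ] at h5; rw [← h5, hX1, hcc, hcc, hcc]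
  · intro hℓ
    have q := congrArg (map (Int.castRingHom ℚ)) (hU_quad a b s X1 (ZP : PowerSeries ℤ) XQ ZQ σ hσ)
    rw [map_zero, map_add, map_sub, map_pow, map_mul, map_mul, map_mul, h1, h2] at q
    set c := cc2 b (XQ : PowerSeries ℤ) ZQ (iX a b X1 (ZP : PowerSeries ℤ) s) (iZ a b X1 (ZP : PowerSeries ℤ) s) with hc
    set u := hU a b s X1 (ZP : PowerSeries ℤ) XQ ZQ with hu
    have q2 : ℓ * (ℓ * (map (Int.castRingHom ℚ) U) ^ 2 - map (Int.castRingHom ℚ) 2 * map (Int.castRingHom ℚ) u * map (Int.castRingHom ℚ) U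
        + map (Int.castRingHom ℚ) W * map (Int.castRingHom ℚ) c) = 0 := by
      rw [← q]; ring
    have q3 := congrArg constantCoeff ((mul_eq_zero.1 q2).resolve_left hℓ)
    have hcm : ∀ y : PowerSeries ℤ, constantCoeff (map (Int.castRingHom ℚ) y) = ((constantCoeff y : ℤ) : ℚ) := by
      intro y; rw [← coeff_zero_eq_constantCoeff_apply, coeff_map, coeff_zero_eq_constantCoeff_apply]; rfl
    have cu : constantCoeff u = hU a b s XP ZP XQ ZQ := by
      rw [hu, map_hU, hX1, hcc, hcc, hcc]
    have ccc : constantCoeff c = cc2 b XQ ZQ (iX a b XP ZP s) (iZ a b XP ZP s) := by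
      rw [hc, cc2, cc2]
      simp only [map_pow, map_sub, map_mul, map_iX, map_iZ, hX1, hcc]
      simp
    have c2' : constantCoeff (2 : PowerSeries ℤ) = 2 := hcc 2
    simp only [map_add, map_sub, map_mul, map_pow, hcm, hU', hW, cu, ccc, c2', map_zero] at q3
    push_cast at q3
    have hμ' : (μ:ℚ) ≠ 0 := by exact_mod_cast hμ
    have : (μ:ℚ) * ((lam * XR ^ 2 - 2 * hU a b s XP ZP XQ ZQ * XR +
        cc2 b XQ ZQ (iX a b XP ZP s) (iZ a b XP ZP s) * ZR : ℤ) : ℚ) = 0 := by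
      push_cast
      rw [← h3]
      linear_combination q3
    exact_mod_cast (mul_eq_zero.1 this).resolve_left hμ'
end

end

section

set_option linter.unusedSectionVars false

section
open Polynomial
lemma shift_dvd {G : ℚ[X]} {x θ : ℚ} (hθ : θ ≠ 0) :
    (G ≠ 0 → Polynomial.eval₂RingHom (PowerSeries.C (R := ℚ)) (PowerSeries.C x + PowerSeries.C θ * PowerSeries.X) G ≠ 0) ∧
    ∀ κ : ℕ, (PowerSeries.X : PowerSeries ℚ) ^ κ ∣
      Polynomial.eval₂RingHom (PowerSeries.C (R := ℚ)) (PowerSeries.C x + PowerSeries.C θ * PowerSeries.X) G → (X - C x) ^ κ ∣ G := by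
  have h1 : Polynomial.eval₂RingHom (PowerSeries.C (R := ℚ)) (PowerSeries.C x + PowerSeries.C θ * PowerSeries.X) G =
      ((G.comp (C x + C θ * X) : ℚ[X]) : PowerSeries ℚ) := by
    have : Polynomial.eval₂RingHom (PowerSeries.C (R := ℚ)) (PowerSeries.C x + PowerSeries.C θ * PowerSeries.X) =
        (Polynomial.coeToPowerSeries.ringHom).comp (Polynomial.compRingHom (C x + C θ * X)) := by
      apply Polynomial.ringHom_ext
      · intro a; simp
      · simp
    rw [this]; simp
  have h2 : (G.comp (C x + C θ * X)).comp (C θ⁻¹ * (X - C x)) = G := by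
    rw [comp_assoc]
    have : (C x + C θ * X).comp (C θ⁻¹ * (X - C x)) = X := by
      simp only [add_comp, C_comp, mul_comp, X_comp]
      rw [← mul_assoc, ← C_mul, mul_inv_cancel₀ hθ]; simp
    rw [this, comp_X]
  rw [h1]
  constructor
  · intro hG h
    apply hG
    have : G.comp (C x + C θ * X) = 0 := by exact_mod_cast h
    rw [← h2, this, zero_comp]
  · intro κ h
    have h3 : (X : ℚ[X]) ^ κ ∣ G.comp (C x + C θ * X) := by
      rw [X_pow_dvd_iff]
      rw [PowerSeries.X_pow_dvd_iff] at h
      intro d hd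
      have := h d hd
      rwa [coeff_coe] at this
    obtain ⟨g, hg⟩ := h3
    rw [← h2, hg, mul_comp, pow_comp, X_comp, mul_pow]
    refine Dvd.dvd.mul_right (Dvd.dvd.mul_left dvd_rfl _) _
end

section
open PowerSeries

def II (m N : ℕ) (c : ℕ → ℕ → ℕ → ℤ) {R : Type*} [CommRing R] (X1 Z1 U1 W1 U2 W2 : R) : R :=
  ∑ i ∈ Finset.range m, ∑ j ∈ Finset.range (N + 1), ∑ k ∈ Finset.range (N + 1),
    (c i j k : R) * (X1 ^ i * Z1 ^ (m - 1 - i)) * ((U1 ^ j * W1 ^ (N - j)) * (U2 ^ k * W2 ^ (N - k)))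

lemma map_II {R S : Type*} [CommRing R] [CommRing S] (φ : R →+* S) (m N : ℕ) (c : ℕ → ℕ → ℕ → ℤ) (X1 Z1 U1 W1 U2 W2 : R) :
    φ (II m N c X1 Z1 U1 W1 U2 W2) = II m N c (φ X1) (φ Z1) (φ U1) (φ W1) (φ U2) (φ W2) := by
  simp only [II, map_sum, map_mul, map_pow, map_intCast]

lemma II_scale {R : Type*} [CommRing R] (m N : ℕ) (c : ℕ → ℕ → ℕ → ℤ) (X1 Z1 U1 W1 U2 W2 u v : R) :
    II m N c X1 Z1 (u * U1) (u * W1) (v * U2) (v * W2) = u ^ N * v ^ N * II m N c X1 Z1 U1 W1 U2 W2 := by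
  simp only [II, Finset.mul_sum]
  refine Finset.sum_congr rfl fun i _ => Finset.sum_congr rfl fun j hj => Finset.sum_congr rfl fun k hk => ?_
  have hj' : j + (N - j) = N := by have := Finset.mem_range.1 hj; omega
  have hk' : k + (N - k) = N := by have := Finset.mem_range.1 hk; omega
  have e1 : u ^ N = u ^ j * u ^ (N - j) := by rw [← pow_add, hj']
  have e2 : v ^ N = v ^ k * v ^ (N - k) := by rw [← pow_add, hk']
  rw [e1, e2]; ring

lemma partG {a₁ b₁ a₂ b₂ : ℤ} {s m N : ℕ} {c : ℕ → ℕ → ℕ → ℤ} {e XP ZP XQ ZQ X₃ Z₃ X₄ Z₄ μ₁ μ₂ θ : ℤ} (hN0 : N ≠ 0)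
    (hθ : θ ≠ 0) (hZP : ZP ≠ 0) (hZQ : ZQ ≠ 0)
    (hF : ∀ α β, Fab a₁ b₁ a₂ b₂ s m N N c α β (Polynomial.X : Polynomial ℤ) 1 (e : Polynomial ℤ) 1 = 0)
    (hNg : Ng a₁ b₁ a₂ b₂ s m N c (Polynomial.X : Polynomial ℚ) 1 (Polynomial.C ((XQ:ℚ) / ZQ)) 1 ≠ 0)
    {X1 σ₁ U₁ W₁ σ₂ U₂ W₂ : PowerSeries ℤ} (hX1 : X1 = (XP : PowerSeries ℤ) + (ZP : PowerSeries ℤ) * ((θ : PowerSeries ℤ) * X))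
    (hσ₁ : σ₁ ^ 2 = hD a₁ b₁ X1 (ZP : PowerSeries ℤ) XQ ZQ)
    (h₁ : (hU a₁ b₁ s X1 (ZP : PowerSeries ℤ) XQ ZQ + hV a₁ b₁ s X1 (ZP : PowerSeries ℤ) * σ₁) * W₁ =
      hZ a₁ b₁ s X1 (ZP : PowerSeries ℤ) XQ ZQ * U₁) (hμ₁ : μ₁ ≠ 0)
    (hU₁ : constantCoeff U₁ = μ₁ * X₃) (hW₁ : constantCoeff W₁ = μ₁ * Z₃) (hco₁ : IsCoprime X₃ Z₃)
    (hσ₂ : σ₂ ^ 2 = hD a₂ b₂ X1 (ZP : PowerSeries ℤ) XQ ZQ)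
    (h₂ : (hU a₂ b₂ s X1 (ZP : PowerSeries ℤ) XQ ZQ + hV a₂ b₂ s X1 (ZP : PowerSeries ℤ) * σ₂) * W₂ =
      hZ a₂ b₂ s X1 (ZP : PowerSeries ℤ) XQ ZQ * U₂) (hμ₂ : μ₂ ≠ 0)
    (hU₂ : constantCoeff U₂ = μ₂ * X₄) (hW₂ : constantCoeff W₂ = μ₂ * Z₄) (hco₂ : IsCoprime X₄ Z₄) :
    ∃ κ : ℕ, ∃ l₁ l₂ : ℤ, (Polynomial.X - Polynomial.C ((XP:ℚ) / ZP)) ^ κ ∣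
        Ng a₁ b₁ a₂ b₂ s m N c (Polynomial.X : Polynomial ℚ) 1 (Polynomial.C ((XQ:ℚ) / ZQ)) 1 ∧
      coeff κ (II m N c X1 (ZP : PowerSeries ℤ) U₁ W₁ U₂ W₂) ≠ 0 ∧
      (XQ - e * ZQ) ∣ l₁ ^ N * l₂ ^ N * coeff κ (II m N c X1 (ZP : PowerSeries ℤ) U₁ W₁ U₂ W₂) ∧
      (hZ a₁ b₁ s XP ZP XQ ZQ = l₁ * Z₃ ∧ l₁ * X₃ ^ 2 - 2 * hU a₁ b₁ s XP ZP XQ ZQ * X₃ +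
        cc2 b₁ XQ ZQ (iX a₁ b₁ XP ZP s) (iZ a₁ b₁ XP ZP s) * Z₃ = 0) ∧
      (hZ a₂ b₂ s XP ZP XQ ZQ = l₂ * Z₄ ∧ l₂ * X₄ ^ 2 - 2 * hU a₂ b₂ s XP ZP XQ ZQ * X₄ +
        cc2 b₂ XQ ZQ (iX a₂ b₂ XP ZP s) (iZ a₂ b₂ XP ZP s) * Z₄ = 0) := by
  have hcc : ∀ n : ℤ, constantCoeff (n : PowerSeries ℤ) = n := fun n => by simp
  have hX1c : constantCoeff X1 = XP := by
    rw [hX1]; simp only [map_add, map_mul, hcc, constantCoeff_X]; ring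
  obtain ⟨ℓ₁, l₁, e1, e2, e3, e4, e5⟩ := ratio a₁ b₁ s hX1c hσ₁ h₁ hμ₁ hU₁ hW₁ hco₁
  obtain ⟨ℓ₂, l₂, g1, g2, g3, g4, g5⟩ := ratio a₂ b₂ s hX1c hσ₂ h₂ hμ₂ hU₂ hW₂ hco₂
  set I := II m N c X1 (ZP : PowerSeries ℤ) U₁ W₁ U₂ W₂ with hI
  set φ := map (Int.castRingHom ℚ) with hφ
  have hFd := fun α β => Fab_dvd (hF α β) X1 (ZP : PowerSeries ℤ) (XQ : PowerSeries ℤ) (ZQ : PowerSeries ℤ)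
  obtain ⟨𝓕, h𝓕⟩ : ∃ 𝓕, 𝓕 = II m N c X1 (ZP : PowerSeries ℤ) (hU a₁ b₁ s X1 (ZP : PowerSeries ℤ) XQ ZQ + hV a₁ b₁ s X1 (ZP : PowerSeries ℤ) * σ₁)
      (hZ a₁ b₁ s X1 (ZP : PowerSeries ℤ) XQ ZQ) (hU a₂ b₂ s X1 (ZP : PowerSeries ℤ) XQ ZQ + hV a₂ b₂ s X1 (ZP : PowerSeries ℤ) * σ₂)
      (hZ a₂ b₂ s X1 (ZP : PowerSeries ℤ) XQ ZQ) := ⟨_, rfl⟩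
  have hspec := Fab_spec a₁ b₁ a₂ b₂ s m N N c X1 (ZP : PowerSeries ℤ) XQ ZQ σ₁ σ₂ hσ₁ hσ₂
  have h𝓕2 : Fab a₁ b₁ a₂ b₂ s m N N c 0 0 X1 (ZP : PowerSeries ℤ) XQ ZQ + Fab a₁ b₁ a₂ b₂ s m N N c 1 0 X1 (ZP : PowerSeries ℤ) XQ ZQ * σ₁
      + Fab a₁ b₁ a₂ b₂ s m N N c 0 1 X1 (ZP : PowerSeries ℤ) XQ ZQ * σ₂
      + Fab a₁ b₁ a₂ b₂ s m N N c 1 1 X1 (ZP : PowerSeries ℤ) XQ ZQ * (σ₁ * σ₂) = 𝓕 := by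
    rw [hspec, h𝓕]; rfl
  have hdN : 𝓕 ∣ Ng a₁ b₁ a₂ b₂ s m N c X1 (ZP : PowerSeries ℤ) XQ ZQ := by
    rw [← h𝓕2, Ng]
    exact Nmf_dvd _ _ _ _ _ _ σ₁ σ₂ hσ₁ hσ₂
  have hYF : ((XQ - e * ZQ : ℤ) : PowerSeries ℤ) ∣ 𝓕 := by
    rw [← h𝓕2]
    push_cast
    exact dvd_add (dvd_add (dvd_add (hFd 0 0) ((hFd 1 0).mul_right _)) ((hFd 0 1).mul_right _)) ((hFd 1 1).mul_right _)
  have hφ𝓕 : φ 𝓕 = ℓ₁ ^ N * ℓ₂ ^ N * φ I := by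
    rw [h𝓕, map_II, e1, e2, g1, g2, II_scale, hI, map_II]
  clear_value I
  -- the norm
  have hZPq : (ZP:ℚ) ≠ 0 := by exact_mod_cast hZP
  have hZQq : (ZQ:ℚ) ≠ 0 := by exact_mod_cast hZQ
  have hθq : (θ:ℚ) ≠ 0 := by exact_mod_cast hθ
  set G := Ng a₁ b₁ a₂ b₂ s m N c (Polynomial.X : Polynomial ℚ) 1 (Polynomial.C ((XQ:ℚ) / ZQ)) 1 with hG
  obtain ⟨s1, s2⟩ := shift_dvd (G := G) (x := (XP:ℚ) / ZP) hθq
  set ψ := Polynomial.eval₂RingHom (PowerSeries.C (R := ℚ)) (PowerSeries.C ((XP:ℚ) / ZP) + PowerSeries.C (θ:ℚ) * PowerSeries.X) with hψ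
  have hφC : ∀ n : ℤ, φ (n : PowerSeries ℤ) = PowerSeries.C (n : ℚ) := by
    intro n; rw [map_intCast]; simp
  have hnorm : ∃ k : PowerSeries ℚ, IsUnit k ∧ φ (Ng a₁ b₁ a₂ b₂ s m N c X1 (ZP : PowerSeries ℤ) XQ ZQ) = k * ψ G := by
    rw [hG, map_Ng, map_Ng, hφC, hφC, hφC]
    have i1 : φ X1 = PowerSeries.C (ZP:ℚ) * ψ Polynomial.X := by
      rw [hX1, map_add, map_mul, map_mul, hφC, hφC, hφC, hψ, Polynomial.coe_eval₂RingHom, Polynomial.eval₂_X, hφ, PowerSeries.map_X,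
        mul_add, ← map_mul, mul_div_cancel₀ _ hZPq]
    have i2 : PowerSeries.C (ZP:ℚ) = PowerSeries.C (ZP:ℚ) * ψ 1 := by rw [map_one, mul_one]
    have i3 : PowerSeries.C (XQ:ℚ) = PowerSeries.C (ZQ:ℚ) * ψ (Polynomial.C ((XQ:ℚ) / ZQ)) := by
      rw [hψ, Polynomial.coe_eval₂RingHom, Polynomial.eval₂_C, ← map_mul, mul_div_cancel₀ _ hZQq]
    have i4 : PowerSeries.C (ZQ:ℚ) = PowerSeries.C (ZQ:ℚ) * ψ 1 := by rw [map_one, mul_one]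
    have uz : IsUnit (PowerSeries.C (ZP:ℚ)) := (IsUnit.mk0 _ hZPq).map _
    have uw : IsUnit (PowerSeries.C (ZQ:ℚ)) := (IsUnit.mk0 _ hZQq).map _
    have key := scale_Ng a₁ b₁ a₂ b₂ s m N c (ψ Polynomial.X) (ψ 1) (ψ (Polynomial.C ((XQ:ℚ) / ZQ))) (ψ 1)
      (PowerSeries.C (ZP:ℚ)) (PowerSeries.C (ZQ:ℚ))
    rw [← i1, ← i2, ← i3, ← i4] at key
    exact ⟨_, (((uz.pow _).mul (((uz.pow _).mul (uw.pow _)).pow _)).pow _), key⟩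
  obtain ⟨k, hk, hnorm⟩ := hnorm
  have hdψ : φ 𝓕 ∣ ψ G := by
    have := map_dvd φ hdN
    rw [hnorm] at this
    exact hk.dvd_mul_left.1 this
  have h𝓕0 : φ 𝓕 ≠ 0 := fun h => by
    rw [h, zero_dvd_iff] at hdψ; exact s1 hNg hdψ
  have hℓ₁ : ℓ₁ ≠ 0 := by
    rintro rfl; exact h𝓕0 (by rw [hφ𝓕]; simp [hN0])
  have hℓ₂ : ℓ₂ ≠ 0 := by
    rintro rfl; exact h𝓕0 (by rw [hφ𝓕]; simp [hN0])
  have hI0 : I ≠ 0 := by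
    rintro rfl; exact h𝓕0 (by rw [hφ𝓕]; simp)
  have hord : (I.order.toNat : ℕ∞) = I.order := ENat.natCast_toNat (by rwa [Ne, order_eq_top])
  set κ := I.order.toNat with hκ
  have hXI : (X : PowerSeries ℤ) ^ κ ∣ I := by
    rw [X_pow_dvd_iff]; intro d hd
    apply coeff_of_lt_order; rw [← hord]; exact_mod_cast hd
  refine ⟨κ, l₁, l₂, ?_, coeff_order hI0, ?_, ⟨e4, e5 hℓ₁⟩, ⟨g4, g5 hℓ₂⟩⟩
  · apply s2
    have : φ (X ^ κ) ∣ φ 𝓕 := by rw [hφ𝓕]; exact (map_dvd φ hXI).mul_left _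
    rw [map_pow, hφ, PowerSeries.map_X] at this
    exact this.trans hdψ
  · obtain ⟨g, hg⟩ := hYF
    have c1 : coeff κ 𝓕 = (XQ - e * ZQ) * coeff κ g := by
      rw [hg]
      have : ((XQ - e * ZQ : ℤ) : PowerSeries ℤ) = PowerSeries.C (XQ - e * ZQ) := by simp
      rw [this, coeff_C_mul]
    obtain ⟨J, hJ⟩ := hXI
    have c2 : coeff κ I = constantCoeff J := by
      rw [hJ]; have := coeff_X_pow_mul J κ 0
      rw [zero_add] at this; rw [this, coeff_zero_eq_constantCoeff_apply]
    have c3 : coeff κ (φ 𝓕) = constantCoeff ℓ₁ ^ N * constantCoeff ℓ₂ ^ N * ((coeff κ I : ℤ) : ℚ) := by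
      rw [hφ𝓕, c2, hJ, map_mul φ, map_pow φ, hφ, PowerSeries.map_X, ← mul_assoc, mul_comm (_ * _) (X ^ κ), mul_assoc]
      have := coeff_X_pow_mul (ℓ₁ ^ N * ℓ₂ ^ N * map (Int.castRingHom ℚ) J) κ 0
      rw [zero_add] at this
      rw [this, coeff_zero_eq_constantCoeff_apply, map_mul, map_mul, map_pow, map_pow]
      congr 1
    have c4 : coeff κ (φ 𝓕) = ((coeff κ 𝓕 : ℤ) : ℚ) := by rw [hφ, coeff_map]; rfl
    have c5 : (μ₁ ^ N * μ₂ ^ N * coeff κ 𝓕 : ℤ) = l₁ ^ N * l₂ ^ N * coeff κ I := by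
      have : ((μ₁ ^ N * μ₂ ^ N * coeff κ 𝓕 : ℤ) : ℚ) = ((l₁ ^ N * l₂ ^ N * coeff κ I : ℤ) : ℚ) := by
        push_cast
        rw [← c4, c3, ← e3, ← g3]; ring
      exact_mod_cast this
    rw [← c5, c1]
    exact ⟨μ₁ ^ N * μ₂ ^ N * coeff κ g, by ring⟩
end

end

section

set_option linter.unusedSectionVars false

lemma dvd_gcd_step {z l A : ℤ} (h : z ∣ l * A) : z ∣ (Int.gcd z l : ℤ) * A := by
  rw [Int.gcd_eq_gcd_ab, add_mul]
  refine dvd_add ⟨Int.gcdA z l * A, by ring⟩ ?_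
  obtain ⟨t, ht⟩ := h
  exact ⟨t * Int.gcdB z l, by linear_combination Int.gcdB z l * ht⟩

lemma dvd_gcd_pow {z l : ℤ} (N : ℕ) : ∀ {A : ℤ}, z ∣ l ^ N * A → z ∣ (Int.gcd z l : ℤ) ^ N * A := by
  induction N with
  | zero => intro A h; simpa using h
  | succ n ih =>
    intro A h
    have h1 : z ∣ l ^ n * (l * A) := by rw [← mul_assoc, ← pow_succ]; exact h
    have h2 := ih h1
    have h3 : z ∣ l * ((Int.gcd z l : ℤ) ^ n * A) := by
      rw [show l * ((Int.gcd z l : ℤ) ^ n * A) = (Int.gcd z l : ℤ) ^ n * (l * A) by ring]; exact h2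
    have h4 := dvd_gcd_step h3
    rw [pow_succ, mul_comm ((Int.gcd z l : ℤ) ^ n), mul_assoc]; exact h4

lemma dvd_of_two {g a b E : ℤ} (h1 : g ∣ a * E) (h2 : g ∣ b * E) : g ∣ (Int.gcd a b : ℤ) * E := by
  rw [Int.gcd_eq_gcd_ab, add_mul]
  obtain ⟨t, ht⟩ := h1
  obtain ⟨u, hu⟩ := h2
  exact ⟨t * Int.gcdA a b + u * Int.gcdB a b, by linear_combination Int.gcdA a b * ht + Int.gcdB a b * hu⟩

def EE (a b e XR ZR : ℤ) : ℤ := (e ^ 2 - b) ^ 2 * ZR - 4 * (e ^ 3 + a * e ^ 2 + b * e) * XR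

lemma gcd_dvd_E {a b e XP ZP XQ ZQ XR ZR l : ℤ} {s : ℕ} (hco : IsCoprime XQ ZQ)
    (h1 : hZ a b s XP ZP XQ ZQ = l * ZR)
    (h2 : l * XR ^ 2 - 2 * hU a b s XP ZP XQ ZQ * XR + cc2 b XQ ZQ (iX a b XP ZP s) (iZ a b XP ZP s) * ZR = 0) :
    (Int.gcd (XQ - e * ZQ) l : ℤ) ∣ (Int.gcd (iX a b XP ZP s) (iZ a b XP ZP s) : ℤ) ^ 4 * EE a b e XR ZR ^ 2 := by
  simp only [hZ, hU, cc2] at h1 h2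
  generalize iX a b XP ZP s = Φ at *
  generalize iZ a b XP ZP s = Ψ at *
  obtain ⟨y, hy⟩ : (Int.gcd (XQ - e * ZQ) l : ℤ) ∣ XQ - e * ZQ := Int.gcd_dvd_left _ _
  obtain ⟨l', hl⟩ : (Int.gcd (XQ - e * ZQ) l : ℤ) ∣ l := Int.gcd_dvd_right _ _
  set g : ℤ := (Int.gcd (XQ - e * ZQ) l : ℤ) with hg
  have hXQ : XQ = e * ZQ + g * y := by linear_combination hy
  have hcg : IsCoprime g ZQ := by
    obtain ⟨u, v, huv⟩ := hco
    exact ⟨u * y, v + u * e, by linear_combination huv - u * hXQ⟩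
  clear_value g
  have d1 : g ∣ (Φ - e * Ψ) ^ 2 := by
    have : g ∣ (Φ - e * Ψ) ^ 2 * ZQ ^ 2 := by
      refine ⟨l' * ZR - (y * Ψ) * (g * y * Ψ + 2 * ZQ * (e * Ψ - Φ)), ?_⟩
      rw [hXQ, hl] at h1
      linear_combination h1
    exact (hcg.pow_right (n := 2)).dvd_of_dvd_mul_right this
  have d2 : g ∣ Ψ ^ 2 * EE a b e XR ZR + (Φ - e * Ψ) *
      (((e * Φ - b * Ψ) + (e ^ 2 - b) * Ψ) * e * ZR - 2 * ((e * Ψ + Φ) * e + (e ^ 2 + b) * Ψ + 2 * a * e * Ψ) * XR) := by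
    have : g ∣ (Ψ ^ 2 * EE a b e XR ZR + (Φ - e * Ψ) *
      (((e * Φ - b * Ψ) + (e ^ 2 - b) * Ψ) * e * ZR - 2 * ((e * Ψ + Φ) * e + (e ^ 2 + b) * Ψ + 2 * a * e * Ψ) * XR)) * ZQ ^ 2 := by
      refine ⟨-l' * XR ^ 2 + 2 * XR * (y * Ψ * (e * ZQ * Φ + b * ZQ * Ψ + g * y * Φ) + (e * ZQ * Ψ + ZQ * Φ) * y * Φ + 2 * a * y * ZQ * Φ * Ψ)
         - ZR * (y * Φ) * (g * y * Φ + 2 * ZQ * (e * Φ - b * Ψ)), ?_⟩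
      rw [hXQ, hl] at h2
      simp only [EE]
      linear_combination h2
    exact (hcg.pow_right (n := 2)).dvd_of_dvd_mul_right this
  have d3 : g ∣ Ψ ^ 4 * EE a b e XR ZR ^ 2 := by
    obtain ⟨t, ht⟩ := d1
    obtain ⟨u, hu⟩ := d2
    generalize (((e * Φ - b * Ψ) + (e ^ 2 - b) * Ψ) * e * ZR - 2 * ((e * Ψ + Φ) * e + (e ^ 2 + b) * Ψ + 2 * a * e * Ψ) * XR) = k at *
    refine ⟨u * (Ψ ^ 2 * EE a b e XR ZR - (Φ - e * Ψ) * k) + t * k ^ 2, ?_⟩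
    linear_combination (Ψ ^ 2 * EE a b e XR ZR - (Φ - e * Ψ) * k) * hu + k ^ 2 * ht
  have d4 : g ∣ (Φ - e * Ψ) ^ 4 * EE a b e XR ZR ^ 2 := by
    refine Dvd.dvd.mul_right (d1.trans ⟨(Φ - e * Ψ) ^ 2, by ring⟩) _
  have d5 := dvd_of_two d4 d3
  have e1 : (Int.gcd ((Φ - e * Ψ) ^ 4) (Ψ ^ 4) : ℤ) = (Int.gcd Φ Ψ : ℤ) ^ 4 := by
    have : Int.gcd (Φ - e * Ψ) Ψ = Int.gcd Φ Ψ := by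
      apply Nat.dvd_antisymm
      · apply Int.dvd_gcd
        · have := dvd_add (Int.gcd_dvd_left (Φ - e * Ψ) Ψ) ((Int.gcd_dvd_right (Φ - e * Ψ) Ψ).mul_left e)
          simpa using this
        · exact Int.gcd_dvd_right _ _
      · apply Int.dvd_gcd
        · exact dvd_sub (Int.gcd_dvd_left _ _) ((Int.gcd_dvd_right _ _).mul_left e)
        · exact Int.gcd_dvd_right _ _
    rw [Int.pow_gcd_pow, this]; push_cast; rfl
  rwa [e1] at d5

lemma gcd_dbl {a b X Z : ℤ} (hco : IsCoprime X Z) {g : ℤ} (h1 : g ∣ dX b X Z) (h2 : g ∣ dZ a b X Z) :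
    g ∣ (4 * b * (a ^ 2 - 4 * b)) ^ 2 := by
  simp only [dX, dZ] at h1 h2
  obtain ⟨u, hu⟩ := h1
  obtain ⟨v, hv⟩ := h2
  set ρ := 4 * b * (a ^ 2 - 4 * b) with hρ
  have z1 : ρ * Z ^ 5 = 4 * Z * (X ^ 2 - b * Z ^ 2) * (2 * X ^ 2 + a * X * Z + (4 * b - a ^ 2) * Z ^ 2) -
      (4 * X * Z * (X ^ 2 + a * X * Z + b * Z ^ 2)) * (2 * X - a * Z) := by rw [hρ]; ring
  have z2 : ρ * X ^ 6 = b ^ 3 * Z * (ρ * Z ^ 5) + ρ * (X ^ 2 - b * Z ^ 2) * (3 * X ^ 4 - 3 * X ^ 2 * (X ^ 2 - b * Z ^ 2) + (X ^ 2 - b * Z ^ 2) ^ 2) := by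
    ring
  have hF : ∀ A B : ℤ, g ∣ ((X ^ 2 - b * Z ^ 2) * A + (4 * X * Z * (X ^ 2 + a * X * Z + b * Z ^ 2)) * B) ^ 2 := by
    intro A B
    refine ⟨u * A ^ 2 + v * (2 * (X ^ 2 - b * Z ^ 2) * A * B + (4 * X * Z * (X ^ 2 + a * X * Z + b * Z ^ 2)) * B ^ 2), ?_⟩
    linear_combination A ^ 2 * hu + (2 * (X ^ 2 - b * Z ^ 2) * A * B + (4 * X * Z * (X ^ 2 + a * X * Z + b * Z ^ 2)) * B ^ 2) * hv
  have k1 : g ∣ ρ ^ 2 * Z ^ 10 := by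
    have := hF (4 * Z * (2 * X ^ 2 + a * X * Z + (4 * b - a ^ 2) * Z ^ 2)) (-(2 * X - a * Z))
    have e : ρ ^ 2 * Z ^ 10 = (ρ * Z ^ 5) ^ 2 := by ring
    rw [e, z1]; convert this using 2; ring
  have k2 : g ∣ ρ ^ 2 * X ^ 12 := by
    have := hF (b ^ 3 * Z * (4 * Z * (2 * X ^ 2 + a * X * Z + (4 * b - a ^ 2) * Z ^ 2)) + ρ * (3 * X ^ 4 - 3 * X ^ 2 * (X ^ 2 - b * Z ^ 2) + (X ^ 2 - b * Z ^ 2) ^ 2))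
      (-(b ^ 3 * Z * (2 * X - a * Z)))
    have e : ρ ^ 2 * X ^ 12 = (ρ * X ^ 6) ^ 2 := by ring
    rw [e, z2, z1]; convert this using 2; ring
  obtain ⟨α, β, h⟩ := (hco.pow (m := 12) (n := 10))
  obtain ⟨t1, ht1⟩ := k1
  obtain ⟨t2, ht2⟩ := k2
  exact ⟨α * t2 + β * t1, by linear_combination -ρ ^ 2 * h + α * ht2 + β * ht1⟩

lemma gcd_iter (a b : ℤ) {XP ZP : ℤ} (hb : b ≠ 0) (hD : a ^ 2 - 4 * b ≠ 0) (hco : IsCoprime XP ZP) (s : ℕ) :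
    Int.gcd (iX a b XP ZP s) (iZ a b XP ZP s) ≠ 0 ∧
    (Int.gcd (iX a b XP ZP s) (iZ a b XP ZP s) : ℤ) * |4 * b * (a ^ 2 - 4 * b)| ≤ |4 * b * (a ^ 2 - 4 * b)| ^ (4 ^ s) := by
  have hρ : 4 * b * (a ^ 2 - 4 * b) ≠ 0 := mul_ne_zero (mul_ne_zero (by norm_num) hb) hD
  induction s with
  | zero => rw [iX_zero, iZ_zero, Int.isCoprime_iff_gcd_eq_one.1 hco]; simp
  | succ n ih =>
    rw [iX_succ, iZ_succ]
    generalize iX a b XP ZP n = X at *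
    generalize iZ a b XP ZP n = Z at *
    obtain ⟨h0, ih⟩ := ih
    set γ : ℕ := Int.gcd X Z with hγ
    obtain ⟨x, hx⟩ : (γ:ℤ) ∣ X := Int.gcd_dvd_left _ _
    obtain ⟨z, hz⟩ : (γ:ℤ) ∣ Z := Int.gcd_dvd_right _ _
    have hγ0 : (γ:ℤ) ≠ 0 := by exact_mod_cast h0
    have hxz : IsCoprime x z := by
      refine ⟨Int.gcdA X Z, Int.gcdB X Z, ?_⟩
      have := Int.gcd_eq_gcd_ab X Z
      apply mul_left_cancel₀ hγ0
      rw [← hγ] at this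
      linear_combination -this - Int.gcdA X Z * hx - Int.gcdB X Z * hz
    have e1 : dX ((b:ℤ):ℤ) X Z = (γ:ℤ) ^ 4 * dX b x z := by rw [hx, hz]; simp only [dX]; ring
    have e2 : dZ ((a:ℤ):ℤ) ((b:ℤ):ℤ) X Z = (γ:ℤ) ^ 4 * dZ a b x z := by rw [hx, hz]; simp only [dZ]; ring
    have e3 : Int.gcd (dX ((b:ℤ):ℤ) X Z) (dZ ((a:ℤ):ℤ) ((b:ℤ):ℤ) X Z) = γ ^ 4 * Int.gcd (dX b x z) (dZ a b x z) := by
      rw [e1, e2, Int.gcd_mul_left]; simp [Int.natAbs_pow]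
    have h3 := gcd_dbl (a := a) hxz (Int.gcd_dvd_left (dX b x z) (dZ a b x z)) (Int.gcd_dvd_right (dX b x z) (dZ a b x z))
    have h4 : (Int.gcd (dX b x z) (dZ a b x z) : ℤ) ≤ |4 * b * (a ^ 2 - 4 * b)| ^ 2 := by
      rw [sq_abs]
      exact Int.le_of_dvd (by positivity) h3
    have h5 : Int.gcd (dX b x z) (dZ a b x z) ≠ 0 := by
      intro h; rw [h] at h3
      exact pow_ne_zero 2 hρ (by simpa using h3)
    have h6 : Int.gcd (dX (Int.cast b : ℤ) X Z) (dZ (Int.cast a : ℤ) (Int.cast b : ℤ) X Z) = γ ^ 4 * Int.gcd (dX b x z) (dZ a b x z) := e3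
    rw [h6]
    refine ⟨mul_ne_zero (pow_ne_zero _ h0) h5, ?_⟩
    have hr1 : 1 ≤ |4 * b * (a ^ 2 - 4 * b)| := Int.one_le_abs hρ
    generalize |4 * b * (a ^ 2 - 4 * b)| = r at *
    push_cast
    calc (γ:ℤ) ^ 4 * (Int.gcd (dX b x z) (dZ a b x z) : ℤ) * r ≤ (γ:ℤ) ^ 4 * r ^ 2 * r := by gcongr
      _ = (γ:ℤ) ^ 4 * r ^ 3 := by ring
      _ ≤ (γ:ℤ) ^ 4 * r ^ 4 := by gcongr; omega
      _ = ((γ:ℤ) * r) ^ 4 := by ring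
      _ ≤ (r ^ 4 ^ n) ^ 4 := by gcongr
      _ = _ := by rw [← pow_mul, pow_succ]

open Polynomial in
lemma choose_e {f₁ f₂ : ℤ[X]} (h1 : f₁ ≠ 0) (h2 : f₂ ≠ 0) (d1 : f₁.natDegree ≤ 4) (d2 : f₂.natDegree ≤ 4) :
    ∃ e e' : ℤ, 0 ≤ e ∧ e ≤ 9 ∧ 0 ≤ e' ∧ e' ≤ 9 ∧ e ≠ e' ∧ f₁.eval e ≠ 0 ∧ f₂.eval e ≠ 0 ∧ f₁.eval e' ≠ 0 ∧ f₂.eval e' ≠ 0 := by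
  have h0 : f₁ * f₂ ≠ 0 := mul_ne_zero h1 h2
  have hc : (f₁ * f₂).roots.toFinset.card ≤ 8 :=
    (Multiset.toFinset_card_le _).trans ((card_roots' _).trans (natDegree_mul_le.trans (by omega)))
  have h3 : 1 < ((Finset.Icc (0:ℤ) 9) \ (f₁ * f₂).roots.toFinset).card := by
    have := Finset.le_card_sdiff (f₁ * f₂).roots.toFinset (Finset.Icc (0:ℤ) 9)
    have h9 : (Finset.Icc (0:ℤ) 9).card = 10 := by decide
    omega
  obtain ⟨e, e', he, he', hne⟩ := Finset.one_lt_card_iff.1 h3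
  have key : ∀ e ∈ ((Finset.Icc (0:ℤ) 9) \ (f₁ * f₂).roots.toFinset), 0 ≤ e ∧ e ≤ 9 ∧ f₁.eval e ≠ 0 ∧ f₂.eval e ≠ 0 := by
    intro e he
    rw [Finset.mem_sdiff, Finset.mem_Icc, Multiset.mem_toFinset, mem_roots h0, IsRoot, eval_mul] at he
    exact ⟨he.1.1, he.1.2, left_ne_zero_of_mul he.2, right_ne_zero_of_mul he.2⟩
  obtain ⟨a1, a2, a3, a4⟩ := key e he
  obtain ⟨c1, c2, c3, c4⟩ := key e' he'
  exact ⟨e, e', a1, a2, c1, c2, hne, a3, a4, c3, c4⟩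

open Polynomial in
noncomputable def EP (a b XR ZR : ℤ) : ℤ[X] := C ZR * X ^ 4 + C (-4 * XR) * X ^ 3 + C (-2 * b * ZR - 4 * a * XR) * X ^ 2 + C (-4 * b * XR) * X + C (b ^ 2 * ZR)

open Polynomial in
lemma EP_prop (a b XR ZR : ℤ) (hco : IsCoprime XR ZR) : EP a b XR ZR ≠ 0 ∧ (EP a b XR ZR).natDegree ≤ 4 ∧
    ∀ e, (EP a b XR ZR).eval e = EE a b e XR ZR := by
  refine ⟨?_, by unfold EP; compute_degree, fun e => by simp [EP, EE]; ring⟩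
  intro h
  have h4 : ZR = 0 := by
    have := congrArg (fun p => coeff p 4) h
    simp only [EP, coeff_add, coeff_C_mul, coeff_X_pow, coeff_X, coeff_C, coeff_zero] at this
    norm_num at this
    omega
  have h3 : XR = 0 := by
    have := congrArg (fun p => coeff p 3) h
    simp only [EP, coeff_add, coeff_C_mul, coeff_X_pow, coeff_X, coeff_C, coeff_zero] at this
    norm_num at this
    omega
  rw [h3, h4] at hco
  exact not_isCoprime_zero_zero hco

lemma choose_e' {a₁ b₁ a₂ b₂ X₃ Z₃ X₄ Z₄ XQ ZQ : ℤ} (hco₁ : IsCoprime X₃ Z₃) (hco₂ : IsCoprime X₄ Z₄) :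
    ∃ e : ℤ, |e| ≤ 9 ∧ EE a₁ b₁ e X₃ Z₃ ≠ 0 ∧ EE a₂ b₂ e X₄ Z₄ ≠ 0 ∧ max |XQ| |ZQ| ≤ 20 * |XQ - e * ZQ| := by
  obtain ⟨p1, p2, p3⟩ := EP_prop a₁ b₁ X₃ Z₃ hco₁
  obtain ⟨q1, q2, q3⟩ := EP_prop a₂ b₂ X₄ Z₄ hco₂
  obtain ⟨e, e', h1, h2, h3, h4, h5, h6, h7, h8, h9⟩ := choose_e p1 q1 p2 q2
  rw [p3] at h6 h8
  rw [q3] at h7 h9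
  by_cases h : max |XQ| |ZQ| ≤ 20 * |XQ - e * ZQ|
  · exact ⟨e, abs_le.2 ⟨by omega, h2⟩, h6, h7, h⟩
  · refine ⟨e', abs_le.2 ⟨by omega, h4⟩, h8, h9, ?_⟩
    by_contra h'
    push Not at h h'
    have k1 : |ZQ| ≤ |XQ - e * ZQ| + |XQ - e' * ZQ| := by
      have : |(e' - e) * ZQ| ≤ |XQ - e * ZQ| + |XQ - e' * ZQ| := by
        rw [show (e' - e) * ZQ = (XQ - e * ZQ) - (XQ - e' * ZQ) by ring]; exact abs_sub _ _
      rw [abs_mul] at this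
      have : 1 ≤ |e' - e| := Int.one_le_abs (sub_ne_zero.2 h5.symm)
      nlinarith [abs_nonneg ZQ]
    have k2 : |XQ| ≤ |XQ - e * ZQ| + 9 * |ZQ| := by
      have : |XQ| ≤ |XQ - e * ZQ| + |e * ZQ| := by
        have := abs_add_le (XQ - e * ZQ) (e * ZQ); simpa using this
      rw [abs_mul, abs_of_nonneg h1] at this
      nlinarith [abs_nonneg ZQ]
    have k3 := abs_nonneg ZQ
    have k4 := abs_nonneg XQ
    rcases le_total |XQ| |ZQ| with hh | hh
    · rw [max_eq_right hh] at h h'; omega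
    · rw [max_eq_left hh] at h h'; omega

end

section

set_option linter.unusedSectionVars false

lemma nu_II {R : Type*} [CommRing R] {ν : R → ℝ} (hν : IsNu ν) {m N : ℕ} {c : ℕ → ℕ → ℕ → ℤ} {X1 Z1 U1 W1 U2 W2 : R} {Kc B B1 B2 : ℝ}
    (hc : ∀ i j k, |(c i j k : ℝ)| ≤ Kc) (h1 : ν X1 ≤ B) (h2 : ν Z1 ≤ B) (h3 : ν U1 ≤ B1) (h4 : ν W1 ≤ B1)
    (h5 : ν U2 ≤ B2) (h6 : ν W2 ≤ B2) :
    ν (II m N c X1 Z1 U1 W1 U2 W2) ≤ m * ((N + 1) * ((N + 1) * (Kc * B ^ (m - 1) * (B1 ^ N * B2 ^ N)))) := by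
  rw [II]
  refine (hν.sum _ _).trans ((Finset.sum_le_card_nsmul _ _ ((N + 1) * ((N + 1) * (Kc * B ^ (m - 1) * (B1 ^ N * B2 ^ N)))) fun i hi => ?_).trans ?_)
  swap
  · rw [Finset.card_range, nsmul_eq_mul]
  refine (hν.sum _ _).trans ((Finset.sum_le_card_nsmul _ _ ((N + 1) * (Kc * B ^ (m - 1) * (B1 ^ N * B2 ^ N))) fun j hj => ?_).trans ?_)
  swap
  · rw [Finset.card_range, nsmul_eq_mul]; push_cast; exact le_rfl
  refine (hν.sum _ _).trans ((Finset.sum_le_card_nsmul _ _ (Kc * B ^ (m - 1) * (B1 ^ N * B2 ^ N)) fun k hk => ?_).trans ?_)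
  swap
  · rw [Finset.card_range, nsmul_eq_mul]; push_cast; exact le_rfl
  have hi' : i + (m - 1 - i) = m - 1 := by have := Finset.mem_range.1 hi; omega
  have hj' : j + (N - j) = N := by have := Finset.mem_range.1 hj; omega
  have hk' : k + (N - k) = N := by have := Finset.mem_range.1 hk; omega
  have e0 : B ^ (m - 1) = B ^ i * B ^ (m - 1 - i) := by rw [← pow_add, hi']
  have e1 : B1 ^ N = B1 ^ j * B1 ^ (N - j) := by rw [← pow_add, hj']
  have e2 : B2 ^ N = B2 ^ k * B2 ^ (N - k) := by rw [← pow_add, hk']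
  rw [e0, e1, e2]
  exact hν.mul' (hν.mul' ((hν.int _).trans (hc i j k)) (hν.mul' (hν.pow' h1 _) (hν.pow' h2 _)))
    (hν.mul' (hν.mul' (hν.pow' h3 _) (hν.pow' h4 _)) (hν.mul' (hν.pow' h5 _) (hν.pow' h6 _)))

lemma num_final {n ρ1 ρ2 e1 e2 k c1 c2 L0 Dr lN l20 q r1 r2 hP m m' hQ y g1 g2 E1 E2 j lm kap : ℝ}
    (hn : 0 ≤ n) (hρ1 : 0 ≤ ρ1) (hρ2 : 0 ≤ ρ2) (he1 : 0 ≤ e1) (he2 : 0 ≤ e2) (hk : 0 ≤ k) (hc1 : 0 ≤ c1) (hc2 : 0 ≤ c2)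
    (hL0 : 0 ≤ L0) (hDr : 0 ≤ Dr) (hlN : 0 ≤ lN) (hl : 0 ≤ l20) (hq : 1 ≤ q) (hr1 : 0 ≤ r1) (hr2 : 0 ≤ r2) (hhP : 0 ≤ hP)
    (hm : m' ≤ m) (hm' : m' ≤ q)
    (a1 : hQ ≤ l20 + y) (a2 : y ≤ n * (4 * g1 + 2 * E1) + n * (4 * g2 + 2 * E2) + j) (a3 : g1 ≤ q * ρ1) (a4 : g2 ≤ q * ρ2)
    (a5 : E1 ≤ e1 + r1) (a6 : E2 ≤ e2 + r2)
    (a7 : j ≤ lm + 2 * lN + q * k + m' * (1 + hP) + n * (q * c1 + 2 * r1 + 2 * hP) + n * (q * c2 + 2 * r2 + 2 * hP) + kap)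
    (a8 : lm ≤ q) (a9 : kap ≤ L0 * (Dr * hP + q * k)) :
    hQ ≤ m * hP + (l20 + 4 * n * (ρ1 + ρ2) + 2 * n * (e1 + e2) + 2 + 2 * lN + k + n * (c1 + c2) + L0 * k + 4 * n + L0 * Dr) *
      (q + r1 + r2 + hP) := by
  have b1 : n * (4 * g1 + 2 * E1) ≤ n * (4 * (q * ρ1) + 2 * (e1 + r1)) := by gcongr
  have b2 : n * (4 * g2 + 2 * E2) ≤ n * (4 * (q * ρ2) + 2 * (e2 + r2)) := by gcongr
  have b3 : m' * hP ≤ m * hP := by gcongr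
  have ne1 := mul_nonneg hn he1
  have ne2 := mul_nonneg hn he2
  have b4 : n * e1 ≤ n * e1 * q := le_mul_of_one_le_right ne1 hq
  have b5 : n * e2 ≤ n * e2 * q := le_mul_of_one_le_right ne2 hq
  have b6 : l20 ≤ l20 * q := le_mul_of_one_le_right hl hq
  have b7 : lN ≤ lN * q := le_mul_of_one_le_right hlN hq
  have p1 := mul_nonneg hn hρ1
  have p2 := mul_nonneg hn hρ2
  have p3 := mul_nonneg hn hc1
  have p4 := mul_nonneg hn hc2
  have p5 := mul_nonneg hL0 hk
  have p6 := mul_nonneg hL0 hDr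
  set A := l20 + 4 * n * (ρ1 + ρ2) + 2 * n * (e1 + e2) + 2 + 2 * lN + k + n * (c1 + c2) + L0 * k with hA
  have hA0 : 0 ≤ A := by rw [hA]; nlinarith
  have z1 : 0 ≤ A * (r1 + r2 + hP) := by positivity
  have z2 : 0 ≤ n * (q + hP) := by positivity
  have z2' : 0 ≤ n * q := by positivity
  have z3 : 0 ≤ L0 * Dr * (q + r1 + r2) := by positivity
  have z4 : A * q = l20 * q + 4 * (n * (q * ρ1)) + 4 * (n * (q * ρ2)) + 2 * (n * e1 * q) + 2 * (n * e2 * q) + 2 * q + 2 * (lN * q) + q * k +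
      n * (q * c1) + n * (q * c2) + L0 * (q * k) := by rw [hA]; ring
  have z5 : (A + 4 * n + L0 * Dr) * (q + r1 + r2 + hP) = A * q + A * (r1 + r2 + hP) + 4 * (n * q) + 4 * (n * r1) + 4 * (n * r2) + 4 * (n * hP)
    + L0 * Dr * (q + r1 + r2) + L0 * Dr * hP := by ring
  rw [z5, z4]
  linarith

lemma abs_EE_le (a b : ℤ) {e XR ZR : ℤ} {H : ℝ} (he : |e| ≤ 9) (hX : |(XR:ℝ)| ≤ H) (hZ : |(ZR:ℝ)| ≤ H) :
    |(EE a b e XR ZR : ℝ)| ≤ ((81 + |(b:ℝ)|) ^ 2 + 4 * (729 + |(a:ℝ)| * 81 + |(b:ℝ)| * 9)) * H := by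
  have he' : |(e:ℝ)| ≤ 9 := by exact_mod_cast he
  have hH : 0 ≤ H := (abs_nonneg _).trans hX
  have h1 : |(e:ℝ) ^ 2 - b| ≤ 81 + |(b:ℝ)| := by
    refine (abs_sub _ _).trans ?_
    rw [abs_pow]; have : |(e:ℝ)| ^ 2 ≤ 9 ^ 2 := by gcongr
    linarith
  have h2 : |(e:ℝ) ^ 3 + a * e ^ 2 + b * e| ≤ 729 + |(a:ℝ)| * 81 + |(b:ℝ)| * 9 := by
    refine (abs_add_le _ _).trans (add_le_add ((abs_add_le _ _).trans (add_le_add ?_ ?_)) ?_)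
    · rw [abs_pow]; calc |(e:ℝ)| ^ 3 ≤ 9 ^ 3 := by gcongr
        _ = _ := by norm_num
    · rw [abs_mul, abs_pow]; calc |(a:ℝ)| * |(e:ℝ)| ^ 2 ≤ |(a:ℝ)| * 9 ^ 2 := by gcongr
        _ = _ := by norm_num
    · rw [abs_mul]; gcongr
  rw [EE]; push_cast
  refine (abs_sub _ _).trans ?_
  rw [abs_mul, abs_mul, abs_mul, abs_pow, add_mul]
  have : |(4:ℝ)| = 4 := by norm_num
  rw [this]
  gcongr

lemma abs_le_Hq_sub (x : ℚ) (e : ℤ) : |((x.num - e * x.den : ℤ) : ℝ)| ≤ Hq (x - e) := by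
  have h1 : (x - e).num = x.num - e * x.den := by
    have h2 := Rat.mul_den_eq_num (x - e)
    rw [Rat.sub_intCast_den, sub_mul, Rat.mul_den_eq_num] at h2
    have : (((x - e).num : ℤ) : ℚ) = ((x.num - e * x.den : ℤ) : ℚ) := by rw [← h2]; push_cast; ring
    exact_mod_cast this
  rw [← h1]
  exact le_max_left _ _

lemma log_J_le {j m K C₁ C₂ H₃ H₄ H Λ : ℝ} {N n' s κ : ℕ} (hm : 0 < m) (hK : 1 ≤ K) (hC₁ : 1 ≤ C₁) (hC₂ : 1 ≤ C₂)
    (h3 : 1 ≤ H₃) (h4 : 1 ≤ H₄) (hH : 1 ≤ H) (hΛ : 1 ≤ Λ) (hj : 0 < j)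
    (hJ : j ≤ m * ((N + 1) * ((N + 1) * (K ^ (4 ^ s) * (2 * H) ^ n' * ((C₁ ^ 4 ^ s * (H₃ ^ 2 * H ^ 2)) ^ N * (C₂ ^ 4 ^ s * (H₄ ^ 2 * H ^ 2)) ^ N)))) * Λ ^ κ) :
    Real.log j ≤ Real.log m + 2 * Real.log (N + 1) + 4 ^ s * Real.log K + (n' : ℝ) * (1 + Real.log H) +
      N * (4 ^ s * Real.log C₁ + 2 * Real.log H₃ + 2 * Real.log H) + N * (4 ^ s * Real.log C₂ + 2 * Real.log H₄ + 2 * Real.log H) +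
      κ * Real.log Λ := by
  have h := Real.log_le_log hj hJ
  have z0 : 0 < H := by linarith
  have z1 : 0 < K := by linarith
  have z2 : 0 < C₁ := by linarith
  have z3 : 0 < C₂ := by linarith
  have z4 : 0 < H₃ := by linarith
  have z5 : 0 < H₄ := by linarith
  have z6 : 0 < Λ := by linarith
  have y1 : Real.log ((C₁ ^ 4 ^ s * (H₃ ^ 2 * H ^ 2)) ^ N) = N * (4 ^ s * Real.log C₁ + 2 * Real.log H₃ + 2 * Real.log H) := by
    rw [Real.log_pow, Real.log_mul (by positivity) (by positivity), Real.log_mul (by positivity) (by positivity), Real.log_pow, Real.log_pow, Real.log_pow]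
    push_cast; ring
  have y2 : Real.log ((C₂ ^ 4 ^ s * (H₄ ^ 2 * H ^ 2)) ^ N) = N * (4 ^ s * Real.log C₂ + 2 * Real.log H₄ + 2 * Real.log H) := by
    rw [Real.log_pow, Real.log_mul (by positivity) (by positivity), Real.log_mul (by positivity) (by positivity), Real.log_pow, Real.log_pow, Real.log_pow]
    push_cast; ring
  have y3 : Real.log ((2 * H) ^ n') ≤ (n' : ℝ) * (1 + Real.log H) := by
    rw [Real.log_pow, Real.log_mul (by norm_num) z0.ne']
    have : Real.log 2 ≤ 1 := by linarith [Real.log_two_lt_d9]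
    gcongr
  have y4 : Real.log (K ^ 4 ^ s) = 4 ^ s * Real.log K := by rw [Real.log_pow]; push_cast; rfl
  have y5 : Real.log (Λ ^ κ) = κ * Real.log Λ := Real.log_pow _ _
  have p1 : 0 < (C₁ ^ 4 ^ s * (H₃ ^ 2 * H ^ 2)) ^ N := by positivity
  have p2 : 0 < (C₂ ^ 4 ^ s * (H₄ ^ 2 * H ^ 2)) ^ N := by positivity
  have p3 : 0 < (2 * H) ^ n' := by positivity
  have p4 : 0 < K ^ 4 ^ s := by positivity
  have p5 : 0 < Λ ^ κ := by positivity
  have p6 : 0 < (N:ℝ) + 1 := by positivity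
  generalize (C₁ ^ 4 ^ s * (H₃ ^ 2 * H ^ 2)) ^ N = A₁ at *
  generalize (C₂ ^ 4 ^ s * (H₄ ^ 2 * H ^ 2)) ^ N = A₂ at *
  generalize (2 * H) ^ n' = A₃ at *
  generalize K ^ 4 ^ s = A₄ at *
  generalize Λ ^ κ = A₅ at *
  rw [Real.log_mul (by positivity) p5.ne', Real.log_mul hm.ne' (by positivity), Real.log_mul p6.ne' (by positivity), Real.log_mul p6.ne' (by positivity),
    Real.log_mul (by positivity) (by positivity), Real.log_mul p4.ne' p3.ne', Real.log_mul p1.ne' p2.ne', y1, y2, y4, y5] at h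
  linarith

open PowerSeries in
set_option maxHeartbeats 2000000 in
lemma vojta {p q r d₁ d₂ : ℤ} (hp : p ≠ 0) (hq : q ≠ 0) (hr : r ≠ 0) (hpq : p ≠ q) (hpr : p ≠ r) (hqr : q ≠ r)
    (hd₁ : d₁ ≠ 0) (hd₂ : d₂ ≠ 0) : ∃ C : ℝ, 1 ≤ C ∧ ∀ s : ℕ, 1 ≤ s → ∀ (x x' : ℚ)
      {P₁ Q₁ R₁ : (EK (-(p+q)) (p*q) d₁ ℚ).Point} {P₂ Q₂ R₂ : (EK (-(p+r)) (p*r) d₂ ℚ).Point} {η₁ η₁' η₂ η₂' η₃ η₄ : ℚ} {X₃ Z₃ X₄ Z₄ : ℤ},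
      QRep P₁ ((x.num : ℤ) : ℚ) η₁ (((x.den : ℕ) : ℤ) : ℚ) → QRep Q₁ ((x'.num : ℤ) : ℚ) η₁' (((x'.den : ℕ) : ℤ) : ℚ) →
      QRep P₂ ((x.num : ℤ) : ℚ) η₂ (((x.den : ℕ) : ℤ) : ℚ) → QRep Q₂ ((x'.num : ℤ) : ℚ) η₂' (((x'.den : ℕ) : ℤ) : ℚ) →
      QRep R₁ (X₃ : ℚ) η₃ (Z₃ : ℚ) → QRep R₂ (X₄ : ℚ) η₄ (Z₄ : ℚ) → IsCoprime X₃ Z₃ → IsCoprime X₄ Z₄ →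
      R₁ = Q₁ - (2 ^ s : ℕ) • P₁ → R₂ = Q₂ - (2 ^ s : ℕ) • P₂ →
      fh (-(p+q)) (p*q) x.num (x.den : ℤ) ≠ 0 → fh (-(p+r)) (p*r) x.num (x.den : ℤ) ≠ 0 → 1 ≤ Real.log (Hq x) →
      Real.log (Hq x') ≤ 4 ^ (s - 1) * Real.log (Hq x) + C * (4 ^ s + Real.log (max |(X₃:ℝ)| |(Z₃:ℝ)|) +
        Real.log (max |(X₄:ℝ)| |(Z₄:ℝ)|) + Real.log (Hq x)) := by
  have hN₁ := ND_of_roots hp hq hpq hd₁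
  have hN₂ := ND_of_roots hp hr hpr hd₂
  obtain ⟨N, hNN⟩ : ∃ N : ℕ, N = 255 := ⟨_, rfl⟩
  obtain ⟨K, hK, D, hF⟩ := part_F hp hq hr hpq hpr hqr N hNN
  obtain ⟨C₁, hC₁, hl₁⟩ := local_exp hN₁
  obtain ⟨C₂, hC₂, hl₂⟩ := local_exp hN₂
  have hb₁ : p * q ≠ 0 := mul_ne_zero hp hq
  have hb₂ : p * r ≠ 0 := mul_ne_zero hp hr
  have hD₁ : (-(p+q)) ^ 2 - 4 * (p * q) ≠ 0 := by
    rw [show (-(p+q)) ^ 2 - 4 * (p * q) = (p - q) ^ 2 by ring]; exact pow_ne_zero 2 (sub_ne_zero.2 hpq)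
  have hD₂ : (-(p+r)) ^ 2 - 4 * (p * r) ≠ 0 := by
    rw [show (-(p+r)) ^ 2 - 4 * (p * r) = (p - r) ^ 2 by ring]; exact pow_ne_zero 2 (sub_ne_zero.2 hpr)
  generalize -(p+q) = a₁ at *
  generalize p*q = b₁ at *
  generalize -(p+r) = a₂ at *
  generalize p*r = b₂ at *
  obtain ⟨M₁, hM₁⟩ : ∃ M : ℝ, M = 1 + |(a₁:ℝ)| + |(b₁:ℝ)| := ⟨_, rfl⟩
  obtain ⟨M₂, hM₂⟩ : ∃ M : ℝ, M = 1 + |(a₂:ℝ)| + |(b₂:ℝ)| := ⟨_, rfl⟩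
  have hM₁1 : 1 ≤ M₁ := by rw [hM₁]; linarith [abs_nonneg (a₁:ℝ), abs_nonneg (b₁:ℝ)]
  have hM₂1 : 1 ≤ M₂ := by rw [hM₂]; linarith [abs_nonneg (a₂:ℝ), abs_nonneg (b₂:ℝ)]
  obtain ⟨ρ₁, hρ₁⟩ : ∃ M : ℝ, M = ((|4 * b₁ * (a₁ ^ 2 - 4 * b₁)| : ℤ) : ℝ) := ⟨_, rfl⟩
  obtain ⟨ρ₂, hρ₂⟩ : ∃ M : ℝ, M = ((|4 * b₂ * (a₂ ^ 2 - 4 * b₂)| : ℤ) : ℝ) := ⟨_, rfl⟩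
  have hρ₁1 : 1 ≤ ρ₁ := by
    rw [hρ₁]; exact_mod_cast Int.one_le_abs (mul_ne_zero (mul_ne_zero (by norm_num) hb₁) hD₁)
  have hρ₂1 : 1 ≤ ρ₂ := by
    rw [hρ₂]; exact_mod_cast Int.one_le_abs (mul_ne_zero (mul_ne_zero (by norm_num) hb₂) hD₂)
  obtain ⟨e₁, he₁⟩ : ∃ M : ℝ, M = (81 + |(b₁:ℝ)|) ^ 2 + 4 * (729 + |(a₁:ℝ)| * 81 + |(b₁:ℝ)| * 9) := ⟨_, rfl⟩
  obtain ⟨e₂, he₂⟩ : ∃ M : ℝ, M = (81 + |(b₂:ℝ)|) ^ 2 + 4 * (729 + |(a₂:ℝ)| * 81 + |(b₂:ℝ)| * 9) := ⟨_, rfl⟩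
  have he₁1 : 1 ≤ e₁ := by rw [he₁]; nlinarith [abs_nonneg (a₁:ℝ), abs_nonneg (b₁:ℝ)]
  have he₂1 : 1 ≤ e₂ := by rw [he₂]; nlinarith [abs_nonneg (a₂:ℝ), abs_nonneg (b₂:ℝ)]
  have hC01 : 1 ≤ 100 * (M₁ * M₂) ^ 3 := by
    have : 1 ≤ (M₁ * M₂) ^ 3 := one_le_pow₀ (one_le_mul_of_one_le_of_one_le hM₁1 hM₂1)
    linarith
  have hN0 : (0:ℝ) ≤ N := Nat.cast_nonneg N
  have q1 := Real.log_nonneg hρ₁1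
  have q2 := Real.log_nonneg hρ₂1
  have q3 := Real.log_nonneg he₁1
  have q4 := Real.log_nonneg he₂1
  have q5 := Real.log_nonneg hK
  have q6 := Real.log_nonneg hC₁
  have q7 := Real.log_nonneg hC₂
  have q8 : 0 ≤ Real.log (100 * (M₁ * M₂) ^ 3) + 20 := by linarith [Real.log_nonneg hC01]
  have q9 : 0 ≤ Real.log (N + 1) := Real.log_nonneg (by linarith)
  have q10 : 0 ≤ Real.log 20 := Real.log_nonneg (by norm_num)
  have q11 : (0:ℝ) ≤ D := Nat.cast_nonneg D
  refine ⟨Real.log 20 + 4 * N * (Real.log ρ₁ + Real.log ρ₂) + 2 * N * (Real.log e₁ + Real.log e₂) + 2 + 2 * Real.log (N + 1) + Real.log K +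
    N * (Real.log C₁ + Real.log C₂) + (Real.log (100 * (M₁ * M₂) ^ 3) + 20) * Real.log K + 4 * N + (Real.log (100 * (M₁ * M₂) ^ 3) + 20) * D, ?_, ?_⟩
  · have : 0 ≤ 4 * N * (Real.log ρ₁ + Real.log ρ₂) := by positivity
    have : 0 ≤ 2 * N * (Real.log e₁ + Real.log e₂) := by positivity
    have : 0 ≤ N * (Real.log C₁ + Real.log C₂) := by positivity
    have : 0 ≤ (Real.log (100 * (M₁ * M₂) ^ 3) + 20) * Real.log K := by positivity
    have : 0 ≤ (Real.log (100 * (M₁ * M₂) ^ 3) + 20) * D := by positivity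
    linarith
  intro s hs x x' P₁ Q₁ R₁ P₂ Q₂ R₂ η₁ η₁' η₂ η₂' η₃ η₄ X₃ Z₃ X₄ Z₄ hP₁ hQ₁ hP₂ hQ₂ hR₁ hR₂ hco₁ hco₂ hPQ₁ hPQ₂ hf₁ hf₂ hhP
  have hcoP : IsCoprime x.num (x.den : ℤ) := Int.isCoprime_iff_gcd_eq_one.2 x.reduced
  have hcoQ : IsCoprime x'.num (x'.den : ℤ) := Int.isCoprime_iff_gcd_eq_one.2 x'.reduced
  have hZP : (x.den : ℤ) ≠ 0 := by exact_mod_cast x.den_ne_zero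
  have hZQ : (x'.den : ℤ) ≠ 0 := by exact_mod_cast x'.den_ne_zero
  have hxdiv : ((x.num : ℤ) : ℚ) / ((x.den : ℤ) : ℚ) = x := by push_cast; exact Rat.num_div_den x
  have hx'div : ((x'.num : ℤ) : ℚ) / ((x'.den : ℤ) : ℚ) = x' := by push_cast; exact Rat.num_div_den x'
  have hHP := one_le_Hq x
  have hHQ := one_le_Hq x'
  have hXP : |((x.num : ℤ) : ℝ)| ≤ Hq x := le_max_left _ _
  have hZPle : |(((x.den : ℕ) : ℤ) : ℝ)| ≤ Hq x := by
    have : |(((x.den : ℕ) : ℤ) : ℝ)| = (x.den : ℝ) := by push_cast; exact abs_of_nonneg (Nat.cast_nonneg _)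
    rw [this]; exact le_max_right _ _
  have hHR : ∀ X Z : ℤ, IsCoprime X Z → 1 ≤ max |(X:ℝ)| |(Z:ℝ)| := by
    intro X Z h
    by_cases hX : X = 0
    · have hZ : Z ≠ 0 := by rintro rfl; rw [hX] at h; exact not_isCoprime_zero_zero h
      exact le_max_of_le_right (by exact_mod_cast Int.one_le_abs hZ)
    · exact le_max_of_le_left (by exact_mod_cast Int.one_le_abs hX)
  have hR₁1 := hHR _ _ hco₁
  have hR₂1 := hHR _ _ hco₂
  have hX₃ : |(X₃:ℝ)| ≤ max |(X₃:ℝ)| |(Z₃:ℝ)| := le_max_left _ _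
  have hZ₃ : |(Z₃:ℝ)| ≤ max |(X₃:ℝ)| |(Z₃:ℝ)| := le_max_right _ _
  have hX₄ : |(X₄:ℝ)| ≤ max |(X₄:ℝ)| |(Z₄:ℝ)| := le_max_left _ _
  have hZ₄ : |(Z₄:ℝ)| ≤ max |(X₄:ℝ)| |(Z₄:ℝ)| := le_max_right _ _
  generalize max |(X₃:ℝ)| |(Z₃:ℝ)| = H₃ at *
  generalize max |(X₄:ℝ)| |(Z₄:ℝ)| = H₄ at *
  obtain ⟨e, he, hE₁, hE₂, hY⟩ := choose_e' (a₁ := a₁) (b₁ := b₁) (a₂ := a₂) (b₂ := b₂) (XQ := x'.num) (ZQ := (x'.den : ℤ)) hco₁ hco₂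
  have hYr : Hq x' ≤ 20 * |((x'.num - e * x'.den : ℤ) : ℝ)| := by
    have h1 : Hq x' = ((max |x'.num| |(x'.den : ℤ)| : ℤ) : ℝ) := by
      rw [Hq]; push_cast; rw [abs_of_nonneg (Nat.cast_nonneg (α := ℝ) x'.den)]
    rw [h1]; exact_mod_cast hY
  have hY0 : x'.num - e * x'.den ≠ 0 := by
    intro h; rw [h] at hYr; norm_num at hYr; linarith
  have hYpos : 0 < |((x'.num - e * x'.den : ℤ) : ℝ)| := abs_pos.2 (by exact_mod_cast hY0)
  have a1 : Real.log (Hq x') ≤ Real.log 20 + Real.log |((x'.num - e * x'.den : ℤ) : ℝ)| := by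
    rw [← Real.log_mul (by norm_num) hYpos.ne']
    exact Real.log_le_log (by linarith) hYr
  have hqr1 : (1:ℝ) ≤ 4 ^ s := one_le_pow₀ (by norm_num)
  obtain ⟨m, hm⟩ : ∃ m : ℕ, m = 4 ^ (s - 1) := ⟨_, rfl⟩
  have hmr : (4:ℝ) ^ (s - 1) = m := by rw [hm]; push_cast; rfl
  have hmq : (m:ℝ) ≤ 4 ^ s := by rw [← hmr]; exact pow_le_pow_right₀ (by norm_num) (by omega)
  have hm1 : 1 ≤ m := by rw [hm]; exact Nat.one_le_pow _ _ (by norm_num)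
  have hr3 := Real.log_nonneg hR₁1
  have hr4 := Real.log_nonneg hR₂1
  have hhQ := Real.log_nonneg hHQ
  obtain ⟨c, hc, hF0, hFx⟩ := hF e he s hs m hm
  rw [hmr]
  by_cases hbig : K ^ (4 ^ s) < Hq (x' - e)
  swap
  · have h1 : Real.log |((x'.num - e * x'.den : ℤ) : ℝ)| ≤ 4 ^ s * Real.log K := by
      have := Real.log_le_log hYpos ((abs_le_Hq_sub x' e).trans (not_lt.1 hbig))
      rw [Real.log_pow] at this; push_cast at this ⊢; exact this
    refine num_final (g1 := 0) (g2 := 0) (E1 := 0) (E2 := 0) (j := 4 ^ s * Real.log K) (lm := 0) (kap := 0) (m' := 0)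
      hN0 q1 q2 q3 q4 q5 q6 q7 q8 q11 q9 q10 hqr1 hr3 hr4 (by linarith) (Nat.cast_nonneg m) (by linarith) a1 (by linarith)
      (by positivity) (by positivity) (by positivity) (by positivity) ?_ (by positivity) (by positivity)
    have : 0 ≤ N * (4 ^ s * Real.log C₁ + 2 * Real.log H₃ + 2 * Real.log (Hq x)) := by positivity
    have : 0 ≤ N * (4 ^ s * Real.log C₂ + 2 * Real.log H₄ + 2 * Real.log (Hq x)) := by positivity
    linarith
  obtain ⟨hNg, hmult⟩ := hFx x' hbig
  obtain ⟨f₁, hf₁e⟩ : ∃ f, f = fh a₁ b₁ x.num (x.den : ℤ) := ⟨_, rfl⟩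
  obtain ⟨f₂, hf₂e⟩ : ∃ f, f = fh a₂ b₂ x.num (x.den : ℤ) := ⟨_, rfl⟩
  have hf₁' : f₁ ≠ 0 := by rw [hf₁e]; exact hf₁
  have hf₂' : f₂ ≠ 0 := by rw [hf₂e]; exact hf₂
  obtain ⟨σ₁, U₁, W₁, μ₁, hμ₁, u1, w1, s1, t1, n1⟩ := hl₁ s hP₁ hQ₁ hR₁ hPQ₁ hZP hco₁ hf₁e hf₁' hf₂'
  obtain ⟨σ₂, U₂, W₂, μ₂, hμ₂, u2, w2, s2, t2, n2⟩ := hl₂ s hP₂ hQ₂ hR₂ hPQ₂ hZP hco₂ hf₂e hf₂' hf₁'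
  have hgc : gX1 ((x.num : ℤ) : PowerSeries ℤ) ((x.den : ℤ) : PowerSeries ℤ) (f₂ : PowerSeries ℤ) (f₁ : PowerSeries ℤ) X =
      gX1 ((x.num : ℤ) : PowerSeries ℤ) ((x.den : ℤ) : PowerSeries ℤ) (f₁ : PowerSeries ℤ) (f₂ : PowerSeries ℤ) X := by
    simp only [gX1]; ring
  rw [hgc] at s2 t2 n2
  obtain ⟨X1, hX1⟩ : ∃ X1, X1 = gX1 ((x.num : ℤ) : PowerSeries ℤ) ((x.den : ℤ) : PowerSeries ℤ) (f₁ : PowerSeries ℤ) (f₂ : PowerSeries ℤ) X := ⟨_, rfl⟩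
  rw [← hX1] at s1 t1 n1 s2 t2 n2
  have hX1' : X1 = ((x.num : ℤ) : PowerSeries ℤ) + ((x.den : ℤ) : PowerSeries ℤ) * (((4 * f₁ * f₂ : ℤ) : PowerSeries ℤ) * X) := by
    rw [hX1, gX1]; push_cast; ring
  rw [← hx'div] at hNg
  obtain ⟨κ, l₁, l₂, v1, v2, v3, ⟨v4, v5⟩, ⟨v6, v7⟩⟩ := partG (by omega) (mul_ne_zero (mul_ne_zero (by norm_num) hf₁') hf₂') hZP hZQ hF0 hNg hX1'
    s1 t1 hμ₁ u1 w1 hco₁ s2 t2 hμ₂ u2 w2 hco₂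
  rw [hxdiv, hx'div] at v1
  have hκ := hmult x κ v1
  clear hNg hmult hFx hF0 v1 hX1' hgc s1 t1 s2 t2 hF
  have d1 := gcd_dvd_E (e := e) hcoQ v4 v5
  have d2 := gcd_dvd_E (e := e) hcoQ v6 v7
  obtain ⟨g1, g1'⟩ := gcd_iter a₁ b₁ hb₁ hD₁ hcoP s
  obtain ⟨g2, g2'⟩ := gcd_iter a₂ b₂ hb₂ hD₂ hcoP s
  generalize Int.gcd (iX a₁ b₁ x.num (x.den : ℤ) s) (iZ a₁ b₁ x.num (x.den : ℤ) s) = γ₁ at *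
  generalize Int.gcd (iX a₂ b₂ x.num (x.den : ℤ) s) (iZ a₂ b₂ x.num (x.den : ℤ) s) = γ₂ at *
  have hE₁b := abs_EE_le a₁ b₁ he hX₃ hZ₃
  have hE₂b := abs_EE_le a₂ b₂ he hX₄ hZ₄
  rw [← he₁] at hE₁b
  rw [← he₂] at hE₂b
  generalize EE a₁ b₁ e X₃ Z₃ = E₁ at *
  generalize EE a₂ b₂ e X₄ Z₄ = E₂ at *
  obtain ⟨Y, hYe⟩ : ∃ Y : ℤ, Y = x'.num - e * x'.den := ⟨_, rfl⟩
  rw [← hYe] at d1 d2 v3 hYpos hY0 a1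
  -- the norm of the coefficient
  obtain ⟨Λ, hΛ⟩ : ∃ Λ : ℝ, Λ = 100 * (M₁ * M₂) ^ 3 * Hq x ^ 20 := ⟨_, rfl⟩
  have hf₁b := abs_fh_le a₁ b₁ hXP hZPle
  have hf₂b := abs_fh_le a₂ b₂ hXP hZPle
  rw [← hf₁e, ← hM₁] at hf₁b
  rw [← hf₂e, ← hM₂] at hf₂b
  have hΛ1 : 1 ≤ Λ := by
    rw [hΛ]; exact one_le_mul_of_one_le_of_one_le hC01 (one_le_pow₀ hHP)
  have hprod : Hq x ^ 4 * |(f₁:ℝ)| ^ 2 * |(f₂:ℝ)| ^ 2 ≤ (M₁ * M₂) ^ 2 * Hq x ^ 20 := by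
    calc Hq x ^ 4 * |(f₁:ℝ)| ^ 2 * |(f₂:ℝ)| ^ 2 ≤ Hq x ^ 4 * (M₁ * Hq x ^ 4) ^ 2 * (M₂ * Hq x ^ 4) ^ 2 := by gcongr
      _ = _ := by ring
  have hΛ₁ : 100 * (1 + |(a₁:ℝ)| + |(b₁:ℝ)|) * Hq x ^ 4 * |(f₁:ℝ)| ^ 2 * |(f₂:ℝ)| ^ 2 ≤ Λ := by
    rw [← hM₁, hΛ]
    calc 100 * M₁ * Hq x ^ 4 * |(f₁:ℝ)| ^ 2 * |(f₂:ℝ)| ^ 2 = 100 * M₁ * (Hq x ^ 4 * |(f₁:ℝ)| ^ 2 * |(f₂:ℝ)| ^ 2) := by ring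
      _ ≤ 100 * M₁ * ((M₁ * M₂) ^ 2 * Hq x ^ 20) := by gcongr
      _ ≤ 100 * (M₁ * M₂) * ((M₁ * M₂) ^ 2 * Hq x ^ 20) := by
        gcongr; exact le_mul_of_one_le_right (by linarith) hM₂1
      _ = _ := by ring
  have hΛ₂ : 100 * (1 + |(a₂:ℝ)| + |(b₂:ℝ)|) * Hq x ^ 4 * |(f₂:ℝ)| ^ 2 * |(f₁:ℝ)| ^ 2 ≤ Λ := by
    rw [← hM₂, hΛ]
    calc 100 * M₂ * Hq x ^ 4 * |(f₂:ℝ)| ^ 2 * |(f₁:ℝ)| ^ 2 = 100 * M₂ * (Hq x ^ 4 * |(f₁:ℝ)| ^ 2 * |(f₂:ℝ)| ^ 2) := by ring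
      _ ≤ 100 * M₂ * ((M₁ * M₂) ^ 2 * Hq x ^ 20) := by gcongr
      _ ≤ 100 * (M₁ * M₂) * ((M₁ * M₂) ^ 2 * Hq x ^ 20) := by
        gcongr; exact le_mul_of_one_le_left (by linarith) hM₁1
      _ = _ := by ring
  obtain ⟨o1, o2, o3⟩ := n1 Λ κ (Hq x) H₃ hHP hR₁1 hXP hZPle hX₃ hZ₃ hΛ₁
  obtain ⟨_, o5, o6⟩ := n2 Λ κ (Hq x) H₄ hHP hR₂1 hXP hZPle hX₄ hZ₄ hΛ₂
  have hν := isNu_wnu (by linarith : 0 < Λ) κ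
  have hJ := (coeff_le_wnu (by linarith : 0 < Λ) κ (II m N c X1 ((x.den : ℤ) : PowerSeries ℤ) U₁ W₁ U₂ W₂)).trans
    (mul_le_mul_of_nonneg_right (nu_II hν hc o1 ((hν.int _).trans (hZPle.trans (by linarith))) o2 o3 o5 o6) (by positivity))
  generalize coeff κ (II m N c X1 ((x.den : ℤ) : PowerSeries ℤ) U₁ W₁ U₂ W₂) = J at *
  clear n1 n2 o1 o2 o3 o5 o6 hΛ₁ hΛ₂ hprod hν
  have hdvd : Y ∣ ((γ₁:ℤ) ^ 4 * E₁ ^ 2) ^ N * (((γ₂:ℤ) ^ 4 * E₂ ^ 2) ^ N * J) := by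
    have k1 : Y ∣ l₁ ^ N * (l₂ ^ N * J) := by rw [← mul_assoc]; exact v3
    have k2 := dvd_gcd_pow N k1
    have k3 : Y ∣ l₂ ^ N * ((Int.gcd Y l₁ : ℤ) ^ N * J) := by
      convert k2 using 1; ring
    have k4 := dvd_gcd_pow N k3
    refine k4.trans ?_
    have k5 := mul_dvd_mul (pow_dvd_pow_of_dvd d2 N) (mul_dvd_mul_right (pow_dvd_pow_of_dvd d1 N) J)
    refine k5.trans (dvd_of_eq ?_); ring
  have hγ₁ : 0 < (γ₁:ℝ) := by exact_mod_cast Nat.pos_of_ne_zero g1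
  have hγ₂ : 0 < (γ₂:ℝ) := by exact_mod_cast Nat.pos_of_ne_zero g2
  have hE₁p : 0 < |(E₁:ℝ)| := abs_pos.2 (by exact_mod_cast hE₁)
  have hE₂p : 0 < |(E₂:ℝ)| := abs_pos.2 (by exact_mod_cast hE₂)
  have hJp : 0 < |(J:ℝ)| := abs_pos.2 (by exact_mod_cast v2)
  have hγ₁b : Real.log γ₁ ≤ 4 ^ s * Real.log ρ₁ := by
    have h1 : (γ₁:ℝ) * ρ₁ ≤ ρ₁ ^ (4 ^ s) := by rw [hρ₁]; exact_mod_cast g1'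
    have h2 : (γ₁:ℝ) ≤ ρ₁ ^ (4 ^ s) := (le_mul_of_one_le_right hγ₁.le hρ₁1).trans h1
    have := Real.log_le_log hγ₁ h2
    rw [Real.log_pow] at this; push_cast at this; exact this
  have hγ₂b : Real.log γ₂ ≤ 4 ^ s * Real.log ρ₂ := by
    have h1 : (γ₂:ℝ) * ρ₂ ≤ ρ₂ ^ (4 ^ s) := by rw [hρ₂]; exact_mod_cast g2'
    have h2 : (γ₂:ℝ) ≤ ρ₂ ^ (4 ^ s) := (le_mul_of_one_le_right hγ₂.le hρ₂1).trans h1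
    have := Real.log_le_log hγ₂ h2
    rw [Real.log_pow] at this; push_cast at this; exact this
  have hE₁l : Real.log |(E₁:ℝ)| ≤ Real.log e₁ + Real.log H₃ := by
    rw [← Real.log_mul (by linarith) (by linarith)]; exact Real.log_le_log hE₁p hE₁b
  have hE₂l : Real.log |(E₂:ℝ)| ≤ Real.log e₂ + Real.log H₄ := by
    rw [← Real.log_mul (by linarith) (by linarith)]; exact Real.log_le_log hE₂p hE₂b
  have hYle : Real.log |(Y:ℝ)| ≤ N * (4 * Real.log γ₁ + 2 * Real.log |(E₁:ℝ)|) + N * (4 * Real.log γ₂ + 2 * Real.log |(E₂:ℝ)|) + Real.log |(J:ℝ)| := by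
    have hne : ((γ₁:ℤ) ^ 4 * E₁ ^ 2) ^ N * (((γ₂:ℤ) ^ 4 * E₂ ^ 2) ^ N * J) ≠ 0 := by
      have : (γ₁:ℤ) ≠ 0 := by exact_mod_cast g1
      have : (γ₂:ℤ) ≠ 0 := by exact_mod_cast g2
      positivity
    have h1 := Int.le_of_dvd (abs_pos.2 hne) ((abs_dvd_abs _ _).2 hdvd)
    have h2 : |(Y:ℝ)| ≤ ((γ₁:ℝ) ^ 4 * |(E₁:ℝ)| ^ 2) ^ N * (((γ₂:ℝ) ^ 4 * |(E₂:ℝ)| ^ 2) ^ N * |(J:ℝ)|) := by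
      rw [abs_mul, abs_mul, abs_pow, abs_pow, abs_mul, abs_mul, abs_pow, abs_pow, abs_pow, abs_pow, Nat.abs_cast, Nat.abs_cast] at h1
      exact_mod_cast h1
    have h3 := Real.log_le_log hYpos h2
    rw [Real.log_mul (by positivity) (by positivity), Real.log_mul (by positivity) (by positivity), Real.log_pow, Real.log_pow,
      Real.log_mul (by positivity) (by positivity), Real.log_mul (by positivity) (by positivity), Real.log_pow, Real.log_pow, Real.log_pow, Real.log_pow] at h3
    push_cast at h3
    linarith
  have hmpos : (0:ℝ) < m := by exact_mod_cast hm1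
  have hJl : Real.log |(J:ℝ)| ≤ Real.log m + 2 * Real.log (N + 1) + 4 ^ s * Real.log K + ((m - 1 : ℕ) : ℝ) * (1 + Real.log (Hq x)) +
      N * (4 ^ s * Real.log C₁ + 2 * Real.log H₃ + 2 * Real.log (Hq x)) + N * (4 ^ s * Real.log C₂ + 2 * Real.log H₄ + 2 * Real.log (Hq x)) +
      κ * Real.log Λ := by
    exact log_J_le hmpos (by linarith) (by linarith) (by linarith) hR₁1 hR₂1 hHP (by linarith) hJp hJ
  have hkap : κ * Real.log Λ ≤ (Real.log (100 * (M₁ * M₂) ^ 3) + 20) * (D * Real.log (Hq x) + 4 ^ s * Real.log K) := by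
    have h1 : ((κ - D : ℕ) : ℝ) * Real.log (Hq x) ≤ 4 ^ s * Real.log K := by
      have := Real.log_le_log (by positivity) hκ
      rw [Real.log_pow, Real.log_pow] at this
      push_cast at this ⊢; exact this
    have h2 : (κ:ℝ) ≤ D + ((κ - D : ℕ) : ℝ) := by
      have : κ ≤ D + (κ - D) := by omega
      exact_mod_cast this
    have h3 : κ * Real.log (Hq x) ≤ D * Real.log (Hq x) + 4 ^ s * Real.log K := by nlinarith
    have h4 : Real.log Λ = Real.log (100 * (M₁ * M₂) ^ 3) + 20 * Real.log (Hq x) := by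
      rw [hΛ, Real.log_mul (by positivity) (by positivity), Real.log_pow]; norm_num
    have h5 : Real.log Λ ≤ (Real.log (100 * (M₁ * M₂) ^ 3) + 20) * Real.log (Hq x) := by
      rw [h4]; nlinarith [Real.log_nonneg hC01]
    calc κ * Real.log Λ ≤ κ * ((Real.log (100 * (M₁ * M₂) ^ 3) + 20) * Real.log (Hq x)) := by gcongr
      _ = (Real.log (100 * (M₁ * M₂) ^ 3) + 20) * (κ * Real.log (Hq x)) := by ring
      _ ≤ _ := by gcongr
  have hm' : ((m - 1 : ℕ) : ℝ) ≤ m := by exact_mod_cast Nat.sub_le m 1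
  exact num_final hN0 q1 q2 q3 q4 q5 q6 q7 q8 q11 q9 q10 hqr1 hr3 hr4 (by linarith) hm' (hm'.trans hmq) a1 hYle hγ₁b hγ₂b hE₁l hE₂l hJl
    ((Real.log_le_sub_one_of_pos hmpos).trans (by linarith)) hkap

end

section

open WeierstrassCurve in
lemma logHq (x : ℚ) : Height.logHeight₁ x = Real.log (Hq x) := by
  rw [Rat.logHeight₁_eq_log_max, Hq]
  congr 1
  push_cast
  rw [Nat.cast_natAbs]; push_cast; rfl

lemma hgt_rep {a b d : ℤ} (hN : ND a b d) {P : (EK a b d ℚ).Point} {x η : ℚ}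
    (h : QRep P ((x.num : ℤ) : ℚ) η (((x.den : ℕ) : ℤ) : ℚ)) :
    |hgt P - Real.log (Hq x)| ≤ Height.logHeight₁ (d : ℚ) := by
  have hd : (d:ℚ) ≠ 0 := by exact_mod_cast hN.hd
  have hz : (((x.den : ℕ) : ℤ) : ℚ) ≠ 0 := by exact_mod_cast x.den_ne_zero
  rcases h with ⟨_, h, _⟩ | ⟨u, y, hh, rfl, _, h1, _⟩
  · exact absurd h hz
  · rw [hgt_some, ← logHq]
    have hx : x * (((x.den : ℕ) : ℤ) : ℚ) = ((x.num : ℤ) : ℚ) := by exact_mod_cast Rat.mul_den_eq_num x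
    have hu : u = d * x := mul_right_cancel₀ hz (by rw [h1, mul_assoc, hx])
    have e1 := Height.logHeight₁_mul_le (d:ℚ) x
    have e2 := Height.logHeight₁_mul_le (d:ℚ)⁻¹ (d * x)
    rw [inv_mul_cancel_left₀ hd, Height.logHeight₁_inv] at e2
    rw [hu, abs_le]; constructor <;> linarith

open WeierstrassCurve in
lemma rep_R {a b d : ℤ} (hN : ND a b d) (R : (EK a b d ℚ).Point) :
    ∃ (X Z : ℤ) (η : ℚ), QRep R (X : ℚ) η (Z : ℚ) ∧ IsCoprime X Z ∧
      Real.log (max |(X:ℝ)| |(Z:ℝ)|) ≤ hgt R + Height.logHeight₁ (d : ℚ) := by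
  have hd : (d:ℚ) ≠ 0 := by exact_mod_cast hN.hd
  rcases R with _ | ⟨u, y, h⟩
  · refine ⟨1, 0, 0, Or.inl ⟨rfl, by simp, rfl, by simp⟩, isCoprime_one_left, ?_⟩
    have := hgt_nonneg (0 : (EK a b d ℚ).Point)
    have h2 := Height.zero_le_logHeight₁ (d : ℚ)
    simp only [Int.cast_one, abs_one, Int.cast_zero, abs_zero, zero_le_one, max_eq_left, Real.log_one]
    exact add_nonneg this h2
  · obtain ⟨x, hx⟩ : ∃ x : ℚ, x = u / d := ⟨_, rfl⟩
    have hz : (((x.den : ℕ) : ℤ) : ℚ) ≠ 0 := by exact_mod_cast x.den_ne_zero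
    have hx' : x * (((x.den : ℕ) : ℤ) : ℚ) = ((x.num : ℤ) : ℚ) := by exact_mod_cast Rat.mul_den_eq_num x
    have hq : QRep (Affine.Point.some u y h) ((x.num : ℤ) : ℚ) (y * (((x.den : ℕ) : ℤ) : ℚ) ^ 2 / d ^ 2) (((x.den : ℕ) : ℤ) : ℚ) := by
      refine Or.inr ⟨u, y, h, rfl, hz, ?_, ?_⟩
      · rw [← hx', hx]; field_simp
      · field_simp
    refine ⟨x.num, x.den, _, hq, ?_, ?_⟩
    · exact Int.isCoprime_iff_gcd_eq_one.2 x.reduced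
    · have := (abs_le.1 (hgt_rep hN hq)).1
      have e : max |(x.num:ℝ)| |(((x.den : ℕ) : ℤ):ℝ)| = Hq x := by
        rw [Hq]; push_cast; rw [Nat.abs_cast]
      rw [e]; linarith

lemma rep_w {p q d : ℤ} (hN : ND (-(p+q)) (p*q) d) {w y : ℚ} (h : d * y ^ 2 = w * (w - p) * (w - q)) :
    ∃ (P : (EK (-(p+q)) (p*q) d ℚ).Point) (η : ℚ), QRep P ((w.num : ℤ) : ℚ) η (((w.den : ℕ) : ℤ) : ℚ) := by
  have hz : (((w.den : ℕ) : ℤ) : ℚ) ≠ 0 := by exact_mod_cast w.den_ne_zero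
  have hx' : w * (((w.den : ℕ) : ℤ) : ℚ) = ((w.num : ℤ) : ℚ) := by exact_mod_cast Rat.mul_den_eq_num w
  have : (d:ℚ) * (y * (((w.den : ℕ) : ℤ) : ℚ) ^ 2) ^ 2 = fh (-(p+q)) (p*q) ((w.num : ℤ) : ℚ) (((w.den : ℕ) : ℤ) : ℚ) := by
    rw [fh, ← hx']
    push_cast

    linear_combination (w.den : ℚ) ^ 4 * h
  obtain ⟨P, hP⟩ := qrep_exists hN hz this
  exact ⟨P, _, hP⟩

lemma fh_w_ne {p q : ℤ} {w : ℚ} (h0 : w ≠ 0) (hp : w ≠ p) (hq : w ≠ q) : fh (-(p+q)) (p*q) w.num (w.den : ℤ) ≠ 0 := by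
  intro h
  have hz : (w.den : ℚ) ≠ 0 := by exact_mod_cast w.den_ne_zero
  have hx' : w * (w.den : ℚ) = (w.num : ℚ) := Rat.mul_den_eq_num w
  have h2 : ((fh (-(p+q)) (p*q) w.num (w.den : ℤ) : ℤ) : ℚ) = 0 := by rw [h]; simp
  rw [fh] at h2
  push_cast at h2
  rw [← hx'] at h2
  have h3 : (w.den : ℚ) ^ 4 * (w * (w - p) * (w - q)) = 0 := by linear_combination h2
  simp [hz, h0, sub_eq_zero, hp, hq] at h3

lemma end_num {C δ ε hP hQ hR L L' q q' rr : ℝ} (hC : 1 ≤ C) (hδ : 0 ≤ δ) (hε : ε = 1 / (8 * C)) (hq : 16 * C ≤ q) (hq' : q = 4 * q')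
    (hB : 4 * (δ / 4 + 2 * C + 3 * C * δ + δ) ≤ hP) (h1 : L ≤ (hP + δ) / 2) (h2 : hQ ≤ 2 * L' + δ)
    (h3 : L' ≤ q' * L + C * (q + rr + L)) (h4 : rr ≤ hR + δ) (h5 : hR ≤ ε * hQ) (h6 : (1 - ε) * q * hP ≤ hQ) : False := by
  have hCε : C * ε = 1 / 8 := by rw [hε]; field_simp
  have hε8 : ε ≤ 1 / 8 := by
    have : 0 < ε := by rw [hε]; positivity
    nlinarith
  have hCd : 0 ≤ C * δ := by positivity
  have hP0 : 0 ≤ hP := by nlinarith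
  have hq0 : 1 ≤ q := by linarith
  have a1 : q' * L ≤ q' * ((hP + δ) / 2) := by apply mul_le_mul_of_nonneg_left h1; linarith
  have a2 : C * (q + rr + L) ≤ C * (q + (ε * hQ + δ) + (hP + δ) / 2) := by
    apply mul_le_mul_of_nonneg_left _ (by linarith); linarith
  have a3 : C * (q + (ε * hQ + δ) + (hP + δ) / 2) = C * q + hQ / 8 + C * δ + C * hP / 2 + C * δ / 2 := by
    linear_combination hQ * hCε
  have a4 : (7 / 8) * (q * hP) ≤ hQ := by
    have : 0 ≤ q * hP := by positivity
    nlinarith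
  have a5 : 16 * (C * hP) ≤ q * hP := by nlinarith
  have a6 : q * (4 * (δ / 4 + 2 * C + 3 * C * δ + δ)) ≤ q * hP := by apply mul_le_mul_of_nonneg_left hB; linarith
  have a7 : C * δ ≤ q * (C * δ) := le_mul_of_one_le_left hCd hq0
  have a8 : δ ≤ q * δ := le_mul_of_one_le_left hδ hq0
  have a9 : 0 < q * C := by positivity
  subst hq'
  nlinarith

set_option maxHeartbeats 1000000 in
theorem core : CoreStmt := by
  intro p q r d₁ d₂ hp hq hr hpq hpr hqr hd₁ hd₂
  by_contra hinf
  have hN₁ := ND_of_roots hp hq hpq hd₁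
  have hN₂ := ND_of_roots hp hr hpr hd₂
  obtain ⟨C, hC, hV⟩ := vojta hp hq hr hpq hpr hqr hd₁ hd₂
  obtain ⟨𝒯₁, hT₁, hdiv₁⟩ := weak_mw hp hq hpq hd₁
  obtain ⟨𝒯₂, hT₂, hdiv₂⟩ := weak_mw hp hr hpr hd₂
  obtain ⟨K₁, hK₁⟩ := hgt_par hN₁
  obtain ⟨K₂, hK₂⟩ := hgt_par hN₂
  have hS := Set.Infinite.sdiff hinf (t := {0, (p:ℚ), (q:ℚ), (r:ℚ)}) (by simp)
  generalize hSe : {w : ℚ | (∃ y : ℚ, d₁ * y ^ 2 = w * (w - p) * (w - q)) ∧ ∃ z : ℚ, d₂ * z ^ 2 = w * (w - p) * (w - r)} \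
    {0, (p:ℚ), (q:ℚ), (r:ℚ)} = S at hS
  have hSw : ∀ w ∈ S, (∃ y : ℚ, d₁ * y ^ 2 = w * (w - p) * (w - q)) ∧ (∃ z : ℚ, d₂ * z ^ 2 = w * (w - p) * (w - r)) ∧
      w ≠ 0 ∧ w ≠ p ∧ w ≠ q ∧ w ≠ r := by
    intro w hw
    rw [← hSe] at hw
    obtain ⟨⟨h1, h2⟩, h3⟩ := hw
    simp only [Set.mem_insert_iff, Set.mem_singleton_iff, not_or] at h3
    exact ⟨h1, h2, h3⟩
  let T : Set ((EK (-(p+q)) (p*q) d₁ ℚ).Point × (EK (-(p+r)) (p*r) d₂ ℚ).Point) :=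
    {P | ∃ w ∈ S, (∃ η, QRep P.1 ((w.num : ℤ) : ℚ) η (((w.den : ℕ) : ℤ) : ℚ)) ∧ ∃ η, QRep P.2 ((w.num : ℤ) : ℚ) η (((w.den : ℕ) : ℤ) : ℚ)}
  have hT : T.Infinite := by
    intro hfin
    apply hS
    choose f hf using fun P : T => P.2
    have := hfin.to_subtype
    refine (Set.finite_range f).subset ?_
    intro w hw
    obtain ⟨⟨y, hy⟩, ⟨z, hz⟩, _⟩ := hSw w hw
    obtain ⟨P₁, η₁, hP₁⟩ := rep_w hN₁ hy
    obtain ⟨P₂, η₂, hP₂⟩ := rep_w hN₂ hz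
    let P : T := ⟨(P₁, P₂), w, hw, ⟨η₁, hP₁⟩, ⟨η₂, hP₂⟩⟩
    refine ⟨P, ?_⟩
    obtain ⟨_, ⟨η, h1⟩, _⟩ := hf P
    have := xpar_cross hN₁ h1.xpar hP₁.xpar
    generalize f P = v at *
    have e1 : (v.den : ℚ) ≠ 0 := by exact_mod_cast v.den_ne_zero
    have e2 : (w.den : ℚ) ≠ 0 := by exact_mod_cast w.den_ne_zero
    rw [← Rat.num_div_den v, ← Rat.num_div_den w, div_eq_div_iff e1 e2]
    push_cast at this
    linear_combination this
  obtain ⟨δ₁, hδ₁⟩ : ∃ δ, δ = Height.logHeight₁ (d₁ : ℚ) := ⟨_, rfl⟩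
  obtain ⟨δ₂, hδ₂⟩ : ∃ δ, δ = Height.logHeight₁ (d₂ : ℚ) := ⟨_, rfl⟩
  have hδ₁0 : 0 ≤ δ₁ := hδ₁ ▸ Height.zero_le_logHeight₁ _
  have hδ₂0 : 0 ≤ δ₂ := hδ₂ ▸ Height.zero_le_logHeight₁ _
  obtain ⟨δ, hδ⟩ : ∃ δ, δ = δ₁ + δ₂ := ⟨_, rfl⟩
  obtain ⟨ε, hε⟩ : ∃ ε, ε = 1 / (8 * C) := ⟨_, rfl⟩
  have hε0 : 0 < ε := by rw [hε]; positivity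
  have hε1 : ε < 1 := by rw [hε, div_lt_one (by positivity)]; linarith
  obtain ⟨s0, hs0⟩ := pow_unbounded_of_one_lt (16 * C) (by norm_num : (1:ℝ) < 4)
  obtain ⟨P, hP, Q, hQ, s, hs, hB, hR, hPQ⟩ := digits_pair
    (fun P : (EK (-(p+q)) (p*q) d₁ ℚ).Point × (EK (-(p+r)) (p*r) d₂ ℚ).Point => hgt P.1 + hgt P.2)
    (fun P => add_nonneg (hgt_nonneg _) (hgt_nonneg _)) (K₁ + K₂)
    (by
      intro x y
      have h1 := abs_le.1 (hK₁ x.1 y.1)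
      have h2 := abs_le.1 (hK₂ x.2 y.2)
      simp only [Prod.fst_add, Prod.fst_sub, Prod.snd_add, Prod.snd_sub]
      rw [abs_le]; constructor <;> linarith [h1.1, h1.2, h2.1, h2.2])
    (by
      intro B
      refine ((hgt_northcott B).prod (hgt_northcott B)).subset ?_
      intro P hP
      have h1 := hgt_nonneg P.1
      have h2 := hgt_nonneg P.2
      have h3 : hgt P.1 + hgt P.2 ≤ B := hP
      exact ⟨show hgt P.1 ≤ B by linarith, show hgt P.2 ≤ B by linarith⟩)
    (𝒯₁ ×ˢ 𝒯₂) (hT₁.prod hT₂)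
    (by
      intro P
      obtain ⟨A, U, hU, h1⟩ := hdiv₁ P.1
      obtain ⟨A', U', hU', h2⟩ := hdiv₂ P.2
      exact ⟨(A, A'), (U, U'), ⟨hU, hU'⟩, Prod.ext h1 h2⟩)
    T hT ε hε0 hε1 (4 * (δ / 4 + 2 * C + 3 * C * δ + δ)) (s0 + 1)
  obtain ⟨x, hx, ⟨η₁, hP₁⟩, ⟨η₂, hP₂⟩⟩ := hP
  obtain ⟨x', hx', ⟨η₁', hQ₁⟩, ⟨η₂', hQ₂⟩⟩ := hQ
  obtain ⟨-, -, n0, np, nq, nr⟩ := hSw x hx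
  obtain ⟨X₃, Z₃, η₃, r1, c1, l1⟩ := rep_R hN₁ (Q.1 - (2 ^ s : ℕ) • P.1)
  obtain ⟨X₄, Z₄, η₄, r2, c2, l2⟩ := rep_R hN₂ (Q.2 - (2 ^ s : ℕ) • P.2)
  simp only [Prod.fst_sub, Prod.snd_sub, Prod.smul_fst, Prod.smul_snd] at hR
  have g1 := abs_le.1 (hgt_rep hN₁ hP₁)
  have g2 := abs_le.1 (hgt_rep hN₂ hP₂)
  have g3 := abs_le.1 (hgt_rep hN₁ hQ₁)
  have g4 := abs_le.1 (hgt_rep hN₂ hQ₂)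
  have hδ0 : 0 ≤ δ := by linarith
  have hCd : 0 ≤ C * δ := by positivity
  have hlog : 1 ≤ Real.log (Hq x) := by
    rw [← hδ₁] at g1
    rw [← hδ₂] at g2
    nlinarith [g1.1, g1.2, g2.1, g2.2]
  have hv := hV s (by omega) x x' hP₁ hQ₁ hP₂ hQ₂ r1 r2 c1 c2 rfl rfl (fh_w_ne n0 np nq) (fh_w_ne n0 np nr) hlog
  have hq4 : 16 * C ≤ (4:ℝ) ^ s := hs0.le.trans (pow_le_pow_right₀ (by norm_num) (by omega))
  have hq' : (4:ℝ) ^ s = 4 * 4 ^ (s - 1) := by rw [← pow_succ']; congr 1; omega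
  rw [← hδ₁] at g1 g3 l1
  rw [← hδ₂] at g2 g4 l2
  generalize Real.log (max |(X₃:ℝ)| |(Z₃:ℝ)|) = ρ₁ at *
  generalize Real.log (max |(X₄:ℝ)| |(Z₄:ℝ)|) = ρ₂ at *
  rw [add_assoc ((4:ℝ) ^ s) ρ₁ ρ₂] at hv
  exact end_num (rr := ρ₁ + ρ₂) hC hδ0 hε hq4 hq' hB (by linarith [g1.1, g2.1]) (L' := Real.log (Hq x')) (by linarith [g3.2, g4.2]) hv
    (by linarith) hR hPQ

end

theorem faltings_corollary (k : ℕ) (hk : 5 ≤ k) (b : Fin k → ℤ)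
    (hb : Function.Injective b) :
    {x : ℚ | ∃ q : ℚ, (∏ i : Fin k, (x + (b i : ℚ))) = q ^ 2}.Finite := reduction core k hk b hb
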